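/- Let n ≥ 3 and p > (n−1)/2, and let the exponents satisfy q ≥ 2, 2 ≤ r < ∞, 2/q + (n−1)/r ≤ (n−1)/2, and σ = 1/q + n/r − (n−1)/2. There is a constant C > 0, depending only on n, p, q, r, such that for every measurable V : ℝ^n → ℂ with ‖V‖_{F^p} < ∞ and every function G : ℝ^n × ℝ → ℂ such that G(·,s) is a Schwartz function for each s, (x,s) ↦ G(x,s) is continuous, and G is compactly supported in s, ‖ (√−Δ)^{σ−1} ∫_ℝ sin((t−s)√−Δ) G(·,s) ds ‖_{L²_{x,t}(|V|)} ≤ C ‖V‖_{F^p}^{1/2} ‖G‖_{L^{q'}_t L^{r'}_x}, where q', r' are the conjugate exponents of q, r. -/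

import Mathlib

noncomputable section

open MeasureTheory Metric Complex
open scoped ENNReal FourierTransform SchwartzMap

/-- The Fourier multiplier operator `m(√−Δ)` on `ℝⁿ`:
`m(√−Δ)h = 𝓕⁻¹(m(|ξ|) 𝓕h(ξ))`. -/
def mOp (n : ℕ) (m : ℝ → ℂ) (h : EuclideanSpace ℝ (Fin n) → ℂ) :
    EuclideanSpace ℝ (Fin n) → ℂ :=
  fun x => 𝓕⁻ (fun ξ : EuclideanSpace ℝ (Fin n) => m ‖ξ‖ * 𝓕 h ξ) x

/-- The multiplier of `e^{it√−Δ}`, i.e. `ρ ↦ e^{itρ}`. -/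
def expMult (t : ℝ) : ℝ → ℂ := fun ρ => Complex.exp (Complex.I * t * ρ)

/-- The multiplier of `cos(t√−Δ)`, i.e. `ρ ↦ cos (tρ)`. -/
def cosMult (t : ℝ) : ℝ → ℂ := fun ρ => ((Real.cos (t * ρ) : ℝ) : ℂ)

/-- The multiplier of `sin(t√−Δ)/√−Δ`, i.e. `ρ ↦ sin (tρ)/ρ`. -/
def sincMult (t : ℝ) : ℝ → ℂ := fun ρ => ((Real.sin (t * ρ) / ρ : ℝ) : ℂ)

/-- The multiplier of `sin(t√−Δ)`, i.e. `ρ ↦ sin (tρ)`. -/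
def sinMult (t : ℝ) : ℝ → ℂ := fun ρ => ((Real.sin (t * ρ) : ℝ) : ℂ)

/-- The multiplier of `(√−Δ)^γ`, i.e. `ρ ↦ ρ^γ`. -/
def powMult (γ : ℝ) : ℝ → ℂ := fun ρ => ((ρ ^ γ : ℝ) : ℂ)

/-- A function is Schwartz if it agrees pointwise with some Schwartz map. -/
def IsSchwartz {n : ℕ} (h : EuclideanSpace ℝ (Fin n) → ℂ) : Prop :=
  ∃ φ : 𝓢(EuclideanSpace ℝ (Fin n), ℂ), ∀ x, h x = φ x

/-- The Fefferman–Phong norm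
`‖V‖_{𝓕^p} = sup_{x, r>0} r^(2-n/p) (∫_{B_r(x)} |V|^p)^(1/p)`. -/
def fpNorm (n : ℕ) (p : ℝ) (V : EuclideanSpace ℝ (Fin n) → ℂ) : ℝ≥0∞ :=
  ⨆ (x : EuclideanSpace ℝ (Fin n)) (r : ℝ) (_ : 0 < r),
    ENNReal.ofReal (r ^ (2 - n / p)) *
      (∫⁻ y in ball x r, ENNReal.ofReal (‖V y‖ ^ p)) ^ (1 / p)

/-- The weak `L^{n/2}` quasinorm `sup_{λ>0} λ · |{|V| > λ}|^{2/n}`. -/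
def wkNorm (n : ℕ) (V : EuclideanSpace ℝ (Fin n) → ℂ) : ℝ≥0∞ :=
  ⨆ (l : ℝ) (_ : 0 < l),
    ENNReal.ofReal l * (volume {x : EuclideanSpace ℝ (Fin n) | l < ‖V x‖}) ^ ((2 : ℝ) / n)

/-- The mixed norm `‖F‖_{L^q_t L^r_x}` for `F : ℝⁿ × ℝ → ℂ`, curried as `F x t`. -/
def mixedNorm (n : ℕ) (q r : ℝ) (F : EuclideanSpace ℝ (Fin n) → ℝ → ℂ) : ℝ≥0∞ :=
  (∫⁻ t : ℝ, (∫⁻ x : EuclideanSpace ℝ (Fin n), (‖F x t‖₊ : ℝ≥0∞) ^ r) ^ (q / r)) ^ (1 / q)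

/-- The weighted norm `‖h‖_{L²_{x,t}(w)}` with weight `w : ℝⁿ → [0,∞]`. -/
def wtNorm (n : ℕ) (w : EuclideanSpace ℝ (Fin n) → ℝ≥0∞)
    (h : EuclideanSpace ℝ (Fin n) → ℝ → ℂ) : ℝ≥0∞ :=
  (∫⁻ t : ℝ, ∫⁻ x : EuclideanSpace ℝ (Fin n), (‖h x t‖₊ : ℝ≥0∞) ^ (2 : ℝ) * w x) ^ ((1 : ℝ) / 2)

/-- The homogeneous Sobolev norm `‖h‖_{Ḣ^γ} = ‖(√−Δ)^γ h‖_{L²}`. -/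
def sobNorm (n : ℕ) (γ : ℝ) (h : EuclideanSpace ℝ (Fin n) → ℂ) : ℝ≥0∞ :=
  eLpNorm (mOp n (powMult γ) h) 2 volume

/-- The point `x/|x|` of the unit sphere, for `x ≠ 0`. -/
def sphMap (n : ℕ) (x : EuclideanSpace ℝ (Fin n)) (hx : x ≠ 0) :
    Metric.sphere (0 : EuclideanSpace ℝ (Fin n)) 1 :=
  ⟨‖x‖⁻¹ • x, by
    rw [mem_sphere_zero_iff_norm, norm_smul, norm_inv, norm_norm,
      inv_mul_cancel₀ (norm_ne_zero_iff.mpr hx)]⟩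

open Filter (Tendsto atTop Eventually)

abbrev Eu (n : ℕ) := EuclideanSpace ℝ (Fin n)


lemma glasser_aux (a b : ℝ) (ha : 0 < a) (hb : 0 < b) :
    ∫ w in Set.Ioi (0:ℝ), Real.exp (-(a * w - b / w)^2) = √Real.pi / (2 * a) := by
  set f : ℝ → ℝ := fun w => a * w - b / w with hf
  have hderiv : ∀ w ∈ Set.Ioi (0:ℝ), HasDerivWithinAt f (a + b / w^2) (Set.Ioi 0) w := by
    intro w hw
    have hw0 : w ≠ 0 := ne_of_gt hw
    have h1 : HasDerivAt f (a * 1 - b * (-(w^2)⁻¹)) w := by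
      have h := ((hasDerivAt_id w).const_mul a).sub ((hasDerivAt_inv hw0).const_mul b)
      exact h
    refine h1.hasDerivWithinAt.congr_deriv ?_
    rw [div_eq_mul_inv]; ring
  have hmono : StrictMonoOn f (Set.Ioi 0) := by
    intro x hx y hy hxy
    have hx' : 0 < x := hx
    have hy' : 0 < y := hy
    have : b / y < b / x := div_lt_div_of_pos_left hb hx' hxy
    have : a * x < a * y := by nlinarith
    simp only [hf]; linarith
  have himage : f '' (Set.Ioi 0) = Set.univ := by
    apply Set.eq_univ_of_forall
    intro s
    refine ⟨(s + √(s^2 + 4*a*b)) / (2*a), ?_, ?_⟩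
    · have h1 : |s| < √(s^2 + 4*a*b) := by
        rw [← Real.sqrt_sq_eq_abs]
        apply Real.sqrt_lt_sqrt (sq_nonneg _)
        nlinarith [mul_pos ha hb]
      have := neg_abs_le s
      rw [Set.mem_Ioi]
      apply div_pos <;> linarith
    · have hp : 0 < s + √(s^2 + 4*a*b) := by
        have h1 : |s| < √(s^2 + 4*a*b) := by
          rw [← Real.sqrt_sq_eq_abs]
          apply Real.sqrt_lt_sqrt (sq_nonneg _)
          nlinarith [mul_pos ha hb]
        have := neg_abs_le s
        linarith
      have hsq : √(s^2 + 4*a*b)^2 = s^2 + 4*a*b := Real.sq_sqrt (by nlinarith [mul_pos ha hb, sq_nonneg s])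
      simp only [hf]
      set D := √(s^2 + 4*a*b) with hD
      have h3 : b / ((s + D)/(2*a)) = (D - s)/2 := by
        field_simp
        nlinarith
      rw [h3]
      field_simp
      ring
  have hI : IntegrableOn (fun w => (a + b/w^2) * Real.exp (-(f w)^2)) (Set.Ioi 0) := by
    have := (integrableOn_image_iff_integrableOn_abs_deriv_smul measurableSet_Ioi hderiv hmono.injOn (fun s => Real.exp (-s^2))).1 (by
      rw [himage]
      simpa using integrable_exp_neg_mul_sq one_pos)
    refine this.congr_fun (fun w hw => ?_) measurableSet_Ioi
    have hw' : 0 < w := hw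
    simp only [smul_eq_mul]
    rw [abs_of_pos (by positivity)]
  have h1 : ∫ w in Set.Ioi (0:ℝ), (a + b/w^2) * Real.exp (-(f w)^2) = √Real.pi := by
    have := integral_image_eq_integral_abs_deriv_smul measurableSet_Ioi hderiv hmono.injOn (fun s => Real.exp (-s^2))
    rw [himage] at this
    have h2 := integral_gaussian 1
    simp at h2
    simp only [Measure.restrict_univ] at this
    rw [h2] at this
    rw [this]
    refine setIntegral_congr_fun measurableSet_Ioi (fun w hw => ?_)
    have hw' : 0 < w := hw
    simp only [smul_eq_mul]
    rw [abs_of_pos (by positivity)]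
  have hIe : IntegrableOn (fun w => Real.exp (-(f w)^2)) (Set.Ioi 0) := by
    refine (hI.const_mul (1/a)).mono' ?_ ?_
    · apply Measurable.aestronglyMeasurable
      simp only [hf]; fun_prop
    · refine (ae_restrict_mem measurableSet_Ioi).mono (fun w hw => ?_)
      have hw' : 0 < w := hw
      rw [Real.norm_of_nonneg (Real.exp_pos _).le, ← mul_assoc]
      apply le_mul_of_one_le_left (Real.exp_pos _).le
      have : 0 < b / w^2 := by positivity
      rw [mul_add, one_div, inv_mul_cancel₀ ha.ne']
      have : 0 < a⁻¹ * (b/w^2) := by positivity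
      linarith
  have h2 : ∫ w in Set.Ioi (0:ℝ), (b/w^2) * Real.exp (-(f w)^2) = a * ∫ w in Set.Ioi (0:ℝ), Real.exp (-(f w)^2) := by
    set g : ℝ → ℝ := fun w => (b/a) / w with hg
    have hgd : ∀ w ∈ Set.Ioi (0:ℝ), HasDerivWithinAt g (-((b/a)/w^2)) (Set.Ioi 0) w := by
      intro w hw
      have hw0 : w ≠ 0 := ne_of_gt hw
      have h1 : HasDerivAt g ((b/a) * (-(w^2)⁻¹)) w := by
        have h := ((hasDerivAt_inv hw0).const_mul (b/a))
        exact h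
      refine h1.hasDerivWithinAt.congr_deriv ?_
      rw [div_eq_mul_inv (b/a) (w^2)]; ring
    have hgi : Set.InjOn g (Set.Ioi 0) := by
      intro x hx y hy hxy
      have hx' : 0 < x := hx
      have hy' : 0 < y := hy
      simp only [hg] at hxy
      field_simp at hxy
      linarith
    have hgim : g '' (Set.Ioi 0) = Set.Ioi 0 := by
      ext y
      constructor
      · rintro ⟨x, hx, rfl⟩
        have hx' : 0 < x := hx
        rw [Set.mem_Ioi]
        simp only [hg]; positivity
      · intro hy
        have hy' : 0 < y := hy
        refine ⟨(b/a)/y, show 0 < (b/a)/y by positivity, ?_⟩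
        simp only [hg]; field_simp
    have := integral_image_eq_integral_abs_deriv_smul measurableSet_Ioi hgd hgi (fun w => Real.exp (-(f w)^2))
    rw [hgim] at this
    rw [this, ← integral_const_mul]
    refine setIntegral_congr_fun measurableSet_Ioi (fun w hw => ?_)
    have hw' : 0 < w := hw
    simp only [smul_eq_mul]
    rw [abs_neg, abs_of_pos (by positivity), ← mul_assoc]
    have e1 : f (g w) = - f w := by
      simp only [hf, hg]; field_simp; ring
    rw [e1]
    have : a * (b/a/w^2) = b/w^2 := by field_simp
    rw [this]; simp
  have h3 : ∫ w in Set.Ioi (0:ℝ), (a + b/w^2) * Real.exp (-(f w)^2) = a * (∫ w in Set.Ioi (0:ℝ), Real.exp (-(f w)^2)) + ∫ w in Set.Ioi (0:ℝ), (b/w^2) * Real.exp (-(f w)^2) := by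
    rw [← integral_const_mul, ← integral_add]
    · refine setIntegral_congr_fun measurableSet_Ioi (fun w hw => ?_)
      ring
    · exact hIe.const_mul a
    · have := hI.sub (hIe.const_mul a)
      refine this.congr (Eventually.of_forall (fun w => ?_))
      simp only [Pi.sub_apply]; ring
  rw [h1, h2] at h3
  rw [eq_div_iff (by positivity)]
  linarith

lemma subord (y r : ℝ) (hy : 0 < y) (hr : 0 < r) :
    Real.exp (-(y * r)) = (2 * y / √Real.pi) *
      ∫ w in Set.Ioi (0:ℝ), Real.exp (-(y^2 * w^2)) * Real.exp (-(1/(4*w^2)) * r^2) := by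
  have h := glasser_aux y (r/2) hy (by positivity)
  have h2 : ∫ w in Set.Ioi (0:ℝ), Real.exp (-(y^2 * w^2)) * Real.exp (-(1/(4*w^2)) * r^2)
      = Real.exp (-(y*r)) * ∫ w in Set.Ioi (0:ℝ), Real.exp (-(y * w - (r/2) / w)^2) := by
    rw [← integral_const_mul]
    refine setIntegral_congr_fun measurableSet_Ioi (fun w hw => ?_)
    have hw' : 0 < w := hw
    rw [← Real.exp_add, ← Real.exp_add]
    congr 1
    field_simp
    ring
  rw [h2, h]
  have : 0 < √Real.pi := Real.sqrt_pos.2 Real.pi_pos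
  field_simp

/-- The complex Poisson kernel. -/
def PK (n : ℕ) (z : ℂ) (x : Eu n) : ℂ :=
  ∫ ξ : Eu n, cexp (-z * ‖ξ‖ + 2 * Real.pi * I * (inner ℝ x ξ : ℝ))

lemma PK_inner_gauss (n : ℕ) (x : Eu n) (w : ℝ) (hw : 0 < w) :
    ∫ ξ : Eu n, cexp (-((1/(4*w^2) : ℝ) : ℂ) * ‖ξ‖^2 + 2 * Real.pi * I * (inner ℝ x ξ : ℝ))
      = (((2 * √Real.pi)^n * (w^n * Real.exp (-(4 * Real.pi^2 * ‖x‖^2) * w^2)) : ℝ) : ℂ) := by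
  have hb : 0 < (((1/(4*w^2) : ℝ) : ℂ)).re := by
    rw [ofReal_re]; positivity
  rw [GaussianFourier.integral_cexp_neg_mul_sq_norm_add hb (2 * Real.pi * I) x]
  have h1 : ((Real.pi : ℂ) / ((1/(4*w^2) : ℝ) : ℂ)) ^ ((Module.finrank ℝ (Eu n) : ℂ) / 2)
      = (((2 * √Real.pi * w)^n : ℝ) : ℂ) := by
    rw [← ofReal_div, finrank_euclideanSpace, Fintype.card_fin]
    have : ((n : ℂ)/2) = (((n:ℝ)/2 : ℝ) : ℂ) := by push_cast; ring
    rw [this, ← ofReal_cpow (by positivity)]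
    congr 1
    have h2 : Real.pi / (1/(4*w^2)) = (2 * √Real.pi * w)^(2:ℝ) := by
      rw [Real.rpow_two]
      have := Real.sq_sqrt Real.pi_pos.le
      field_simp
      nlinarith
    rw [h2, ← Real.rpow_mul (by positivity), ← Real.rpow_natCast]
    congr 1; ring
  rw [h1]
  have h2 : (2 * (Real.pi:ℂ) * I)^2 * ‖x‖^2 / (4 * ((1/(4*w^2) : ℝ) : ℂ)) = ((-(4 * Real.pi^2 * ‖x‖^2) * w^2 : ℝ) : ℂ) := by
    have hwc : (w:ℂ) ≠ 0 := by exact_mod_cast hw.ne'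
    push_cast
    rw [mul_pow, mul_pow, I_sq]
    field_simp
    try ring
  rw [h2, ← ofReal_exp, ← ofReal_mul]
  congr 1
  rw [mul_pow]; ring

lemma PK_real (n : ℕ) (hn : 1 ≤ n) : ∃ c : ℝ, 0 < c ∧ ∀ (y : ℝ) (x : Eu n), 0 < y →
    PK n y x = ((c * y * (y^2 + 4 * Real.pi^2 * ‖x‖^2)^(-((n:ℝ)+1)/2) : ℝ) : ℂ) := by
  refine ⟨2 / √Real.pi * (2 * √Real.pi)^n * (1/2 * Real.Gamma (((n:ℝ)+1)/2)), ?_, ?_⟩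
  · have := Real.Gamma_pos_of_pos (show 0 < ((n:ℝ)+1)/2 by positivity)
    have : 0 < √Real.pi := Real.sqrt_pos.2 Real.pi_pos
    positivity
  intro y x hy
  have : Nontrivial (Eu n) := by
    have : Nonempty (Fin n) := ⟨⟨0, by omega⟩⟩
    infer_instance
  set Φ : Eu n → ℝ → ℂ := fun ξ w =>
    (Real.exp (-(y^2 * w^2)) : ℂ) * cexp (-((1/(4*w^2) : ℝ) : ℂ) * ‖ξ‖^2 + 2 * Real.pi * I * (inner ℝ x ξ : ℝ)) with hΦ
  have e1 : PK n y x = ∫ ξ : Eu n, ((2 * y / √Real.pi : ℝ) : ℂ) * ∫ w in Set.Ioi (0:ℝ), Φ ξ w := by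
    unfold PK
    apply integral_congr_ae
    have : ∀ᵐ ξ : Eu n, ξ ≠ 0 := by
      simp [ae_iff]
    filter_upwards [this] with ξ hξ
    rw [Complex.exp_add]
    have h1 : cexp (-(y:ℂ) * ‖ξ‖) = ((Real.exp (-(y * ‖ξ‖)) : ℝ) : ℂ) := by
      rw [ofReal_exp]; push_cast; ring_nf
    rw [h1, subord y ‖ξ‖ hy (norm_pos_iff.2 hξ), ofReal_mul, mul_assoc]
    congr 1
    rw [← integral_complex_ofReal, ← integral_mul_const]
    congr 1
    ext w
    simp only [hΦ]
    rw [Complex.exp_add]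
    push_cast
    ring
  have hnorm : ∀ ξ w, ‖Φ ξ w‖ = Real.exp (-(y^2 * w^2)) * Real.exp (-(1/(4*w^2)) * ‖ξ‖^2) := by
    intro ξ w
    simp only [hΦ]
    rw [norm_mul, Complex.norm_exp, Complex.norm_real, Real.norm_of_nonneg (Real.exp_pos _).le]
    congr 2
    simp [-ofReal_div, ← ofReal_pow]
  have hIn : Integrable (Function.uncurry Φ) ((volume : Measure (Eu n)).prod (volume.restrict (Set.Ioi (0:ℝ)))) := by
    rw [integrable_prod_iff']
    · constructor
      · refine (ae_restrict_mem measurableSet_Ioi).mono (fun w hw => ?_)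
        have hw' : 0 < w := hw
        simp only [Function.uncurry, hΦ]
        apply Integrable.const_mul
        apply GaussianFourier.integrable_cexp_neg_mul_sq_norm_add
        rw [ofReal_re]; positivity
      · simp only [Function.uncurry, hnorm]
        have : IntegrableOn (fun w : ℝ => (2 * √Real.pi)^n * (w^(n:ℝ) * Real.exp (- y^2 * w^2))) (Set.Ioi 0) := by
          apply Integrable.const_mul
          exact integrableOn_rpow_mul_exp_neg_mul_sq (by positivity) (by have : (0:ℝ) ≤ n := by positivity
                                                                         linarith)
        refine IntegrableOn.congr_fun this (fun w hw => ?_) measurableSet_Ioi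
        have hw' : 0 < w := hw
        rw [integral_const_mul, GaussianFourier.integral_rexp_neg_mul_sq_norm (by positivity), finrank_euclideanSpace, Fintype.card_fin]
        have h2 : Real.pi / (1/(4*w^2)) = (2 * √Real.pi * w)^(2:ℝ) := by
          rw [Real.rpow_two]
          have := Real.sq_sqrt Real.pi_pos.le
          field_simp
          nlinarith
        rw [h2, ← Real.rpow_mul (by positivity), show (2:ℝ) * ((n:ℝ)/2) = (n:ℝ) by ring, Real.rpow_natCast, Real.rpow_natCast, mul_pow]
        ring_nf
    · apply Measurable.aestronglyMeasurable
      simp only [Function.uncurry_def, hΦ]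
      fun_prop
  rw [e1, integral_const_mul, integral_integral_swap hIn]
  have e2 : ∫ w in Set.Ioi (0:ℝ), ∫ ξ, Φ ξ w = (((2 * √Real.pi)^n * ∫ w in Set.Ioi (0:ℝ), w^(n:ℝ) * Real.exp (- (y^2 + 4 * Real.pi^2 * ‖x‖^2) * w^(2:ℝ)) : ℝ) : ℂ) := by
    rw [← integral_const_mul, ← integral_complex_ofReal]
    refine setIntegral_congr_fun measurableSet_Ioi (fun w hw => ?_)
    have hw' : 0 < w := hw
    simp only [hΦ]
    rw [integral_const_mul, PK_inner_gauss n x w hw', ← ofReal_mul]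
    norm_cast
    have : -(y ^ 2 + 4 * Real.pi ^ 2 * ‖x‖ ^ 2) * w ^ 2 = (-(y^2*w^2)) + (-(4 * Real.pi ^ 2 * ‖x‖ ^ 2) * w ^ 2) := by ring
    rw [this, Real.exp_add]
    ring
  rw [e2, integral_rpow_mul_exp_neg_mul_rpow two_pos (by have : (0:ℝ) ≤ n := by positivity
                                                         linarith) (by positivity), ← ofReal_mul]
  congr 1
  ring

lemma exp_neg_le_japanese (l r : ℝ) (m : ℕ) (hm : 0 < m) (hl : 0 < l) (hr : 0 ≤ r) :
    Real.exp (-(l * r)) ≤ (max 1 (m / l))^m * (1 + r)^(-(m:ℝ)) := by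
  set K := max 1 ((m:ℝ)/l) with hK
  have hm' : (0:ℝ) < m := by exact_mod_cast hm
  have hK1 : 1 ≤ K := le_max_left _ _
  have hK2 : (m:ℝ)/l ≤ K := le_max_right _ _
  have h1 : (1 + r) ≤ K * (1 + l * r / m) := by
    have : r ≤ K * (l * r / m) := by
      have h3 : (m:ℝ)/l * (l * r / m) = r := by field_simp
      calc r = (m:ℝ)/l * (l * r / m) := h3.symm
        _ ≤ K * (l * r / m) := by gcongr
    nlinarith
  have h2 : (1 + l * r / m) ≤ Real.exp (l * r / m) := by
    have := Real.add_one_le_exp (l * r / m); linarith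
  have h3 : (1 + r)^m ≤ K^m * Real.exp (l * r) := by
    calc (1+r)^m ≤ (K * Real.exp (l * r / m))^m := by
          apply pow_le_pow_left₀ (by positivity)
          exact h1.trans (by gcongr)
      _ = K^m * Real.exp (l * r) := by
          rw [mul_pow, ← Real.exp_nat_mul]
          congr 2; field_simp
  rw [Real.rpow_neg (by positivity), Real.rpow_natCast, Real.exp_neg, ← div_eq_mul_inv, le_div_iff₀ (by positivity), inv_mul_le_iff₀ (Real.exp_pos _)]
  linarith

lemma integrable_exp_neg_norm (n : ℕ) (l : ℝ) (hl : 0 < l) :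
    Integrable (fun ξ : Eu n => Real.exp (-(l * ‖ξ‖))) := by
  have h := integrable_one_add_norm (E := Eu n) (μ := volume) (r := ((n+1 : ℕ) : ℝ)) (by simp)
  refine (h.const_mul ((max 1 (((n+1:ℕ):ℝ) / l))^(n+1))).mono' (by fun_prop) (Eventually.of_forall (fun ξ => ?_))
  rw [Real.norm_of_nonneg (Real.exp_pos _).le]
  exact exp_neg_le_japanese l ‖ξ‖ (n+1) (by omega) hl (norm_nonneg _)

lemma PK_norm_integrand (n : ℕ) (z : ℂ) (x ξ : Eu n) :
    ‖cexp (-z * ‖ξ‖ + 2 * Real.pi * I * (inner ℝ x ξ : ℝ))‖ = Real.exp (-(z.re * ‖ξ‖)) := by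
  rw [Complex.norm_exp]
  congr 1
  simp

lemma PK_integrable (n : ℕ) (z : ℂ) (hz : 0 < z.re) (x : Eu n) :
    Integrable (fun ξ : Eu n => cexp (-z * ‖ξ‖ + 2 * Real.pi * I * (inner ℝ x ξ : ℝ))) := by
  refine (integrable_exp_neg_norm n z.re hz).mono' (by fun_prop) (Eventually.of_forall (fun ξ => ?_))
  rw [PK_norm_integrand]

lemma PK_differentiableOn (n : ℕ) (x : Eu n) :
    DifferentiableOn ℂ (fun z => PK n z x) {z | 0 < z.re} := by
  intro z hz
  have hz' : 0 < z.re := hz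
  apply DifferentiableAt.differentiableWithinAt
  have hnh : {w : ℂ | z.re / 2 < w.re} ∈ nhds z := by
    apply (isOpen_lt continuous_const Complex.continuous_re).mem_nhds
    show z.re/2 < z.re
    linarith
  have := (hasDerivAt_integral_of_dominated_loc_of_deriv_le (μ := (volume : Measure (Eu n)))
    (F := fun z ξ => cexp (-z * ‖ξ‖ + 2 * Real.pi * I * (inner ℝ x ξ : ℝ)))
    (F' := fun z ξ => cexp (-z * ‖ξ‖ + 2 * Real.pi * I * (inner ℝ x ξ : ℝ)) * (-‖ξ‖))
    (bound := fun ξ => (4/z.re) * Real.exp (-(z.re/4 * ‖ξ‖))) hnh ?_ ?_ ?_ ?_ ?_ ?_).2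
  · exact this.differentiableAt
  · exact Eventually.of_forall (fun w => by fun_prop)
  · exact PK_integrable n z hz' x
  · fun_prop
  · refine Eventually.of_forall (fun ξ w hw => ?_)
    have hw' : z.re/2 < w.re := hw
    rw [norm_mul, PK_norm_integrand, norm_neg, Complex.norm_real, norm_norm]
    have h1 := Real.add_one_le_exp (z.re/4 * ‖ξ‖)
    have h2 : ‖ξ‖ ≤ 4/z.re * Real.exp (z.re/4 * ‖ξ‖) := by
      rw [div_mul_eq_mul_div, le_div_iff₀ hz']
      linarith
    have h3 : Real.exp (-(w.re * ‖ξ‖)) ≤ Real.exp (-(z.re/2 * ‖ξ‖)) := by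
      apply Real.exp_le_exp.2
      have := norm_nonneg ξ
      nlinarith
    calc _ ≤ Real.exp (-(z.re/2 * ‖ξ‖)) * (4/z.re * Real.exp (z.re/4 * ‖ξ‖)) := by gcongr
      _ = 4/z.re * Real.exp (-(z.re/4 * ‖ξ‖)) := by
        rw [mul_left_comm, ← Real.exp_add]
        congr 2; ring
  · exact (integrable_exp_neg_norm n (z.re/4) (by positivity)).const_mul _
  · refine Eventually.of_forall (fun ξ w hw => ?_)
    apply HasDerivAt.cexp
    have := (((hasDerivAt_id w).neg).mul_const (‖ξ‖:ℂ)).add_const (2 * Real.pi * I * (inner ℝ x ξ : ℝ))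
    simpa using this

lemma sq_add_mem_slitPlane (z : ℂ) (hz : 0 < z.re) (a : ℝ) : z^2 + (a:ℂ)^2 ∈ slitPlane := by
  rw [mem_slitPlane_iff]
  by_cases h : z.im = 0
  · left
    have : (z^2 + (a:ℂ)^2).re = z.re^2 - z.im^2 + a^2 := by
      simp [sq]
    rw [this, h]; nlinarith [sq_nonneg a]
  · right
    have : (z^2 + (a:ℂ)^2).im = 2 * z.re * z.im := by
      simp [sq]; ring
    rw [this]
    have := hz.ne'
    positivity

lemma PK_formula (n : ℕ) (hn : 1 ≤ n) : ∃ c : ℝ, 0 < c ∧ ∀ (z : ℂ) (x : Eu n), 0 < z.re →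
    ‖PK n z x‖ = c * ‖z‖ * ‖z^2 + ((2 * Real.pi * ‖x‖ : ℝ) : ℂ)^2‖^(-((n:ℝ)+1)/2) := by
  obtain ⟨c, hc, hcf⟩ := PK_real n hn
  refine ⟨c, hc, fun z x hz => ?_⟩
  set a : ℝ := 2 * Real.pi * ‖x‖ with ha
  have hopen : IsOpen {z : ℂ | 0 < z.re} := isOpen_lt continuous_const Complex.continuous_re
  have h1 : AnalyticOnNhd ℂ (fun z => PK n z x) {z | 0 < z.re} :=
    (PK_differentiableOn n x).analyticOnNhd hopen
  have h2 : AnalyticOnNhd ℂ (fun z : ℂ => (c:ℂ) * z * (z^2 + (a:ℂ)^2)^((-((n:ℝ)+1)/2 : ℝ) : ℂ)) {z | 0 < z.re} := by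
    apply DifferentiableOn.analyticOnNhd _ hopen
    intro w hw
    apply DifferentiableAt.differentiableWithinAt
    apply DifferentiableAt.mul (by fun_prop)
    apply DifferentiableAt.cpow_const (by fun_prop)
    exact sq_add_mem_slitPlane w hw a
  have hconv : IsPreconnected {z : ℂ | 0 < z.re} := (convex_halfSpace_re_gt 0).isPreconnected
  have heq : Set.EqOn (fun z => PK n z x) (fun z : ℂ => (c:ℂ) * z * (z^2 + (a:ℂ)^2)^((-((n:ℝ)+1)/2 : ℝ) : ℂ)) {z | 0 < z.re} := by
    have key : ∀ y : ℝ, 0 < y → PK n y x = (c:ℂ) * y * ((y:ℂ)^2 + (a:ℂ)^2)^((-((n:ℝ)+1)/2 : ℝ) : ℂ) := by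
      intro y hy
      rw [hcf y x hy]
      have e : (y:ℂ)^2 + (a:ℂ)^2 = ((y^2 + a^2 : ℝ) : ℂ) := by push_cast; ring
      rw [e, ← ofReal_cpow (by positivity), ← ofReal_mul, ← ofReal_mul]
      have : 4 * Real.pi^2 * ‖x‖^2 = a^2 := by rw [ha]; ring
      rw [this]
    refine h1.eqOn_of_preconnected_of_frequently_eq h2 hconv (z₀ := 1) (by simp) ?_
    have ht : Tendsto (fun k : ℕ => (((1 + 1 / ((k:ℝ) + 1) : ℝ)) : ℂ)) atTop (nhdsWithin 1 {1}ᶜ) := by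
      apply tendsto_nhdsWithin_of_tendsto_nhds_of_eventually_within
      · have h0 := (tendsto_one_div_add_atTop_nhds_zero_nat (𝕜 := ℝ)).const_add 1
        rw [add_zero] at h0
        have := (Complex.continuous_ofReal.tendsto 1).comp h0
        rw [Complex.ofReal_one] at this
        exact this
      · refine Eventually.of_forall (fun k => ?_)
        rw [Set.mem_compl_iff, Set.mem_singleton_iff]
        intro h
        have h' : (1 + 1/((k:ℝ)+1) : ℝ) = 1 := by exact_mod_cast h
        have : 0 < 1/((k:ℝ)+1) := by positivity
        linarith
    refine ht.frequently (Filter.Frequently.of_forall (fun k => ?_))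
    exact key _ (by positivity)
  have := heq hz
  simp only at this
  rw [this, norm_mul, norm_mul, Complex.norm_real, Real.norm_of_nonneg hc.le]
  congr 1
  have hne : z^2 + (a:ℂ)^2 ≠ 0 := slitPlane_ne_zero (sq_add_mem_slitPlane z hz a)
  rw [Complex.norm_cpow_of_ne_zero hne]
  simp

/-- modulus of `l + i τ` -/
def zm (l τ : ℝ) : ℝ := √(l^2 + τ^2)

lemma zm_norm (l τ : ℝ) : ‖(l:ℂ) + τ * I‖ = zm l τ := by
  rw [zm, Complex.norm_add_mul_I]

lemma zm_nonneg (l τ : ℝ) : 0 ≤ zm l τ := Real.sqrt_nonneg _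

lemma zm_ge (l τ : ℝ) (_hl : 0 < l) : l ≤ zm l τ := by
  rw [zm]; apply Real.le_sqrt_of_sq_le; nlinarith [sq_nonneg τ]

lemma zm_ge' (l τ : ℝ) : |τ| ≤ zm l τ := by
  rw [zm]; apply Real.abs_le_sqrt; nlinarith [sq_nonneg l]

lemma zm_neg (l τ : ℝ) : zm l (-τ) = zm l τ := by
  rw [zm, zm]; congr 1; ring

lemma zm_cont (l : ℝ) : Continuous (zm l) := by unfold zm; fun_prop

lemma zm_mono (l : ℝ) {s t : ℝ} (h : |s| ≤ |t|) : zm l s ≤ zm l t := by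
  rw [zm, zm]; apply Real.sqrt_le_sqrt
  have := sq_le_sq.2 h
  linarith

lemma D_lower (l τ a : ℝ) (ha : 0 ≤ a) :
    zm l τ * zm l (|τ| - a) ≤ ‖((l:ℂ) + τ * I)^2 + (a:ℂ)^2‖ ∧
    zm l (|τ| + a) * zm l (|τ| - a) ≤ ‖((l:ℂ) + τ * I)^2 + (a:ℂ)^2‖ := by
  have e : ((l:ℂ) + τ * I)^2 + (a:ℂ)^2 = ((l:ℂ) + ((τ + a : ℝ):ℂ) * I) * ((l:ℂ) + ((τ - a : ℝ):ℂ) * I) := by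
    push_cast
    have : I * I = -1 := I_mul_I
    linear_combination ((a:ℂ)^2 ) * this
  have h2 : ‖((l:ℂ) + τ * I)^2 + (a:ℂ)^2‖ = zm l (|τ| + a) * zm l (|τ| - a) := by
    rw [e, norm_mul, zm_norm, zm_norm]
    rcases abs_cases τ with ⟨h, _⟩ | ⟨h, _⟩
    · rw [h]
    · rw [h, mul_comm, ← zm_neg l (τ - a), ← zm_neg l (τ + a)]
      congr 2 <;> ring
  refine ⟨?_, h2.ge⟩
  rw [h2]
  apply mul_le_mul_of_nonneg_right _ (Real.sqrt_nonneg _)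
  apply zm_mono
  rw [abs_of_nonneg (show 0 ≤ |τ| + a by positivity)]
  linarith

lemma PK_bound (n : ℕ) (hn : 1 ≤ n) : ∃ c : ℝ, 0 < c ∧ ∀ (l τ : ℝ) (x : Eu n), 0 < l →
    ‖PK n (l + τ * I) x‖ ≤ c * (zm l τ)^(-((n:ℝ)-1)/2) * (zm l (|τ| - 2 * Real.pi * ‖x‖))^(-((n:ℝ)+1)/2) ∧
    ‖PK n (l + τ * I) x‖ ≤ c * zm l τ * (zm l (|τ| + 2 * Real.pi * ‖x‖) * zm l (|τ| - 2 * Real.pi * ‖x‖))^(-((n:ℝ)+1)/2) := by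
  obtain ⟨c, hc, h⟩ := PK_formula n hn
  refine ⟨c, hc, fun l τ x hl => ?_⟩
  have hz : 0 < ((l:ℂ) + τ * I).re := by simpa using hl
  have hx : 0 ≤ 2 * Real.pi * ‖x‖ := by positivity
  rw [h _ x hz, zm_norm]
  obtain ⟨h1, h2⟩ := D_lower l τ (2 * Real.pi * ‖x‖) hx
  have p1 : 0 < zm l τ := hl.trans_le (zm_ge l τ hl)
  have p2 : 0 < zm l (|τ| - 2 * Real.pi * ‖x‖) := hl.trans_le (zm_ge l _ hl)
  have p3 : 0 < zm l (|τ| + 2 * Real.pi * ‖x‖) := hl.trans_le (zm_ge l _ hl)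
  have hneg : -((n:ℝ)+1)/2 ≤ 0 := by
    have : (0:ℝ) ≤ n := by positivity
    linarith
  constructor
  · calc _ ≤ c * zm l τ * (zm l τ * zm l (|τ| - 2 * Real.pi * ‖x‖))^(-((n:ℝ)+1)/2) := by
          apply mul_le_mul_of_nonneg_left _ (by positivity)
          exact Real.rpow_le_rpow_of_nonpos (by positivity) h1 hneg
      _ = _ := by
          rw [Real.mul_rpow p1.le p2.le, ← mul_assoc, mul_assoc c]
          congr 2
          nth_rewrite 1 [← Real.rpow_one (zm l τ)]
          rw [← Real.rpow_add p1]
          congr 1; ring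
  · apply mul_le_mul_of_nonneg_left _ (by positivity)
    exact Real.rpow_le_rpow_of_nonpos (by positivity) h2 hneg

/-- K1 bound -/
lemma PK_K1 (n : ℕ) (hn : 1 ≤ n) : ∃ c : ℝ, 0 < c ∧ ∀ (l τ s : ℝ) (x : Eu n), 0 < l →
    0 ≤ s → s ≤ ((n:ℝ)-1)/2 → τ ≠ 0 →
    ‖PK n (l + τ * I) x‖ ≤ c * l^(-(n:ℝ) + s) * |τ|^(-s) := by
  obtain ⟨c, hc, h⟩ := PK_bound n hn
  refine ⟨c, hc, fun l τ s x hl hs0 hs hτ => (h l τ x hl).1.trans ?_⟩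
  have p1 : 0 < zm l τ := hl.trans_le (zm_ge l τ hl)
  have hneg : -((n:ℝ)+1)/2 ≤ 0 := by
    have : (0:ℝ) ≤ n := by positivity
    linarith
  have hτ' : 0 < |τ| := abs_pos.2 hτ
  have h1 : (zm l (|τ| - 2 * Real.pi * ‖x‖))^(-((n:ℝ)+1)/2) ≤ l^(-((n:ℝ)+1)/2) :=
    Real.rpow_le_rpow_of_nonpos hl (zm_ge l _ hl) hneg
  have h2 : (zm l τ)^(-((n:ℝ)-1)/2) ≤ l^(-((n:ℝ)-1)/2 + s) * |τ|^(-s) := by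
    have : (zm l τ)^(-((n:ℝ)-1)/2) = (zm l τ)^(-((n:ℝ)-1)/2 + s) * (zm l τ)^(-s) := by
      rw [← Real.rpow_add p1]; congr 1; ring
    rw [this]
    apply mul_le_mul
    · exact Real.rpow_le_rpow_of_nonpos hl (zm_ge l _ hl) (by linarith)
    · exact Real.rpow_le_rpow_of_nonpos hτ' (zm_ge' l _) (by linarith)
    · positivity
    · positivity
  calc _ ≤ c * (l^(-((n:ℝ)-1)/2 + s) * |τ|^(-s)) * l^(-((n:ℝ)+1)/2) := by
        have := zm_nonneg l (|τ| - 2 * Real.pi * ‖x‖)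
        gcongr
    _ = c * (l^(-((n:ℝ)-1)/2 + s) * l^(-((n:ℝ)+1)/2)) * |τ|^(-s) := by ring
    _ = _ := by
      rw [← Real.rpow_add hl]
      congr 3; ring

lemma zm_integral (n : ℕ) (hn : 3 ≤ n) : ∃ c : ℝ, 0 < c ∧ ∀ l : ℝ, 0 < l →
    ∀ a : ℝ, ∫⁻ τ : ℝ, ENNReal.ofReal ((zm l (|τ| - a))^(-((n:ℝ)+1)/2)) ≤ ENNReal.ofReal (c * l^(-((n:ℝ)-1)/2)) := by
  have hn' : (3:ℝ) ≤ n := by exact_mod_cast hn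
  have hIn : Integrable (fun τ : ℝ => (1 + τ^2)^(-((n:ℝ)+1)/2/2)) := by
    have := integrable_rpow_neg_one_add_norm_sq (E := ℝ) (μ := volume) (r := ((n:ℝ)+1)/2) (by simp; linarith)
    refine this.congr (Eventually.of_forall (fun τ => ?_))
    simp only [Real.norm_eq_abs, sq_abs]
    congr 1; ring
  set c0 := ∫ τ : ℝ, (1 + τ^2)^(-((n:ℝ)+1)/2/2) with hc0
  have hc0' : 0 ≤ c0 := integral_nonneg (fun τ => by positivity)
  refine ⟨2 * c0 + 1, by positivity, fun l hl a => ?_⟩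
  have e0 : ∀ b : ℝ, ∫⁻ τ : ℝ, ENNReal.ofReal ((zm l (τ - b))^(-((n:ℝ)+1)/2)) = ENNReal.ofReal (c0 * l^(-((n:ℝ)-1)/2)) := by
    intro b
    rw [lintegral_sub_right_eq_self (fun τ => ENNReal.ofReal ((zm l τ)^(-((n:ℝ)+1)/2)))]
    have e1 : ∀ τ, (zm l τ)^(-((n:ℝ)+1)/2) = l^(-((n:ℝ)+1)/2) * (1 + (l⁻¹ * τ)^2)^(-((n:ℝ)+1)/2/2) := by
      intro τ
      have : zm l τ = l * √(1 + (l⁻¹ * τ)^2) := by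
        rw [zm]
        have : l^2 + τ^2 = l^2 * (1 + (l⁻¹*τ)^2) := by field_simp
        rw [this, Real.sqrt_mul (by positivity), Real.sqrt_sq hl.le]
      rw [this, Real.mul_rpow hl.le (Real.sqrt_nonneg _), Real.sqrt_eq_rpow, ← Real.rpow_mul (by positivity)]
      congr 2; ring
    simp_rw [e1]
    have hi : Integrable (fun τ : ℝ => l^(-((n:ℝ)+1)/2) * (1 + (l⁻¹ * τ)^2)^(-((n:ℝ)+1)/2/2)) :=
      (hIn.comp_mul_left' (inv_ne_zero hl.ne')).const_mul _
    rw [← ofReal_integral_eq_lintegral_ofReal hi (Eventually.of_forall (fun τ => by positivity))]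
    congr 1
    rw [integral_const_mul, Measure.integral_comp_mul_left (fun τ : ℝ => (1 + τ^2)^(-((n:ℝ)+1)/2/2)), inv_inv, abs_of_pos hl, smul_eq_mul, ← hc0]
    have : l^(-((n:ℝ)-1)/2) = l^(-((n:ℝ)+1)/2) * l := by
      nth_rewrite 3 [← Real.rpow_one l]
      rw [← Real.rpow_add hl]; congr 1; ring
    rw [this]; ring
  calc ∫⁻ τ : ℝ, ENNReal.ofReal ((zm l (|τ| - a))^(-((n:ℝ)+1)/2))
      ≤ ∫⁻ τ : ℝ, (ENNReal.ofReal ((zm l (τ - a))^(-((n:ℝ)+1)/2)) + ENNReal.ofReal ((zm l (τ - (-a)))^(-((n:ℝ)+1)/2))) := by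
        apply lintegral_mono
        intro τ
        dsimp only
        rcases abs_cases τ with ⟨h, _⟩ | ⟨h, _⟩
        · rw [h]; exact le_self_add
        · rw [h, ← zm_neg l (-τ - a), show -(-τ - a) = τ - (-a) by ring]; exact le_add_self
    _ = ENNReal.ofReal (2 * (c0 * l^(-((n:ℝ)-1)/2))) := by
        rw [lintegral_add_left, e0, e0, ← ENNReal.ofReal_add (by positivity) (by positivity)]
        · congr 1; ring
        · apply ENNReal.measurable_ofReal.comp
          have : Measurable (zm l) := (zm_cont l).measurable
          fun_prop
    _ ≤ _ := by
        apply ENNReal.ofReal_le_ofReal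
        have : 0 < l^(-((n:ℝ)-1)/2) := by positivity
        nlinarith

/-- dyadic time shell -/
def Jset (l : ℝ) (j : ℕ) : Set ℝ := {τ | l * 2^j ≤ zm l τ ∧ zm l τ < l * 2^(j+1)}

lemma Jset_meas (l : ℝ) (j : ℕ) : MeasurableSet (Jset l j) := by
  apply MeasurableSet.inter
  · exact measurableSet_le measurable_const (zm_cont l).measurable
  · exact measurableSet_lt (zm_cont l).measurable measurable_const

lemma Jset_vol (l : ℝ) (_hl : 0 < l) (j : ℕ) : volume (Jset l j) ≤ ENNReal.ofReal (4 * (l * 2^j)) := by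
  calc volume (Jset l j) ≤ volume (Set.Icc (-(l*2^(j+1))) (l*2^(j+1))) := by
        apply measure_mono
        intro τ hτ
        have := (zm_ge' l τ).trans hτ.2.le
        exact abs_le.1 this
    _ = _ := by rw [Real.volume_Icc]; congr 1; ring

lemma Jset_exists (l : ℝ) (hl : 0 < l) (τ : ℝ) : ∃ j, τ ∈ Jset l j := by
  have h := zm_ge l τ hl
  obtain ⟨j, h1, h2⟩ := exists_nat_pow_near (x := zm l τ / l) (y := 2) (by rw [le_div_iff₀ hl]; linarith) (by norm_num)
  refine ⟨j, ?_, ?_⟩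
  · rw [le_div_iff₀ hl] at h1; linarith
  · rw [div_lt_iff₀ hl] at h2; linarith

lemma Jset_disj (l : ℝ) (hl : 0 < l) : Pairwise (Function.onFun Disjoint (Jset l)) := by
  intro i j hij
  rw [Function.onFun, Set.disjoint_left]
  intro τ h1 h2
  apply hij
  have key : ∀ i j, τ ∈ Jset l i → τ ∈ Jset l j → i ≤ j := by
    intro i j h1 h2
    have : l * 2^i < l * 2^(j+1) := h1.1.trans_lt h2.2
    have : (2:ℝ)^i < 2^(j+1) := lt_of_mul_lt_mul_left this hl.le
    have := (pow_lt_pow_iff_right₀ (by norm_num : (1:ℝ) < 2)).1 this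
    omega
  exact le_antisymm (key i j h1 h2) (key j i h2 h1)

/-- K2 bound -/
lemma PK_K2 (n : ℕ) (hn : 3 ≤ n) : ∃ C : ℝ, 0 < C ∧ ∀ (l : ℝ) (j : ℕ) (x : Eu n), 0 < l →
    ∫⁻ τ in Jset l j, ‖PK n (l + τ * I) x‖ₑ ≤
      ENNReal.ofReal (C * l^(-((n:ℝ)-1)/2) * (l * 2^j)^(-((n:ℝ)-1)/2) * (1 + ‖x‖/(l*2^j))^(-((n:ℝ)+1))) := by
  obtain ⟨c, hc, h⟩ := PK_bound n (by omega)
  obtain ⟨c1, hc1, hI⟩ := zm_integral n hn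
  have hn' : (3:ℝ) ≤ n := by exact_mod_cast hn
  refine ⟨c * c1 * 2^((n:ℝ)+1) + 8 * c * 2^(((n:ℝ)+1)/2), by positivity, fun l j x hl => ?_⟩
  set T := l * 2^j with hT
  have hTpos : 0 < T := by positivity
  have hlT : l ≤ T := by
    rw [hT]; exact le_mul_of_one_le_right hl.le (one_le_pow₀ (by norm_num))
  have hJ : ∀ τ ∈ Jset l j, T ≤ zm l τ ∧ zm l τ ≤ 2 * T := by
    intro τ hτ
    refine ⟨hτ.1, hτ.2.le.trans ?_⟩
    rw [hT, pow_succ]; linarith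
  set a := 2 * Real.pi * ‖x‖ with ha
  have ha0 : 0 ≤ a := by positivity
  have hxa : 6 * ‖x‖ ≤ a := by
    have := Real.pi_gt_three
    have := norm_nonneg x
    nlinarith
  rcases le_total a (4 * T) with hcase | hcase
  · calc ∫⁻ τ in Jset l j, ‖PK n (l + τ * I) x‖ₑ
        ≤ ∫⁻ τ in Jset l j, ENNReal.ofReal (c * T^(-((n:ℝ)-1)/2)) * ENNReal.ofReal ((zm l (|τ| - a))^(-((n:ℝ)+1)/2)) := by
          apply setLIntegral_mono' (Jset_meas l j)
          intro τ hτ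
          rw [← ofReal_norm, ← ENNReal.ofReal_mul (by positivity)]
          apply ENNReal.ofReal_le_ofReal
          refine (h l τ x hl).1.trans ?_
          have := zm_nonneg l (|τ| - a)
          have h2 : zm l τ ^ (-((n:ℝ) - 1) / 2) ≤ T^(-((n:ℝ)-1)/2) :=
            Real.rpow_le_rpow_of_nonpos hTpos (hJ τ hτ).1 (by linarith)
          gcongr
      _ ≤ ENNReal.ofReal (c * T^(-((n:ℝ)-1)/2)) * ENNReal.ofReal (c1 * l^(-((n:ℝ)-1)/2)) := by
          rw [lintegral_const_mul' _ _ ENNReal.ofReal_ne_top]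
          gcongr
          exact (setLIntegral_le_lintegral _ _).trans (hI l hl a)
      _ ≤ _ := by
          rw [← ENNReal.ofReal_mul (by positivity)]
          apply ENNReal.ofReal_le_ofReal
          have h3 : (2:ℝ)^(-((n:ℝ)+1)) ≤ (1 + ‖x‖/T)^(-((n:ℝ)+1)) := by
            apply Real.rpow_le_rpow_of_nonpos (by positivity) _ (by linarith)
            have : ‖x‖/T ≤ 1 := by rw [div_le_one hTpos]; linarith
            linarith
          have h4 : (2:ℝ)^((n:ℝ)+1) * 2^(-((n:ℝ)+1)) = 1 := by
            rw [← Real.rpow_add two_pos]; simp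
          have h5 : 1 ≤ (2:ℝ)^((n:ℝ)+1) * (1 + ‖x‖/T)^(-((n:ℝ)+1)) := by
            calc (1:ℝ) = (2:ℝ)^((n:ℝ)+1) * 2^(-((n:ℝ)+1)) := h4.symm
              _ ≤ _ := by gcongr
          calc c * T^(-((n:ℝ)-1)/2) * (c1 * l^(-((n:ℝ)-1)/2))
              = c * T^(-((n:ℝ)-1)/2) * (c1 * l^(-((n:ℝ)-1)/2)) * 1 := by ring
            _ ≤ c * T^(-((n:ℝ)-1)/2) * (c1 * l^(-((n:ℝ)-1)/2)) * ((2:ℝ)^((n:ℝ)+1) * (1 + ‖x‖/T)^(-((n:ℝ)+1))) := by gcongr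
            _ = (c * c1 * 2^((n:ℝ)+1) + 0) * l^(-((n:ℝ)-1)/2) * T^(-((n:ℝ)-1)/2) * (1 + ‖x‖/T)^(-((n:ℝ)+1)) := by ring
            _ ≤ _ := by gcongr; positivity
  · have hapos : 0 < a := by linarith
    have hpt : ∀ τ ∈ Jset l j, ‖PK n (l + τ * I) x‖ ≤ c * (2*T) * (a * (a/2))^(-((n:ℝ)+1)/2) := by
      intro τ hτ
      refine (h l τ x hl).2.trans ?_
      have hu : |τ| ≤ 2 * T := (zm_ge' l τ).trans (hJ τ hτ).2
      have h1 : a ≤ zm l (|τ| + a) := by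
        refine le_trans ?_ (zm_ge' l _)
        refine le_trans ?_ (le_abs_self _)
        have := abs_nonneg τ; linarith
      have h2 : a/2 ≤ zm l (|τ| - a) := by
        refine le_trans ?_ (zm_ge' l _)
        refine le_trans ?_ (neg_le_abs _)
        linarith
      have h3 : (zm l (|τ| + a) * zm l (|τ| - a))^(-((n:ℝ)+1)/2) ≤ (a * (a/2))^(-((n:ℝ)+1)/2) := by
        apply Real.rpow_le_rpow_of_nonpos (by positivity) _ (by linarith)
        gcongr
        exact zm_nonneg _ _
      have := zm_nonneg l (|τ| - a)
      have := zm_nonneg l (|τ| + a)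
      have := zm_nonneg l τ
      have := (hJ τ hτ).2
      gcongr
    calc ∫⁻ τ in Jset l j, ‖PK n (l + τ * I) x‖ₑ
        ≤ ∫⁻ τ in Jset l j, ENNReal.ofReal (c * (2*T) * (a * (a/2))^(-((n:ℝ)+1)/2)) := by
          apply setLIntegral_mono' (Jset_meas l j)
          intro τ hτ
          rw [← ofReal_norm]
          exact ENNReal.ofReal_le_ofReal (hpt τ hτ)
      _ ≤ ENNReal.ofReal (c * (2*T) * (a * (a/2))^(-((n:ℝ)+1)/2)) * ENNReal.ofReal (4 * T) := by
          rw [setLIntegral_const]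
          gcongr
          exact Jset_vol l hl j
      _ ≤ _ := by
          rw [← ENNReal.ofReal_mul (by positivity)]
          apply ENNReal.ofReal_le_ofReal
          have e1 : (a * (a/2))^(-((n:ℝ)+1)/2) = 2^(((n:ℝ)+1)/2) * a^(-((n:ℝ)+1)) := by
            have : a * (a/2) = a^(2:ℝ) * 2⁻¹ := by rw [Real.rpow_two]; ring
            rw [this, Real.mul_rpow (by positivity) (by positivity), ← Real.rpow_mul ha0, Real.inv_rpow (by norm_num), ← Real.rpow_neg (by norm_num)]
            rw [mul_comm]
            congr 2 <;> ring
          have e2 : a^(-((n:ℝ)+1)) * T^2 ≤ T^(-((n:ℝ)-1)) * (1 + ‖x‖/T)^(-((n:ℝ)+1)) := by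
            have h6 : (a/T)^(-((n:ℝ)+1)) ≤ (1 + ‖x‖/T)^(-((n:ℝ)+1)) := by
              apply Real.rpow_le_rpow_of_nonpos (by positivity) _ (by linarith)
              rw [le_div_iff₀ hTpos, add_mul, div_mul_cancel₀ _ hTpos.ne']
              linarith
            have h7 : a^(-((n:ℝ)+1)) * T^2 = T^(-((n:ℝ)-1)) * (a/T)^(-((n:ℝ)+1)) := by
              rw [Real.div_rpow ha0 hTpos.le, ← Real.rpow_two, Real.rpow_neg hTpos.le ((n:ℝ)+1), div_inv_eq_mul, mul_left_comm, ← Real.rpow_add hTpos]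
              congr 2; ring
            rw [h7]
            gcongr
          have e3 : T^(-((n:ℝ)-1)) ≤ l^(-((n:ℝ)-1)/2) * T^(-((n:ℝ)-1)/2) := by
            have : T^(-((n:ℝ)-1)) = T^(-((n:ℝ)-1)/2) * T^(-((n:ℝ)-1)/2) := by
              rw [← Real.rpow_add hTpos]; congr 1; ring
            rw [this]
            gcongr ?_ * _
            exact Real.rpow_le_rpow_of_nonpos hl hlT (by linarith)
          rw [e1]
          calc c * (2*T) * (2^(((n:ℝ)+1)/2) * a^(-((n:ℝ)+1))) * (4 * T)
              = 8 * c * 2^(((n:ℝ)+1)/2) * (a^(-((n:ℝ)+1)) * T^2) := by ring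
            _ ≤ 8 * c * 2^(((n:ℝ)+1)/2) * ((l^(-((n:ℝ)-1)/2) * T^(-((n:ℝ)-1)/2)) * (1 + ‖x‖/T)^(-((n:ℝ)+1))) := by
              apply mul_le_mul_of_nonneg_left _ (by positivity)
              exact e2.trans (mul_le_mul_of_nonneg_right e3 (by positivity))
            _ = (0 + 8 * c * 2^(((n:ℝ)+1)/2)) * l^(-((n:ℝ)-1)/2) * T^(-((n:ℝ)-1)/2) * (1 + ‖x‖/T)^(-((n:ℝ)+1)) := by ring
            _ ≤ _ := by gcongr; positivity

/-- powers of two with real exponents -/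
def p2 (y : ℝ) : ℝ≥0∞ := (2:ℝ≥0∞)^y

lemma p2_add (a b : ℝ) : p2 (a + b) = p2 a * p2 b :=
  ENNReal.rpow_add _ _ two_ne_zero ENNReal.ofNat_ne_top
lemma p2_zero : p2 0 = 1 := ENNReal.rpow_zero
lemma p2_one : p2 1 = 2 := ENNReal.rpow_one _
lemma p2_pos (a : ℝ) : 0 < p2 a := ENNReal.rpow_pos two_pos ENNReal.ofNat_ne_top
lemma p2_ne_zero (a : ℝ) : p2 a ≠ 0 := (p2_pos a).ne'
lemma p2_ne_top (a : ℝ) : p2 a ≠ ⊤ := by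
  unfold p2
  rw [ne_eq, ENNReal.rpow_eq_top_iff]
  simp
lemma p2_rpow (a b : ℝ) : (p2 a)^b = p2 (a * b) := (ENNReal.rpow_mul _ _ _).symm
lemma p2_mono {a b : ℝ} (h : a ≤ b) : p2 a ≤ p2 b :=
  ENNReal.rpow_le_rpow_of_exponent_le one_le_two h
lemma p2_ofReal (a : ℝ) : p2 a = ENNReal.ofReal (2^a) := by
  unfold p2
  rw [← ENNReal.ofReal_rpow_of_pos two_pos]; simp
lemma p2_strictMono {a b : ℝ} (h : a < b) : p2 a < p2 b := by
  rw [p2_ofReal, p2_ofReal]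
  apply (ENNReal.ofReal_lt_ofReal_iff (by positivity)).2
  exact Real.rpow_lt_rpow_of_exponent_lt one_lt_two h
lemma p2_le_iff {a b : ℝ} : p2 a ≤ p2 b ↔ a ≤ b :=
  ⟨fun h => by
    by_contra hc
    exact absurd (p2_strictMono (not_le.1 hc)) (not_lt.2 h), p2_mono⟩
lemma p2_lt_iff {a b : ℝ} : p2 a < p2 b ↔ a < b := by
  rw [← not_le, p2_le_iff, not_le]
lemma p2_mul_neg (a : ℝ) : p2 a * p2 (-a) = 1 := by rw [← p2_add]; simp [p2_zero]
lemma p2_neg_mul (a : ℝ) : p2 (-a) * p2 a = 1 := by rw [← p2_add]; simp [p2_zero]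
lemma ofReal_eq_p2 (x : ℝ) (hx : 0 < x) : ENNReal.ofReal x = p2 (Real.logb 2 x) := by
  rw [p2_ofReal, Real.rpow_logb two_pos (by norm_num) hx]
lemma exists_p2 (x : ℝ≥0∞) (h0 : x ≠ 0) (ht : x ≠ ⊤) : ∃ c : ℝ, x = p2 c := by
  refine ⟨Real.logb 2 x.toReal, ?_⟩
  rw [← ofReal_eq_p2 _ (ENNReal.toReal_pos h0 ht), ENNReal.ofReal_toReal ht]
lemma exists_dyadic (x : ℝ≥0∞) (h0 : x ≠ 0) (ht : x ≠ ⊤) : ∃ k : ℤ, p2 k ≤ x ∧ x < p2 (k + 1) := by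
  obtain ⟨c, rfl⟩ := exists_p2 x h0 ht
  exact ⟨⌊c⌋, p2_mono (Int.floor_le c), p2_strictMono (Int.lt_floor_add_one c)⟩

lemma summable_two_rpow_abs (ε : ℝ) (hε : 0 < ε) : Summable (fun k : ℤ => (2:ℝ)^(-(ε * |(k:ℝ)|))) := by
  have h1 : Summable (fun k : ℕ => (2:ℝ)^(-(ε * (k:ℝ)))) := by
    have : ∀ k : ℕ, (2:ℝ)^(-(ε * (k:ℝ))) = ((2:ℝ)^(-ε))^k := by
      intro k
      rw [← Real.rpow_natCast, ← Real.rpow_mul two_pos.le]; congr 1; ring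
    simp_rw [this]
    apply summable_geometric_of_lt_one (by positivity)
    exact Real.rpow_lt_one_of_one_lt_of_neg one_lt_two (by linarith)
  apply Summable.of_nat_of_neg <;> simpa using h1

lemma sum_p2_abs (ε σ : ℝ) (hε : 0 < ε) (hσ : 0 < σ) : ∃ C : ℝ≥0∞, C ≠ ⊤ ∧ ∀ c : ℝ,
    ∑' k : ℤ, p2 (-(ε * |σ * k + c|)) ≤ C := by
  have hs := summable_two_rpow_abs (ε * σ) (by positivity)
  refine ⟨p2 (ε*σ) * ∑' k : ℤ, p2 (-(ε * σ * |(k:ℝ)|)), ?_, fun c => ?_⟩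
  · apply ENNReal.mul_ne_top (p2_ne_top _)
    simp_rw [p2_ofReal]
    rw [← ENNReal.ofReal_tsum_of_nonneg (fun k => by positivity) hs]
    exact ENNReal.ofReal_ne_top
  · set k0 := ⌊-c/σ⌋ with hk0
    rw [← ENNReal.tsum_mul_left]
    rw [← (Equiv.addRight k0).tsum_eq (fun k : ℤ => p2 (-(ε * |σ * k + c|)))]
    apply ENNReal.tsum_le_tsum
    intro k
    rw [← p2_add]
    apply p2_mono
    have h1 := Int.floor_le (-c/σ)
    have h2 := Int.lt_floor_add_one (-c/σ)
    rw [← hk0] at h1 h2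
    rw [le_div_iff₀ hσ] at h1
    rw [div_lt_iff₀ hσ] at h2
    have h3 : σ * |(k:ℝ)| - σ ≤ |σ * ((k + k0 : ℤ):ℝ) + c| := by
      have e : σ * ((k + k0 : ℤ):ℝ) + c = σ * k - (-(σ * k0 + c)) := by push_cast; ring
      rw [e]
      have h4 := abs_sub_abs_le_abs_sub (σ * (k:ℝ)) (-(σ * k0 + c))
      have h5 : |-(σ * (k0:ℝ) + c)| ≤ σ := by rw [abs_le]; constructor <;> nlinarith
      rw [abs_mul, abs_of_pos hσ] at h4
      linarith
    simp only [Equiv.coe_addRight]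
    nlinarith

/-- G1: two sided geometric sums of minima -/
lemma sum_min_geom (α β : ℝ) (hα : 0 < α) (hβ : 0 < β) : ∃ C : ℝ≥0∞, C ≠ ⊤ ∧ ∀ a b : ℝ≥0∞, a ≠ 0 → a ≠ ⊤ → b ≠ 0 → b ≠ ⊤ →
    ∑' m : ℤ, min (a * p2 (α * m)) (b * p2 (-(β * m))) ≤ C * (a^(β/(α+β)) * b^(α/(α+β))) := by
  obtain ⟨C, hC, h⟩ := sum_p2_abs (min α β) 1 (lt_min hα hβ) one_pos
  refine ⟨C, hC, fun a b ha ha' hb hb' => ?_⟩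
  obtain ⟨c, rfl⟩ := exists_p2 a ha ha'
  obtain ⟨d, rfl⟩ := exists_p2 b hb hb'
  rw [p2_rpow, p2_rpow, ← p2_add]
  set x0 := (d - c)/(α + β) with hx0
  have hx : x0 * (α + β) = d - c := by rw [hx0]; field_simp
  have e0 : c * (β/(α+β)) + d * (α/(α+β)) = c + α * x0 := by
    rw [hx0]; field_simp; ring
  rw [e0]
  calc ∑' m : ℤ, min (p2 c * p2 (α * m)) (p2 d * p2 (-(β * m)))
      ≤ ∑' m : ℤ, p2 (-(min α β * |1 * m + (-x0)|)) * p2 (c + α * x0) := by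
        apply ENNReal.tsum_le_tsum
        intro m
        rw [← p2_add, ← p2_add, ← p2_add]
        rcases le_total (m:ℝ) x0 with hm | hm
        · refine (min_le_left _ _).trans (p2_mono ?_)
          rw [abs_of_nonpos (by linarith)]
          have := min_le_left α β
          nlinarith
        · refine (min_le_right _ _).trans (p2_mono ?_)
          rw [abs_of_nonneg (by linarith)]
          have := min_le_right α β
          nlinarith
    _ = (∑' m : ℤ, p2 (-(min α β * |1 * m + (-x0)|))) * p2 (c + α * x0) := ENNReal.tsum_mul_right
    _ ≤ _ := by gcongr; exact h _

lemma ENN_amgm (x y : ℝ≥0∞) : x * y ≤ x^2 + y^2 := by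
  rcases le_total x y with h | h
  · calc x * y ≤ y * y := by gcongr
      _ = y^2 := by ring
      _ ≤ _ := le_add_self
  · calc x * y ≤ x * x := by gcongr
      _ = x^2 := by ring
      _ ≤ _ := le_self_add

lemma lintegral_cs {α : Type*} [MeasurableSpace α] (μ : Measure α) (f g : α → ℝ≥0∞)
    (hf : AEMeasurable f μ) (hg : AEMeasurable g μ) :
    ∫⁻ a, f a * g a ∂μ ≤ (∫⁻ a, f a^2 ∂μ)^((1:ℝ)/2) * (∫⁻ a, g a^2 ∂μ)^((1:ℝ)/2) := by
  have := ENNReal.lintegral_mul_le_Lp_mul_Lq μ (p := 2) (q := 2) (by constructor <;> norm_num) hf hg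
  simpa [ENNReal.rpow_two] using this

lemma tsum_cs {α : Type*} [Countable α] (f g : α → ℝ≥0∞) :
    ∑' a, f a * g a ≤ (∑' a, f a^2)^((1:ℝ)/2) * (∑' a, g a^2)^((1:ℝ)/2) := by
  letI : MeasurableSpace α := ⊤
  have := lintegral_cs (Measure.count : Measure α) f g (measurable_of_countable f).aemeasurable (measurable_of_countable g).aemeasurable
  simpa [lintegral_count] using this

/-- Hankel type Schur test -/
lemma hankel_schur (w : ℤ → ℝ≥0∞) (x y : ℤ → ℝ≥0∞) :
    ∑' k : ℤ, ∑' l : ℤ, w (k + l) * (x k * y l) ≤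
      (∑' m, w m) * ((∑' k, x k^2)^((1:ℝ)/2) * (∑' k, y k^2)^((1:ℝ)/2)) := by
  calc ∑' k : ℤ, ∑' l : ℤ, w (k + l) * (x k * y l)
      = ∑' k : ℤ, ∑' m : ℤ, w m * (x k * y (m - k)) := by
        congr 1; ext k
        rw [← (Equiv.addLeft k).tsum_eq (fun m => w m * (x k * y (m - k)))]
        congr 1; ext l
        simp
    _ = ∑' m : ℤ, w m * ∑' k : ℤ, x k * y (m - k) := by
        rw [ENNReal.tsum_comm]
        congr 1; ext m
        rw [ENNReal.tsum_mul_left]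
    _ ≤ ∑' m : ℤ, w m * ((∑' k, x k^2)^((1:ℝ)/2) * (∑' k, y k^2)^((1:ℝ)/2)) := by
        apply ENNReal.tsum_le_tsum; intro m
        gcongr
        refine (tsum_cs _ _).trans ?_
        have h5 := (Equiv.subLeft m).tsum_eq (fun k => y k^2)
        simp only [Equiv.subLeft_apply] at h5
        rw [h5]
    _ = _ := ENNReal.tsum_mul_right

/-- sums of x^2 versus sums of x^p, p ≤ 2 -/
lemma tsum_sq_le (x : ℤ → ℝ≥0∞) (p : ℝ) (hp0 : 0 < p) (hp : p ≤ 2) :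
    ∑' k, x k^2 ≤ (∑' k, x k^p)^(2/p) := by
  set S := ∑' k, x k^p with hS
  have h1 : ∀ k, x k^2 ≤ x k^p * S^((2-p)/p) := by
    intro k
    have h2 : x k^p ≤ S := ENNReal.le_tsum k
    have h3 : x k ≤ S^(1/p) := by
      calc x k = (x k^p)^(1/p) := by rw [← ENNReal.rpow_mul, mul_one_div_cancel hp0.ne', ENNReal.rpow_one]
        _ ≤ _ := by gcongr
    calc x k^2 = x k^p * x k^(2-p) := by
          rw [← ENNReal.rpow_add_of_nonneg _ _ hp0.le (by linarith), ← ENNReal.rpow_two]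
          congr 1; ring
      _ ≤ x k^p * (S^(1/p))^(2-p) := by gcongr
      _ = _ := by rw [← ENNReal.rpow_mul]; congr 2; ring
  calc ∑' k, x k^2 ≤ ∑' k, x k^p * S^((2-p)/p) := ENNReal.tsum_le_tsum h1
    _ = S * S^((2-p)/p) := ENNReal.tsum_mul_right
    _ = S^(2/p) := by
      nth_rewrite 1 [← ENNReal.rpow_one S]
      rw [← ENNReal.rpow_add_of_nonneg _ _ (by norm_num) (div_nonneg (by linarith) hp0.le)]
      congr 1; field_simp; ring

lemma sum_p2_le (H : ℝ≥0∞) : ∑' k : ℤ, (if p2 k ≤ H then p2 k else 0) ≤ 2 * H := by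
  rcases eq_or_ne H 0 with rfl | h0
  · have : ∀ k : ℤ, (if p2 k ≤ 0 then p2 k else 0) = 0 := by
      intro k; rw [if_neg (not_le.2 (p2_pos _))]
    simp [this]
  rcases eq_or_ne H ⊤ with rfl | ht
  · rw [ENNReal.mul_top two_ne_zero]; exact le_top
  obtain ⟨K, h1, h2⟩ := exists_dyadic H h0 ht
  have hinj : Function.Injective (fun j : ℕ => K - (j:ℤ)) := by
    intro a b hab; simp at hab; exact hab
  rw [← hinj.tsum_eq]
  · calc ∑' j : ℕ, (if p2 ((K - (j:ℤ) : ℤ)) ≤ H then p2 ((K - (j:ℤ) : ℤ)) else 0)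
        ≤ ∑' j : ℕ, p2 K * (2⁻¹)^j := by
          apply ENNReal.tsum_le_tsum; intro j
          have : p2 ((K - (j:ℤ) : ℤ)) = p2 K * (2⁻¹)^j := by
            push_cast
            rw [sub_eq_add_neg, p2_add]
            congr 1
            unfold p2
            rw [ENNReal.rpow_neg, ENNReal.rpow_natCast, ENNReal.inv_pow]
          split_ifs
          · rw [this]
          · simp
      _ = p2 K * 2 := by rw [ENNReal.tsum_mul_left, ENNReal.tsum_geometric_two]
      _ ≤ _ := by rw [mul_comm]; gcongr
  · intro k hk
    simp only [Function.mem_support, ne_eq, ite_eq_right_iff, Classical.not_imp] at hk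
    have h3 : (k:ℝ) < K + 1 := p2_lt_iff.1 (hk.1.trans_lt h2)
    have h4 : k ≤ K := by
      have : k < K + 1 := by exact_mod_cast h3
      omega
    exact ⟨(K - k).toNat, by simp; omega⟩

section atoms
variable {X T : Type*} [MeasurableSpace X] [MeasurableSpace T]

/-- mass of a dyadic level -/
def lmass (μ : Measure X) (f : X × T → ℝ≥0∞) (k : ℤ) (t : T) : ℝ≥0∞ :=
  μ {x | p2 k ≤ f (x, t) ∧ f (x, t) < p2 (k + 1)}

/-- atoms -/
def Aset (μ : Measure X) (f : X × T → ℝ≥0∞) (m : ℤ) : Set (X × T) :=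
  ⋃ k : ℤ, {z | (p2 k ≤ f z ∧ f z < p2 (k + 1)) ∧ (p2 m ≤ lmass μ f k z.2 ∧ lmass μ f k z.2 < p2 (m + 1))}

/-- pieces -/
def fat (μ : Measure X) (f : X × T → ℝ≥0∞) (m : ℤ) : X × T → ℝ≥0∞ := (Aset μ f m).indicator f

/-- heights -/
def Hat (μ : Measure X) (p : ℝ) (f : X × T → ℝ≥0∞) (m : ℤ) (t : T) : ℝ≥0∞ :=
  (p2 (-m) * ∫⁻ x, (fat μ f m (x, t))^p ∂μ)^(1/p)

variable {μ : Measure X} [SFinite μ] {f : X × T → ℝ≥0∞}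

lemma lmass_meas (hf : Measurable f) (k : ℤ) : Measurable (lmass μ f k) := by
  have : MeasurableSet {z : X × T | p2 k ≤ f z ∧ f z < p2 (k + 1)} :=
    (measurableSet_le measurable_const hf).inter (measurableSet_lt hf measurable_const)
  exact measurable_measure_prodMk_right this

lemma Aset_meas (hf : Measurable f) (m : ℤ) : MeasurableSet (Aset μ f m) := by
  apply MeasurableSet.iUnion; intro k
  have h : Measurable (fun z : X × T => lmass μ f k z.2) := (lmass_meas (μ := μ) hf k).comp measurable_snd
  exact ((measurableSet_le measurable_const hf).inter (measurableSet_lt hf measurable_const)).inter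
    ((measurableSet_le measurable_const h).inter (measurableSet_lt h measurable_const))

lemma fat_meas (hf : Measurable f) (m : ℤ) : Measurable (fat μ f m) :=
  hf.indicator (Aset_meas hf m)

lemma Hat_meas (hf : Measurable f) (p : ℝ) (m : ℤ) : Measurable (Hat μ p f m) := by
  unfold Hat
  apply Measurable.pow_const
  apply Measurable.const_mul
  exact Measurable.lintegral_prod_left' ((fat_meas hf m).pow_const p)

lemma dyadic_unique {x : ℝ≥0∞} {k l : ℤ} (h1 : p2 k ≤ x ∧ x < p2 (k + 1)) (h2 : p2 l ≤ x ∧ x < p2 (l + 1)) : k = l := by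
  have h3 : (k:ℝ) < l + 1 := p2_lt_iff.1 (h1.1.trans_lt h2.2)
  have h4 : (l:ℝ) < k + 1 := p2_lt_iff.1 (h2.1.trans_lt h1.2)
  have h3' : k < l + 1 := by exact_mod_cast h3
  have h4' : l < k + 1 := by exact_mod_cast h4
  omega

lemma Aset_disj {m m' : ℤ} {z : X × T} (h : z ∈ Aset μ f m) (h' : z ∈ Aset μ f m') : m = m' := by
  simp only [Aset, Set.mem_iUnion, Set.mem_ofPred_eq] at h h'
  obtain ⟨k, h1, h2⟩ := h
  obtain ⟨k', h1', h2'⟩ := h'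
  obtain rfl := dyadic_unique h1 h1'
  exact dyadic_unique h2 h2'

lemma Hat_ge (hf : Measurable f) {p : ℝ} (hp : 0 < p) {m k : ℤ} {t : T}
    (h2 : p2 m ≤ lmass μ f k t ∧ lmass μ f k t < p2 (m + 1)) : p2 k ≤ Hat μ p f m t := by
  have hS : MeasurableSet {x | p2 k ≤ f (x, t) ∧ f (x, t) < p2 (k + 1)} := by
    have h := hf.comp (measurable_prodMk_right (y := t))
    exact (measurableSet_le measurable_const h).inter (measurableSet_lt h measurable_const)
  have h3 : p2 (k * p) * p2 m ≤ ∫⁻ x, (fat μ f m (x, t))^p ∂μ := by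
    calc p2 (k * p) * p2 m ≤ p2 (k * p) * lmass μ f k t := by gcongr; exact h2.1
      _ = ∫⁻ x in {x | p2 k ≤ f (x, t) ∧ f (x, t) < p2 (k + 1)}, p2 (k * p) ∂μ := by
        rw [setLIntegral_const]; rfl
      _ ≤ ∫⁻ x in {x | p2 k ≤ f (x, t) ∧ f (x, t) < p2 (k + 1)}, (fat μ f m (x, t))^p ∂μ := by
        apply setLIntegral_mono' hS
        intro x hx
        have : (x, t) ∈ Aset μ f m := Set.mem_iUnion.2 ⟨k, hx, h2⟩
        rw [fat, Set.indicator_of_mem this, ← p2_rpow]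
        gcongr; exact hx.1
      _ ≤ _ := setLIntegral_le_lintegral _ _
  unfold Hat
  calc p2 k = (p2 (-m) * (p2 (k * p) * p2 m))^(1/p) := by
        rw [← p2_add, ← p2_add, p2_rpow]; congr 1; field_simp; ring
    _ ≤ _ := by gcongr

lemma fat_le (hf : Measurable f) {p : ℝ} (hp : 0 < p) (m : ℤ) (x : X) (t : T) :
    fat μ f m (x, t) ≤ 2 * Hat μ p f m t := by
  by_cases h : (x, t) ∈ Aset μ f m
  · rw [fat, Set.indicator_of_mem h]
    simp only [Aset, Set.mem_iUnion, Set.mem_ofPred_eq] at h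
    obtain ⟨k, h1, h2⟩ := h
    calc f (x, t) ≤ p2 (k + 1) := h1.2.le
      _ = 2 * p2 k := by rw [p2_add, p2_one, mul_comm]
      _ ≤ _ := by gcongr; exact Hat_ge hf hp h2
  · rw [fat, Set.indicator_of_notMem h]; simp

lemma fat_int (hf : Measurable f) {p : ℝ} (hp : 0 < p) (m : ℤ) (t : T) :
    ∫⁻ x, fat μ f m (x, t) ∂μ ≤ 8 * (p2 m * Hat μ p f m t) := by
  have hft := hf.comp (measurable_prodMk_right (α := X) (y := t))
  have hS : ∀ k : ℤ, MeasurableSet {x | p2 k ≤ f (x, t) ∧ f (x, t) < p2 (k + 1)} := fun k =>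
    (measurableSet_le measurable_const hft).inter (measurableSet_lt hft measurable_const)
  calc ∫⁻ x, fat μ f m (x, t) ∂μ ≤ ∫⁻ x, ∑' k : ℤ, (if p2 m ≤ lmass μ f k t ∧ lmass μ f k t < p2 (m + 1) then
        ({x | p2 k ≤ f (x, t) ∧ f (x, t) < p2 (k + 1)}.indicator (fun _ => p2 (k + 1)) x) else 0) ∂μ := by
        apply lintegral_mono; intro x
        by_cases h : (x, t) ∈ Aset μ f m
        · simp only [fat]
          rw [Set.indicator_of_mem h]
          simp only [Aset, Set.mem_iUnion, Set.mem_ofPred_eq] at h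
          obtain ⟨k, h1, h2⟩ := h
          refine le_trans ?_ (ENNReal.le_tsum k)
          rw [if_pos h2, Set.indicator_of_mem (by exact h1)]
          exact h1.2.le
        · simp only [fat]
          rw [Set.indicator_of_notMem h]; simp
    _ = ∑' k : ℤ, ∫⁻ x, (if p2 m ≤ lmass μ f k t ∧ lmass μ f k t < p2 (m + 1) then
        ({x | p2 k ≤ f (x, t) ∧ f (x, t) < p2 (k + 1)}.indicator (fun _ => p2 (k + 1)) x) else 0) ∂μ := by
        rw [lintegral_tsum]
        intro k
        split_ifs
        · exact (measurable_const.indicator (hS k)).aemeasurable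
        · exact aemeasurable_const
    _ ≤ ∑' k : ℤ, (4 * p2 m) * (if p2 k ≤ Hat μ p f m t then p2 k else 0) := by
        apply ENNReal.tsum_le_tsum; intro k
        split_ifs with h1 h2 h2
        · rw [lintegral_indicator (hS k), setLIntegral_const]
          calc p2 (k + 1) * μ {x | p2 k ≤ f (x, t) ∧ f (x, t) < p2 (k + 1)}
              ≤ p2 (k + 1) * p2 (m + 1) := by gcongr; exact h1.2.le
            _ = _ := by rw [p2_add, p2_add, p2_one]; ring
        · exact absurd (Hat_ge hf hp h1) h2
        · simp
        · simp
    _ ≤ (4 * p2 m) * (2 * Hat μ p f m t) := by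
        rw [ENNReal.tsum_mul_left]; gcongr; exact sum_p2_le _
    _ = _ := by ring

lemma fat_int2 (hf : Measurable f) {p : ℝ} (hp : 0 < p) (m : ℤ) (t : T) :
    ∫⁻ x, fat μ f m (x, t)^2 ∂μ ≤ 16 * (p2 m * Hat μ p f m t^2) := by
  have hft := (fat_meas (μ := μ) hf m).comp (measurable_prodMk_right (α := X) (y := t))
  calc ∫⁻ x, fat μ f m (x, t)^2 ∂μ ≤ ∫⁻ x, 2 * Hat μ p f m t * fat μ f m (x, t) ∂μ := by
        apply lintegral_mono; intro x
        simp only [pow_two]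
        gcongr; exact fat_le hf hp m x t
    _ = 2 * Hat μ p f m t * ∫⁻ x, fat μ f m (x, t) ∂μ := lintegral_const_mul _ hft
    _ ≤ 2 * Hat μ p f m t * (8 * (p2 m * Hat μ p f m t)) := by gcongr; exact fat_int hf hp m t
    _ = _ := by ring

lemma Hat_pow {p : ℝ} (hp : 0 < p) (m : ℤ) (t : T) :
    p2 m * Hat μ p f m t^p = ∫⁻ x, fat μ f m (x, t)^p ∂μ := by
  unfold Hat
  rw [← ENNReal.rpow_mul, one_div_mul_cancel hp.ne', ENNReal.rpow_one, ← mul_assoc, p2_mul_neg, one_mul]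

lemma Hat_sum (hf : Measurable f) {p : ℝ} (hp : 0 < p) (t : T) :
    ∑' m : ℤ, p2 m * Hat μ p f m t^p ≤ ∫⁻ x, f (x, t)^p ∂μ := by
  simp_rw [Hat_pow hp]
  have h0 : ∀ m : ℤ, AEMeasurable (fun x => fat μ f m (x, t)^p) μ := fun m =>
    (((fat_meas (μ := μ) hf m).comp (measurable_prodMk_right (α := X) (y := t))).pow_const p).aemeasurable
  rw [← lintegral_tsum h0]
  apply lintegral_mono; intro x
  dsimp only
  by_cases h : ∃ m, (x, t) ∈ Aset μ f m
  · obtain ⟨m, hm⟩ := h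
    rw [tsum_eq_single m]
    · simp only [fat]; rw [Set.indicator_of_mem hm]
    · intro m' hm'
      have : (x, t) ∉ Aset μ f m' := fun h => hm' (Aset_disj h hm)
      simp only [fat]; rw [Set.indicator_of_notMem this, ENNReal.zero_rpow_of_pos hp]
  · push Not at h
    have : ∀ m, fat μ f m (x, t)^p = 0 := by
      intro m; simp only [fat]; rw [Set.indicator_of_notMem (h m), ENNReal.zero_rpow_of_pos hp]
    simp [this]

lemma Aset_cover (hf : Measurable f) {p : ℝ} (hp : 0 < p) (t : T) (hft : ∀ x, f (x, t) ≠ ⊤)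
    (hfin : ∫⁻ x, f (x, t)^p ∂μ ≠ ⊤) : ∀ᵐ x ∂μ, f (x, t) = 0 ∨ ∃ m, (x, t) ∈ Aset μ f m := by
  have hf1 := hf.comp (measurable_prodMk_right (α := X) (y := t))
  have h1 : ∀ k : ℤ, lmass μ f k t ≠ ⊤ := by
    intro k hk
    apply hfin
    rw [eq_top_iff]
    calc ⊤ = p2 (k * p) * lmass μ f k t := by rw [hk, ENNReal.mul_top (p2_ne_zero _)]
      _ = ∫⁻ x in {x | p2 k ≤ f (x, t) ∧ f (x, t) < p2 (k + 1)}, p2 (k * p) ∂μ := by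
        rw [setLIntegral_const]; rfl
      _ ≤ ∫⁻ x in {x | p2 k ≤ f (x, t) ∧ f (x, t) < p2 (k + 1)}, f (x, t)^p ∂μ := by
        apply setLIntegral_mono (hf1.pow_const p)
        intro x hx
        rw [← p2_rpow]
        gcongr; exact hx.1
      _ ≤ _ := setLIntegral_le_lintegral _ _
  have h2 : ∀ᵐ x ∂μ, ∀ k : ℤ, lmass μ f k t = 0 → ¬ (p2 k ≤ f (x, t) ∧ f (x, t) < p2 (k + 1)) := by
    rw [ae_all_iff]; intro k
    by_cases h : lmass μ f k t = 0
    · have : ∀ᵐ x ∂μ, ¬ (p2 k ≤ f (x, t) ∧ f (x, t) < p2 (k + 1)) := by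
        rw [ae_iff]; simpa [lmass] using h
      filter_upwards [this] with x hx _ using hx
    · exact Eventually.of_forall fun x hx => absurd hx h
  filter_upwards [h2] with x hx
  rcases eq_or_ne (f (x, t)) 0 with h0 | h0
  · exact Or.inl h0
  right
  obtain ⟨k, hk⟩ := exists_dyadic _ h0 (hft x)
  have h3 : lmass μ f k t ≠ 0 := fun h => hx k h hk
  obtain ⟨m, hm⟩ := exists_dyadic _ h3 (h1 k)
  exact ⟨m, Set.mem_iUnion.2 ⟨k, hk, hm⟩⟩
end atoms

/-- Euclidean space -/

lemma PK_mass (n : ℕ) (hn : 1 ≤ n) : ∃ C : ℝ, 0 < C ∧ ∀ l : ℝ, 0 < l →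
    ∫⁻ x : Eu n, ‖PK n l x‖ₑ ≤ ENNReal.ofReal C := by
  obtain ⟨c, hc, h⟩ := PK_real n hn
  set φ : Eu n → ℝ := fun x => (1 + ‖x‖^2)^(-((n:ℝ)+1)/2) with hφ
  have hφi : Integrable φ := by
    have := integrable_rpow_neg_one_add_norm_sq (E := Eu n) (μ := volume) (r := (n:ℝ)+1) (by simp)
    exact this
  have hφ0 : ∀ x, 0 ≤ φ x := fun x => by simp only [hφ]; positivity
  refine ⟨c * (∫ x, φ x) + 1, by have : 0 ≤ ∫ x, φ x := integral_nonneg (fun x => hφ0 x); positivity, fun l hl => ?_⟩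
  have hle : ∀ x : Eu n, ‖PK n l x‖ₑ ≤ ENNReal.ofReal (c * l^(-(n:ℝ)) * φ (l⁻¹ • x)) := by
    intro x
    rw [h l x hl, ← ofReal_norm]
    apply ENNReal.ofReal_le_ofReal
    rw [Complex.norm_real, Real.norm_of_nonneg (by positivity)]
    have e1 : φ (l⁻¹ • x) = (l^2)^(((n:ℝ)+1)/2) * (l^2 + ‖x‖^2)^(-((n:ℝ)+1)/2) := by
      simp only [hφ]
      rw [norm_smul, norm_inv, Real.norm_of_nonneg hl.le]
      have : 1 + (l⁻¹ * ‖x‖)^2 = (l^2)⁻¹ * (l^2 + ‖x‖^2) := by field_simp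
      rw [this, Real.mul_rpow (by positivity) (by positivity), Real.inv_rpow (by positivity),
        ← Real.rpow_neg (by positivity)]
      congr 2; ring
    have e2 : l^(-(n:ℝ)) * (l^2)^(((n:ℝ)+1)/2) = l := by
      rw [← Real.rpow_natCast l 2, ← Real.rpow_mul hl.le, ← Real.rpow_add hl]
      push_cast
      have : -(n:ℝ) + 2 * (((n:ℝ)+1)/2) = 1 := by ring
      rw [this, Real.rpow_one]
    rw [e1]
    calc c * l * (l^2 + 4 * Real.pi^2 * ‖x‖^2)^(-((n:ℝ)+1)/2) ≤ c * l * (l^2 + ‖x‖^2)^(-((n:ℝ)+1)/2) := by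
          gcongr c * l * ?_
          apply Real.rpow_le_rpow_of_nonpos (by positivity)
          · have := Real.pi_gt_three
            have h3 : 1 ≤ 4 * Real.pi^2 := by nlinarith
            nlinarith [sq_nonneg ‖x‖]
          · have : (0:ℝ) ≤ n := by positivity
            linarith
      _ = c * (l^(-(n:ℝ)) * (l^2)^(((n:ℝ)+1)/2)) * (l^2 + ‖x‖^2)^(-((n:ℝ)+1)/2) := by rw [e2]
      _ = _ := by ring
  calc ∫⁻ x : Eu n, ‖PK n l x‖ₑ ≤ ∫⁻ x : Eu n, ENNReal.ofReal (c * l^(-(n:ℝ)) * φ (l⁻¹ • x)) := lintegral_mono hle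
    _ = ENNReal.ofReal (∫ x : Eu n, c * l^(-(n:ℝ)) * φ (l⁻¹ • x)) := by
        rw [ofReal_integral_eq_lintegral_ofReal]
        · exact ((integrable_comp_smul_iff volume φ (inv_ne_zero hl.ne')).2 hφi).const_mul _
        · exact Eventually.of_forall fun x => by have := hφ0 (l⁻¹ • x); positivity
    _ ≤ _ := by
        apply ENNReal.ofReal_le_ofReal
        rw [integral_const_mul, Measure.integral_comp_inv_smul_of_nonneg volume φ hl.le]
        simp only [finrank_euclideanSpace, Fintype.card_fin, smul_eq_mul]
        have : c * l^(-(n:ℝ)) * (l^n * ∫ x, φ x) = c * ∫ x, φ x := by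
          rw [Real.rpow_neg hl.le, Real.rpow_natCast]; field_simp
        rw [this]; linarith

/-- the bilinear form at fixed time difference -/
def Bil (n : ℕ) (l τ : ℝ) (f g : Eu n → ℂ) : ℂ :=
  ∫ ξ : Eu n, cexp (-((l:ℂ) + τ * I) * ‖ξ‖) * (𝓕 f ξ * starRingEnd ℂ (𝓕 g ξ))

lemma norm_cexp_lt (l τ r : ℝ) : ‖cexp (-((l:ℂ) + τ * I) * r)‖ = Real.exp (-(l * r)) := by
  rw [Complex.norm_exp]; congr 1; simp

lemma fourier_cont {n : ℕ} {f : Eu n → ℂ} (hf : Integrable f) : Continuous (𝓕 f) :=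
  VectorFourier.fourierIntegral_continuous Real.continuous_fourierChar (innerSL ℝ).continuous₂ hf

lemma fourier_norm_le {n : ℕ} (f : Eu n → ℂ) (ξ : Eu n) : ‖𝓕 f ξ‖ₑ ≤ ∫⁻ x, ‖f x‖ₑ := by
  rw [Real.fourier_eq]
  refine (enorm_integral_le_lintegral_enorm _).trans (le_of_eq ?_)
  apply lintegral_congr; intro x
  rw [← ofReal_norm, ← ofReal_norm, Circle.norm_smul]

lemma fourier_prod {n : ℕ} (f g : Eu n → ℂ) (ξ : Eu n) :
    𝓕 f ξ * starRingEnd ℂ (𝓕 g ξ) = ∫ w : Eu n × Eu n, cexp (2 * Real.pi * I * (inner ℝ (w.2 - w.1) ξ : ℝ)) * (f w.1 * starRingEnd ℂ (g w.2)) := by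
  rw [Real.fourier_eq', Real.fourier_eq', ← integral_conj, ← integral_prod_mul]
  apply integral_congr_ae
  refine Eventually.of_forall fun w => ?_
  simp only [smul_eq_mul, map_mul]
  rw [← Complex.exp_conj, inner_sub_left]
  have : cexp (2 * Real.pi * I * ((inner ℝ w.2 ξ - inner ℝ w.1 ξ : ℝ):ℂ)) = cexp (↑(-2 * Real.pi * inner ℝ w.1 ξ) * I) * cexp ((starRingEnd ℂ) (↑(-2 * Real.pi * inner ℝ w.2 ξ) * I)) := by
    rw [← Complex.exp_add]; congr 1
    rw [map_mul, Complex.conj_I, Complex.conj_ofReal]; push_cast; ring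
  rw [this]; ring

lemma Bil_le_PK (n : ℕ) (l τ : ℝ) (hl : 0 < l) (f g : Eu n → ℂ) (hf : Integrable f) (hg : Integrable g) :
    ‖Bil n l τ f g‖ₑ ≤ ∫⁻ w : Eu n × Eu n, ‖PK n (l + τ * I) (w.2 - w.1)‖ₑ * (‖f w.1‖ₑ * ‖g w.2‖ₑ) := by
  have e1 : Bil n l τ f g = ∫ ξ : Eu n, ∫ w : Eu n × Eu n, cexp (-((l:ℂ) + τ * I) * ‖ξ‖) *
      (cexp (2 * Real.pi * I * (inner ℝ (w.2 - w.1) ξ : ℝ)) * (f w.1 * starRingEnd ℂ (g w.2))) := by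
    unfold Bil
    congr 1; ext ξ
    rw [fourier_prod, integral_const_mul]
  have hi : Integrable (fun v : Eu n × (Eu n × Eu n) => cexp (-((l:ℂ) + τ * I) * ‖v.1‖) *
      (cexp (2 * Real.pi * I * (inner ℝ (v.2.2 - v.2.1) v.1 : ℝ)) * (f v.2.1 * starRingEnd ℂ (g v.2.2)))) (volume.prod (volume.prod volume)) := by
    have h1 : Integrable (fun w : Eu n × Eu n => f w.1 * starRingEnd ℂ (g w.2)) (volume.prod volume) :=
      hf.mul_prod (g := fun y => starRingEnd ℂ (g y)) ((LinearIsometryEquiv.integrable_comp_iff conjLIE).2 hg)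
    have h2 : Integrable (fun v : Eu n × (Eu n × Eu n) => (Real.exp (-(l * ‖v.1‖)) : ℂ) * (f v.2.1 * starRingEnd ℂ (g v.2.2))) (volume.prod (volume.prod volume)) :=
      (integrable_exp_neg_norm n l hl).ofReal.mul_prod h1
    refine h2.mono ?_ (Eventually.of_forall fun v => ?_)
    · apply AEStronglyMeasurable.mul
      · exact Continuous.aestronglyMeasurable (by fun_prop)
      · apply AEStronglyMeasurable.mul
        · exact Continuous.aestronglyMeasurable (by fun_prop)
        · exact h1.aestronglyMeasurable.comp_snd
    · rw [norm_mul, norm_mul, norm_mul, norm_cexp_lt]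
      have : ‖cexp (2 * Real.pi * I * ((inner ℝ (v.2.2 - v.2.1) v.1 : ℝ):ℂ))‖ = 1 := by
        rw [Complex.norm_exp]; simp
      rw [this, one_mul, norm_mul, norm_mul, Complex.norm_real, Real.norm_of_nonneg (Real.exp_pos _).le]
  rw [e1, integral_integral_swap hi]
  refine (enorm_integral_le_lintegral_enorm _).trans (le_of_eq ?_)
  apply lintegral_congr; intro w
  have e2 : ∫ ξ : Eu n, cexp (-((l:ℂ) + τ * I) * ‖ξ‖) *
      (cexp (2 * Real.pi * I * (inner ℝ (w.2 - w.1) ξ : ℝ)) * (f w.1 * starRingEnd ℂ (g w.2)))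
      = PK n (l + τ * I) (w.2 - w.1) * (f w.1 * starRingEnd ℂ (g w.2)) := by
    unfold PK
    rw [← integral_mul_const]
    congr 1; ext ξ
    rw [Complex.exp_add]; ring
  rw [e2, enorm_mul, enorm_mul]
  congr 2
  rw [← ofReal_norm, ← ofReal_norm, RCLike.norm_conj]

lemma PK_cont (n : ℕ) (z : ℂ) (hz : 0 < z.re) : Continuous (PK n z) := by
  unfold PK
  apply continuous_of_dominated (bound := fun ξ => Real.exp (-(z.re * ‖ξ‖)))
  · intro x
    exact Continuous.aestronglyMeasurable (by fun_prop)
  · intro x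
    refine Eventually.of_forall fun ξ => ?_
    rw [PK_norm_integrand]
  · exact integrable_exp_neg_norm n z.re hz
  · refine Eventually.of_forall fun ξ => ?_
    fun_prop

set_option maxHeartbeats 1000000 in
/-- weighted L2 bound -/
lemma fourier_L2 (n : ℕ) (hn : 1 ≤ n) : ∃ C : ℝ, 0 < C ∧ ∀ (l : ℝ) (f : Eu n → ℂ), 0 < l → Integrable f →
    ∫⁻ ξ : Eu n, ENNReal.ofReal (Real.exp (-(l * ‖ξ‖))) * ‖𝓕 f ξ‖ₑ^2 ≤ ENNReal.ofReal C * ∫⁻ x, ‖f x‖ₑ^2 := by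
  obtain ⟨C, hC, h⟩ := PK_mass n hn
  refine ⟨2 * C, by positivity, fun l f hl hf => ?_⟩
  have hc : Continuous (𝓕 f) := fourier_cont hf
  have e1 : ∫⁻ ξ : Eu n, ENNReal.ofReal (Real.exp (-(l * ‖ξ‖))) * ‖𝓕 f ξ‖ₑ^2 = ‖Bil n l 0 f f‖ₑ := by
    have e2 : Bil n l 0 f f = ((∫ ξ : Eu n, Real.exp (-(l * ‖ξ‖)) * ‖𝓕 f ξ‖^2 : ℝ) : ℂ) := by
      rw [← integral_complex_ofReal]
      unfold Bil
      congr 1; ext ξ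
      rw [Complex.mul_conj, Complex.normSq_eq_norm_sq]
      push_cast
      congr 2; simp
    rw [e2, ← ofReal_norm, Complex.norm_real, Real.norm_of_nonneg (integral_nonneg fun ξ => by positivity),
      ofReal_integral_eq_lintegral_ofReal]
    · apply lintegral_congr; intro ξ
      rw [ENNReal.ofReal_mul (Real.exp_pos _).le, ENNReal.ofReal_pow (norm_nonneg _), ofReal_norm]
    · refine Integrable.mono' ((integrable_exp_neg_norm n l hl).mul_const ((∫ x, ‖f x‖)^2)) ?_ (Eventually.of_forall fun ξ => ?_)
      · exact Continuous.aestronglyMeasurable (by fun_prop)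
      · rw [Real.norm_of_nonneg (by positivity)]
        gcongr
        exact VectorFourier.norm_fourierIntegral_le_integral_norm _ _ _ _ _
    · exact Eventually.of_forall fun ξ => by positivity
  rw [e1]
  refine (Bil_le_PK n l 0 hl f f hf hf).trans ?_
  have hPc := PK_cont n ((l:ℂ) + (0:ℝ) * I) (by simpa using hl)
  have hPm : Measurable (fun w : Eu n × Eu n => ‖PK n ((l:ℂ) + (0:ℝ) * I) (w.2 - w.1)‖ₑ) := by
    exact (Continuous.measurable (by fun_prop)).enorm
  have hfm : AEMeasurable (fun x => ‖f x‖ₑ) := hf.aestronglyMeasurable.enorm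
  have hA1 : AEMeasurable (fun w : Eu n × Eu n => ‖PK n ((l:ℂ) + (0:ℝ) * I) (w.2 - w.1)‖ₑ * ‖f w.1‖ₑ^2) (volume.prod volume) :=
    hPm.aemeasurable.mul ((hfm.comp_quasiMeasurePreserving Measure.quasiMeasurePreserving_fst).pow_const 2)
  have hA2 : AEMeasurable (fun w : Eu n × Eu n => ‖PK n ((l:ℂ) + (0:ℝ) * I) (w.2 - w.1)‖ₑ * ‖f w.2‖ₑ^2) (volume.prod volume) :=
    hPm.aemeasurable.mul ((hfm.comp_quasiMeasurePreserving Measure.quasiMeasurePreserving_snd).pow_const 2)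
  have hl0 : ((l:ℂ) + (0:ℝ) * I) = (l:ℂ) := by simp
  calc ∫⁻ w : Eu n × Eu n, ‖PK n (l + (0:ℝ) * I) (w.2 - w.1)‖ₑ * (‖f w.1‖ₑ * ‖f w.2‖ₑ)
      ≤ ∫⁻ w : Eu n × Eu n, (‖PK n (l + (0:ℝ) * I) (w.2 - w.1)‖ₑ * ‖f w.1‖ₑ^2 + ‖PK n (l + (0:ℝ) * I) (w.2 - w.1)‖ₑ * ‖f w.2‖ₑ^2) := by
        apply lintegral_mono; intro w
        dsimp only
        rw [← mul_add]; gcongr; exact ENN_amgm _ _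
    _ = (∫⁻ w : Eu n × Eu n, ‖PK n (l + (0:ℝ) * I) (w.2 - w.1)‖ₑ * ‖f w.1‖ₑ^2) + ∫⁻ w : Eu n × Eu n, ‖PK n (l + (0:ℝ) * I) (w.2 - w.1)‖ₑ * ‖f w.2‖ₑ^2 := by
        apply lintegral_add_left'
        exact hPm.aemeasurable.mul ((hfm.comp_quasiMeasurePreserving Measure.quasiMeasurePreserving_fst).pow_const 2)
    _ ≤ ENNReal.ofReal C * (∫⁻ x, ‖f x‖ₑ^2) + ENNReal.ofReal C * ∫⁻ x, ‖f x‖ₑ^2 := by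
        gcongr
        · rw [Measure.volume_eq_prod, lintegral_prod _ hA1,
            ← lintegral_const_mul'' _ (hfm.pow_const 2)]
          apply lintegral_mono; intro x
          dsimp only
          have hm : Measurable (fun y => ‖PK n (l + (0:ℝ) * I) (y - x)‖ₑ) := hPc.measurable.enorm.comp (measurable_id.sub_const x)
          rw [lintegral_mul_const _ hm]
          gcongr
          rw [lintegral_sub_right_eq_self (fun y => ‖PK n (l + (0:ℝ) * I) y‖ₑ) x, hl0]
          exact h l hl
        · rw [Measure.volume_eq_prod, lintegral_prod_symm _ hA2,
            ← lintegral_const_mul'' _ (hfm.pow_const 2)]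
          apply lintegral_mono; intro x
          dsimp only
          have hm : Measurable (fun y => ‖PK n (l + (0:ℝ) * I) (x - y)‖ₑ) := hPc.measurable.enorm.comp (measurable_id.const_sub x)
          rw [lintegral_mul_const _ hm]
          gcongr
          rw [lintegral_sub_left_eq_self (fun y => ‖PK n (l + (0:ℝ) * I) y‖ₑ) x, hl0]
          exact h l hl
    _ = _ := by rw [← add_mul, ← ENNReal.ofReal_add hC.le hC.le]; congr 2; ring

lemma ofReal_exp_meas (n : ℕ) (l : ℝ) : Measurable (fun ξ : Eu n => ENNReal.ofReal (Real.exp (-(l * ‖ξ‖)))) :=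
  ENNReal.measurable_ofReal.comp (Continuous.measurable (by fun_prop))

/-- weighted Cauchy-Schwarz on the Fourier side -/
lemma wt_cs (n : ℕ) (l : ℝ) (a b : Eu n → ℂ) (ha : Continuous a) (hb : Continuous b) :
    ∫⁻ ξ : Eu n, ENNReal.ofReal (Real.exp (-(l * ‖ξ‖))) * (‖a ξ‖ₑ * ‖b ξ‖ₑ) ≤
    (∫⁻ ξ : Eu n, ENNReal.ofReal (Real.exp (-(l * ‖ξ‖))) * ‖a ξ‖ₑ^2)^((1:ℝ)/2) *
    (∫⁻ ξ : Eu n, ENNReal.ofReal (Real.exp (-(l * ‖ξ‖))) * ‖b ξ‖ₑ^2)^((1:ℝ)/2) := by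
  have hw := ofReal_exp_meas n l
  have := lintegral_cs (volume.withDensity (fun ξ : Eu n => ENNReal.ofReal (Real.exp (-(l * ‖ξ‖))))) (fun ξ => ‖a ξ‖ₑ) (fun ξ => ‖b ξ‖ₑ)
    ha.measurable.enorm.aemeasurable hb.measurable.enorm.aemeasurable
  have e : ∀ h : Eu n → ℝ≥0∞, Measurable h → ∫⁻ ξ, h ξ ∂(volume.withDensity (fun ξ : Eu n => ENNReal.ofReal (Real.exp (-(l * ‖ξ‖))))) = ∫⁻ ξ : Eu n, ENNReal.ofReal (Real.exp (-(l * ‖ξ‖))) * h ξ :=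
    fun h hh => lintegral_withDensity_eq_lintegral_mul _ hw hh
  rwa [e (fun ξ => ‖a ξ‖ₑ * ‖b ξ‖ₑ) (ha.measurable.enorm.mul hb.measurable.enorm), e _ (ha.measurable.enorm.pow_const 2),
    e _ (hb.measurable.enorm.pow_const 2)] at this

lemma Bil_le_L2 (n : ℕ) (hn : 1 ≤ n) : ∃ C : ℝ, 0 < C ∧ ∀ (l τ : ℝ) (f g : Eu n → ℂ), 0 < l → Integrable f → Integrable g →
    ‖Bil n l τ f g‖ₑ ≤ ENNReal.ofReal C * ((∫⁻ x, ‖f x‖ₑ^2)^((1:ℝ)/2) * (∫⁻ x, ‖g x‖ₑ^2)^((1:ℝ)/2)) := by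
  obtain ⟨C, hC, h⟩ := fourier_L2 n hn
  refine ⟨C, hC, fun l τ f g hl hf hg => ?_⟩
  unfold Bil
  refine (enorm_integral_le_lintegral_enorm _).trans ?_
  calc ∫⁻ ξ : Eu n, ‖cexp (-((l:ℂ) + τ * I) * ‖ξ‖) * (𝓕 f ξ * starRingEnd ℂ (𝓕 g ξ))‖ₑ
      = ∫⁻ ξ : Eu n, ENNReal.ofReal (Real.exp (-(l * ‖ξ‖))) * (‖𝓕 f ξ‖ₑ * ‖𝓕 g ξ‖ₑ) := by
        apply lintegral_congr; intro ξ
        rw [enorm_mul, enorm_mul, ← ofReal_norm (cexp _), norm_cexp_lt]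
        congr 2
        rw [← ofReal_norm, ← ofReal_norm, RCLike.norm_conj]
    _ ≤ _ := wt_cs n l _ _ (fourier_cont hf) (fourier_cont hg)
    _ ≤ (ENNReal.ofReal C * ∫⁻ x, ‖f x‖ₑ^2)^((1:ℝ)/2) * (ENNReal.ofReal C * ∫⁻ x, ‖g x‖ₑ^2)^((1:ℝ)/2) := by
        gcongr
        · exact h l f hl hf
        · exact h l g hl hg
    _ = _ := by
        rw [ENNReal.mul_rpow_of_nonneg _ _ (by norm_num), ENNReal.mul_rpow_of_nonneg _ _ (by norm_num)]
        have : ENNReal.ofReal C = ENNReal.ofReal C^((1:ℝ)/2) * ENNReal.ofReal C^((1:ℝ)/2) := by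
          rw [← ENNReal.rpow_add_of_nonneg _ _ (by norm_num) (by norm_num)]; norm_num
        nth_rewrite 3 [this]
        ring

/-- space-time Fourier amplitude on the cone -/
def Amp (n : ℕ) (F : Eu n × ℝ → ℂ) (ξ : Eu n) : ℂ :=
  ∫ z : Eu n × ℝ, cexp (-(2 * Real.pi * I * (inner ℝ z.1 ξ : ℝ) + I * z.2 * ‖ξ‖)) * F z

/-- damped quadratic form -/
def Nsq (n : ℕ) (l : ℝ) (F : Eu n × ℝ → ℂ) : ℝ≥0∞ :=
  ∫⁻ ξ : Eu n, ENNReal.ofReal (Real.exp (-(l * ‖ξ‖))) * ‖Amp n F ξ‖ₑ^2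

/-- damped sesquilinear form -/
def Nn (n : ℕ) (l : ℝ) (F G : Eu n × ℝ → ℂ) : ℂ :=
  ∫ ξ : Eu n, (Real.exp (-(l * ‖ξ‖)) : ℂ) * (Amp n F ξ * starRingEnd ℂ (Amp n G ξ))

/-- its density in the two times -/
def bet (n : ℕ) (l : ℝ) (F G : Eu n × ℝ → ℂ) (w : ℝ × ℝ) : ℂ :=
  Bil n l (w.1 - w.2) (fun x => F (x, w.1)) (fun y => G (y, w.2))

lemma Amp_phase_norm {n : ℕ} (z : Eu n × ℝ) (ξ : Eu n) :
    ‖cexp (-(2 * Real.pi * I * (inner ℝ z.1 ξ : ℝ) + I * z.2 * ‖ξ‖))‖ = 1 := by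
  rw [Complex.norm_exp]; simp

lemma Amp_integrable {n : ℕ} {F : Eu n × ℝ → ℂ} (hF : Integrable F) (ξ : Eu n) :
    Integrable (fun z : Eu n × ℝ => cexp (-(2 * Real.pi * I * (inner ℝ z.1 ξ : ℝ) + I * z.2 * ‖ξ‖)) * F z) := by
  refine hF.mono ?_ (Eventually.of_forall fun z => ?_)
  · exact (Continuous.aestronglyMeasurable (by fun_prop)).mul hF.aestronglyMeasurable
  · rw [norm_mul, Amp_phase_norm, one_mul]

lemma Amp_cont {n : ℕ} {F : Eu n × ℝ → ℂ} (hF : Integrable F) : Continuous (Amp n F) := by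
  unfold Amp
  apply continuous_of_dominated (bound := fun z => ‖F z‖)
  · intro ξ; exact (Amp_integrable hF ξ).aestronglyMeasurable
  · intro ξ
    refine Eventually.of_forall fun z => ?_
    rw [norm_mul, Amp_phase_norm, one_mul]
  · exact hF.norm
  · refine Eventually.of_forall fun z => ?_
    fun_prop

lemma Amp_le {n : ℕ} (F : Eu n × ℝ → ℂ) (ξ : Eu n) : ‖Amp n F ξ‖ ≤ ∫ z, ‖F z‖ := by
  unfold Amp
  refine (norm_integral_le_integral_norm _).trans (le_of_eq ?_)
  congr 1; ext z
  rw [norm_mul, Amp_phase_norm, one_mul]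

lemma Amp_eq {n : ℕ} {F : Eu n × ℝ → ℂ} (hF : Integrable F) (ξ : Eu n) :
    Amp n F ξ = ∫ s : ℝ, cexp (-(I * s * ‖ξ‖)) * 𝓕 (fun x => F (x, s)) ξ := by
  unfold Amp
  rw [Measure.volume_eq_prod, integral_prod_symm _ (Amp_integrable hF ξ)]
  congr 1; ext s
  rw [Real.fourier_eq', ← integral_const_mul]
  congr 1; ext x
  rw [smul_eq_mul, ← mul_assoc, ← Complex.exp_add]
  congr 2
  push_cast; ring

lemma slice_meas {n : ℕ} {F : Eu n × ℝ → ℂ} (hF : StronglyMeasurable F) :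
    StronglyMeasurable (fun v : Eu n × ℝ => 𝓕 (fun x => F (x, v.2)) v.1) := by
  simp_rw [Real.fourier_eq']
  have : StronglyMeasurable (fun u : Eu n × (Eu n × ℝ) => cexp (↑(-2 * Real.pi * inner ℝ u.1 u.2.1) * I) • F (u.1, u.2.2)) := by
    have h1 : StronglyMeasurable (fun u : Eu n × (Eu n × ℝ) => cexp (↑(-2 * Real.pi * inner ℝ u.1 u.2.1) * I)) :=
      Continuous.stronglyMeasurable (by fun_prop)
    have h2 : StronglyMeasurable (fun u : Eu n × (Eu n × ℝ) => F (u.1, u.2.2)) := hF.comp_measurable (by fun_prop)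
    exact h1.smul h2
  exact this.integral_prod_left' (μ := (volume : Measure (Eu n)))

lemma fourier_norm_le' {n : ℕ} (f : Eu n → ℂ) (ξ : Eu n) : ‖𝓕 f ξ‖ ≤ ∫ x, ‖f x‖ :=
  VectorFourier.norm_fourierIntegral_le_integral_norm _ _ _ _ _

lemma slice_norm_int {n : ℕ} {F : Eu n × ℝ → ℂ} (hF : Integrable F) :
    Integrable (fun s : ℝ => ∫ x, ‖F (x, s)‖) := by
  have := hF.norm.integral_prod_right (μ := volume) (ν := volume)
  exact this

/-- integrability of the triple integrand -/
lemma triple_int {n : ℕ} {l : ℝ} (hl : 0 < l) {F G : Eu n × ℝ → ℂ} (hFm : StronglyMeasurable F) (hF : Integrable F)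
    (hGm : StronglyMeasurable G) (hG : Integrable G) :
    Integrable (fun v : Eu n × (ℝ × ℝ) => cexp (-((l:ℂ) + ((v.2.1 - v.2.2 : ℝ):ℂ) * I) * ‖v.1‖) *
      (𝓕 (fun x => F (x, v.2.1)) v.1 * starRingEnd ℂ (𝓕 (fun x => G (x, v.2.2)) v.1))) (volume.prod (volume.prod volume)) := by
  have h1 : Integrable (fun w : ℝ × ℝ => (∫ x, ‖F (x, w.1)‖) * (∫ x, ‖G (x, w.2)‖)) (volume.prod volume) :=
    (slice_norm_int hF).mul_prod (slice_norm_int hG)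
  have h2 : Integrable (fun v : Eu n × (ℝ × ℝ) => Real.exp (-(l * ‖v.1‖)) * ((∫ x, ‖F (x, v.2.1)‖) * (∫ x, ‖G (x, v.2.2)‖))) (volume.prod (volume.prod volume)) :=
    (integrable_exp_neg_norm n l hl).mul_prod h1
  refine h2.mono' ?_ (Eventually.of_forall fun v => ?_)
  · apply AEStronglyMeasurable.mul
    · exact Continuous.aestronglyMeasurable (by fun_prop)
    · apply AEStronglyMeasurable.mul
      · exact ((slice_meas hFm).comp_measurable (g := fun v : Eu n × (ℝ × ℝ) => (v.1, v.2.1)) (by fun_prop)).aestronglyMeasurable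
      · exact Complex.continuous_conj.comp_aestronglyMeasurable
          ((slice_meas hGm).comp_measurable (g := fun v : Eu n × (ℝ × ℝ) => (v.1, v.2.2)) (by fun_prop)).aestronglyMeasurable
  · rw [norm_mul, norm_mul, norm_cexp_lt, RCLike.norm_conj]
    gcongr
    · exact fourier_norm_le' _ _
    · exact fourier_norm_le' _ _

lemma bet_int {n : ℕ} {l : ℝ} (hl : 0 < l) {F G : Eu n × ℝ → ℂ} (hFm : StronglyMeasurable F) (hF : Integrable F)
    (hGm : StronglyMeasurable G) (hG : Integrable G) : Integrable (bet n l F G) (volume.prod volume) :=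
  (triple_int hl hFm hF hGm hG).integral_prod_right

lemma Nn_eq {n : ℕ} {l : ℝ} (hl : 0 < l) {F G : Eu n × ℝ → ℂ} (hFm : StronglyMeasurable F) (hF : Integrable F)
    (hGm : StronglyMeasurable G) (hG : Integrable G) : Nn n l F G = ∫ w : ℝ × ℝ, bet n l F G w := by
  have e1 : Nn n l F G = ∫ ξ : Eu n, ∫ w : ℝ × ℝ, cexp (-((l:ℂ) + ((w.1 - w.2 : ℝ):ℂ) * I) * ‖ξ‖) *
      (𝓕 (fun x => F (x, w.1)) ξ * starRingEnd ℂ (𝓕 (fun x => G (x, w.2)) ξ)) := by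
    unfold Nn
    congr 1; ext ξ
    rw [Amp_eq hF, Amp_eq hG, ← integral_conj, ← integral_prod_mul, ← integral_const_mul]
    congr 1; ext w
    rw [map_mul, ← Complex.exp_conj]
    have : cexp (-((l:ℂ) + ((w.1 - w.2 : ℝ):ℂ) * I) * ‖ξ‖) = (Real.exp (-(l * ‖ξ‖)) : ℂ) * (cexp (-(I * w.1 * ‖ξ‖)) * cexp (starRingEnd ℂ (-(I * w.2 * ‖ξ‖)))) := by
      rw [Complex.ofReal_exp, ← Complex.exp_add, ← Complex.exp_add]
      congr 1
      simp only [map_neg, map_mul, Complex.conj_I, Complex.conj_ofReal]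
      push_cast; ring
    rw [this]; ring
  rw [e1, integral_integral_swap (triple_int hl hFm hF hGm hG)]
  rfl

lemma Nsq_eq {n : ℕ} {l : ℝ} (hl : 0 < l) {F : Eu n × ℝ → ℂ} (hF : Integrable F) : Nsq n l F = ‖Nn n l F F‖ₑ := by
  have hc := Amp_cont hF
  have e2 : Nn n l F F = ((∫ ξ : Eu n, Real.exp (-(l * ‖ξ‖)) * ‖Amp n F ξ‖^2 : ℝ) : ℂ) := by
    rw [← integral_complex_ofReal]
    unfold Nn
    congr 1; ext ξ
    rw [Complex.mul_conj, Complex.normSq_eq_norm_sq]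
    push_cast
    rfl
  rw [e2, ← ofReal_norm, Complex.norm_real, Real.norm_of_nonneg (integral_nonneg fun ξ => by positivity),
    ofReal_integral_eq_lintegral_ofReal]
  · apply lintegral_congr; intro ξ
    rw [ENNReal.ofReal_mul (Real.exp_pos _).le, ENNReal.ofReal_pow (norm_nonneg _), ofReal_norm]
  · refine Integrable.mono' ((integrable_exp_neg_norm n l hl).mul_const ((∫ x, ‖F x‖)^2)) ?_ (Eventually.of_forall fun ξ => ?_)
    · exact Continuous.aestronglyMeasurable (by fun_prop)
    · rw [Real.norm_of_nonneg (by positivity)]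
      gcongr
      exact Amp_le _ _
  · exact Eventually.of_forall fun ξ => by positivity

lemma Nn_int {n : ℕ} {l : ℝ} (hl : 0 < l) {F G : Eu n × ℝ → ℂ} (hF : Integrable F) (hG : Integrable G) :
    Integrable (fun ξ : Eu n => (Real.exp (-(l * ‖ξ‖)) : ℂ) * (Amp n F ξ * starRingEnd ℂ (Amp n G ξ))) := by
  have hc := Amp_cont hF
  have hc' := Amp_cont hG
  have hc2 : Continuous (fun ξ => starRingEnd ℂ (Amp n G ξ)) := Complex.continuous_conj.comp hc'
  refine Integrable.mono' ((integrable_exp_neg_norm n l hl).mul_const ((∫ x, ‖F x‖) * ∫ x, ‖G x‖)) ?_ (Eventually.of_forall fun ξ => ?_)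
  · exact Continuous.aestronglyMeasurable (by fun_prop)
  · rw [norm_mul, norm_mul, RCLike.norm_conj, Complex.norm_real, Real.norm_of_nonneg (Real.exp_pos _).le]
    gcongr <;> exact Amp_le _ _

lemma Amp_sum {n : ℕ} {ι : Type*} (s : Finset ι) (F : ι → Eu n × ℝ → ℂ) (hF : ∀ i, Integrable (F i)) (ξ : Eu n) :
    Amp n (fun z => ∑ i ∈ s, F i z) ξ = ∑ i ∈ s, Amp n (F i) ξ := by
  unfold Amp
  rw [← integral_finsetSum _ (fun i _ => Amp_integrable (hF i) ξ)]
  congr 1; ext z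
  rw [Finset.mul_sum]

lemma Nsq_finsum {n : ℕ} {l : ℝ} (hl : 0 < l) {ι : Type*} (s : Finset ι) (F : ι → Eu n × ℝ → ℂ) (hF : ∀ i, Integrable (F i)) :
    Nsq n l (fun z => ∑ i ∈ s, F i z) ≤ ∑' i, ∑' j, ‖Nn n l (F i) (F j)‖ₑ := by
  rw [Nsq_eq hl (integrable_finsetSum _ fun i _ => hF i)]
  have e : Nn n l (fun z => ∑ i ∈ s, F i z) (fun z => ∑ i ∈ s, F i z) = ∑ i ∈ s, ∑ j ∈ s, Nn n l (F i) (F j) := by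
    unfold Nn
    simp_rw [← integral_finsetSum s (fun j _ => Nn_int hl (hF _) (hF j))]
    rw [← integral_finsetSum s (fun i _ => integrable_finsetSum s (fun j _ => Nn_int hl (hF i) (hF j)))]
    congr 1; ext ξ
    rw [Amp_sum s F hF, map_sum, Finset.sum_mul_sum, Finset.mul_sum]
    congr 1; ext i
    rw [Finset.mul_sum]
  rw [e]
  refine (enorm_sum_le _ _).trans ?_
  refine le_trans ?_ (ENNReal.sum_le_tsum s)
  apply Finset.sum_le_sum; intro i _
  exact (enorm_sum_le _ _).trans (ENNReal.sum_le_tsum s)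

/-- decomposition over countably many disjoint pieces -/
lemma Nsq_le_tsum {n : ℕ} {l : ℝ} (hl : 0 < l) {F : Eu n × ℝ → ℂ} (hF : Integrable F) (A : ℤ → Set (Eu n × ℝ))
    (hA : ∀ m, MeasurableSet (A m)) (hd : ∀ z m m', z ∈ A m → z ∈ A m' → m = m')
    (hc : ∀ᵐ z : Eu n × ℝ, F z = 0 ∨ ∃ m, z ∈ A m) :
    Nsq n l F ≤ ∑' i, ∑' j, ‖Nn n l ((A i).indicator F) ((A j).indicator F)‖ₑ := by
  have hFi : ∀ m, Integrable ((A m).indicator F) := fun m => hF.indicator (hA m)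
  set FK : ℕ → Eu n × ℝ → ℂ := fun K z => ∑ i ∈ Finset.Icc (-(K:ℤ)) K, (A i).indicator F z with hFK
  have hone : ∀ z m, z ∈ A m → ∀ K : ℕ, FK K z = if m ∈ Finset.Icc (-(K:ℤ)) K then F z else 0 := by
    intro z m hm K
    simp only [hFK]
    split_ifs with h
    · rw [Finset.sum_eq_single m]
      · rw [Set.indicator_of_mem hm]
      · intro b _ hb
        rw [Set.indicator_of_notMem (fun h => hb (hd z _ _ h hm))]
      · intro h'; exact absurd h h'
    · apply Finset.sum_eq_zero
      intro b hb
      rw [Set.indicator_of_notMem]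
      intro h'
      exact h ((hd z _ _ h' hm) ▸ hb)
  have hle : ∀ z K, ‖FK K z‖ ≤ ‖F z‖ := by
    intro z K
    by_cases h : ∃ m, z ∈ A m
    · obtain ⟨m, hm⟩ := h
      rw [hone z m hm]; split_ifs <;> simp
    · push Not at h
      have : FK K z = 0 := Finset.sum_eq_zero fun b _ => Set.indicator_of_notMem (h b) _
      rw [this]; simp
  have hlim : ∀ᵐ z : Eu n × ℝ, Tendsto (fun K => FK K z) atTop (nhds (F z)) := by
    filter_upwards [hc] with z hz
    rcases hz with hz | ⟨m, hm⟩
    · have : ∀ K, FK K z = F z := by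
        intro K; have := hle z K; rw [hz, norm_zero] at this
        rw [hz]; exact norm_le_zero_iff.1 this
      simp [this]
    · apply tendsto_const_nhds.congr'
      filter_upwards [Filter.eventually_ge_atTop m.natAbs] with K hK
      rw [hone z m hm, if_pos]
      rw [Finset.mem_Icc]; omega
  have hAmp : ∀ ξ, Tendsto (fun K => Amp n (FK K) ξ) atTop (nhds (Amp n F ξ)) := by
    intro ξ
    unfold Amp
    apply tendsto_integral_of_dominated_convergence (fun z => ‖F z‖)
    · intro K
      exact (Amp_integrable (integrable_finsetSum _ fun i _ => hFi i) ξ).aestronglyMeasurable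
    · exact hF.norm
    · intro K
      refine Eventually.of_forall fun z => ?_
      rw [norm_mul, Amp_phase_norm, one_mul]; exact hle z K
    · filter_upwards [hlim] with z hz
      exact hz.const_mul _
  calc Nsq n l F = ∫⁻ ξ : Eu n, Filter.liminf (fun K => ENNReal.ofReal (Real.exp (-(l * ‖ξ‖))) * ‖Amp n (FK K) ξ‖ₑ^2) atTop := by
        unfold Nsq
        apply lintegral_congr; intro ξ
        symm
        apply Tendsto.liminf_eq
        apply ENNReal.Tendsto.const_mul _ (Or.inr ENNReal.ofReal_ne_top)
        exact ((ENNReal.continuous_pow 2).tendsto _).comp ((continuous_enorm.tendsto _).comp (hAmp ξ))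
    _ ≤ Filter.liminf (fun K => ∫⁻ ξ : Eu n, ENNReal.ofReal (Real.exp (-(l * ‖ξ‖))) * ‖Amp n (FK K) ξ‖ₑ^2) atTop := by
        apply lintegral_liminf_le
        intro K
        exact (ofReal_exp_meas n l).mul ((Amp_cont (integrable_finsetSum _ fun i _ => hFi i)).measurable.enorm.pow_const 2)
    _ ≤ _ := by
        refine Filter.liminf_le_of_frequently_le' (Filter.Frequently.of_forall fun K => ?_)
        exact Nsq_finsum hl _ _ hFi

/-- partition of an integral -/
lemma enorm_integral_le_parts {α ι : Type*} [MeasurableSpace α] [Countable ι] {μ : Measure α} {f : α → ℂ} (hf : Integrable f μ)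
    (S : ι → Set α) (hS : ∀ j, MeasurableSet (S j)) (hd : ∀ z i j, z ∈ S i → z ∈ S j → i = j)
    (hc : ∀ᵐ z ∂μ, ∃ j, z ∈ S j) : ‖∫ z, f z ∂μ‖ₑ ≤ ∑' j, ‖∫ z in S j, f z ∂μ‖ₑ := by
  have h1 : ∫ z, f z ∂μ = ∫ z in ⋃ j, S j, f z ∂μ := by
    rw [← setIntegral_univ]
    apply setIntegral_congr_set
    filter_upwards [hc] with z hz
    apply propext
    obtain ⟨j, hj⟩ := hz
    exact ⟨fun _ => Set.mem_iUnion.2 ⟨j, hj⟩, fun _ => trivial⟩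
  have hs := hasSum_integral_iUnion (μ := μ) (f := f) hS (fun i j hij => Set.disjoint_left.2 fun z h1 h2 => hij (hd z i j h1 h2)) hf.integrableOn
  rw [h1, ← hs.tsum_eq]
  exact enorm_tsum_le_tsum_enorm

lemma Bil_zero_left (n : ℕ) (l τ : ℝ) (g : Eu n → ℂ) : Bil n l τ (fun _ => 0) g = 0 := by
  unfold Bil
  have : 𝓕 (fun _ : Eu n => (0:ℂ)) = 0 := by
    ext ξ; rw [Real.fourier_eq']; simp
  rw [this]; simp

lemma bet_slice (n : ℕ) (hn : 1 ≤ n) : ∃ C : ℝ, 0 < C ∧ ∀ (l : ℝ) (F : Eu n × ℝ → ℂ) (g : Eu n → ℂ) (A : Set ℝ) (t : ℝ), 0 < l →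
    StronglyMeasurable F → Integrable F → Integrable g → MeasurableSet A →
    ‖∫ s in A, Bil n l (s - t) (fun x => F (x, s)) g‖ₑ ≤
      ENNReal.ofReal C * ((Nsq n l ((Prod.snd ⁻¹' A).indicator F))^((1:ℝ)/2) * (∫⁻ x, ‖g x‖ₑ^2)^((1:ℝ)/2)) := by
  obtain ⟨C, hC, h⟩ := fourier_L2 n hn
  refine ⟨C^((1:ℝ)/2), by positivity, fun l F g A t hl hFm hF hg hA => ?_⟩
  set F' := (Prod.snd ⁻¹' A).indicator F with hF'
  have hA' : MeasurableSet ((Prod.snd : Eu n × ℝ → ℝ) ⁻¹' A) := measurable_snd hA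
  have hFm' : StronglyMeasurable F' := hFm.indicator hA'
  have hFi' : Integrable F' := hF.indicator hA'
  have hgc := fourier_cont hg
  have e0 : ∫ s in A, Bil n l (s - t) (fun x => F (x, s)) g = ∫ s, Bil n l (s - t) (fun x => F' (x, s)) g := by
    rw [← integral_indicator hA]
    congr 1; ext s
    by_cases hs : s ∈ A
    · rw [Set.indicator_of_mem hs]
      congr 1; ext x
      rw [hF', Set.indicator_of_mem (by exact hs)]
    · rw [Set.indicator_of_notMem hs]
      have : (fun x => F' (x, s)) = fun _ => 0 := by
        ext x; rw [hF', Set.indicator_of_notMem (by exact hs)]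
      rw [this, Bil_zero_left]
  have hi : Integrable (fun v : ℝ × Eu n => cexp (-((l:ℂ) + ((v.1 - t : ℝ):ℂ) * I) * ‖v.2‖) *
      (𝓕 (fun x => F' (x, v.1)) v.2 * starRingEnd ℂ (𝓕 g v.2))) (volume.prod volume) := by
    have h2 : Integrable (fun v : ℝ × Eu n => (∫ x, ‖F' (x, v.1)‖) * Real.exp (-(l * ‖v.2‖))) (volume.prod volume) :=
      (slice_norm_int hFi').mul_prod (integrable_exp_neg_norm n l hl)
    refine (h2.mul_const (∫ x, ‖g x‖)).mono' ?_ (Eventually.of_forall fun v => ?_)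
    · apply AEStronglyMeasurable.mul
      · exact Continuous.aestronglyMeasurable (by fun_prop)
      · apply AEStronglyMeasurable.mul
        · exact ((slice_meas hFm').comp_measurable (g := fun v : ℝ × Eu n => (v.2, v.1)) (by fun_prop)).aestronglyMeasurable
        · exact Continuous.aestronglyMeasurable (Complex.continuous_conj.comp (hgc.comp continuous_snd))
    · rw [norm_mul, norm_mul, norm_cexp_lt, RCLike.norm_conj]
      have a1 := fourier_norm_le' (fun x => F' (x, v.1)) v.2
      have a2 := fourier_norm_le' g v.2
      calc Real.exp (-(l * ‖v.2‖)) * (‖𝓕 (fun x => F' (x, v.1)) v.2‖ * ‖𝓕 g v.2‖)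
          ≤ Real.exp (-(l * ‖v.2‖)) * ((∫ x, ‖F' (x, v.1)‖) * (∫ x, ‖g x‖)) := by gcongr
        _ = _ := by ring
  have e1 : ∫ s, Bil n l (s - t) (fun x => F' (x, s)) g = ∫ ξ : Eu n, cexp (-((l:ℂ) + ((-t : ℝ):ℂ) * I) * ‖ξ‖) * (Amp n F' ξ * starRingEnd ℂ (𝓕 g ξ)) := by
    unfold Bil
    rw [integral_integral_swap hi]
    congr 1; ext ξ
    rw [Amp_eq hFi', ← integral_mul_const, ← integral_const_mul]
    congr 1; ext s
    have : cexp (-((l:ℂ) + ((s - t : ℝ):ℂ) * I) * ‖ξ‖) = cexp (-((l:ℂ) + ((-t : ℝ):ℂ) * I) * ‖ξ‖) * cexp (-(I * s * ‖ξ‖)) := by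
      rw [← Complex.exp_add]; congr 1; push_cast; ring
    rw [this]; ring
  rw [e0, e1]
  calc ‖∫ ξ : Eu n, cexp (-((l:ℂ) + ((-t : ℝ):ℂ) * I) * ‖ξ‖) * (Amp n F' ξ * starRingEnd ℂ (𝓕 g ξ))‖ₑ
      ≤ ∫⁻ ξ : Eu n, ‖cexp (-((l:ℂ) + ((-t : ℝ):ℂ) * I) * ‖ξ‖) * (Amp n F' ξ * starRingEnd ℂ (𝓕 g ξ))‖ₑ := enorm_integral_le_lintegral_enorm _
    _ = ∫⁻ ξ : Eu n, ENNReal.ofReal (Real.exp (-(l * ‖ξ‖))) * (‖Amp n F' ξ‖ₑ * ‖𝓕 g ξ‖ₑ) := by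
        apply lintegral_congr; intro ξ
        rw [enorm_mul, enorm_mul, ← ofReal_norm (cexp _), norm_cexp_lt]
        congr 2
        rw [← ofReal_norm, ← ofReal_norm, RCLike.norm_conj]
    _ ≤ _ := wt_cs n l _ _ (Amp_cont hFi') hgc
    _ ≤ (Nsq n l F')^((1:ℝ)/2) * (ENNReal.ofReal C * ∫⁻ x, ‖g x‖ₑ^2)^((1:ℝ)/2) := by
        gcongr
        · exact le_refl _
        · exact h l g hl hg
    _ = _ := by
        rw [ENNReal.mul_rpow_of_nonneg _ _ (by norm_num), ENNReal.ofReal_rpow_of_pos hC]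
        ring

lemma Bil_symm (n : ℕ) (l τ : ℝ) (f g : Eu n → ℂ) : ‖Bil n l τ f g‖ₑ = ‖Bil n l (-τ) g f‖ₑ := by
  have : Bil n l (-τ) g f = starRingEnd ℂ (Bil n l τ f g) := by
    unfold Bil
    rw [← integral_conj]
    congr 1; ext ξ
    rw [map_mul, map_mul, Complex.conj_conj, ← Complex.exp_conj, mul_comm (𝓕 g ξ)]
    congr 2
    simp only [map_neg, map_mul, map_add, Complex.conj_I, Complex.conj_ofReal]
    push_cast; ring
  rw [this, ← ofReal_norm, ← ofReal_norm, RCLike.norm_conj]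

/-- dyadic shells on the line -/
def Dj (j : ℤ) : Set ℝ := {τ | p2 j ≤ ‖τ‖ₑ ∧ ‖τ‖ₑ < p2 (j + 1)}

lemma Dj_meas (j : ℤ) : MeasurableSet (Dj j) :=
  (measurableSet_le measurable_const measurable_enorm).inter (measurableSet_lt measurable_enorm measurable_const)

lemma Dj_exists (τ : ℝ) (h : τ ≠ 0) : ∃ j, τ ∈ Dj j :=
  exists_dyadic _ (by simpa using h) (by simp)

lemma Dj_disj {τ : ℝ} {i j : ℤ} (h : τ ∈ Dj i) (h' : τ ∈ Dj j) : i = j := dyadic_unique h h'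

lemma Dj_neg {τ : ℝ} {i : ℤ} : -τ ∈ Dj i ↔ τ ∈ Dj i := by simp [Dj]

lemma Dj_vol (j : ℤ) : volume (Dj j) ≤ 4 * p2 j := by
  have : Dj j ⊆ Set.Icc (-(2:ℝ)^((j:ℝ)+1)) ((2:ℝ)^((j:ℝ)+1)) := by
    intro τ hτ
    have h := hτ.2
    rw [p2_ofReal, ← ofReal_norm, ENNReal.ofReal_lt_ofReal_iff (by positivity), Real.norm_eq_abs, abs_lt] at h
    exact ⟨h.1.le, h.2.le⟩
  refine (measure_mono this).trans ?_
  rw [Real.volume_Icc, show (2:ℝ)^((j:ℝ)+1) - -(2:ℝ)^((j:ℝ)+1) = 2 * 2^((j:ℝ)+1) by ring,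
    ENNReal.ofReal_mul two_pos.le, ← p2_ofReal, p2_add, p2_one]
  rw [show ENNReal.ofReal 2 = 2 by simp]
  apply le_of_eq; ring

lemma Dj_split (g : ℝ → ℝ≥0∞) : ∫⁻ τ, g τ ≤ ∑' j, ∫⁻ τ in Dj j, g τ := by
  have h : ∫⁻ τ, g τ = ∫⁻ τ in ⋃ j, Dj j, g τ := by
    rw [← setLIntegral_univ]
    apply setLIntegral_congr
    have : ∀ᵐ τ : ℝ, τ ≠ 0 := by simp [ae_iff]
    filter_upwards [this] with τ hτ
    apply propext
    obtain ⟨j, hj⟩ := Dj_exists τ hτ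
    exact ⟨fun _ => Set.mem_iUnion.2 ⟨j, hj⟩, fun _ => trivial⟩
  rw [h]
  exact lintegral_iUnion_le _ _

lemma Dj_rpow {τ : ℝ} {j : ℤ} (h : τ ∈ Dj j) {s : ℝ} (hs : 0 ≤ s) : ‖τ‖ₑ^(-s) ≤ p2 (-(s * j)) := by
  calc ‖τ‖ₑ^(-s) ≤ (p2 j)^(-s) := by
        rw [ENNReal.rpow_neg, ENNReal.rpow_neg]
        apply ENNReal.inv_le_inv.2
        gcongr; exact h.1
    _ = _ := by rw [p2_rpow]; congr 1; ring

lemma time_schur (κ a b : ℝ → ℝ≥0∞) (hκ : Measurable κ) (ha : Measurable a) (hb : Measurable b) :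
    ∫⁻ t, ∫⁻ s, κ (s - t) * (a s * b t) ≤ (∫⁻ τ, κ τ) * ((∫⁻ s, a s^2)^((1:ℝ)/2) * (∫⁻ t, b t^2)^((1:ℝ)/2)) := by
  calc ∫⁻ t, ∫⁻ s, κ (s - t) * (a s * b t) = ∫⁻ t, ∫⁻ τ, κ τ * (a (τ + t) * b t) := by
        apply lintegral_congr; intro t
        have := lintegral_add_right_eq_self (μ := volume) (fun s => κ (s - t) * (a s * b t)) t
        rw [← this]; simp
    _ = ∫⁻ τ, ∫⁻ t, κ τ * (a (τ + t) * b t) := by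
        rw [lintegral_lintegral_swap]
        apply Measurable.aemeasurable
        apply Measurable.mul
        · exact hκ.comp measurable_snd
        · exact (ha.comp (by fun_prop)).mul (hb.comp measurable_fst)
    _ = ∫⁻ τ, κ τ * ∫⁻ t, a (τ + t) * b t := by
        apply lintegral_congr; intro τ
        rw [lintegral_const_mul]
        exact (ha.comp (by fun_prop)).mul hb
    _ ≤ ∫⁻ τ, κ τ * ((∫⁻ s, a s^2)^((1:ℝ)/2) * (∫⁻ t, b t^2)^((1:ℝ)/2)) := by
        apply lintegral_mono; intro τ
        dsimp only
        gcongr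
        have ha' : Measurable (fun t => a (τ + t)) := ha.comp (by fun_prop)
        refine (lintegral_cs _ _ _ ha'.aemeasurable hb.aemeasurable).trans (le_of_eq ?_)
        rw [lintegral_add_left_eq_self (fun s => a s^2) τ]
    _ = _ := lintegral_mul_const _ hκ

lemma min_integral (s : ℝ) (hs : 1 < s) : ∃ C : ℝ≥0∞, C ≠ ⊤ ∧ ∀ M : ℝ≥0∞, M ≠ 0 → M ≠ ⊤ →
    ∫⁻ τ : ℝ, min 1 (M * ‖τ‖ₑ^(-s)) ≤ C * M^(1/s) := by
  obtain ⟨C, hC, h⟩ := sum_min_geom 1 (s-1) one_pos (by linarith)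
  refine ⟨4 * C, ENNReal.mul_ne_top (by simp) hC, fun M h0 ht => ?_⟩
  refine (Dj_split _).trans ?_
  calc ∑' j : ℤ, ∫⁻ τ in Dj j, min 1 (M * ‖τ‖ₑ^(-s))
      ≤ ∑' j : ℤ, 4 * min (1 * p2 (1 * j)) (M * p2 (-((s-1)*j))) := by
        apply ENNReal.tsum_le_tsum; intro j
        calc ∫⁻ τ in Dj j, min 1 (M * ‖τ‖ₑ^(-s)) ≤ ∫⁻ τ in Dj j, min 1 (M * p2 (-(s * j))) := by
              apply setLIntegral_mono' (Dj_meas j)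
              intro τ hτ
              gcongr; exact Dj_rpow hτ (by linarith)
          _ = min 1 (M * p2 (-(s * j))) * volume (Dj j) := setLIntegral_const _ _
          _ ≤ min 1 (M * p2 (-(s * j))) * (4 * p2 j) := by gcongr; exact Dj_vol j
          _ = 4 * (p2 j * min 1 (M * p2 (-(s * j)))) := by ring
          _ ≤ _ := by
              gcongr
              rw [one_mul, one_mul]
              apply le_min
              · calc p2 j * min 1 (M * p2 (-(s * j))) ≤ p2 j * 1 := by gcongr; exact min_le_left _ _
                  _ = _ := mul_one _
              · calc p2 j * min 1 (M * p2 (-(s * j))) ≤ p2 j * (M * p2 (-(s * j))) := by gcongr; exact min_le_right _ _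
                  _ = M * (p2 j * p2 (-(s * j))) := by ring
                  _ = _ := by rw [← p2_add]; congr 2; ring
    _ = 4 * ∑' j : ℤ, min (1 * p2 (1 * j)) (M * p2 (-((s-1)*j))) := ENNReal.tsum_mul_left
    _ ≤ 4 * (C * (1^((s-1)/(1+(s-1))) * M^(1/(1+(s-1))))) := by
        gcongr; exact h 1 M one_ne_zero ENNReal.one_ne_top h0 ht
    _ = _ := by rw [ENNReal.one_rpow, one_mul, mul_assoc]; congr 4; ring

/-- potential of a bounded integrable function -/
lemma riesz_sup (θ : ℝ) (h0 : 0 < θ) (h1 : θ < 1) : ∃ C : ℝ≥0∞, C ≠ ⊤ ∧ ∀ (φ : ℝ → ℝ≥0∞) (H : ℝ≥0∞) (m : ℤ) (s : ℝ),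
    Measurable φ → H ≠ ⊤ → (∀ t, φ t ≤ 2 * H) → (∫⁻ t, φ t ≤ 8 * (p2 m * H)) →
    ∫⁻ t, ‖s - t‖ₑ^(-θ) * φ t ≤ C * (p2 (m * (1 - θ)) * H) := by
  obtain ⟨C, hC, h⟩ := sum_min_geom (1-θ) θ (by linarith) h0
  refine ⟨8 * C, ENNReal.mul_ne_top (by simp) hC, fun φ H m s hφ hH h2 h8 => ?_⟩
  rcases eq_or_ne H 0 with rfl | hH0
  · have : ∀ t, φ t = 0 := fun t => by simpa using h2 t
    simp [this]
  have e1 : ∫⁻ t, ‖s - t‖ₑ^(-θ) * φ t = ∫⁻ τ, ‖τ‖ₑ^(-θ) * φ (s - τ) := by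
    rw [← lintegral_sub_left_eq_self (fun τ => ‖τ‖ₑ^(-θ) * φ (s - τ)) s]
    simp
  rw [e1]
  refine (Dj_split _).trans ?_
  calc ∑' j : ℤ, ∫⁻ τ in Dj j, ‖τ‖ₑ^(-θ) * φ (s - τ)
      ≤ ∑' j : ℤ, 8 * min (H * p2 ((1-θ) * j)) ((p2 m * H) * p2 (-(θ*j))) := by
        apply ENNReal.tsum_le_tsum; intro j
        have b1 : ∫⁻ τ in Dj j, ‖τ‖ₑ^(-θ) * φ (s - τ) ≤ ∫⁻ τ in Dj j, p2 (-(θ * j)) * φ (s - τ) := by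
          apply setLIntegral_mono' (Dj_meas j)
          intro τ hτ
          gcongr; exact Dj_rpow hτ h0.le
        refine b1.trans ?_
        have hφs : Measurable (fun τ => φ (s - τ)) := hφ.comp (by fun_prop)
        rw [lintegral_const_mul _ hφs]
        rw [mul_min]
        apply le_min
        · calc p2 (-(θ * j)) * ∫⁻ τ in Dj j, φ (s - τ) ≤ p2 (-(θ * j)) * ∫⁻ τ in Dj j, 2 * H := by
                gcongr; exact h2 _
            _ = p2 (-(θ * j)) * (2 * H * volume (Dj j)) := by rw [setLIntegral_const]
            _ ≤ p2 (-(θ * j)) * (2 * H * (4 * p2 j)) := by gcongr; exact Dj_vol j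
            _ = 8 * (H * (p2 (-(θ * j)) * p2 j)) := by ring
            _ = _ := by rw [← p2_add]; congr 3; ring
        · calc p2 (-(θ * j)) * ∫⁻ τ in Dj j, φ (s - τ) ≤ p2 (-(θ * j)) * ∫⁻ τ, φ (s - τ) := by
                gcongr; exact Measure.restrict_le_self
            _ = p2 (-(θ * j)) * ∫⁻ τ, φ τ := by rw [lintegral_sub_left_eq_self φ s]
            _ ≤ p2 (-(θ * j)) * (8 * (p2 m * H)) := by gcongr
            _ = _ := by ring
    _ = 8 * ∑' j : ℤ, min (H * p2 ((1-θ) * j)) ((p2 m * H) * p2 (-(θ*j))) := ENNReal.tsum_mul_left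
    _ ≤ 8 * (C * (H^(θ/((1-θ)+θ)) * (p2 m * H)^((1-θ)/((1-θ)+θ)))) := by
        gcongr; exact h _ _ hH0 hH (mul_ne_zero (p2_ne_zero _) hH0) (ENNReal.mul_ne_top (p2_ne_top _) hH)
    _ = _ := by
        rw [show 1 - θ + θ = 1 by ring, div_one, div_one, ENNReal.mul_rpow_of_nonneg _ _ (by linarith), p2_rpow]
        have : H = H^θ * H^(1-θ) := by
          rw [← ENNReal.rpow_add_of_nonneg _ _ h0.le (by linarith)]; simp
        nth_rewrite 3 [this]
        ring

/-- one dimensional Hardy-Littlewood-Sobolev -/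
lemma hls (θ : ℝ) (h0 : 0 < θ) (h1 : θ < 1) : ∃ C : ℝ≥0∞, C ≠ ⊤ ∧ ∀ (φ : ℝ → ℝ≥0∞), Measurable φ →
    ∫⁻ t, ∫⁻ s, ‖s - t‖ₑ^(-θ) * (φ s * φ t) ≤ C * (∫⁻ t, φ t^(2/(2-θ)))^(2-θ) := by
  obtain ⟨C, hC, hR⟩ := riesz_sup θ h0 h1
  obtain ⟨W, hW, hw⟩ := sum_p2_abs (θ/2) 1 (by linarith) one_pos
  set p := 2/(2-θ) with hp
  have hp0 : 0 < p := by rw [hp]; apply div_pos <;> linarith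
  have hp2 : p ≤ 2 := by rw [hp, div_le_iff₀ (by linarith)]; linarith
  have hpi : 2/p = 2-θ := by rw [hp]; field_simp
  have hpi1 : 1/p = 1-θ/2 := by rw [hp]; field_simp
  refine ⟨1 + (8 * C) * W, by finiteness, fun φ hφ => ?_⟩
  by_cases hfin : ∫⁻ t, φ t^p = ⊤
  · rw [hfin, ENNReal.top_rpow_of_pos (by linarith)]
    rw [ENNReal.mul_top (by simp)]; exact le_top
  have hae : ∀ᵐ t, φ t < ⊤ := by
    filter_upwards [ae_lt_top (hφ.pow_const p) hfin] with t ht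
    by_contra hc
    rw [not_lt, top_le_iff] at hc
    rw [hc, ENNReal.top_rpow_of_pos hp0] at ht
    exact lt_irrefl _ ht
  -- finite version
  set ψ : ℝ → ℝ≥0∞ := fun t => ((φ t).toNNReal : ℝ≥0∞) with hψ
  have hψe : ∀ᵐ t, φ t = ψ t := by
    filter_upwards [hae] with t ht
    rw [hψ]; exact (ENNReal.coe_toNNReal ht.ne).symm
  have hψm : Measurable ψ := hφ.ennreal_toNNReal.coe_nnreal_ennreal
  set f : ℝ × Unit → ℝ≥0∞ := fun z => ψ z.1 with hf
  have hfm : Measurable f := hψm.comp measurable_fst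
  set fm : ℤ → ℝ → ℝ≥0∞ := fun m t => fat volume f m (t, ()) with hfmdef
  set H : ℤ → ℝ≥0∞ := fun m => Hat volume p f m () with hHdef
  have hfmm : ∀ m, Measurable (fm m) := fun m => (fat_meas hfm m).comp (by fun_prop)
  have hψfin : ∫⁻ t, ψ t^p ≠ ⊤ := by
    rw [← lintegral_congr_ae (f := fun t => φ t^p)]
    · exact hfin
    · filter_upwards [hψe] with t ht; rw [ht]
  have hsum : ∑' m : ℤ, p2 m * H m^p ≤ ∫⁻ t, φ t^p := by
    refine (Hat_sum (μ := volume) hfm hp0 ()).trans (le_of_eq ?_)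
    apply lintegral_congr_ae
    filter_upwards [hψe] with t ht
    simp only [hf]; rw [ht]
  have hHfin : ∀ m, H m ≠ ⊤ := by
    intro m hm
    have h3 : p2 m * H m^p ≤ ∫⁻ t, φ t^p := (ENNReal.le_tsum m).trans hsum
    rw [hm, ENNReal.top_rpow_of_pos hp0, ENNReal.mul_top (p2_ne_zero _), top_le_iff] at h3
    exact hfin h3
  have hcov : ∀ᵐ t : ℝ, φ t ≤ ∑' m, fm m t := by
    have := Aset_cover (μ := volume) hfm hp0 () (fun x => by simp [hf, hψ]) (by exact hψfin)
    filter_upwards [this, hψe] with t ht hte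
    rcases ht with ht | ⟨m, hm⟩
    · rw [hte]; simp only [hf] at ht; rw [ht]; simp
    · refine le_trans ?_ (ENNReal.le_tsum m)
      simp only [hfmdef, fat]
      rw [Set.indicator_of_mem hm, hte]
  have hkm : Measurable (fun z : ℝ × ℝ => ‖z.2 - z.1‖ₑ^(-θ)) := by fun_prop
  have pair1 : ∀ m l : ℤ, ∫⁻ t, ∫⁻ s, ‖s - t‖ₑ^(-θ) * (fm m s * fm l t) ≤ (8 * C) * (p2 (m * (1-θ) + l) * (H m * H l)) := by
    intro m l
    calc ∫⁻ t, ∫⁻ s, ‖s - t‖ₑ^(-θ) * (fm m s * fm l t) = ∫⁻ t, (∫⁻ s, ‖t - s‖ₑ^(-θ) * fm m s) * fm l t := by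
          apply lintegral_congr; intro t
          rw [← lintegral_mul_const]
          · apply lintegral_congr; intro s
            rw [← enorm_neg (s - t), neg_sub]; ring
          · have := hfmm m
            fun_prop
      _ ≤ ∫⁻ t, (C * (p2 (m * (1-θ)) * H m)) * fm l t := by
          apply lintegral_mono; intro t
          dsimp only
          gcongr
          exact hR (fm m) (H m) m t (hfmm m) (hHfin m) (fun s => fat_le hfm hp0 m s ()) (fat_int hfm hp0 m ())
      _ = (C * (p2 (m * (1-θ)) * H m)) * ∫⁻ t, fm l t := lintegral_const_mul _ (hfmm l)
      _ ≤ (C * (p2 (m * (1-θ)) * H m)) * (8 * (p2 l * H l)) := by gcongr; exact fat_int hfm hp0 l ()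
      _ = _ := by rw [p2_add]; ring
  have pair2 : ∀ m l : ℤ, ∫⁻ t, ∫⁻ s, ‖s - t‖ₑ^(-θ) * (fm m s * fm l t) ≤ (8 * C) * (p2 (l * (1-θ) + m) * (H m * H l)) := by
    intro m l
    have h5 := pair1 l m
    rw [lintegral_lintegral_swap] at h5
    · rw [mul_comm (H m)]
      refine le_trans (le_of_eq ?_) h5
      apply lintegral_congr; intro t
      apply lintegral_congr; intro s
      rw [← enorm_neg (s - t), neg_sub]; ring
    · apply Measurable.aemeasurable
      have a1 := hfmm m
      have a2 := hfmm l
      simp only [Function.uncurry_def]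
      fun_prop
  set x : ℤ → ℝ≥0∞ := fun m => p2 (m * (1/p)) * H m with hx
  have hx2 : ∑' m, x m^2 ≤ (∫⁻ t, φ t^p)^(2-θ) := by
    refine (tsum_sq_le x p hp0 hp2).trans ?_
    rw [hpi]
    gcongr
    · linarith
    refine le_trans (le_of_eq ?_) hsum
    congr 1; ext m
    simp only [hx]
    rw [ENNReal.mul_rpow_of_nonneg _ _ hp0.le, p2_rpow]
    congr 2; field_simp
  have pair : ∀ m l : ℤ, ∫⁻ t, ∫⁻ s, ‖s - t‖ₑ^(-θ) * (fm m s * fm l t) ≤ (8 * C) * (p2 (-(θ/2 * |1 * (((m - l : ℤ)):ℝ) + 0|)) * (x m * x l)) := by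
    intro m l
    have e : ∀ y : ℝ, p2 y * (x m * x l) = p2 (y + (m + l) * (1 - θ/2)) * (H m * H l) := by
      intro y
      simp only [hx]
      rw [hpi1, add_mul, p2_add, p2_add]; ring
    rw [e]
    push_cast
    rcases le_total (m:ℝ) l with hml | hml
    · refine (pair2 m l).trans (le_of_eq ?_)
      congr 3
      rw [abs_of_nonpos (by linarith)]; ring
    · refine (pair1 m l).trans (le_of_eq ?_)
      congr 3
      rw [abs_of_nonneg (by linarith)]; ring
  calc ∫⁻ t, ∫⁻ s, ‖s - t‖ₑ^(-θ) * (φ s * φ t) ≤ ∫⁻ t, ∫⁻ s, ∑' m, ∑' l, ‖s - t‖ₑ^(-θ) * (fm m s * fm l t) := by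
        apply lintegral_mono_ae
        filter_upwards [hcov] with t ht
        apply lintegral_mono_ae
        filter_upwards [hcov] with s hs
        simp_rw [ENNReal.tsum_mul_left, ENNReal.tsum_mul_right]
        gcongr
    _ = ∑' m, ∑' l, ∫⁻ t, ∫⁻ s, ‖s - t‖ₑ^(-θ) * (fm m s * fm l t) := by
        have hM : ∀ m l, Measurable (fun z : ℝ × ℝ => ‖z.2 - z.1‖ₑ^(-θ) * (fm m z.2 * fm l z.1)) := by
          intro m l
          have a1 := hfmm m
          have a2 := hfmm l
          fun_prop
        have hMs : ∀ m l t, Measurable (fun s : ℝ => ‖s - t‖ₑ^(-θ) * (fm m s * fm l t)) := by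
          intro m l t
          have a1 := hfmm m
          fun_prop
        have hI : ∀ m l, Measurable (fun t => ∫⁻ s, ‖s - t‖ₑ^(-θ) * (fm m s * fm l t)) := fun m l =>
          (hM m l).lintegral_prod_right'
        have e1 : ∀ t, ∫⁻ s, ∑' m, ∑' l, ‖s - t‖ₑ^(-θ) * (fm m s * fm l t) = ∑' m, ∑' l, ∫⁻ s, ‖s - t‖ₑ^(-θ) * (fm m s * fm l t) := by
          intro t
          rw [lintegral_tsum (fun m => (Measurable.tsum fun l => hMs m l t).aemeasurable)]
          congr 1; ext m
          rw [lintegral_tsum (fun l => (hMs m l t).aemeasurable)]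
        simp_rw [e1]
        rw [lintegral_tsum (fun m => (Measurable.tsum fun l => hI m l).aemeasurable)]
        congr 1; ext m
        rw [lintegral_tsum (fun l => (hI m l).aemeasurable)]
    _ ≤ ∑' m : ℤ, ∑' l : ℤ, (8 * C) * (p2 (-(θ/2 * |1 * (((m - l : ℤ)):ℝ) + 0|)) * (x m * x l)) := by
        apply ENNReal.tsum_le_tsum; intro m
        apply ENNReal.tsum_le_tsum; intro l
        exact pair m l
    _ = (8 * C) * ∑' m : ℤ, ∑' l : ℤ, (p2 (-(θ/2 * |1 * (((m + l : ℤ)):ℝ) + 0|)) * (x m * x (-l))) := by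
        simp_rw [ENNReal.tsum_mul_left]
        congr 2; ext m
        rw [← (Equiv.neg ℤ).tsum_eq]
        simp [sub_eq_add_neg]
    _ ≤ (8 * C) * ((∑' k : ℤ, p2 (-(θ/2 * |1 * (k:ℝ) + 0|))) * ((∑' k, x k^2)^((1:ℝ)/2) * (∑' k, x (-k)^2)^((1:ℝ)/2))) := by
        gcongr
        exact hankel_schur (fun k : ℤ => p2 (-(θ/2 * |1 * (k:ℝ) + 0|))) x (fun l => x (-l))
    _ ≤ (8 * C) * (W * ((∑' k, x k^2)^((1:ℝ)/2) * (∑' k, x k^2)^((1:ℝ)/2))) := by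
        have e := (Equiv.neg ℤ).tsum_eq (fun k => x k^2)
        simp only [Equiv.neg_apply] at e
        rw [e]
        gcongr
        exact hw 0
    _ = ((8 * C) * W) * ∑' k, x k^2 := by
        rw [← ENNReal.rpow_add_of_nonneg _ _ (by norm_num) (by norm_num)]
        norm_num [mul_assoc]
    _ ≤ (1 + (8 * C) * W) * (∫⁻ t, φ t^p)^(2-θ) := by
        gcongr
        exact le_add_self

/-- atoms of a complex function -/
def FA (n : ℕ) (F : Eu n × ℝ → ℂ) (m : ℤ) : Eu n × ℝ → ℂ := (Aset volume (fun z => ‖F z‖ₑ) m).indicator F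

/-- heights of a complex function -/
def HA (n : ℕ) (p : ℝ) (F : Eu n × ℝ → ℂ) (m : ℤ) (t : ℝ) : ℝ≥0∞ := Hat volume p (fun z => ‖F z‖ₑ) m t

lemma FA_enorm {n : ℕ} (F : Eu n × ℝ → ℂ) (m : ℤ) (z : Eu n × ℝ) :
    ‖FA n F m z‖ₑ = fat volume (fun z => ‖F z‖ₑ) m z := by
  unfold FA fat
  rw [enorm_indicator_eq_indicator_enorm]

lemma FA_slice_int {n : ℕ} {F : Eu n × ℝ → ℂ} (hFm : StronglyMeasurable F) (m : ℤ) {t : ℝ}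
    (h : Integrable (fun x => F (x, t))) : Integrable (fun x => FA n F m (x, t)) := by
  have hm : MeasurableSet (Aset volume (fun z => ‖F z‖ₑ) m) := Aset_meas hFm.measurable.enorm m
  have hm' : MeasurableSet {x | (x, t) ∈ Aset volume (fun z => ‖F z‖ₑ) m} := measurable_prodMk_right hm
  exact h.indicator hm'

lemma FA_sm {n : ℕ} {F : Eu n × ℝ → ℂ} (hFm : StronglyMeasurable F) (m : ℤ) : StronglyMeasurable (FA n F m) :=
  hFm.indicator (Aset_meas hFm.measurable.enorm m)

lemma FA_int {n : ℕ} {F : Eu n × ℝ → ℂ} (hFm : StronglyMeasurable F) (hF : Integrable F) (m : ℤ) : Integrable (FA n F m) :=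
  hF.indicator (Aset_meas hFm.measurable.enorm m)

lemma HA_meas {n : ℕ} {F : Eu n × ℝ → ℂ} (hFm : StronglyMeasurable F) (p : ℝ) (m : ℤ) : Measurable (HA n p F m) :=
  Hat_meas hFm.measurable.enorm p m

lemma FA_L2 {n : ℕ} {F : Eu n × ℝ → ℂ} (hFm : StronglyMeasurable F) {p : ℝ} (hp : 0 < p) (m : ℤ) (t : ℝ) :
    ∫⁻ x, ‖FA n F m (x, t)‖ₑ^2 ≤ 16 * (p2 m * HA n p F m t^2) := by
  simp_rw [FA_enorm]
  exact fat_int2 hFm.measurable.enorm hp m t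

lemma FA_L2r {n : ℕ} {F : Eu n × ℝ → ℂ} (hFm : StronglyMeasurable F) {p : ℝ} (hp : 0 < p) (m : ℤ) (t : ℝ) :
    (∫⁻ x, ‖FA n F m (x, t)‖ₑ^2)^((1:ℝ)/2) ≤ 4 * (p2 (m/2) * HA n p F m t) := by
  have h := ENNReal.rpow_le_rpow (FA_L2 hFm hp m t) (by norm_num : (0:ℝ) ≤ 1/2)
  refine h.trans (le_of_eq ?_)
  rw [ENNReal.mul_rpow_of_nonneg _ _ (by norm_num), ENNReal.mul_rpow_of_nonneg _ _ (by norm_num), p2_rpow,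
    ← ENNReal.rpow_two, ← ENNReal.rpow_mul]
  rw [show (16:ℝ≥0∞) = 4^(2:ℝ) by rw [ENNReal.rpow_two]; norm_num, ← ENNReal.rpow_mul]
  norm_num
  rw [show (m:ℝ) * (1/2) = m/2 by ring]

lemma FA_L1 {n : ℕ} {F : Eu n × ℝ → ℂ} (hFm : StronglyMeasurable F) {p : ℝ} (hp : 0 < p) (m : ℤ) (t : ℝ) :
    ∫⁻ x, ‖FA n F m (x, t)‖ₑ ≤ 8 * (p2 m * HA n p F m t) := by
  simp_rw [FA_enorm]
  exact fat_int hFm.measurable.enorm hp m t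

lemma bet_atoms (n : ℕ) (hn : 1 ≤ n) : ∃ C : ℝ≥0∞, C ≠ ⊤ ∧ ∀ (l p σ' : ℝ) (F : Eu n × ℝ → ℂ), 0 < l → 0 < p → 0 ≤ σ' →
    σ' ≤ ((n:ℝ)-1)/2 → StronglyMeasurable F → ∀ (s t : ℝ) (m k : ℤ), s ≠ t → Integrable (fun x => F (x, s)) →
    Integrable (fun x => F (x, t)) → ‖bet n l (FA n F m) (FA n F k) (s, t)‖ₑ ≤
      C * (min (p2 (((m:ℝ)+k)/2)) (ENNReal.ofReal (l^(-(n:ℝ)+σ')) * ‖s - t‖ₑ^(-σ') * p2 (m + k)) * (HA n p F m s * HA n p F k t)) := by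
  obtain ⟨C1, hC1, h1⟩ := Bil_le_L2 n hn
  obtain ⟨C2, hC2, h2⟩ := PK_K1 n hn
  refine ⟨16 * ENNReal.ofReal C1 + 64 * ENNReal.ofReal C2, by finiteness, ?_⟩
  intro l p σ' F hl hp hs0 hs hFm s t m k hst hs1 ht1
  have i1 := FA_slice_int hFm m hs1
  have i2 := FA_slice_int hFm k ht1
  rw [mul_comm (min _ _), mul_min, mul_min]
  apply le_min
  · refine le_trans (h1 l (s-t) _ _ hl i1 i2) ?_
    calc _ ≤ ENNReal.ofReal C1 * ((4 * (p2 (m/2) * HA n p F m s)) * (4 * (p2 (k/2) * HA n p F k t))) := by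
          gcongr
          · exact FA_L2r hFm hp m s
          · exact FA_L2r hFm hp k t
      _ = (16 * ENNReal.ofReal C1) * (HA n p F m s * HA n p F k t * (p2 (m/2) * p2 (k/2))) := by ring
      _ ≤ _ := by
          rw [← p2_add, ← add_div]
          gcongr
          exact le_self_add
  · refine le_trans (Bil_le_PK n l (s-t) hl _ _ i1 i2) ?_
    have hst' : s - t ≠ 0 := sub_ne_zero.2 hst
    set B := ENNReal.ofReal C2 * (ENNReal.ofReal (l^(-(n:ℝ)+σ')) * ‖s - t‖ₑ^(-σ')) with hB
    have hk : ∀ x, ‖PK n (l + ((s-t : ℝ):ℂ) * I) x‖ₑ ≤ B := by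
      intro x
      rw [← ofReal_norm]
      refine (ENNReal.ofReal_le_ofReal (h2 l (s-t) σ' x hl hs0 hs hst')).trans (le_of_eq ?_)
      rw [hB, ENNReal.ofReal_mul (by positivity), ENNReal.ofReal_mul (by positivity), mul_assoc]
      congr 2
      rw [← ofReal_norm, Real.norm_eq_abs, ENNReal.ofReal_rpow_of_pos (by positivity)]
    have m1 : AEMeasurable (fun x => ‖FA n F m (x, s)‖ₑ) := i1.aestronglyMeasurable.enorm
    have m2 : AEMeasurable (fun x => ‖FA n F k (x, t)‖ₑ) := i2.aestronglyMeasurable.enorm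
    calc _ ≤ ∫⁻ w : Eu n × Eu n, B * (‖FA n F m (w.1, s)‖ₑ * ‖FA n F k (w.2, t)‖ₑ) := by
          apply lintegral_mono; intro w
          dsimp only
          gcongr
          exact hk _
      _ = B * ((∫⁻ x, ‖FA n F m (x, s)‖ₑ) * ∫⁻ x, ‖FA n F k (x, t)‖ₑ) := by
          rw [lintegral_const_mul' _ _ (by rw [hB]; apply ENNReal.mul_ne_top (by simp); apply ENNReal.mul_ne_top (by simp); rw [← ofReal_norm, ENNReal.ofReal_rpow_of_pos (by positivity)]; simp)]
          rw [Measure.volume_eq_prod, lintegral_prod_mul m1 m2]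
      _ ≤ B * ((8 * (p2 m * HA n p F m s)) * (8 * (p2 k * HA n p F k t))) := by
          gcongr
          · exact FA_L1 hFm hp m s
          · exact FA_L1 hFm hp k t
      _ = (64 * ENNReal.ofReal C2) * (HA n p F m s * HA n p F k t * (ENNReal.ofReal (l^(-(n:ℝ)+σ')) * ‖s - t‖ₑ^(-σ') * (p2 m * p2 k))) := by
          rw [hB]; ring
      _ ≤ _ := by
          rw [← p2_add]
          gcongr
          exact le_add_self

/-- atoms cover -/
lemma FA_cover {n : ℕ} {F : Eu n × ℝ → ℂ} (hFm : StronglyMeasurable F) {p : ℝ} (hp : 0 < p)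
    (h : ∀ᵐ t : ℝ, ∫⁻ x, ‖F (x, t)‖ₑ^p ≠ ⊤) :
    ∀ᵐ z : Eu n × ℝ, F z = 0 ∨ ∃ m, z ∈ Aset volume (fun z => ‖F z‖ₑ) m := by
  have hfm : Measurable (fun z => ‖F z‖ₑ) := hFm.measurable.enorm
  have hS : MeasurableSet {z : Eu n × ℝ | F z = 0 ∨ ∃ m, z ∈ Aset volume (fun z => ‖F z‖ₑ) m} := by
    have e : {z : Eu n × ℝ | F z = 0 ∨ ∃ m, z ∈ Aset volume (fun z => ‖F z‖ₑ) m} = {z | F z = 0} ∪ ⋃ m, Aset volume (fun z => ‖F z‖ₑ) m := by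
      ext z; simp
    rw [e]
    exact (hFm.measurable (measurableSet_singleton 0)).union (MeasurableSet.iUnion fun m => Aset_meas hfm m)
  have h2 : ∀ᵐ w : ℝ × Eu n, (w.2, w.1) ∈ {z : Eu n × ℝ | F z = 0 ∨ ∃ m, z ∈ Aset volume (fun z => ‖F z‖ₑ) m} := by
    rw [Measure.volume_eq_prod]
    refine (Measure.ae_prod_iff_ae_ae (μ := volume) (ν := volume) (p := fun w : ℝ × Eu n => (w.2, w.1) ∈ {z : Eu n × ℝ | F z = 0 ∨ ∃ m, z ∈ Aset volume (fun z => ‖F z‖ₑ) m}) (measurable_swap hS)).2 ?_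
    filter_upwards [h] with t ht
    have := Aset_cover (μ := volume) hfm hp t (fun x => by simp) ht
    filter_upwards [this] with x hx
    rcases hx with hx | hx
    · left; simpa using hx
    · right; exact hx
  have h3 := (Measure.measurePreserving_swap (μ := (volume : Measure (Eu n))) (ν := (volume : Measure ℝ))).quasiMeasurePreserving.ae (p := fun w : ℝ × Eu n => (w.2, w.1) ∈ {z : Eu n × ℝ | F z = 0 ∨ ∃ m, z ∈ Aset volume (fun z => ‖F z‖ₑ) m}) h2
  filter_upwards [h3] with z hz
  exact hz

/-- summing heights -/
lemma HA_sum {n : ℕ} {F : Eu n × ℝ → ℂ} (hFm : StronglyMeasurable F) {p : ℝ} (hp : 0 < p) (hp2 : p ≤ 2) (t : ℝ) :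
    ∑' m : ℤ, (p2 (m / p) * HA n p F m t)^2 ≤ (∫⁻ x, ‖F (x, t)‖ₑ^p)^(2/p) := by
  refine (tsum_sq_le _ p hp hp2).trans ?_
  gcongr
  refine le_trans (le_of_eq ?_) (Hat_sum (μ := (volume : Measure (Eu n))) hFm.measurable.enorm hp t)
  congr 1; ext m
  rw [ENNReal.mul_rpow_of_nonneg _ _ hp.le, p2_rpow]
  congr 2; field_simp

lemma Nsq_le_FA {n : ℕ} {l : ℝ} (hl : 0 < l) {F : Eu n × ℝ → ℂ} (hFm : StronglyMeasurable F) (hF : Integrable F) {p : ℝ} (hp : 0 < p)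
    (h : ∀ᵐ t : ℝ, ∫⁻ x, ‖F (x, t)‖ₑ^p ≠ ⊤) :
    Nsq n l F ≤ ∑' i, ∑' j, ‖Nn n l (FA n F i) (FA n F j)‖ₑ :=
  Nsq_le_tsum hl hF _ (fun m => Aset_meas hFm.measurable.enorm m) (fun _ _ _ h h' => Aset_disj h h') (FA_cover hFm hp h)

/-- frequency localized Strichartz, non endpoint -/
lemma strich_ne (n : ℕ) (hn : 1 ≤ n) (q r q' r' : ℝ) (hq : 2 < q) (hr : 2 < r) (hadm : 2/q + ((n:ℝ)-1)/r ≤ ((n:ℝ)-1)/2)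
    (hq' : 1/q + 1/q' = 1) (hr' : 1/r + 1/r' = 1) :
    ∃ C : ℝ≥0∞, C ≠ ⊤ ∧ ∀ (l : ℝ) (F : Eu n × ℝ → ℂ), 0 < l → StronglyMeasurable F → Integrable F →
      Nsq n l F ≤ C * (ENNReal.ofReal (l^(2/q + 2*n/r - n)) * (∫⁻ t, (∫⁻ x, ‖F (x, t)‖ₑ^r')^(q'/r'))^(2/q')) := by
  obtain ⟨C1, hC1, h1⟩ := bet_atoms n hn
  have hr0 : 0 < 1/2 - 1/r := by
    rw [sub_pos]; exact one_div_lt_one_div_of_lt two_pos hr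
  have hr1 : 0 < 1/r := by positivity
  obtain ⟨C2, hC2, h2⟩ := sum_min_geom (1/r) (1/2-1/r) hr1 hr0
  have hθ0 : 0 < 2/q := by positivity
  have hθ1 : 2/q < 1 := by rw [div_lt_one (by linarith)]; exact hq
  obtain ⟨C3, hC3, h3⟩ := hls (2/q) hθ0 hθ1
  have er' : 1/r' = 1 - 1/r := by linarith
  have eq' : 1/q' = 1 - 1/q := by linarith
  have hr'0 : 0 < r' := by
    rw [← one_div_pos, er']; linarith
  have hq'0 : 0 < q' := by
    have : 2/q = 2*(1/q) := by ring
    rw [← one_div_pos, eq']; linarith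
  have hr'2 : r' ≤ 2 := by
    rw [← one_div_le_one_div (by norm_num) hr'0, er']; linarith
  have eq2 : 2/(2-2/q) = q' := by
    have : 2 - 2/q = 2*(1/q') := by rw [eq']; ring
    rw [this]; field_simp
  have eq3 : 2 - 2/q = 2/q' := by
    have : 2/q' = 2*(1/q') := by ring
    rw [this, eq']; ring
  set σ' := (2/q)/(1-2/r) with hσ'
  have h2r : 0 < 1 - 2/r := by
    have : 2/r = 2*(1/r) := by ring
    rw [this]; linarith
  have hs0 : 0 ≤ σ' := by positivity
  have hs1 : σ' ≤ ((n:ℝ)-1)/2 := by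
    rw [hσ', div_le_iff₀ h2r]
    have : ((n:ℝ)-1)/2 * (1-2/r) = ((n:ℝ)-1)/2 - ((n:ℝ)-1)/r := by ring
    rw [this]; linarith
  have hsm : σ' * (1-2/r) = 2/q := by rw [hσ']; exact div_mul_cancel₀ _ h2r.ne'
  refine ⟨1 + C1 * C2 * C3, by finiteness, fun l F hl hFm hF => ?_⟩
  have hL : (0:ℝ) < l^(2/q + 2*n/r - n) := by positivity
  set φ : ℝ → ℝ≥0∞ := fun t => (∫⁻ x, ‖F (x, t)‖ₑ^r')^(1/r') with hφ
  have hφm : Measurable φ := by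
    apply Measurable.pow_const
    exact Measurable.lintegral_prod_left' (f := fun z : Eu n × ℝ => ‖F z‖ₑ^r') (hFm.measurable.enorm.pow_const _)
  have eφ : ∀ t, (∫⁻ x, ‖F (x, t)‖ₑ^r')^(q'/r') = φ t^q' := by
    intro t; rw [hφ]; dsimp only
    rw [← ENNReal.rpow_mul]; congr 1; ring
  simp_rw [eφ]
  by_cases hfin : ∫⁻ t, φ t^q' = ⊤
  · rw [hfin, ENNReal.top_rpow_of_pos (by positivity), ENNReal.mul_top, ENNReal.mul_top]
    · exact le_top
    · simp
    · simpa using hL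
  have hae : ∀ᵐ t : ℝ, ∫⁻ x, ‖F (x, t)‖ₑ^r' ≠ ⊤ := by
    filter_upwards [ae_lt_top (hφm.pow_const q') hfin] with t ht
    intro hc
    rw [hφ] at ht; dsimp only at ht
    rw [hc, ENNReal.top_rpow_of_pos (by positivity), ENNReal.top_rpow_of_pos hq'0] at ht
    exact lt_irrefl _ ht
  have hsl : ∀ᵐ t : ℝ, Integrable (fun x => F (x, t)) := hF.prod_left_ae
  set L := ENNReal.ofReal (l^(-(n:ℝ)+σ')) with hLd
  have hL0 : L ≠ 0 := by
    rw [hLd]; simp; positivity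
  have hLt : L ≠ ⊤ := by simp [hLd]
  -- pointwise in times
  have key : ∀ s t : ℝ, s ≠ t → Integrable (fun x => F (x, s)) → Integrable (fun x => F (x, t)) →
      ∑' m : ℤ, ∑' k : ℤ, ‖bet n l (FA n F m) (FA n F k) (s, t)‖ₑ ≤
        (C1 * C2 * ENNReal.ofReal (l^(2/q + 2*n/r - n))) * (‖s-t‖ₑ^(-(2/q)) * (φ s * φ t)) := by
    intro s t hst hs ht
    set B := L * ‖s-t‖ₑ^(-σ') with hB
    have hst0 : ‖s-t‖ₑ ≠ 0 := by simpa [sub_eq_zero] using hst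
    have hB0 : B ≠ 0 := mul_ne_zero hL0 (by simp; exact fun h => absurd (sub_eq_zero.1 h) hst)
    have hBt : B ≠ ⊤ := ENNReal.mul_ne_top hLt (by simp [hst0])
    set x : ℝ → ℤ → ℝ≥0∞ := fun t m => p2 (m/r') * HA n r' F m t with hx
    set w : ℤ → ℝ≥0∞ := fun m => min (B * p2 (1/r * m)) (1 * p2 (-((1/2-1/r) * m))) with hw
    have hx2 : ∀ t, (∑' m, x t m^2)^((1:ℝ)/2) ≤ φ t := by
      intro t
      refine (ENNReal.rpow_le_rpow (HA_sum hFm hr'0 hr'2 t) (by norm_num)).trans (le_of_eq ?_)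
      rw [hφ]; dsimp only; rw [← ENNReal.rpow_mul]; congr 1; ring
    calc ∑' m : ℤ, ∑' k : ℤ, ‖bet n l (FA n F m) (FA n F k) (s, t)‖ₑ
        ≤ ∑' m : ℤ, ∑' k : ℤ, C1 * (w (m + k) * (x s m * x t k)) := by
          apply ENNReal.tsum_le_tsum; intro m
          apply ENNReal.tsum_le_tsum; intro k
          refine (h1 l r' σ' F hl hr'0 hs0 hs1 hFm s t m k hst hs ht).trans (le_of_eq ?_)
          congr 1
          simp only [hw, hx]
          rw [show p2 (m / r') * HA n r' F m s * (p2 (k / r') * HA n r' F k t) =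
            p2 (m / r' + k / r') * (HA n r' F m s * HA n r' F k t) by rw [p2_add]; ring, ← mul_assoc _ (p2 (m / r' + k / r'))]
          congr 1
          rw [mul_comm (min _ _), mul_min, one_mul, min_comm]
          congr 1
          · rw [mul_left_comm, ← p2_add]; congr 2
            rw [div_eq_mul_one_div, div_eq_mul_one_div (k:ℝ), er']; push_cast; ring
          · rw [← p2_add]; congr 1
            rw [div_eq_mul_one_div (m:ℝ), div_eq_mul_one_div (k:ℝ), er']; push_cast; ring
      _ = C1 * ∑' m : ℤ, ∑' k : ℤ, (w (m + k) * (x s m * x t k)) := by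
          simp_rw [ENNReal.tsum_mul_left]
      _ ≤ C1 * ((C2 * (B^((1/2-1/r)/(1/r+(1/2-1/r))) * 1^((1/r)/(1/r+(1/2-1/r))))) * (φ s * φ t)) := by
          gcongr
          refine (hankel_schur _ _ _).trans ?_
          gcongr
          · exact h2 B 1 hB0 hBt one_ne_zero ENNReal.one_ne_top
          · exact hx2 s
          · exact hx2 t
      _ = _ := by
          rw [ENNReal.one_rpow, mul_one, show (1/2-1/r)/(1/r+(1/2-1/r)) = 1 - 2/r by ring, hB,
            ENNReal.mul_rpow_of_nonneg _ _ h2r.le, ← ENNReal.rpow_mul, hLd, ENNReal.ofReal_rpow_of_pos (by positivity),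
            ← Real.rpow_mul hl.le]
          rw [show (-(n:ℝ)+σ') * (1-2/r) = 2/q + 2*n/r - n by rw [add_mul, hsm]; ring,
            show -σ' * (1-2/r) = -(2/q) by rw [neg_mul, hsm]]
          ring
  have hmeas : ∀ i j : ℤ, AEMeasurable (fun w : ℝ × ℝ => ‖bet n l (FA n F i) (FA n F j) w‖ₑ) (volume.prod volume) := fun i j =>
    (bet_int hl (FA_sm hFm i) (FA_int hFm hF i) (FA_sm hFm j) (FA_int hFm hF j)).aestronglyMeasurable.enorm
  have hsl1 : ∀ᵐ w : ℝ × ℝ ∂(volume.prod volume), Integrable (fun x => F (x, w.1)) :=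
    Measure.quasiMeasurePreserving_fst.ae hsl
  have hsl2 : ∀ᵐ w : ℝ × ℝ ∂(volume.prod volume), Integrable (fun x => F (x, w.2)) :=
    Measure.quasiMeasurePreserving_snd.ae hsl
  have hdiag : ∀ᵐ w : ℝ × ℝ ∂(volume.prod volume), w.1 ≠ w.2 := by
    have hm : MeasurableSet {w : ℝ × ℝ | w.1 ≠ w.2} := (measurableSet_eq_fun measurable_fst measurable_snd).compl
    rw [Measure.ae_prod_iff_ae_ae hm]
    refine Eventually.of_forall fun s => ?_
    have : ∀ᵐ t : ℝ, t ≠ s := by simp [ae_iff]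
    filter_upwards [this] with t ht
    exact fun h => ht h.symm
  calc Nsq n l F ≤ ∑' i, ∑' j, ‖Nn n l (FA n F i) (FA n F j)‖ₑ := Nsq_le_FA hl hFm hF hr'0 hae
    _ ≤ ∑' i, ∑' j, ∫⁻ w : ℝ × ℝ, ‖bet n l (FA n F i) (FA n F j) w‖ₑ ∂(volume.prod volume) := by
        apply ENNReal.tsum_le_tsum; intro m
        apply ENNReal.tsum_le_tsum; intro k
        rw [Nn_eq hl (FA_sm hFm m) (FA_int hFm hF m) (FA_sm hFm k) (FA_int hFm hF k)]
        exact enorm_integral_le_lintegral_enorm _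
    _ = ∫⁻ w : ℝ × ℝ, ∑' i, ∑' j, ‖bet n l (FA n F i) (FA n F j) w‖ₑ ∂(volume.prod volume) := by
        rw [lintegral_tsum (fun i => AEMeasurable.tsum (hmeas i))]
        congr 1; ext i
        rw [lintegral_tsum (hmeas i)]
    _ ≤ ∫⁻ w : ℝ × ℝ, (C1 * C2 * ENNReal.ofReal (l^(2/q + 2*n/r - n))) * (‖w.1-w.2‖ₑ^(-(2/q)) * (φ w.1 * φ w.2)) ∂(volume.prod volume) := by
        apply lintegral_mono_ae
        filter_upwards [hsl1, hsl2, hdiag] with w h1 h2 h3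
        exact key w.1 w.2 h3 h1 h2
    _ = (C1 * C2 * ENNReal.ofReal (l^(2/q + 2*n/r - n))) * ∫⁻ s, ∫⁻ t, ‖s-t‖ₑ^(-(2/q)) * (φ s * φ t) := by
        have hm : Measurable (fun w : ℝ × ℝ => ‖w.1-w.2‖ₑ^(-(2/q)) * (φ w.1 * φ w.2)) := by fun_prop
        rw [lintegral_const_mul _ hm, lintegral_prod _ hm.aemeasurable]
    _ = (C1 * C2 * ENNReal.ofReal (l^(2/q + 2*n/r - n))) * ∫⁻ t, ∫⁻ s, ‖s-t‖ₑ^(-(2/q)) * (φ s * φ t) := by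
        congr 1
        apply lintegral_congr; intro t
        apply lintegral_congr; intro s
        rw [← enorm_neg (s - t), neg_sub, mul_comm (φ s)]
    _ ≤ (C1 * C2 * ENNReal.ofReal (l^(2/q + 2*n/r - n))) * (C3 * (∫⁻ t, φ t^(2/(2-2/q)))^(2-2/q)) := by
        gcongr; exact h3 φ hφm
    _ = (C1 * C2 * C3) * (ENNReal.ofReal (l^(2/q + 2*n/r - n)) * (∫⁻ t, φ t^q')^(2/q')) := by
        rw [eq2, eq3]; ring
    _ ≤ _ := by
        gcongr; exact le_add_self

lemma Bil_conj (n : ℕ) (l τ : ℝ) (f g : Eu n → ℂ) : Bil n l (-τ) g f = starRingEnd ℂ (Bil n l τ f g) := by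
  unfold Bil
  rw [← integral_conj]
  congr 1; ext ξ
  rw [map_mul, map_mul, Complex.conj_conj, ← Complex.exp_conj, mul_comm (𝓕 g ξ)]
  congr 2
  simp only [map_neg, map_mul, map_add, Complex.conj_I, Complex.conj_ofReal]
  push_cast; ring

/-- two-time shells -/
def Sj (j : ℤ) : Set (ℝ × ℝ) := {w | w.1 - w.2 ∈ Dj j}

lemma Sj_meas (j : ℤ) : MeasurableSet (Sj j) := (Dj_meas j).preimage (by fun_prop : Measurable fun w : ℝ × ℝ => w.1 - w.2)

lemma bet_swap (n : ℕ) (l : ℝ) (F G : Eu n × ℝ → ℂ) (j : ℤ) :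
    ‖∫ w in Sj j, bet n l F G w ∂(volume.prod volume)‖ₑ = ‖∫ w in Sj j, bet n l G F w ∂(volume.prod volume)‖ₑ := by
  have e : ∫ w in Sj j, bet n l F G w ∂(volume.prod volume) = starRingEnd ℂ (∫ w in Sj j, bet n l G F w ∂(volume.prod volume)) := by
    rw [← integral_conj, ← integral_indicator (Sj_meas j), ← integral_indicator (Sj_meas j),
      ← integral_prod_swap]
    congr 1; ext w
    have : w.swap ∈ Sj j ↔ w ∈ Sj j := by
      simp only [Sj, Set.mem_ofPred_eq, Prod.fst_swap, Prod.snd_swap]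
      rw [← Dj_neg, neg_sub]
    by_cases h : w ∈ Sj j
    · rw [Set.indicator_of_mem h, Set.indicator_of_mem (this.2 h)]
      simp only [bet, Prod.fst_swap, Prod.snd_swap]
      rw [← Bil_conj]; congr 1; ring
    · rw [Set.indicator_of_notMem h, Set.indicator_of_notMem (fun h' => h (this.1 h'))]
  rw [e, ← ofReal_norm, ← ofReal_norm, RCLike.norm_conj]

lemma slices_ae {n : ℕ} {F : Eu n × ℝ → ℂ} (hF : Integrable F) :
    ∀ᵐ w : ℝ × ℝ ∂(volume.prod volume), w.1 ≠ w.2 ∧ Integrable (fun x => F (x, w.1)) ∧ Integrable (fun x => F (x, w.2)) := by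
  have hsl : ∀ᵐ t : ℝ, Integrable (fun x => F (x, t)) := hF.prod_left_ae
  have hsl1 : ∀ᵐ w : ℝ × ℝ ∂(volume.prod volume), Integrable (fun x => F (x, w.1)) :=
    Measure.quasiMeasurePreserving_fst.ae hsl
  have hsl2 : ∀ᵐ w : ℝ × ℝ ∂(volume.prod volume), Integrable (fun x => F (x, w.2)) :=
    Measure.quasiMeasurePreserving_snd.ae hsl
  have hdiag : ∀ᵐ w : ℝ × ℝ ∂(volume.prod volume), w.1 ≠ w.2 := by
    have hm : MeasurableSet {w : ℝ × ℝ | w.1 ≠ w.2} := (measurableSet_eq_fun measurable_fst measurable_snd).compl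
    rw [Measure.ae_prod_iff_ae_ae hm]
    refine Eventually.of_forall fun s => ?_
    have : ∀ᵐ t : ℝ, t ≠ s := by simp [ae_iff]
    filter_upwards [this] with t ht
    exact fun h => ht h.symm
  filter_upwards [hsl1, hsl2, hdiag] with w h1 h2 h3
  exact ⟨h3, h1, h2⟩

lemma bet_zero (n : ℕ) (l : ℝ) (F G : Eu n × ℝ → ℂ) (w : ℝ × ℝ) (h : (∀ x, F (x, w.1) = 0) ∨ ∀ x, G (x, w.2) = 0) :
    bet n l F G w = 0 := by
  unfold bet
  rcases h with h | h
  · rw [show (fun x => F (x, w.1)) = fun _ => 0 from funext h]; exact Bil_zero_left _ _ _ _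
  · rw [show (fun x => G (x, w.2)) = fun _ => 0 from funext h]
    have := Bil_symm n l (w.1 - w.2) (fun x => F (x, w.1)) (fun _ => 0)
    rw [Bil_zero_left] at this
    simpa using this

lemma Nsq_atom (n : ℕ) (hn : 1 ≤ n) (σ' : ℝ) (hs : 1 < σ') (hs2 : σ' ≤ ((n:ℝ)-1)/2) : ∃ C : ℝ≥0∞, C ≠ ⊤ ∧
    ∀ (l p : ℝ) (F : Eu n × ℝ → ℂ) (m : ℤ) (B : Set ℝ), 0 < l → 0 < p → StronglyMeasurable F → Integrable F → MeasurableSet B →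
    Nsq n l ((Prod.snd ⁻¹' B).indicator (FA n F m)) ≤
      C * (p2 m * (ENNReal.ofReal (l^(-(n:ℝ)+σ')) * p2 m)^(1/σ') * ∫⁻ t in B, HA n p F m t^2) := by
  obtain ⟨C1, hC1, h1⟩ := bet_atoms n hn
  obtain ⟨C2, hC2, h2⟩ := min_integral σ' hs
  refine ⟨C1 * C2, by finiteness, fun l p F m B hl hp hFm hF hB => ?_⟩
  set L := ENNReal.ofReal (l^(-(n:ℝ)+σ')) with hLd
  have hL0 : L ≠ 0 := by
    rw [hLd]; simp; positivity
  have hLt : L ≠ ⊤ := by simp [hLd]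
  have hM0 : L * p2 m ≠ 0 := mul_ne_zero hL0 (p2_ne_zero _)
  have hMt : L * p2 m ≠ ⊤ := ENNReal.mul_ne_top hLt (p2_ne_top _)
  set F' := (Prod.snd ⁻¹' B).indicator (FA n F m) with hF'
  have hB' : MeasurableSet ((Prod.snd : Eu n × ℝ → ℝ) ⁻¹' B) := measurable_snd hB
  have hFm' : StronglyMeasurable F' := (FA_sm hFm m).indicator hB'
  have hFi' : Integrable F' := (FA_int hFm hF m).indicator hB'
  have hH := HA_meas hFm p m
  set a : ℝ → ℝ≥0∞ := B.indicator (HA n p F m) with ha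
  have ham : Measurable a := hH.indicator hB
  have ha2 : ∫⁻ s, a s^2 = ∫⁻ t in B, HA n p F m t^2 := by
    rw [← lintegral_indicator hB]
    congr 1; ext s
    by_cases h : s ∈ B <;> simp [ha, h]
  set κ : ℝ → ℝ≥0∞ := fun τ => min 1 ((L * p2 m) * ‖τ‖ₑ^(-σ')) with hκ
  have hκm : Measurable κ := by fun_prop
  rw [Nsq_eq hl hFi', Nn_eq hl hFm' hFi' hFm' hFi']
  refine (enorm_integral_le_lintegral_enorm _).trans ?_
  calc ∫⁻ w, ‖bet n l F' F' w‖ₑ ≤ ∫⁻ w : ℝ × ℝ, (C1 * p2 m) * (κ (w.1 - w.2) * (a w.1 * a w.2)) ∂(volume.prod volume) := by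
        rw [Measure.volume_eq_prod]
        apply lintegral_mono_ae
        filter_upwards [slices_ae hF] with w hw
        obtain ⟨h3, h4, h5⟩ := hw
        by_cases h6 : w.1 ∈ B
        · by_cases h7 : w.2 ∈ B
          · have : bet n l F' F' w = bet n l (FA n F m) (FA n F m) (w.1, w.2) := by
              unfold bet; congr 1 <;> ext x <;> rw [hF', Set.indicator_of_mem (by simpa)]
            rw [this]
            refine (h1 l p σ' F hl hp (by linarith) hs2 hFm w.1 w.2 m m h3 h4 h5).trans (le_of_eq ?_)
            simp only [ha, hκ]
            rw [Set.indicator_of_mem h6, Set.indicator_of_mem h7, mul_assoc C1]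
            congr 1
            rw [← mul_assoc (p2 m), mul_min, mul_one]
            congr 2
            · congr 1; ring
            · rw [p2_add]; ring
          · rw [bet_zero _ _ _ _ _ (Or.inr fun x => by rw [hF', Set.indicator_of_notMem (by simpa)])]; simp
        · rw [bet_zero _ _ _ _ _ (Or.inl fun x => by rw [hF', Set.indicator_of_notMem (by simpa)])]; simp
    _ = (C1 * p2 m) * ∫⁻ t, ∫⁻ s, κ (s - t) * (a s * a t) := by
        have hm : Measurable (fun w : ℝ × ℝ => κ (w.1 - w.2) * (a w.1 * a w.2)) := by fun_prop
        rw [lintegral_const_mul _ hm, lintegral_prod_symm' _ hm]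
    _ ≤ (C1 * p2 m) * ((∫⁻ τ, κ τ) * ((∫⁻ s, a s^2)^((1:ℝ)/2) * (∫⁻ t, a t^2)^((1:ℝ)/2))) := by
        gcongr; exact time_schur κ a a hκm ham ham
    _ ≤ (C1 * p2 m) * ((C2 * (L * p2 m)^(1/σ')) * (∫⁻ s, a s^2)) := by
        gcongr
        · exact h2 _ hM0 hMt
        · rw [← ENNReal.rpow_add_of_nonneg _ _ (by norm_num) (by norm_num)]; norm_num
    _ = _ := by rw [ha2]; ring

lemma Tj_ii (n : ℕ) (hn : 1 ≤ n) (σ' : ℝ) (hs : 1 < σ') (hs2 : σ' ≤ ((n:ℝ)-1)/2) : ∃ C : ℝ≥0∞, C ≠ ⊤ ∧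
    ∀ (l p : ℝ) (F : Eu n × ℝ → ℂ) (j m k : ℤ), 0 < l → 0 < p → StronglyMeasurable F → Integrable F →
    ‖∫ w in Sj j, bet n l (FA n F m) (FA n F k) w ∂(volume.prod volume)‖ₑ ≤
      C * ((p2 m * (ENNReal.ofReal (l^(-(n:ℝ)+σ')) * p2 m)^(1/σ') * p2 j * p2 k)^((1:ℝ)/2) *
        ((∫⁻ t, HA n p F m t^2)^((1:ℝ)/2) * (∫⁻ t, HA n p F k t^2)^((1:ℝ)/2))) := by
  obtain ⟨C1, hC1, h1⟩ := Nsq_atom n hn σ' hs hs2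
  obtain ⟨C2, hC2, h2⟩ := bet_slice n hn
  refine ⟨ENNReal.ofReal C2 * C1^((1:ℝ)/2) * 8, by finiteness, fun l p F j m k hl hp hFm hF => ?_⟩
  set D := p2 m * (ENNReal.ofReal (l^(-(n:ℝ)+σ')) * p2 m)^(1/σ') with hD
  have hi := bet_int hl (FA_sm hFm m) (FA_int hFm hF m) (FA_sm hFm k) (FA_int hFm hF k)
  have hHm := HA_meas hFm p m
  have hHk := HA_meas hFm p k
  rw [← integral_indicator (Sj_meas j), integral_prod_symm _ (hi.indicator (Sj_meas j))]
  refine (enorm_integral_le_lintegral_enorm _).trans ?_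
  have hsl : ∀ᵐ t : ℝ, Integrable (fun x => F (x, t)) := hF.prod_left_ae
  set A : ℝ → Set ℝ := fun t => (fun s => s - t) ⁻¹' Dj j with hA
  have hAm : ∀ t, MeasurableSet (A t) := fun t => (Dj_meas j).preimage (by fun_prop)
  set J : ℝ → ℝ≥0∞ := fun t => ∫⁻ s in A t, HA n p F m s^2 with hJ
  have hJ' : ∀ t, J t = ∫⁻ s, (Sj j).indicator (fun w => HA n p F m w.1^2) (s, t) := by
    intro t
    rw [hJ]; dsimp only
    rw [← lintegral_indicator (hAm t)]
    rfl
  have hm1 : Measurable ((Sj j).indicator (fun w : ℝ × ℝ => HA n p F m w.1^2)) :=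
    Measurable.indicator (by fun_prop) (Sj_meas j)
  have hJm : Measurable J := by
    rw [show J = _ from funext hJ']
    exact hm1.lintegral_prod_left'
  calc _ ≤ ∫⁻ t, ENNReal.ofReal C2 * ((C1 * (D * J t))^((1:ℝ)/2) * (4 * (p2 (k/2) * HA n p F k t))) := by
        apply lintegral_mono_ae
        filter_upwards [hsl] with t ht
        have e : ∫ s, (Sj j).indicator (bet n l (FA n F m) (FA n F k)) (s, t) =
            ∫ s in A t, Bil n l (s - t) (fun x => FA n F m (x, s)) (fun x => FA n F k (x, t)) := by
          rw [← integral_indicator (hAm t)]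
          rfl
        rw [e]
        refine (h2 l _ _ (A t) t hl (FA_sm hFm m) (FA_int hFm hF m) (FA_slice_int hFm k ht) (hAm t)).trans ?_
        gcongr
        · exact h1 l p F m (A t) hl hp hFm hF (hAm t)
        · exact FA_L2r hFm hp k t
    _ = ∫⁻ t, (ENNReal.ofReal C2 * C1^((1:ℝ)/2) * 4 * D^((1:ℝ)/2) * p2 (k/2)) * (J t^((1:ℝ)/2) * HA n p F k t) := by
        congr 1; ext t
        rw [ENNReal.mul_rpow_of_nonneg _ _ (by norm_num), ENNReal.mul_rpow_of_nonneg _ _ (by norm_num)]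
        ring
    _ = (ENNReal.ofReal C2 * C1^((1:ℝ)/2) * 4 * D^((1:ℝ)/2) * p2 (k/2)) * ∫⁻ t, (J t^((1:ℝ)/2) * HA n p F k t) := by
        have hm : Measurable (fun t => J t^((1:ℝ)/2) * HA n p F k t) := by fun_prop
        rw [lintegral_const_mul _ hm]
    _ ≤ (ENNReal.ofReal C2 * C1^((1:ℝ)/2) * 4 * D^((1:ℝ)/2) * p2 (k/2)) * ((∫⁻ t, (J t^((1:ℝ)/2))^2)^((1:ℝ)/2) * (∫⁻ t, HA n p F k t^2)^((1:ℝ)/2)) := by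
        gcongr
        exact lintegral_cs _ _ _ (hJm.pow_const _).aemeasurable hHk.aemeasurable
    _ ≤ (ENNReal.ofReal C2 * C1^((1:ℝ)/2) * 4 * D^((1:ℝ)/2) * p2 (k/2)) * ((4 * p2 j * ∫⁻ t, HA n p F m t^2)^((1:ℝ)/2) * (∫⁻ t, HA n p F k t^2)^((1:ℝ)/2)) := by
        gcongr
        calc ∫⁻ t, (J t^((1:ℝ)/2))^2 = ∫⁻ t, J t := by
              congr 1; ext t
              rw [← ENNReal.rpow_two, ← ENNReal.rpow_mul]; norm_num
          _ = ∫⁻ s, ∫⁻ t, (Sj j).indicator (fun w => HA n p F m w.1^2) (s, t) := by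
              simp_rw [hJ']
              rw [lintegral_lintegral_swap]
              exact (hm1.comp measurable_swap).aemeasurable
          _ = ∫⁻ s, volume (Dj j) * HA n p F m s^2 := by
              apply lintegral_congr; intro s
              have : ∀ t, (Sj j).indicator (fun w => HA n p F m w.1^2) (s, t) = ((fun t => s - t) ⁻¹' Dj j).indicator (fun _ => HA n p F m s^2) t := fun t => rfl
              simp_rw [this]
              rw [lintegral_indicator_const ((Dj_meas j).preimage (by fun_prop)), mul_comm]
              congr 1
              exact (Measure.measurePreserving_sub_left volume s).measure_preimage (Dj_meas j).nullMeasurableSet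
          _ = volume (Dj j) * ∫⁻ s, HA n p F m s^2 := by
              have hm : Measurable (fun s => HA n p F m s^2) := by fun_prop
              rw [lintegral_const_mul _ hm]
          _ ≤ _ := by gcongr; exact Dj_vol j
    _ = _ := by
        simp_rw [ENNReal.mul_rpow_of_nonneg _ _ (by norm_num : (0:ℝ) ≤ 1/2)]
        rw [show ((4:ℝ≥0∞)^((1:ℝ)/2)) = 2 by
          rw [show (4:ℝ≥0∞) = 2^(2:ℝ) by rw [ENNReal.rpow_two]; norm_num, ← ENNReal.rpow_mul]; norm_num]
        rw [p2_rpow k, show (k:ℝ) * (1/2) = k/2 by ring]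
        ring

lemma Tj_i (n : ℕ) (hn : 1 ≤ n) (σ' : ℝ) (hs : 1 < σ') (hs2 : σ' ≤ ((n:ℝ)-1)/2) : ∃ C : ℝ≥0∞, C ≠ ⊤ ∧
    ∀ (l p : ℝ) (F : Eu n × ℝ → ℂ) (j m k : ℤ), 0 < l → 0 < p → StronglyMeasurable F → Integrable F →
    ‖∫ w in Sj j, bet n l (FA n F m) (FA n F k) w ∂(volume.prod volume)‖ₑ ≤
      C * ((ENNReal.ofReal (l^(-(n:ℝ)+σ')) * p2 (m + k) * p2 (-(σ' * j)) * p2 j) *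
        ((∫⁻ t, HA n p F m t^2)^((1:ℝ)/2) * (∫⁻ t, HA n p F k t^2)^((1:ℝ)/2))) := by
  obtain ⟨C1, hC1, h1⟩ := bet_atoms n hn
  refine ⟨C1 * 4, by finiteness, fun l p F j m k hl hp hFm hF => ?_⟩
  set L := ENNReal.ofReal (l^(-(n:ℝ)+σ')) with hLd
  have hHm := HA_meas hFm p m
  have hHk := HA_meas hFm p k
  set κ : ℝ → ℝ≥0∞ := (Dj j).indicator 1 with hκ
  have hκm : Measurable κ := measurable_one.indicator (Dj_meas j)
  refine (enorm_integral_le_lintegral_enorm _).trans ?_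
  rw [← lintegral_indicator (Sj_meas j)]
  calc _ ≤ ∫⁻ w : ℝ × ℝ, (C1 * (L * p2 (m + k) * p2 (-(σ' * j)))) * (κ (w.1 - w.2) * (HA n p F m w.1 * HA n p F k w.2)) ∂(volume.prod volume) := by
        apply lintegral_mono_ae
        filter_upwards [slices_ae hF] with w hw
        obtain ⟨h3, h4, h5⟩ := hw
        by_cases h6 : w ∈ Sj j
        · have h7 : w.1 - w.2 ∈ Dj j := h6
          rw [Set.indicator_of_mem h6, hκ, Set.indicator_of_mem h7]
          refine (h1 l p σ' F hl hp (by linarith) hs2 hFm w.1 w.2 m k h3 h4 h5).trans ?_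
          rw [Pi.one_apply, one_mul, mul_assoc C1]
          gcongr
          refine (min_le_right _ _).trans ?_
          rw [mul_right_comm]
          gcongr
          exact Dj_rpow h7 (by linarith)
        · rw [Set.indicator_of_notMem h6]; simp
    _ = (C1 * (L * p2 (m + k) * p2 (-(σ' * j)))) * ∫⁻ t, ∫⁻ s, κ (s - t) * (HA n p F m s * HA n p F k t) := by
        have hm : Measurable (fun w : ℝ × ℝ => κ (w.1 - w.2) * (HA n p F m w.1 * HA n p F k w.2)) := by fun_prop
        rw [lintegral_const_mul _ hm, lintegral_prod_symm' _ hm]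
    _ ≤ (C1 * (L * p2 (m + k) * p2 (-(σ' * j)))) * ((4 * p2 j) * ((∫⁻ t, HA n p F m t^2)^((1:ℝ)/2) * (∫⁻ t, HA n p F k t^2)^((1:ℝ)/2))) := by
        gcongr
        refine (time_schur κ _ _ hκm hHm hHk).trans ?_
        gcongr
        rw [hκ, lintegral_indicator_one (Dj_meas j)]
        exact Dj_vol j
    _ = _ := by ring

lemma uv_min (α β u v : ℝ) (hα : 0 < α) (hβ : 0 < β) :
    min (β*(u+v)) (min (-(α*v)) (-(α*u))) ≤ -(min α β/3 * |u|) + -(min α β/3*|v|) := by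
  set ε := min α β with hε
  have h1 : ε ≤ α := min_le_left _ _
  have h2 : ε ≤ β := min_le_right _ _
  have h0 : 0 < ε := lt_min hα hβ
  have key : ∀ M o : ℝ, o ≤ M → min (β*(M+o)) (-(α*M)) ≤ -(ε/3*|M|) + -(ε/3*|o|) := by
    intro M o ho
    rcases le_or_gt M 0 with hM | hM
    · refine (min_le_left _ _).trans ?_
      rw [abs_of_nonpos hM, abs_of_nonpos (ho.trans hM)]
      nlinarith
    · rw [abs_of_pos hM]
      rcases le_or_gt (|o|) (2*M) with h | h
      · refine (min_le_right _ _).trans ?_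
        nlinarith
      · have ho' : o < 0 := by
          by_contra hc
          rw [abs_of_nonneg (not_lt.1 hc)] at h
          linarith
        rw [abs_of_neg ho'] at h ⊢
        refine (min_le_left _ _).trans ?_
        nlinarith
  rcases le_total u v with h | h
  · refine le_trans ?_ ((key v u h).trans (le_of_eq (add_comm _ _)))
    apply le_min
    · exact (min_le_left _ _).trans (le_of_eq (by ring))
    · exact (min_le_right _ _).trans (min_le_left _ _)
  · refine le_trans ?_ (key u v h)
    apply le_min
    · exact (min_le_left _ _)
    · exact (min_le_right _ _).trans (min_le_right _ _)

/-- frequency localized Strichartz, endpoint -/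
lemma strich_end (n : ℕ) (hn : 1 ≤ n) (r r' : ℝ) (hr : 2 < r) (hadm : 1 + ((n:ℝ)-1)/r ≤ ((n:ℝ)-1)/2)
    (hr' : 1/r + 1/r' = 1) :
    ∃ C : ℝ≥0∞, C ≠ ⊤ ∧ ∀ (l : ℝ) (F : Eu n × ℝ → ℂ), 0 < l → StronglyMeasurable F → Integrable F →
      Nsq n l F ≤ C * (ENNReal.ofReal (l^(1 + 2*n/r - n)) * (∫⁻ t, (∫⁻ x, ‖F (x, t)‖ₑ^r')^(2/r'))) := by
  have h2r : 0 < 1 - 2/r := by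
    rw [sub_pos, div_lt_one (by linarith)]; exact hr
  have hr1 : 0 < 1/r := by positivity
  have h2r' : 2/r = 2*(1/r) := by ring
  have er' : 1/r' = 1 - 1/r := by linarith
  have hr'0 : 0 < r' := by
    rw [← one_div_pos, er']; linarith
  have hr'2 : r' ≤ 2 := by
    rw [← one_div_le_one_div (by norm_num) hr'0, er']; linarith
  set σ' := 1/(1-2/r) with hσ'
  have hs1 : 1 < σ' := by
    rw [hσ', lt_div_iff₀ h2r]; linarith
  have hsi : 1/σ' = 1 - 2/r := by rw [hσ', one_div_one_div]
  have hsm : σ' * (1-2/r) = 1 := by rw [hσ']; exact div_mul_cancel₀ _ h2r.ne'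
  have hs2 : σ' ≤ ((n:ℝ)-1)/2 := by
    rw [hσ', div_le_iff₀ h2r]
    have : ((n:ℝ)-1)/2 * (1-2/r) = ((n:ℝ)-1)/2 - ((n:ℝ)-1)/r := by ring
    rw [this]; linarith
  obtain ⟨C1, hC1, h1⟩ := Tj_i n hn σ' hs1 hs2
  obtain ⟨C2, hC2, h2⟩ := Tj_ii n hn σ' hs1 hs2
  set α := (1 - 2/r)/2 with hα
  set β := 1/r with hβ
  have hα0 : 0 < α := by rw [hα]; linarith
  set ε := min α β/3 with hε
  have hε0 : 0 < ε := by
    have := lt_min hα0 hr1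
    rw [hε]; linarith
  obtain ⟨W1, hW1, hw1⟩ := sum_p2_abs ε 1 hε0 one_pos
  obtain ⟨W2, hW2, hw2⟩ := sum_p2_abs ε σ' hε0 (by linarith)
  refine ⟨1 + (C1 + C2) * (2 * (W1 * W2)), by finiteness, fun l F hl hFm hF => ?_⟩
  have hL : (0:ℝ) < l^(1 + 2*n/r - n) := by positivity
  set Φ : ℝ → ℝ≥0∞ := fun t => ∫⁻ x, ‖F (x, t)‖ₑ^r' with hΦ
  have hΦm : Measurable Φ :=
    Measurable.lintegral_prod_left' (f := fun z : Eu n × ℝ => ‖F z‖ₑ^r') (hFm.measurable.enorm.pow_const _)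
  by_cases hfin : ∫⁻ t, Φ t^(2/r') = ⊤
  · rw [hfin, ENNReal.mul_top, ENNReal.mul_top]
    · exact le_top
    · simp
    · simpa using hL
  have hae : ∀ᵐ t : ℝ, ∫⁻ x, ‖F (x, t)‖ₑ^r' ≠ ⊤ := by
    filter_upwards [ae_lt_top (hΦm.pow_const (2/r')) hfin] with t ht
    intro hc
    rw [hΦ] at ht; dsimp only at ht
    rw [hc, ENNReal.top_rpow_of_pos (by positivity)] at ht
    exact lt_irrefl _ ht
  set L := ENNReal.ofReal (l^(-(n:ℝ)+σ')) with hLd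
  have hL0 : L ≠ 0 := by
    rw [hLd]; simp; positivity
  have hLt : L ≠ ⊤ := by simp [hLd]
  obtain ⟨c, hc⟩ := exists_p2 L hL0 hLt
  set h : ℤ → ℝ≥0∞ := fun m => (∫⁻ t, HA n r' F m t^2)^((1:ℝ)/2) with hh
  set y : ℤ → ℝ≥0∞ := fun m => p2 (m/r') * h m with hy
  have hH : ∀ m, Measurable (HA n r' F m) := fun m => HA_meas hFm r' m
  have hy2 : ∑' m, y m^2 ≤ ∫⁻ t, Φ t^(2/r') := by
    have e : ∀ m, y m^2 = ∫⁻ t, (p2 (m/r') * HA n r' F m t)^2 := by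
      intro m
      have hm := hH m
      have hm' : Measurable (fun t => HA n r' F m t^2) := by fun_prop
      simp only [hy, hh, mul_pow]
      rw [lintegral_const_mul _ hm', ← ENNReal.rpow_two ((∫⁻ t, HA n r' F m t^2)^((1:ℝ)/2)), ← ENNReal.rpow_mul]
      norm_num
    simp_rw [e]
    have hm : ∀ m : ℤ, AEMeasurable (fun t => (p2 (m/r') * HA n r' F m t)^2) := by
      intro m
      have hm := hH m
      apply Measurable.aemeasurable; fun_prop
    rw [← lintegral_tsum hm]
    apply lintegral_mono; intro t
    exact HA_sum hFm hr'0 hr'2 t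
  set a : ℤ → ℤ → ℝ≥0∞ := fun j m => p2 (-(ε * |(m:ℝ) + c - j * σ'|)) with ha
  have ha1 : ∀ j, ∑' m, a j m ≤ W1 := by
    intro j
    refine le_trans (le_of_eq ?_) (hw1 (c - j*σ'))
    congr 1; ext m
    simp only [ha]; congr 4; ring
  have ha2 : ∀ m, ∑' j, a j m ≤ W2 := by
    intro m
    refine le_trans (le_of_eq ?_) (hw2 (-(m + c)))
    congr 1; ext j
    simp only [ha]; congr 3
    rw [← abs_neg]; congr 1; ring
  have T : ∀ j m k : ℤ, ‖∫ w in Sj j, bet n l (FA n F m) (FA n F k) w ∂(volume.prod volume)‖ₑ ≤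
      (C1 + C2) * p2 (c/σ') * ((a j m * y m) * (a j k * y k)) := by
    intro j m k
    set u := (m:ℝ) + c - j * σ' with hu
    set v := (k:ℝ) + c - j * σ' with hv
    have ey : ∀ e : ℝ, p2 e * (h m * h k) = p2 (e - (m + k) * (1 - 1/r)) * (y m * y k) := by
      intro e
      simp only [hy]
      rw [show p2 ((m:ℝ)/r') * h m * (p2 ((k:ℝ)/r') * h k) = (p2 ((m:ℝ)/r') * p2 ((k:ℝ)/r')) * (h m * h k) by ring, ← mul_assoc (p2 (e - (m + k) * (1 - 1/r))),
        ← p2_add, ← p2_add]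
      congr 2
      rw [div_eq_mul_one_div (m:ℝ), div_eq_mul_one_div (k:ℝ), er', hβ]; ring
    have es : c/σ' = c * (1 - 2/r) := by rw [← hsi]; ring
    have b1 : ‖∫ w in Sj j, bet n l (FA n F m) (FA n F k) w ∂(volume.prod volume)‖ₑ ≤
        (C1 + C2) * (p2 (c/σ' + β*(u+v)) * (y m * y k)) := by
      refine (h1 l r' F j m k hl hr'0 hFm hF).trans ?_
      rw [← hLd, hc, ← p2_add, ← p2_add, ← p2_add]
      rw [ey]
      refine le_trans (mul_le_mul' (le_self_add : C1 ≤ C1 + C2) (le_of_eq ?_)) le_rfl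
      congr 2
      rw [es, hu, hv, hβ]
      have : (j:ℝ) = j * (σ' * (1-2/r)) := by rw [hsm, mul_one]
      linear_combination this
    have b2' : ∀ m k : ℤ, ((p2 m * (L * p2 m)^(1/σ') * p2 j * p2 k)^((1:ℝ)/2)) = p2 ((m + (c + m)*(1-2/r) + j + k)*(1/2)) := by
      intro m k
      rw [hc, ← p2_add, p2_rpow, ← p2_add, ← p2_add, ← p2_add, p2_rpow, hsi]
    have b2 : ‖∫ w in Sj j, bet n l (FA n F m) (FA n F k) w ∂(volume.prod volume)‖ₑ ≤
        (C1 + C2) * (p2 (c/σ' + -(α*v)) * (y m * y k)) := by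
      refine (h2 l r' F j m k hl hr'0 hFm hF).trans ?_
      rw [← hLd, b2', ey]
      refine le_trans (mul_le_mul' (le_add_self : C2 ≤ C1 + C2) (le_of_eq ?_)) le_rfl
      congr 2
      rw [es, hv, hα]
      have : (j:ℝ) = j * (σ' * (1-2/r)) := by rw [hsm, mul_one]
      linear_combination this/2
    have b3 : ‖∫ w in Sj j, bet n l (FA n F m) (FA n F k) w ∂(volume.prod volume)‖ₑ ≤
        (C1 + C2) * (p2 (c/σ' + -(α*u)) * (y m * y k)) := by
      rw [bet_swap]
      refine (h2 l r' F j k m hl hr'0 hFm hF).trans ?_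
      rw [← hLd, b2', mul_comm ((∫⁻ t, HA n r' F k t^2)^((1:ℝ)/2)), ey]
      refine le_trans (mul_le_mul' (le_add_self : C2 ≤ C1 + C2) (le_of_eq ?_)) le_rfl
      congr 2
      rw [es, hu, hα]
      have : (j:ℝ) = j * (σ' * (1-2/r)) := by rw [hsm, mul_one]
      linear_combination this/2
    have b4 : ‖∫ w in Sj j, bet n l (FA n F m) (FA n F k) w ∂(volume.prod volume)‖ₑ ≤
        (C1 + C2) * (p2 (c/σ' + min (β*(u+v)) (min (-(α*v)) (-(α*u)))) * (y m * y k)) := by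
      rcases min_choice (β*(u+v)) (min (-(α*v)) (-(α*u))) with h | h
      · rw [h]; exact b1
      · rw [h]
        rcases min_choice (-(α*v)) (-(α*u)) with h | h
        · rw [h]; exact b2
        · rw [h]; exact b3
    refine b4.trans ?_
    calc _ ≤ (C1 + C2) * (p2 (c/σ' + (-(ε * |u|) + -(ε*|v|))) * (y m * y k)) := by
          gcongr
          apply p2_mono
          have := uv_min α β u v hα0 hr1
          rw [← hε] at this
          linarith
      _ = _ := by
          rw [p2_add, p2_add]; simp only [ha]; ring
  calc Nsq n l F ≤ ∑' m, ∑' k, ‖Nn n l (FA n F m) (FA n F k)‖ₑ := Nsq_le_FA hl hFm hF hr'0 hae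
    _ ≤ ∑' m, ∑' k, ∑' j, (C1 + C2) * p2 (c/σ') * ((a j m * y m) * (a j k * y k)) := by
        apply ENNReal.tsum_le_tsum; intro m
        apply ENNReal.tsum_le_tsum; intro k
        rw [Nn_eq hl (FA_sm hFm m) (FA_int hFm hF m) (FA_sm hFm k) (FA_int hFm hF k)]
        have hi := bet_int hl (FA_sm hFm m) (FA_int hFm hF m) (FA_sm hFm k) (FA_int hFm hF k)
        refine (enorm_integral_le_parts hi Sj Sj_meas (fun z i j h h' => Dj_disj h h') ?_).trans ?_
        · filter_upwards [slices_ae hF] with w hw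
          exact Dj_exists _ (sub_ne_zero.2 hw.1)
        · exact ENNReal.tsum_le_tsum fun j => T j m k
    _ ≤ ∑' m, ∑' k, ∑' j, (C1 + C2) * p2 (c/σ') * (a j k * (a j m * y m^2) + a j m * (a j k * y k^2)) := by
        apply ENNReal.tsum_le_tsum; intro m
        apply ENNReal.tsum_le_tsum; intro k
        apply ENNReal.tsum_le_tsum; intro j
        gcongr
        calc a j m * y m * (a j k * y k) = a j m * a j k * (y m * y k) := by ring
          _ ≤ a j m * a j k * (y m^2 + y k^2) := by gcongr; exact ENN_amgm _ _
          _ = _ := by ring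
    _ = (C1 + C2) * p2 (c/σ') * (∑' m, ∑' k, ∑' j, a j k * (a j m * y m^2) + ∑' m, ∑' k, ∑' j, a j m * (a j k * y k^2)) := by
        simp_rw [ENNReal.tsum_mul_left, ENNReal.tsum_add]
    _ ≤ (C1 + C2) * p2 (c/σ') * (W1 * W2 * (∑' m, y m^2) + W1 * W2 * ∑' m, y m^2) := by
        have B : ∑' m, ∑' k, ∑' j, a j k * (a j m * y m^2) ≤ W1 * W2 * (∑' m, y m^2) := by
          calc ∑' m, ∑' k, ∑' j, a j k * (a j m * y m^2) = ∑' m, ∑' j, ∑' k, a j k * (a j m * y m^2) := by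
                congr 1; ext m; rw [ENNReal.tsum_comm]
            _ = ∑' m, ∑' j, (∑' k, a j k) * (a j m * y m^2) := by simp_rw [ENNReal.tsum_mul_right]
            _ ≤ ∑' m, ∑' j, W1 * (a j m * y m^2) := by
                apply ENNReal.tsum_le_tsum; intro m
                apply ENNReal.tsum_le_tsum; intro j
                gcongr; exact ha1 j
            _ = ∑' m, W1 * ((∑' j, a j m) * y m^2) := by simp_rw [ENNReal.tsum_mul_left, ENNReal.tsum_mul_right]
            _ ≤ ∑' m, W1 * (W2 * y m^2) := by
                apply ENNReal.tsum_le_tsum; intro m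
                gcongr; exact ha2 m
            _ = _ := by simp_rw [ENNReal.tsum_mul_left]; ring
        gcongr
        rw [ENNReal.tsum_comm]; exact B
    _ ≤ (C1 + C2) * p2 (c/σ') * (W1 * W2 * (∫⁻ t, Φ t^(2/r')) + W1 * W2 * ∫⁻ t, Φ t^(2/r')) := by gcongr
    _ = ((C1 + C2) * (2 * (W1 * W2))) * (ENNReal.ofReal (l^(1 + 2*n/r - n)) * (∫⁻ t, Φ t^(2/r'))) := by
        have : p2 (c/σ') = ENNReal.ofReal (l^(1 + 2*n/r - n)) := by
          rw [div_eq_mul_one_div, ← p2_rpow, ← hc, hLd, ENNReal.ofReal_rpow_of_pos (by positivity), ← Real.rpow_mul hl.le, hsi]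
          congr 2
          rw [add_mul, hsm]; ring
        rw [this]; ring
    _ ≤ _ := by
        gcongr; exact le_add_self

/-- frequency localized Strichartz -/
lemma strich (n : ℕ) (hn : 1 ≤ n) (q r q' r' : ℝ) (hq : 2 ≤ q) (hr : 2 < r) (hadm : 2/q + ((n:ℝ)-1)/r ≤ ((n:ℝ)-1)/2)
    (hq' : 1/q + 1/q' = 1) (hr' : 1/r + 1/r' = 1) :
    ∃ C : ℝ≥0∞, C ≠ ⊤ ∧ ∀ (l : ℝ) (F : Eu n × ℝ → ℂ), 0 < l → StronglyMeasurable F → Integrable F →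
      Nsq n l F ≤ C * (ENNReal.ofReal (l^(2/q + 2*n/r - n)) * (∫⁻ t, (∫⁻ x, ‖F (x, t)‖ₑ^r')^(q'/r'))^(2/q')) := by
  rcases hq.eq_or_lt with rfl | hq
  · have e : q' = 2 := by
      have : q' ≠ 0 := by rintro rfl; norm_num at hq'
      field_simp at hq'; linarith
    subst e
    have := strich_end n hn r r' hr (by norm_num at hadm; linarith) hr'
    simpa using this
  · exact strich_ne n hn q r q' r' hq hr hadm hq' hr'

/-- level sets of the weight -/
def Uk {n : ℕ} (W : Eu n → ℝ≥0∞) (k : ℤ) : Set (Eu n) := {x | p2 k ≤ W x ∧ W x < p2 (k + 1)}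

lemma Uk_meas {n : ℕ} {W : Eu n → ℝ≥0∞} (hW : Measurable W) (k : ℤ) : MeasurableSet (Uk W k) :=
  (measurableSet_le measurable_const hW).inter (measurableSet_lt hW measurable_const)

lemma tail_pt (n : ℕ) (T : ℝ) (hT : 0 < T) (z : ℝ) (hz : 0 ≤ z) :
    ENNReal.ofReal ((1 + z/T)^(-((n:ℝ)+1))) ≤ ∑' i : ℕ, (if z < T * 2^i then p2 ((n+1) * (1 - i)) else 0) := by
  have hex : ∃ i : ℕ, z < T * 2^i := by
    obtain ⟨i, hi⟩ := pow_unbounded_of_one_lt (z/T) (one_lt_two)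
    refine ⟨i, ?_⟩
    rw [div_lt_iff₀ hT] at hi; linarith
  classical
  set i := Nat.find hex with hi
  have h1 : z < T * 2^i := Nat.find_spec hex
  refine le_trans ?_ (ENNReal.le_tsum i)
  rw [if_pos h1, p2_ofReal]
  apply ENNReal.ofReal_le_ofReal
  have hn : (0:ℝ) < (n:ℝ) + 1 := by positivity
  rcases Nat.eq_zero_or_pos i with h0 | h0
  · rw [h0]
    calc (1 + z/T)^(-((n:ℝ)+1)) ≤ 1 := by
          apply Real.rpow_le_one_of_one_le_of_nonpos
          · have : 0 ≤ z/T := by positivity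
            linarith
          · linarith
      _ ≤ _ := Real.one_le_rpow (by norm_num) (by simp; linarith)
  · have h2 : ¬ z < T * 2^(i-1) := Nat.find_min hex (by omega)
    have h3 : (2:ℝ)^((i:ℝ)-1) ≤ 1 + z/T := by
      have : (2:ℝ)^((i:ℝ)-1) = 2^(i-1) := by
        rw [← Real.rpow_natCast]; congr 1; push_cast [Nat.cast_sub h0]; ring
      rw [this]
      have : (2:ℝ)^(i-1) ≤ z/T := by rw [le_div_iff₀ hT]; linarith [not_lt.1 h2]
      linarith
    calc (1 + z/T)^(-((n:ℝ)+1)) ≤ ((2:ℝ)^((i:ℝ)-1))^(-((n:ℝ)+1)) :=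
          Real.rpow_le_rpow_of_nonpos (by positivity) h3 (by linarith)
      _ = _ := by rw [← Real.rpow_mul (by norm_num)]; congr 1; ring

lemma Kb_mass (n : ℕ) (p : ℝ) (hp : 0 < p) : ∃ C : ℝ≥0∞, C ≠ ⊤ ∧ ∀ (W : Eu n → ℝ≥0∞) (Λ : ℝ≥0∞) (T : ℝ) (k : ℤ) (x : Eu n),
    Measurable W → 0 < T → (∀ x r, 0 < r → ∫⁻ y in ball x r, W y^p ≤ Λ^p * ENNReal.ofReal (r^((n:ℝ)-2*p))) →
    ∫⁻ y in Uk W k, ENNReal.ofReal ((1 + ‖y - x‖/T)^(-((n:ℝ)+1))) ≤ C * (p2 (-(k*p)) * Λ^p * ENNReal.ofReal (T^((n:ℝ)-2*p))) := by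
  refine ⟨p2 (n+1) * ∑' i : ℕ, p2 (-((1 + 2*p) * i)), ?_, fun W Λ T k x hW hT h => ?_⟩
  · apply ENNReal.mul_ne_top (p2_ne_top _)
    obtain ⟨C, hC, h⟩ := sum_p2_abs (1+2*p) 1 (by linarith) one_pos
    refine ne_top_of_le_ne_top hC (le_trans ?_ (h 0))
    refine le_trans (le_of_eq ?_) (ENNReal.tsum_comp_le_tsum_of_injective (f := fun i : ℕ => (i:ℤ)) (fun a b h => by simpa using h) _)
    congr 1; ext i
    congr 3; simp
  have hm : ∀ i : ℕ, Measurable (fun y : Eu n => if ‖y - x‖ < T * 2^i then p2 (((n:ℝ)+1) * (1 - i)) else 0) := fun i =>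
    Measurable.ite (measurableSet_lt (by fun_prop) measurable_const) measurable_const measurable_const
  calc _ ≤ ∫⁻ y in Uk W k, ∑' i : ℕ, (if ‖y - x‖ < T * 2^i then p2 (((n:ℝ)+1) * (1 - i)) else 0) := by
        apply lintegral_mono; intro y
        exact tail_pt n T hT _ (norm_nonneg _)
    _ = ∑' i : ℕ, ∫⁻ y in Uk W k, (if ‖y - x‖ < T * 2^i then p2 (((n:ℝ)+1) * (1 - i)) else 0) :=
        lintegral_tsum fun i => (hm i).aemeasurable
    _ ≤ ∑' i : ℕ, p2 (n+1) * (p2 (-((1 + 2*p) * i)) * (p2 (-(k*p)) * Λ^p * ENNReal.ofReal (T^((n:ℝ)-2*p)))) := by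
        apply ENNReal.tsum_le_tsum; intro i
        have hB : MeasurableSet (ball x (T*2^i)) := measurableSet_ball
        have hr : 0 < T * 2^i := by positivity
        have e1 : ∫⁻ y in Uk W k, (if ‖y - x‖ < T * 2^i then p2 (((n:ℝ)+1) * (1 - i)) else 0) = p2 (((n:ℝ)+1) * (1 - i)) * volume (ball x (T*2^i) ∩ Uk W k) := by
          have : (fun y : Eu n => if ‖y - x‖ < T * 2^i then p2 (((n:ℝ)+1) * (1 - i)) else 0) = (ball x (T*2^i)).indicator (fun _ => p2 (((n:ℝ)+1) * (1 - i))) := by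
            ext y; simp only [Set.indicator, mem_ball, dist_eq_norm]
          rw [this, lintegral_indicator_const hB, Measure.restrict_apply hB]
        have e2 : volume (ball x (T*2^i) ∩ Uk W k) ≤ p2 (-(k*p)) * (Λ^p * ENNReal.ofReal ((T*2^i)^((n:ℝ)-2*p))) := by
          have : p2 (k*p) * volume (ball x (T*2^i) ∩ Uk W k) ≤ Λ^p * ENNReal.ofReal ((T*2^i)^((n:ℝ)-2*p)) := by
            refine le_trans ?_ (h x _ hr)
            calc p2 (k*p) * volume (ball x (T*2^i) ∩ Uk W k) = ∫⁻ y in ball x (T*2^i) ∩ Uk W k, p2 (k*p) := by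
                  rw [setLIntegral_const]
              _ ≤ ∫⁻ y in ball x (T*2^i) ∩ Uk W k, W y^p := by
                  apply setLIntegral_mono' (hB.inter (Uk_meas hW k))
                  intro y hy
                  rw [← p2_rpow]
                  gcongr; exact hy.2.1
              _ ≤ _ := lintegral_mono_set Set.inter_subset_left
          calc volume (ball x (T*2^i) ∩ Uk W k) = p2 (-(k*p)) * (p2 (k*p) * volume (ball x (T*2^i) ∩ Uk W k)) := by
                rw [← mul_assoc, p2_neg_mul, one_mul]
            _ ≤ _ := by gcongr
        rw [e1]
        refine (mul_le_mul_right e2 _).trans (le_of_eq ?_)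
        rw [Real.mul_rpow hT.le (by positivity), ENNReal.ofReal_mul (by positivity),
          show ((2:ℝ)^i)^((n:ℝ)-2*p) = 2^((i:ℝ)*((n:ℝ)-2*p)) by rw [← Real.rpow_natCast, ← Real.rpow_mul (by norm_num)], ← p2_ofReal]
        rw [show p2 (((n:ℝ)+1) * (1 - i)) * (p2 (-(k*p)) * (Λ^p * (ENNReal.ofReal (T^((n:ℝ)-2*p)) * p2 ((i:ℝ)*((n:ℝ)-2*p))))) = (p2 (((n:ℝ)+1) * (1 - i)) * p2 ((i:ℝ)*((n:ℝ)-2*p))) * (p2 (-(k*p)) * Λ^p * ENNReal.ofReal (T^((n:ℝ)-2*p))) by ring, ← mul_assoc (p2 (n+1)),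
          ← p2_add, ← p2_add]
        congr 2; ring
    _ = _ := by rw [ENNReal.tsum_mul_left, ENNReal.tsum_mul_right]; ring

lemma wt_conv {n : ℕ} (K : Eu n → ℝ≥0∞) (hK : Measurable K) (φ ψ : Eu n → ℝ≥0∞) (hφ : Measurable φ) (hψ : Measurable ψ)
    (U U' : Set (Eu n)) (hU : MeasurableSet U) (hU' : MeasurableSet U') (h1 : ∀ x, x ∉ U → φ x = 0) (h2 : ∀ x, x ∉ U' → ψ x = 0)
    (M M' : ℝ≥0∞) (hM : ∀ y, ∫⁻ x in U, K (y - x) ≤ M) (hM' : ∀ x, ∫⁻ y in U', K (y - x) ≤ M') :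
    ∫⁻ x, ∫⁻ y, K (y - x) * (φ x * ψ y) ≤ (M * M')^((1:ℝ)/2) * ((∫⁻ x, φ x^2)^((1:ℝ)/2) * (∫⁻ x, ψ x^2)^((1:ℝ)/2)) := by
  set f : Eu n × Eu n → ℝ≥0∞ := fun z => K (z.2 - z.1)^((1:ℝ)/2) * (φ z.1 * U'.indicator 1 z.2) with hf
  set g : Eu n × Eu n → ℝ≥0∞ := fun z => K (z.2 - z.1)^((1:ℝ)/2) * (U.indicator 1 z.1 * ψ z.2) with hg
  have m1 : Measurable (U.indicator (1 : Eu n → ℝ≥0∞)) := measurable_one.indicator hU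
  have m2 : Measurable (U'.indicator (1 : Eu n → ℝ≥0∞)) := measurable_one.indicator hU'
  have hKm : Measurable (fun z : Eu n × Eu n => K (z.2 - z.1)) := hK.comp (by fun_prop)
  have hfm : Measurable f := by fun_prop
  have hgm : Measurable g := by fun_prop
  have half : ∀ a : ℝ≥0∞, (a^((1:ℝ)/2))^2 = a := by
    intro a; rw [← ENNReal.rpow_two, ← ENNReal.rpow_mul]; norm_num
  have half2 : ∀ a : ℝ≥0∞, a^((1:ℝ)/2) * a^((1:ℝ)/2) = a := by
    intro a; rw [← pow_two, half]
  have hfg : ∀ x y, K (y - x) * (φ x * ψ y) = f (x, y) * g (x, y) := by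
    intro x y
    simp only [hf, hg]
    by_cases hx : x ∈ U
    · by_cases hy : y ∈ U'
      · rw [Set.indicator_of_mem hx, Set.indicator_of_mem hy]
        simp only [Pi.one_apply, mul_one, one_mul]
        rw [show K (y - x)^((1:ℝ)/2) * φ x * (K (y - x)^((1:ℝ)/2) * ψ y) = (K (y - x)^((1:ℝ)/2) * K (y - x)^((1:ℝ)/2)) * (φ x * ψ y) by ring, half2]
      · rw [h2 y hy]; simp
    · rw [h1 x hx]; simp
  have hf2 : ∫⁻ z, f z^2 ≤ M' * ∫⁻ x, φ x^2 := by
    rw [Measure.volume_eq_prod, lintegral_prod _ (hfm.pow_const 2).aemeasurable]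
    have hm : Measurable (fun x => φ x^2) := by fun_prop
    rw [← lintegral_const_mul _ hm]
    apply lintegral_mono; intro x
    calc ∫⁻ y, f (x, y)^2 = ∫⁻ y, U'.indicator (fun y => K (y - x)) y * φ x^2 := by
          congr 1; ext y
          simp only [hf, mul_pow, half]
          by_cases hy : y ∈ U' <;> simp [hy]
      _ = (∫⁻ y in U', K (y - x)) * φ x^2 := by
          have hm : Measurable (U'.indicator (fun y => K (y - x))) := (hK.comp (by fun_prop)).indicator hU'
          rw [lintegral_mul_const _ hm, lintegral_indicator hU']
      _ ≤ M' * φ x^2 := by gcongr; exact hM' x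
  have hg2 : ∫⁻ z, g z^2 ≤ M * ∫⁻ x, ψ x^2 := by
    rw [Measure.volume_eq_prod, lintegral_prod_symm' _ (hgm.pow_const 2)]
    have hm : Measurable (fun x => ψ x^2) := by fun_prop
    rw [← lintegral_const_mul _ hm]
    apply lintegral_mono; intro y
    calc ∫⁻ x, g (x, y)^2 = ∫⁻ x, U.indicator (fun x => K (y - x)) x * ψ y^2 := by
          congr 1; ext x
          simp only [hg, mul_pow, half]
          by_cases hx : x ∈ U <;> simp [hx]
      _ = (∫⁻ x in U, K (y - x)) * ψ y^2 := by
          have hm : Measurable (U.indicator (fun x => K (y - x))) := (hK.comp (by fun_prop)).indicator hU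
          rw [lintegral_mul_const _ hm, lintegral_indicator hU]
      _ ≤ M * ψ y^2 := by gcongr; exact hM y
  calc ∫⁻ x, ∫⁻ y, K (y - x) * (φ x * ψ y) = ∫⁻ z, f z * g z := by
        simp_rw [hfg]
        have hm : Measurable (fun z => f z * g z) := hfm.mul hgm
        rw [Measure.volume_eq_prod, lintegral_prod _ hm.aemeasurable]
    _ ≤ (∫⁻ z, f z^2)^((1:ℝ)/2) * (∫⁻ z, g z^2)^((1:ℝ)/2) := lintegral_cs _ _ _ hfm.aemeasurable hgm.aemeasurable
    _ ≤ (M' * ∫⁻ x, φ x^2)^((1:ℝ)/2) * (M * ∫⁻ x, ψ x^2)^((1:ℝ)/2) := by gcongr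
    _ = _ := by
        simp_rw [ENNReal.mul_rpow_of_nonneg _ _ (by norm_num : (0:ℝ) ≤ 1/2)]; ring

/-- weight pieces -/
def FU {n : ℕ} (W : Eu n → ℝ≥0∞) (F : Eu n × ℝ → ℂ) (k : ℤ) : Eu n × ℝ → ℂ := (Prod.fst ⁻¹' Uk W k).indicator F

/-- two-time shells for J -/
def SJ (l : ℝ) (j : ℕ) : Set (ℝ × ℝ) := {w | w.1 - w.2 ∈ Jset l j}

lemma E_L2 (n : ℕ) (hn : 1 ≤ n) : ∃ C : ℝ≥0∞, C ≠ ⊤ ∧ ∀ (l : ℝ) (j : ℕ) (F G : Eu n × ℝ → ℂ), 0 < l →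
    StronglyMeasurable F → Integrable F → StronglyMeasurable G → Integrable G →
    ∫⁻ w in SJ l j, ‖bet n l F G w‖ₑ ∂(volume.prod volume) ≤
      C * (ENNReal.ofReal (l*2^j) * ((∫⁻ z, ‖F z‖ₑ^2)^((1:ℝ)/2) * (∫⁻ z, ‖G z‖ₑ^2)^((1:ℝ)/2))) := by
  obtain ⟨C1, hC1, h1⟩ := Bil_le_L2 n hn
  refine ⟨ENNReal.ofReal C1 * 4, by finiteness, fun l j F G hl hFm hF hGm hG => ?_⟩
  have hJ : MeasurableSet (Jset l j) := Jset_meas l j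
  have hS : MeasurableSet (SJ l j) := hJ.preimage (by fun_prop : Measurable fun w : ℝ × ℝ => w.1 - w.2)
  set κ : ℝ → ℝ≥0∞ := (Jset l j).indicator 1 with hκ
  have hκm : Measurable κ := measurable_one.indicator hJ
  have mF2 : Measurable (fun z => ‖F z‖ₑ^2) := hFm.measurable.enorm.pow_const 2
  have mG2 : Measurable (fun z => ‖G z‖ₑ^2) := hGm.measurable.enorm.pow_const 2
  set a : ℝ → ℝ≥0∞ := fun s => (∫⁻ x, ‖F (x, s)‖ₑ^2)^((1:ℝ)/2) with ha
  set b : ℝ → ℝ≥0∞ := fun s => (∫⁻ x, ‖G (x, s)‖ₑ^2)^((1:ℝ)/2) with hb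
  have ham : Measurable a := (mF2.lintegral_prod_left').pow_const _
  have hbm : Measurable b := (mG2.lintegral_prod_left').pow_const _
  have half : ∀ a : ℝ≥0∞, (a^((1:ℝ)/2))^2 = a := by
    intro a; rw [← ENNReal.rpow_two, ← ENNReal.rpow_mul]; norm_num
  have ea : ∫⁻ s, a s^2 = ∫⁻ z, ‖F z‖ₑ^2 := by
    simp only [ha, half]; rw [Measure.volume_eq_prod, lintegral_prod_symm' _ mF2]
  have eb : ∫⁻ s, b s^2 = ∫⁻ z, ‖G z‖ₑ^2 := by
    simp only [hb, half]; rw [Measure.volume_eq_prod, lintegral_prod_symm' _ mG2]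
  have hsF : ∀ᵐ w : ℝ × ℝ ∂(volume.prod volume), Integrable (fun x => F (x, w.1)) :=
    Measure.quasiMeasurePreserving_fst.ae hF.prod_left_ae
  have hsG : ∀ᵐ w : ℝ × ℝ ∂(volume.prod volume), Integrable (fun x => G (x, w.2)) :=
    Measure.quasiMeasurePreserving_snd.ae hG.prod_left_ae
  rw [← lintegral_indicator hS]
  calc _ ≤ ∫⁻ w : ℝ × ℝ, ENNReal.ofReal C1 * (κ (w.1 - w.2) * (a w.1 * b w.2)) ∂(volume.prod volume) := by
        apply lintegral_mono_ae
        filter_upwards [hsF, hsG] with w h3 h4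
        by_cases h6 : w ∈ SJ l j
        · have h7 : w.1 - w.2 ∈ Jset l j := h6
          rw [Set.indicator_of_mem h6, hκ, Set.indicator_of_mem h7, Pi.one_apply, one_mul]
          exact h1 l _ _ _ hl h3 h4
        · rw [Set.indicator_of_notMem h6]; simp
    _ = ENNReal.ofReal C1 * ∫⁻ t, ∫⁻ s, κ (s - t) * (a s * b t) := by
        have hm : Measurable (fun w : ℝ × ℝ => κ (w.1 - w.2) * (a w.1 * b w.2)) := by fun_prop
        rw [lintegral_const_mul _ hm, lintegral_prod_symm' _ hm]
    _ ≤ ENNReal.ofReal C1 * ((4 * ENNReal.ofReal (l*2^j)) * ((∫⁻ z, ‖F z‖ₑ^2)^((1:ℝ)/2) * (∫⁻ z, ‖G z‖ₑ^2)^((1:ℝ)/2))) := by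
        gcongr
        refine (time_schur κ _ _ hκm ham hbm).trans ?_
        rw [ea, eb]
        gcongr
        rw [hκ, lintegral_indicator_one hJ]
        refine (Jset_vol l hl j).trans (le_of_eq ?_)
        rw [ENNReal.ofReal_mul (by norm_num)]; simp
    _ = _ := by ring

lemma PK_enorm_meas (n : ℕ) (hn : 1 ≤ n) (l : ℝ) (hl : 0 < l) :
    Measurable (fun v : ℝ × Eu n => ‖PK n (l + v.1 * I) v.2‖ₑ) := by
  obtain ⟨c, hc, h⟩ := PK_formula n hn
  have : (fun v : ℝ × Eu n => ‖PK n (l + v.1 * I) v.2‖ₑ) = fun v => ENNReal.ofReal (c * ‖(l + v.1 * I : ℂ)‖ * ‖(l + v.1 * I : ℂ)^2 + ((2 * Real.pi * ‖v.2‖ : ℝ) : ℂ)^2‖^(-((n:ℝ)+1)/2)) := by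
    ext v
    rw [← ofReal_norm, h _ _ (by simpa using hl)]
  rw [this]
  fun_prop

lemma FU_meas {n : ℕ} {W : Eu n → ℝ≥0∞} (hW : Measurable W) {F : Eu n × ℝ → ℂ} (hF : StronglyMeasurable F) (k : ℤ) :
    StronglyMeasurable (FU W F k) := hF.indicator ((Uk_meas hW k).preimage measurable_fst)

lemma FU_int {n : ℕ} {W : Eu n → ℝ≥0∞} (hW : Measurable W) {F : Eu n × ℝ → ℂ} (hF : Integrable F) (k : ℤ) :
    Integrable (FU W F k) := hF.indicator ((Uk_meas hW k).preimage measurable_fst)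

lemma FU_zero {n : ℕ} {W : Eu n → ℝ≥0∞} {F : Eu n × ℝ → ℂ} {k : ℤ} {x : Eu n} (hx : x ∉ Uk W k) (t : ℝ) :
    FU W F k (x, t) = 0 := Set.indicator_of_notMem (by simpa using hx) _

lemma E_K (n : ℕ) (hn : 3 ≤ n) (p : ℝ) (hp : 0 < p) : ∃ C : ℝ≥0∞, C ≠ ⊤ ∧ ∀ (W : Eu n → ℝ≥0∞) (Λ : ℝ≥0∞) (l : ℝ) (j : ℕ) (k m : ℤ) (F : Eu n × ℝ → ℂ),
    Measurable W → 0 < l → (∀ x r, 0 < r → ∫⁻ y in ball x r, W y^p ≤ Λ^p * ENNReal.ofReal (r^((n:ℝ)-2*p))) →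
    StronglyMeasurable F → Integrable F →
    ∫⁻ w in SJ l j, ‖bet n l (FU W F k) (FU W F m) w‖ₑ ∂(volume.prod volume) ≤
      C * ((ENNReal.ofReal (l^(-((n:ℝ)-1)/2) * (l*2^j)^(-((n:ℝ)-1)/2) * (l*2^j)^((n:ℝ)-2*p)) * Λ^p * p2 (-((k+m)*(p/2)))) *
        ((∫⁻ z, ‖FU W F k z‖ₑ^2)^((1:ℝ)/2) * (∫⁻ z, ‖FU W F m z‖ₑ^2)^((1:ℝ)/2))) := by
  obtain ⟨C1, hC1, hK2⟩ := PK_K2 n hn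
  obtain ⟨C2, hC2, hKb⟩ := Kb_mass n p hp
  refine ⟨ENNReal.ofReal C1 * C2, by finiteness, fun W Λ l j k m F hW hl hball hFm0 hF0 => ?_⟩
  set F1 := FU W F k with hF1
  set F2 := FU W F m with hF2
  have hFm : StronglyMeasurable F1 := FU_meas hW hFm0 k
  have hGm : StronglyMeasurable F2 := FU_meas hW hFm0 m
  have hF : Integrable F1 := FU_int hW hF0 k
  have hG : Integrable F2 := FU_int hW hF0 m
  have hT : 0 < l * 2^j := by positivity
  set T := l * 2^j with hTdef
  have hJ : MeasurableSet (Jset l j) := Jset_meas l j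
  have hS : MeasurableSet (SJ l j) := hJ.preimage (by fun_prop : Measurable fun w : ℝ × ℝ => w.1 - w.2)
  set Q : ℝ × Eu n → ℝ≥0∞ := fun v => (Jset l j).indicator 1 v.1 * ‖PK n (l + v.1 * I) v.2‖ₑ with hQ
  have hQm : Measurable Q := by
    have h1 : Measurable ((Jset l j).indicator (1 : ℝ → ℝ≥0∞)) := measurable_one.indicator hJ
    exact (h1.comp measurable_fst).mul (PK_enorm_meas n (by omega) l hl)
  have mF : Measurable (fun z => ‖F1 z‖ₑ) := hFm.measurable.enorm
  have mG : Measurable (fun z => ‖F2 z‖ₑ) := hGm.measurable.enorm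
  have mF2 : Measurable (fun z => ‖F1 z‖ₑ^2) := hFm.measurable.enorm.pow_const 2
  have mG2 : Measurable (fun z => ‖F2 z‖ₑ^2) := hGm.measurable.enorm.pow_const 2
  have half : ∀ a : ℝ≥0∞, (a^((1:ℝ)/2))^2 = a := by
    intro a; rw [← ENNReal.rpow_two, ← ENNReal.rpow_mul]; norm_num
  set a : Eu n → ℝ≥0∞ := fun x => (∫⁻ s, ‖F1 (x, s)‖ₑ^2)^((1:ℝ)/2) with ha
  set b : Eu n → ℝ≥0∞ := fun x => (∫⁻ s, ‖F2 (x, s)‖ₑ^2)^((1:ℝ)/2) with hb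
  have ham : Measurable a := (mF2.lintegral_prod_right').pow_const _
  have hbm : Measurable b := (mG2.lintegral_prod_right').pow_const _
  have ea : ∫⁻ s, a s^2 = ∫⁻ z, ‖F1 z‖ₑ^2 := by
    simp only [ha, half]; rw [Measure.volume_eq_prod, lintegral_prod _ mF2.aemeasurable]
  have eb : ∫⁻ s, b s^2 = ∫⁻ z, ‖F2 z‖ₑ^2 := by
    simp only [hb, half]; rw [Measure.volume_eq_prod, lintegral_prod _ mG2.aemeasurable]
  have a0 : ∀ x, x ∉ Uk W k → a x = 0 := by
    intro x hx; simp [ha, hF1, FU_zero hx]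
  have b0 : ∀ x, x ∉ Uk W m → b x = 0 := by
    intro x hx; simp [hb, hF2, FU_zero hx]
  have hsF : ∀ᵐ w : ℝ × ℝ ∂(volume.prod volume), Integrable (fun x => F1 (x, w.1)) :=
    Measure.quasiMeasurePreserving_fst.ae hF.prod_left_ae
  have hsG : ∀ᵐ w : ℝ × ℝ ∂(volume.prod volume), Integrable (fun x => F2 (x, w.2)) :=
    Measure.quasiMeasurePreserving_snd.ae hG.prod_left_ae
  set c0 := C1 * l^(-((n:ℝ)-1)/2) * T^(-((n:ℝ)-1)/2) with hc0
  have hc0p : 0 ≤ c0 := by positivity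
  set K : Eu n → ℝ≥0∞ := fun y => ENNReal.ofReal ((1 + ‖y‖/T)^(-((n:ℝ)+1))) with hKd
  have hKm : Measurable K := by fun_prop
  set N : ℝ≥0∞ := Λ^p * ENNReal.ofReal (T^((n:ℝ)-2*p)) with hN
  rw [← lintegral_indicator hS]
  calc _ ≤ ∫⁻ w : ℝ × ℝ, ∫⁻ z : Eu n × Eu n, Q (w.1 - w.2, z.2 - z.1) * (‖F1 (z.1, w.1)‖ₑ * ‖F2 (z.2, w.2)‖ₑ) ∂(volume.prod volume) := by
        apply lintegral_mono_ae
        filter_upwards [hsF, hsG] with w h3 h4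
        by_cases h6 : w ∈ SJ l j
        · have h7 : w.1 - w.2 ∈ Jset l j := h6
          rw [Set.indicator_of_mem h6]
          refine (Bil_le_PK n l (w.1 - w.2) hl _ _ h3 h4).trans (le_of_eq ?_)
          congr 1; ext z
          simp only [hQ, Set.indicator_of_mem h7, Pi.one_apply, one_mul]
        · rw [Set.indicator_of_notMem h6]; exact zero_le
    _ = ∫⁻ z : Eu n × Eu n, ∫⁻ w : ℝ × ℝ, Q (w.1 - w.2, z.2 - z.1) * (‖F1 (z.1, w.1)‖ₑ * ‖F2 (z.2, w.2)‖ₑ) ∂(volume.prod volume) := by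
        apply lintegral_lintegral_swap
        apply Measurable.aemeasurable
        have h1 : Measurable (fun v : (ℝ × ℝ) × (Eu n × Eu n) => Q (v.1.1 - v.1.2, v.2.2 - v.2.1)) := hQm.comp (by fun_prop)
        have h2 : Measurable (fun v : (ℝ × ℝ) × (Eu n × Eu n) => ‖F1 (v.2.1, v.1.1)‖ₑ) := mF.comp (by fun_prop)
        have h3 : Measurable (fun v : (ℝ × ℝ) × (Eu n × Eu n) => ‖F2 (v.2.2, v.1.2)‖ₑ) := mG.comp (by fun_prop)
        exact h1.mul (h2.mul h3)
    _ ≤ ∫⁻ z : Eu n × Eu n, ENNReal.ofReal c0 * (K (z.2 - z.1) * (a z.1 * b z.2)) := by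
        apply lintegral_mono; intro z
        have h1 : Measurable (fun w : ℝ × ℝ => Q (w.1 - w.2, z.2 - z.1)) := hQm.comp (by fun_prop)
        have h2 : Measurable (fun w : ℝ × ℝ => ‖F1 (z.1, w.1)‖ₑ) := mF.comp (by fun_prop)
        have h3 : Measurable (fun w : ℝ × ℝ => ‖F2 (z.2, w.2)‖ₑ) := mG.comp (by fun_prop)
        have hm : Measurable (fun w : ℝ × ℝ => Q (w.1 - w.2, z.2 - z.1) * (‖F1 (z.1, w.1)‖ₑ * ‖F2 (z.2, w.2)‖ₑ)) := h1.mul (h2.mul h3)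
        dsimp only
        rw [lintegral_prod_symm' _ hm]
        have h4 : Measurable (fun s => ‖F1 (z.1, s)‖ₑ) := mF.comp (by fun_prop)
        have h5 : Measurable (fun s => ‖F2 (z.2, s)‖ₑ) := mG.comp (by fun_prop)
        refine (time_schur (fun τ => Q (τ, z.2 - z.1)) _ _ (hQm.comp (by fun_prop)) h4 h5).trans ?_
        have : ∫⁻ τ, Q (τ, z.2 - z.1) ≤ ENNReal.ofReal c0 * K (z.2 - z.1) := by
          have e : ∫⁻ τ, Q (τ, z.2 - z.1) = ∫⁻ τ in Jset l j, ‖PK n (l + τ * I) (z.2 - z.1)‖ₑ := by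
            rw [← lintegral_indicator hJ]
            congr 1; ext τ
            by_cases hτ : τ ∈ Jset l j <;> simp [hQ, hτ]
          rw [e, hKd, ← ENNReal.ofReal_mul hc0p]
          exact hK2 l j _ hl
        calc _ ≤ ENNReal.ofReal c0 * K (z.2 - z.1) * (a z.1 * b z.2) := by gcongr
          _ = _ := by ring
    _ = ENNReal.ofReal c0 * ∫⁻ x, ∫⁻ y, K (y - x) * (a x * b y) := by
        have hm : Measurable (fun z : Eu n × Eu n => K (z.2 - z.1) * (a z.1 * b z.2)) := by fun_prop
        rw [lintegral_const_mul _ hm, Measure.volume_eq_prod, lintegral_prod _ hm.aemeasurable]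
    _ ≤ ENNReal.ofReal c0 * (((C2 * (p2 (-(k*p)) * N)) * (C2 * (p2 (-(m*p)) * N)))^((1:ℝ)/2) * ((∫⁻ x, a x^2)^((1:ℝ)/2) * (∫⁻ x, b x^2)^((1:ℝ)/2))) := by
        gcongr
        refine wt_conv K hKm a b ham hbm (Uk W k) (Uk W m) (Uk_meas hW k) (Uk_meas hW m) a0 b0 _ _ ?_ ?_
        · intro y
          simp only [hKd]
          simp_rw [norm_sub_rev y]
          refine (hKb W Λ T k y hW hT hball).trans (le_of_eq ?_)
          rw [hN]; ring
        · intro x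
          refine (hKb W Λ T m x hW hT hball).trans (le_of_eq ?_)
          rw [hN]; ring
    _ = _ := by
        have : ((C2 * (p2 (-(k*p)) * N)) * (C2 * (p2 (-(m*p)) * N)))^((1:ℝ)/2) = C2 * N * p2 (-((k+m)*(p/2))) := by
          rw [show (C2 * (p2 (-(k*p)) * N)) * (C2 * (p2 (-(m*p)) * N)) = (C2 * N)^2 * (p2 (-(k*p)) * p2 (-(m*p))) by ring, ← p2_add,
            ENNReal.mul_rpow_of_nonneg _ _ (by norm_num), p2_rpow, ← ENNReal.rpow_two, ← ENNReal.rpow_mul]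
          norm_num
          congr 1; ring
        rw [this, ea, eb, hc0, hN, mul_assoc C1, ENNReal.ofReal_mul hC1.le, ENNReal.ofReal_mul (p := l^(-((n:ℝ)-1)/2) * T^(-((n:ℝ)-1)/2)) (by positivity)]
        ring

lemma sum_p2_nat (ε : ℝ) (hε : 0 < ε) : ∑' i : ℕ, p2 (-(ε * i)) ≠ ⊤ := by
  obtain ⟨C, hC, h⟩ := sum_p2_abs ε 1 hε one_pos
  refine ne_top_of_le_ne_top hC (le_trans ?_ (h 0))
  refine le_trans (le_of_eq ?_) (ENNReal.tsum_comp_le_tsum_of_injective (f := fun i : ℕ => (i:ℤ)) (fun a b h => by simpa using h) _)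
  congr 1; ext i
  congr 3; simp

lemma Uk_disj {n : ℕ} {W : Eu n → ℝ≥0∞} {x : Eu n} {i j : ℤ} (h : x ∈ Uk W i) (h' : x ∈ Uk W j) : i = j := dyadic_unique h h'

lemma Nn_le_J {n : ℕ} {l : ℝ} (hl : 0 < l) {F G : Eu n × ℝ → ℂ} (hFm : StronglyMeasurable F) (hF : Integrable F)
    (hGm : StronglyMeasurable G) (hG : Integrable G) :
    ‖Nn n l F G‖ₑ ≤ ∑' j : ℕ, ∫⁻ w in SJ l j, ‖bet n l F G w‖ₑ ∂(volume.prod volume) := by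
  rw [Nn_eq hl hFm hF hGm hG]
  refine (enorm_integral_le_parts (bet_int hl hFm hF hGm hG) (fun j : ℕ => SJ l j) ?_ ?_ ?_).trans ?_
  · intro j; exact (Jset_meas l j).preimage (by fun_prop : Measurable fun w : ℝ × ℝ => w.1 - w.2)
  · intro z i j h1 h2
    by_contra hij
    exact Set.disjoint_left.1 (Jset_disj l hl hij) h1 h2
  · exact Eventually.of_forall fun z => Jset_exists l hl _
  · exact ENNReal.tsum_le_tsum fun j => enorm_integral_le_lintegral_enorm _

lemma G_sum {n : ℕ} {W : Eu n → ℝ≥0∞} (hW : Measurable W) {F : Eu n × ℝ → ℂ} (hF : StronglyMeasurable F) :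
    ∑' k : ℤ, (p2 (-(k/2)) * (∫⁻ z, ‖FU W F k z‖ₑ^2)^((1:ℝ)/2))^2 ≤ 2 * ∫⁻ z, ‖F z‖ₑ^2 * (W z.1)⁻¹ := by
  have half : ∀ a : ℝ≥0∞, (a^((1:ℝ)/2))^2 = a := by
    intro a; rw [← ENNReal.rpow_two, ← ENNReal.rpow_mul]; norm_num
  have hS : ∀ k, MeasurableSet (Prod.fst ⁻¹' Uk W k : Set (Eu n × ℝ)) := fun k => (Uk_meas hW k).preimage measurable_fst
  have mF2 : Measurable (fun z => ‖F z‖ₑ^2) := hF.measurable.enorm.pow_const 2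
  calc _ ≤ ∑' k : ℤ, 2 * ∫⁻ z in (Prod.fst ⁻¹' Uk W k : Set (Eu n × ℝ)), ‖F z‖ₑ^2 * (W z.1)⁻¹ := by
        apply ENNReal.tsum_le_tsum; intro k
        rw [mul_pow, half, show p2 (-(k/2))^2 = p2 (-k) by rw [← ENNReal.rpow_two, p2_rpow]; congr 1; ring]
        have e : ∫⁻ z, ‖FU W F k z‖ₑ^2 = ∫⁻ z in (Prod.fst ⁻¹' Uk W k : Set (Eu n × ℝ)), ‖F z‖ₑ^2 := by
          rw [← lintegral_indicator (hS k)]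
          congr 1; ext z
          by_cases hz : z ∈ (Prod.fst ⁻¹' Uk W k : Set (Eu n × ℝ))
          · rw [FU, Set.indicator_of_mem hz, Set.indicator_of_mem hz]
          · rw [FU, Set.indicator_of_notMem hz, Set.indicator_of_notMem hz]; simp
        rw [e, ← lintegral_const_mul _ mF2, ← lintegral_const_mul' _ _ (by norm_num)]
        apply setLIntegral_mono' (hS k)
        intro z hz
        have h1 : W z.1 ≤ p2 (k+1) := hz.2.le
        have h2 : p2 (-(k+1)) ≤ (W z.1)⁻¹ := by
          rw [ENNReal.le_inv_iff_mul_le, ← p2_neg_mul (k+1)]; gcongr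
        calc p2 (-k) * ‖F z‖ₑ^2 = 2 * (‖F z‖ₑ^2 * p2 (-(k+1))) := by
              rw [show -(k:ℝ) = 1 + -(k+1) by ring, p2_add, p2_one]; ring
          _ ≤ _ := by gcongr
    _ = 2 * ∫⁻ z in ⋃ k, (Prod.fst ⁻¹' Uk W k : Set (Eu n × ℝ)), ‖F z‖ₑ^2 * (W z.1)⁻¹ := by
        rw [ENNReal.tsum_mul_left, lintegral_iUnion hS]
        intro i j hij
        rw [Function.onFun, Set.disjoint_left]
        intro z h1 h2
        exact hij (Uk_disj h1 h2)
    _ ≤ _ := by gcongr; exact Measure.restrict_le_self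

lemma wtd_expo (n : ℕ) (p l : ℝ) (j : ℕ) (Λ : ℝ≥0∞) (hp : 0 < p) (hl : 0 < l) :
    (ENNReal.ofReal (l*2^j))^(((p-1)/2)/(1/2+(p-1)/2)) *
      (ENNReal.ofReal (l^(-((n:ℝ)-1)/2) * (l*2^j)^(-((n:ℝ)-1)/2) * (l*2^j)^((n:ℝ)-2*p)) * Λ^p)^((1/2)/(1/2+(p-1)/2)) =
    ENNReal.ofReal (l⁻¹) * Λ * p2 (-((1 - ((n:ℝ)-1)/(2*p)) * j)) := by
  have e1 : ((p-1)/2)/(1/2+(p-1)/2) = (p-1)/p := by rw [show 1/2 + (p-1)/2 = p/2 by ring]; field_simp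
  have e2 : ((1:ℝ)/2)/(1/2+(p-1)/2) = 1/p := by rw [show 1/2 + (p-1)/2 = p/2 by ring]; field_simp
  have hT : 0 < l*2^j := by positivity
  have h2 : (2:ℝ)^j = 2^(j:ℝ) := (Real.rpow_natCast _ _).symm
  rw [e1, e2, ENNReal.mul_rpow_of_nonneg _ _ (by positivity), ← ENNReal.rpow_mul, mul_one_div_cancel hp.ne', ENNReal.rpow_one,
    ENNReal.ofReal_rpow_of_pos hT, ENNReal.ofReal_rpow_of_pos (by positivity), p2_ofReal,
    ← mul_assoc, ← ENNReal.ofReal_mul (by positivity), mul_right_comm (ENNReal.ofReal (l⁻¹)), ← ENNReal.ofReal_mul (by positivity)]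
  congr 2
  have hlog : ∀ x y : ℝ, 0 < x → 0 < y → Real.log x = Real.log y → x = y := fun x y hx hy h => Real.log_injOn_pos hx hy h
  apply hlog _ _ (by positivity) (by positivity)
  have p2pos : (0:ℝ) < 2^(j:ℝ) := by positivity
  have lne := hl.ne'
  have A1 : ∀ a : ℝ, (l * 2^j)^a ≠ 0 := fun a => (Real.rpow_pos_of_pos hT a).ne'
  have A2 : ∀ a : ℝ, l^a ≠ 0 := fun a => (Real.rpow_pos_of_pos hl a).ne'
  have A3 : ∀ a : ℝ, (2:ℝ)^a ≠ 0 := fun a => (Real.rpow_pos_of_pos two_pos a).ne'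
  have B : 0 < l^(-((n:ℝ)-1)/2) * (l*2^j)^(-((n:ℝ)-1)/2) * (l*2^j)^((n:ℝ)-2*p) := by positivity
  rw [Real.log_mul (A1 _) (Real.rpow_pos_of_pos B _).ne', Real.log_rpow B, Real.log_mul (mul_ne_zero (A2 _) (A1 _)) (A1 _), Real.log_mul (A2 _) (A1 _),
    Real.log_mul (inv_ne_zero lne) (A3 _), Real.log_inv, Real.log_rpow hl, Real.log_rpow hT, Real.log_rpow hT, Real.log_rpow hT, Real.log_rpow two_pos,
    Real.log_mul lne (by positivity), Real.log_pow]
  field_simp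
  ring

set_option maxHeartbeats 1000000 in
/-- damped weighted estimate -/
lemma wtd (n : ℕ) (hn : 3 ≤ n) (p : ℝ) (hp : ((n:ℝ)-1)/2 < p) : ∃ C : ℝ≥0∞, C ≠ ⊤ ∧ ∀ (W : Eu n → ℝ≥0∞) (Λ : ℝ≥0∞) (l : ℝ) (F : Eu n × ℝ → ℂ),
    Measurable W → (∀ x, W x ≠ ⊤) → Λ ≠ 0 → Λ ≠ ⊤ → 0 < l →
    (∀ x r, 0 < r → ∫⁻ y in ball x r, W y^p ≤ Λ^p * ENNReal.ofReal (r^((n:ℝ)-2*p))) →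
    StronglyMeasurable F → Integrable F →
    Nsq n l F ≤ C * (ENNReal.ofReal (l⁻¹) * Λ * ∫⁻ z, ‖F z‖ₑ^2 * (W z.1)⁻¹) := by
  have hn' : (3:ℝ) ≤ n := by exact_mod_cast hn
  have hp1 : 1 < p := by linarith
  obtain ⟨C1, hC1, h1⟩ := E_L2 n (by omega)
  obtain ⟨C2, hC2, h2⟩ := E_K n hn p (by linarith)
  obtain ⟨C3, hC3, h3⟩ := sum_min_geom (1/2) ((p-1)/2) (by norm_num) (by linarith)
  have hε : 0 < 1 - ((n:ℝ)-1)/(2*p) := by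
    rw [sub_pos, div_lt_one (by linarith)]; linarith
  set ε := 1 - ((n:ℝ)-1)/(2*p) with hεd
  have hC4 := sum_p2_nat ε hε
  set C4 := ∑' i : ℕ, p2 (-(ε * i)) with hC4d
  refine ⟨(C1 + C2) * C3 * C4 * 2 + 1, by finiteness, fun W Λ l F hW hWt hΛ0 hΛt hl hball hFm hF => ?_⟩
  set J := ∫⁻ z, ‖F z‖ₑ^2 * (W z.1)⁻¹ with hJd
  by_cases hJ : J = ⊤
  · rw [hJ, ENNReal.mul_top (by simp [hΛ0, hl]), ENNReal.mul_top (by simp)]; exact le_top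
  have hmJ : Measurable (fun z : Eu n × ℝ => ‖F z‖ₑ^2 * (W z.1)⁻¹) :=
    (hFm.measurable.enorm.pow_const 2).mul (hW.comp measurable_fst).inv
  have hc : ∀ᵐ z : Eu n × ℝ, F z = 0 ∨ ∃ m, z ∈ (Prod.fst ⁻¹' Uk W m : Set (Eu n × ℝ)) := by
    filter_upwards [ae_lt_top hmJ hJ] with z hz
    by_cases h0 : W z.1 = 0
    · left
      rw [h0, ENNReal.inv_zero] at hz
      by_contra hne
      rw [ENNReal.mul_top (by simpa using hne)] at hz
      exact lt_irrefl _ hz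
    · right; exact exists_dyadic _ h0 (hWt _)
  set g : ℤ → ℝ≥0∞ := fun k => (∫⁻ z, ‖FU W F k z‖ₑ^2)^((1:ℝ)/2) with hg
  set G : ℤ → ℝ≥0∞ := fun k => p2 (-(k/2)) * g k with hG
  set A : ℕ → ℝ≥0∞ := fun j => ENNReal.ofReal (l^(-((n:ℝ)-1)/2) * (l*2^j)^(-((n:ℝ)-1)/2) * (l*2^j)^((n:ℝ)-2*p)) * Λ^p with hA
  set w : ℕ → ℤ → ℝ≥0∞ := fun j m => min (ENNReal.ofReal (l*2^j) * p2 (1/2 * m)) (A j * p2 (-((p-1)/2 * m))) with hw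
  have hgG : ∀ k, g k = p2 (k/2) * G k := by
    intro k; rw [hG]; dsimp only; rw [← mul_assoc, p2_mul_neg, one_mul]
  have key : ∀ k m j, ∫⁻ v in SJ l j, ‖bet n l (FU W F k) (FU W F m) v‖ₑ ∂(volume.prod volume) ≤ (C1 + C2) * (w j (k+m) * (G k * G m)) := by
    intro k m j
    have b1 := h1 l j _ _ hl (FU_meas hW hFm k) (FU_int hW hF k) (FU_meas hW hFm m) (FU_int hW hF m)
    have b2 := h2 W Λ l j k m F hW hl hball hFm hF
    have b1' : ∫⁻ v in SJ l j, ‖bet n l (FU W F k) (FU W F m) v‖ₑ ∂(volume.prod volume) ≤ (C1+C2) * ((ENNReal.ofReal (l*2^j) * p2 (1/2 * (k+m : ℤ))) * (G k * G m)) := by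
      refine b1.trans ?_
      change C1 * (_ * (g k * g m)) ≤ _
      rw [hgG k, hgG m]
      calc _ = C1 * ((ENNReal.ofReal (l*2^j) * (p2 (k/2) * p2 (m/2))) * (G k * G m)) := by ring
        _ = C1 * ((ENNReal.ofReal (l*2^j) * p2 (1/2 * (k+m : ℤ))) * (G k * G m)) := by
            rw [← p2_add]; congr 4; push_cast; ring
        _ ≤ _ := by gcongr; exact le_self_add
    have b2' : ∫⁻ v in SJ l j, ‖bet n l (FU W F k) (FU W F m) v‖ₑ ∂(volume.prod volume) ≤ (C1+C2) * ((A j * p2 (-((p-1)/2 * (k+m : ℤ)))) * (G k * G m)) := by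
      refine b2.trans ?_
      change C2 * ((A j * _) * (g k * g m)) ≤ _
      rw [hgG k, hgG m]
      calc _ = C2 * ((A j * (p2 (-((k+m)*(p/2))) * p2 (k/2) * p2 (m/2))) * (G k * G m)) := by ring
        _ = C2 * ((A j * p2 (-((p-1)/2 * (k+m : ℤ)))) * (G k * G m)) := by
            rw [← p2_add, ← p2_add]; congr 4; push_cast; ring
        _ ≤ _ := by gcongr; exact le_add_self
    rcases min_choice (ENNReal.ofReal (l*2^j) * p2 (1/2 * (k+m : ℤ))) (A j * p2 (-((p-1)/2 * (k+m : ℤ)))) with h | h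
    · simp only [hw, h]; exact b1'
    · simp only [hw, h]; exact b2'
  have hA0 : ∀ j, A j ≠ 0 := by
    intro j
    have : 0 < l^(-((n:ℝ)-1)/2) * (l*2^j)^(-((n:ℝ)-1)/2) * (l*2^j)^((n:ℝ)-2*p) := by positivity
    simp only [hA]
    apply mul_ne_zero
    · simpa using this
    · exact (ENNReal.rpow_pos (pos_iff_ne_zero.2 hΛ0) hΛt).ne'
  have hAt : ∀ j, A j ≠ ⊤ := fun j => ENNReal.mul_ne_top ENNReal.ofReal_ne_top (ENNReal.rpow_ne_top_of_nonneg (by linarith) hΛt)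
  have hG2 : ∑' k, G k^2 ≤ 2 * J := G_sum hW hFm
  calc Nsq n l F ≤ ∑' k, ∑' m, ‖Nn n l (FU W F k) (FU W F m)‖ₑ := by
        refine Nsq_le_tsum hl hF (fun k => Prod.fst ⁻¹' Uk W k) (fun k => (Uk_meas hW k).preimage measurable_fst) ?_ hc
        intro z m m' a b; exact Uk_disj a b
    _ ≤ ∑' k, ∑' m, ∑' j : ℕ, (C1 + C2) * (w j (k+m) * (G k * G m)) := by
        apply ENNReal.tsum_le_tsum; intro k
        apply ENNReal.tsum_le_tsum; intro m
        refine (Nn_le_J hl (FU_meas hW hFm k) (FU_int hW hF k) (FU_meas hW hFm m) (FU_int hW hF m)).trans ?_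
        exact ENNReal.tsum_le_tsum fun j => key k m j
    _ = (C1 + C2) * ∑' j : ℕ, ∑' k, ∑' m, (w j (k+m) * (G k * G m)) := by
        simp_rw [ENNReal.tsum_mul_left]
        congr 1
        rw [ENNReal.tsum_comm]
        conv_rhs => rw [ENNReal.tsum_comm]
        rw [ENNReal.tsum_comm]
        congr 1; ext k
        rw [ENNReal.tsum_comm]
    _ ≤ (C1 + C2) * ∑' j : ℕ, C3 * (ENNReal.ofReal (l⁻¹) * Λ * p2 (-(ε * j))) * (2 * J) := by
        gcongr with j
        refine (hankel_schur (w j) G G).trans ?_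
        have hh : (∑' k, G k^2)^((1:ℝ)/2) * (∑' k, G k^2)^((1:ℝ)/2) = ∑' k, G k^2 := by
          rw [← ENNReal.rpow_add_of_nonneg _ _ (by norm_num) (by norm_num)]; norm_num
        rw [hh]
        gcongr
        have := h3 (ENNReal.ofReal (l*2^j)) (A j) (by have : 0 < l * 2^j := by positivity
                                                      simpa using this) ENNReal.ofReal_ne_top (hA0 j) (hAt j)
        refine this.trans (le_of_eq ?_)
        rw [hA]; dsimp only
        rw [wtd_expo n p l j Λ (by linarith) hl]
    _ = ((C1 + C2) * C3 * C4 * 2) * (ENNReal.ofReal (l⁻¹) * Λ * J) := by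
        rw [ENNReal.tsum_mul_right, ENNReal.tsum_mul_left, ENNReal.tsum_mul_left, ← hC4d]; ring
    _ ≤ _ := by gcongr; exact le_self_add

lemma lp_pt_real (p : ℝ) (h1 : 1 < p) (h2 : p ≤ 2) (u v : ℝ) (hu : 0 < u) (hv : 0 ≤ v) :
    u^p + p * u^(p-1) * (v - u) + p*(p-1)/2 * ((v-u)^2 * (u+v)^(p-2)) ≤ v^p := by
  set M := u + v with hM
  have hMp : 0 < M := by positivity
  set c := p*(p-1)/2 * M^(p-2) with hc
  have hd : ∀ x : ℝ, 0 < x → HasDerivAt (fun x : ℝ => x^p - c * x^2) (p * x^(p-1) - c * (2 * x)) x := by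
    intro x hx
    have a := Real.hasDerivAt_rpow_const (x := x) (p := p) (Or.inl hx.ne')
    have b := (hasDerivAt_pow 2 x).const_mul c
    refine (a.sub b).congr_deriv ?_
    simp
  have hd2 : ∀ x : ℝ, 0 < x → HasDerivAt (fun x : ℝ => p * x^(p-1) - c * (2 * x)) (p * ((p-1) * x^(p-2)) - c * 2) x := by
    intro x hx
    have a := (Real.hasDerivAt_rpow_const (x := x) (p := p-1) (Or.inl hx.ne')).const_mul p
    have b := ((hasDerivAt_id x).const_mul 2).const_mul c
    refine (a.sub b).congr_deriv ?_
    rw [show p - 1 - 1 = p - 2 by ring]; simp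
  have hconv : ConvexOn ℝ (Set.Icc 0 M) (fun x : ℝ => x^p - c * x^2) := by
    apply MonotoneOn.convexOn_of_deriv (convex_Icc 0 M)
    · apply ContinuousOn.sub
      · exact (Real.continuous_rpow_const (by linarith)).continuousOn
      · fun_prop
    · intro x hx
      rw [interior_Icc] at hx
      exact (hd x hx.1).differentiableAt.differentiableWithinAt
    · rw [interior_Icc]
      have : MonotoneOn (fun x : ℝ => p * x^(p-1) - c * (2 * x)) (Set.Ioo 0 M) := by
        apply monotoneOn_of_deriv_nonneg (convex_Ioo 0 M)
        · intro x hx; exact (hd2 x hx.1).continuousAt.continuousWithinAt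
        · rw [interior_Ioo]; intro x hx; exact (hd2 x hx.1).differentiableAt.differentiableWithinAt
        · rw [interior_Ioo]; intro x hx
          rw [(hd2 x hx.1).deriv, hc]
          have := Real.rpow_le_rpow_of_nonpos hx.1 hx.2.le (by linarith : p - 2 ≤ 0)
          have h3 : 0 ≤ p * (p-1) := by nlinarith
          nlinarith
      intro x hx y hy hxy
      rw [(hd x hx.1).deriv, (hd y hy.1).deriv]
      exact this hx hy hxy
  have hx : u ∈ Set.Icc 0 M := ⟨hu.le, by linarith⟩
  have hy : v ∈ Set.Icc 0 M := ⟨hv, by linarith⟩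
  have key : (u^p - c*u^2) + (p * u^(p-1) - c * (2 * u)) * (v - u) ≤ v^p - c * v^2 := by
    rcases lt_trichotomy u v with h | h | h
    · have := hconv.le_slope_of_hasDerivAt hx hy h (hd u hu)
      rw [slope_def_field, le_div_iff₀ (by linarith)] at this
      linarith
    · rw [h]; simp
    · have := hconv.slope_le_of_hasDerivAt hy hx h (hd u hu)
      rw [slope_def_field, div_le_iff₀ (by linarith)] at this
      linarith
  have : p*(p-1)/2 * ((v-u)^2 * M^(p-2)) = c * (v-u)^2 := by rw [hc]; ring
  rw [this]; nlinarith

/-- pointwise uniform convexity -/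
lemma lp_pt (p : ℝ) (h1 : 1 < p) (h2 : p ≤ 2) (a y : ℂ) :
    ‖a‖^p + p * ‖a‖^(p-2) * (starRingEnd ℂ a * (y - a)).re + p*(p-1)/2 * (‖y-a‖^2 * (‖y‖+‖a‖)^(p-2)) ≤ ‖y‖^p := by
  have hc1 : p*(p-1)/2 ≤ 1 := by nlinarith
  have hc0 : 0 ≤ p*(p-1)/2 := by nlinarith
  by_cases ha : a = 0
  · subst ha
    simp only [norm_zero, map_zero, zero_mul, Complex.zero_re, mul_zero, add_zero, sub_zero]
    rw [Real.zero_rpow (by linarith), zero_add]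
    by_cases hy : y = 0
    · subst hy; simp [Real.zero_rpow (by linarith : p ≠ 0)]
    · have hyp : 0 < ‖y‖ := norm_pos_iff.2 hy
      have : ‖y‖^2 * ‖y‖^(p-2) = ‖y‖^p := by
        rw [← Real.rpow_two, ← Real.rpow_add hyp]; congr 1; ring
      rw [this]
      have := Real.rpow_nonneg hyp.le p
      nlinarith
  · have hu : 0 < ‖a‖ := norm_pos_iff.2 ha
    have key := lp_pt_real p h1 h2 ‖a‖ ‖y‖ hu (norm_nonneg y)
    set w := (starRingEnd ℂ a * y).re with hw
    have hwle : w ≤ ‖a‖ * ‖y‖ := by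
      refine (Complex.re_le_norm _).trans ?_
      rw [norm_mul, RCLike.norm_conj]
    have e1 : (starRingEnd ℂ a * (y - a)).re = w - ‖a‖^2 := by
      rw [mul_sub, Complex.sub_re, mul_comm _ a, Complex.mul_conj, Complex.ofReal_re, Complex.normSq_eq_norm_sq]
    have e2 : ‖y - a‖^2 = ‖y‖^2 + ‖a‖^2 - 2 * w := by
      rw [hw, ← Complex.normSq_eq_norm_sq, ← Complex.normSq_eq_norm_sq, ← Complex.normSq_eq_norm_sq, Complex.normSq_sub, mul_comm (starRingEnd ℂ a)]
    rw [e1, e2]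
    have e3 : ‖a‖^(p-2) * ‖a‖^2 = ‖a‖^p := by
      rw [← Real.rpow_two, ← Real.rpow_add hu]; congr 1; ring
    have e4 : ‖a‖^(p-1) = ‖a‖^(p-2) * ‖a‖ := by
      rw [← Real.rpow_add_one hu.ne']; congr 1; ring
    have e5 : (‖a‖+‖y‖)^(p-2) ≤ ‖a‖^(p-2) :=
      Real.rpow_le_rpow_of_nonpos hu (by linarith [norm_nonneg y]) (by linarith)
    rw [e4] at key
    rw [add_comm ‖y‖ ‖a‖]
    have e6 : 0 ≤ (‖a‖*‖y‖ - w) * (p * ‖a‖^(p-2) - 2 * (p*(p-1)/2) * (‖a‖+‖y‖)^(p-2)) := by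
      apply mul_nonneg (by linarith)
      have h3 := Real.rpow_nonneg (by positivity : 0 ≤ ‖a‖+‖y‖) (p-2)
      have : p*(p-1) * (‖a‖+‖y‖)^(p-2) ≤ p * (‖a‖+‖y‖)^(p-2) := by
        apply mul_le_mul_of_nonneg_right _ h3; nlinarith
      have : p * (‖a‖+‖y‖)^(p-2) ≤ p * ‖a‖^(p-2) := by gcongr
      linarith
    nlinarith

/-- averaging operator -/
def Pav {E : Type*} [AddCommGroup E] [MeasurableSpace E] (ν : Measure E) (f : E → ℂ) (x : E) : ℂ := ∫ z, f (x + z) ∂ν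

section avg
variable {E : Type*} [AddCommGroup E] [MeasurableSpace E] [MeasurableAdd₂ E] [MeasurableNeg E]

lemma Pav_meas {ν : Measure E} [IsProbabilityMeasure ν] {f : E → ℂ} (hf : StronglyMeasurable f) : StronglyMeasurable (Pav ν f) := by
  have : StronglyMeasurable (fun w : E × E => f (w.1 + w.2)) := hf.comp_measurable (by fun_prop)
  exact this.integral_prod_right

lemma Pav_bdd {ν : Measure E} [IsProbabilityMeasure ν] {f : E → ℂ} {M : ℝ} (hM : ∀ x, ‖f x‖ ≤ M) (x : E) : ‖Pav ν f x‖ ≤ M := by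
  refine (norm_integral_le_of_norm_le_const (C := M) (Eventually.of_forall fun z => hM _)).trans ?_
  simp

lemma Pav_slice_int {ν : Measure E} [IsProbabilityMeasure ν] {f : E → ℂ} (hf : StronglyMeasurable f) {M : ℝ} (hM : ∀ x, ‖f x‖ ≤ M) (x : E) :
    Integrable (fun z => f (x + z)) ν :=
  Integrable.of_bound (hf.comp_measurable (by fun_prop)).aestronglyMeasurable M (Eventually.of_forall fun z => hM _)

lemma jensen_enn {ν : Measure E} [IsProbabilityMeasure ν] {h : E → ℝ≥0∞} (hh : Measurable h) (p : ℝ) (hp : 1 ≤ p) :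
    (∫⁻ z, h z ∂ν)^p ≤ ∫⁻ z, h z^p ∂ν := by
  have := ENNReal.lintegral_mul_norm_pow_le (μ := ν) (f := fun z => h z^p) (g := fun _ => 1) (hh.pow_const p).aemeasurable aemeasurable_const
    (p := 1/p) (q := 1 - 1/p) (by positivity) (by rw [sub_nonneg, div_le_one (by linarith)]; exact hp) (by ring)
  simp only [ENNReal.one_rpow, mul_one, lintegral_one, measure_univ] at this
  simp_rw [← ENNReal.rpow_mul] at this
  rw [mul_one_div_cancel (by linarith)] at this
  simp only [ENNReal.rpow_one] at this
  calc _ ≤ ((∫⁻ z, h z^p ∂ν)^(1/p))^p := by gcongr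
    _ = _ := by rw [← ENNReal.rpow_mul, one_div_mul_cancel (by linarith), ENNReal.rpow_one]

/-- kernel -/
def lpK (p : ℝ) (a y : ℂ) : ℝ := ‖y-a‖^2 * (‖y‖+‖a‖)^(p-2)

lemma lp_avg (p : ℝ) (h1 : 1 < p) (h2 : p ≤ 2) {ν : Measure E} [IsProbabilityMeasure ν] {f : E → ℂ} (hf : StronglyMeasurable f) {M : ℝ} (hM : ∀ x, ‖f x‖ ≤ M) (x : E) :
    ‖Pav ν f x‖ₑ^p + ENNReal.ofReal (p*(p-1)/2) * ∫⁻ z, ENNReal.ofReal (lpK p (Pav ν f x) (f (x+z))) ∂ν ≤ ∫⁻ z, ‖f (x+z)‖ₑ^p ∂ν := by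
  set a := Pav ν f x with ha
  have hc0 : 0 ≤ p*(p-1)/2 := by nlinarith
  have hM0 : 0 ≤ M := (norm_nonneg _).trans (hM x)
  have hfz : StronglyMeasurable (fun z => f (x + z)) := hf.comp_measurable (by fun_prop)
  have hIn : Integrable (fun z => f (x + z)) ν := Pav_slice_int hf hM x
  have hK0 : ∀ y, 0 ≤ lpK p a y := fun y => by unfold lpK; positivity
  have hKm : Measurable (fun z => lpK p a (f (x+z))) := by
    unfold lpK
    have := hfz.measurable
    fun_prop
  have hKb : ∀ y, lpK p a y ≤ (‖y‖+‖a‖)^p := by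
    intro y
    unfold lpK
    by_cases h0 : ‖y‖ + ‖a‖ = 0
    · have hy : ‖y‖ = 0 := by linarith [norm_nonneg y, norm_nonneg a]
      have ha' : ‖a‖ = 0 := by linarith [norm_nonneg y, norm_nonneg a]
      rw [norm_eq_zero] at hy ha'
      simp [hy, ha', Real.zero_rpow (by linarith : p ≠ 0)]
    · have hp : 0 < ‖y‖ + ‖a‖ := lt_of_le_of_ne (by positivity) (Ne.symm h0)
      calc _ ≤ (‖y‖+‖a‖)^2 * (‖y‖+‖a‖)^(p-2) := by gcongr; exact norm_sub_le _ _
        _ = _ := by rw [← Real.rpow_two, ← Real.rpow_add hp]; congr 1; ring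
  have hKi : Integrable (fun z => lpK p a (f (x+z))) ν := by
    refine Integrable.of_bound hKm.aestronglyMeasurable ((M+‖a‖)^p) (Eventually.of_forall fun z => ?_)
    rw [Real.norm_of_nonneg (hK0 _)]
    refine (hKb _).trans ?_
    gcongr; exact hM _
  have hpi : Integrable (fun z => ‖f (x+z)‖^p) ν := by
    refine Integrable.of_bound (by have : Measurable (fun z => ‖f (x+z)‖^p) := by { have := hfz.measurable; fun_prop }
                                   exact this.aestronglyMeasurable) (M^p) (Eventually.of_forall fun z => ?_)
    rw [Real.norm_of_nonneg (by positivity)]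
    gcongr; exact hM _
  have hre : Integrable (fun z => (starRingEnd ℂ a * (f (x+z) - a)).re) ν :=
    ((hIn.sub (integrable_const a)).const_mul _).re
  have hre0 : ∫ z, (starRingEnd ℂ a * (f (x+z) - a)).re ∂ν = 0 := by
    have h : Integrable (fun z => starRingEnd ℂ a * (f (x+z) - a)) ν := (hIn.sub (integrable_const a)).const_mul _
    have := integral_re h
    simp only [RCLike.re_to_complex] at this
    rw [this, integral_const_mul, integral_sub hIn (integrable_const a)]
    have : ∫ z, f (x+z) ∂ν = a := rfl
    rw [this]; simp
  have key : ‖a‖^p + (p*(p-1)/2) * ∫ z, lpK p a (f (x+z)) ∂ν ≤ ∫ z, ‖f (x+z)‖^p ∂ν := by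
    calc _ = ∫ z, (‖a‖^p + p * ‖a‖^(p-2) * (starRingEnd ℂ a * (f (x+z) - a)).re + p*(p-1)/2 * lpK p a (f (x+z))) ∂ν := by
          have i1 : Integrable (fun z => ‖a‖^p + p * ‖a‖^(p-2) * (starRingEnd ℂ a * (f (x+z) - a)).re) ν := (integrable_const _).add (hre.const_mul _)
          rw [integral_add i1 (hKi.const_mul _), integral_add (integrable_const _) (hre.const_mul _), integral_const_mul,
            integral_const_mul, hre0]
          simp
      _ ≤ _ := by
          apply integral_mono _ hpi
          · intro z; exact lp_pt p h1 h2 a _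
          · exact ((integrable_const _).add (hre.const_mul _)).add (hKi.const_mul _)
  have c1 : ∀ y : ℂ, ‖y‖ₑ^p = ENNReal.ofReal (‖y‖^p) := fun y => by
    rw [← ofReal_norm, ENNReal.ofReal_rpow_of_nonneg (norm_nonneg _) (by linarith)]
  simp_rw [c1]
  rw [← ofReal_integral_eq_lintegral_ofReal hKi (Eventually.of_forall fun z => hK0 _),
    ← ofReal_integral_eq_lintegral_ofReal hpi (Eventually.of_forall fun z => by positivity),
    ← ENNReal.ofReal_mul hc0, ← ENNReal.ofReal_add (by positivity) (mul_nonneg hc0 (integral_nonneg fun z => hK0 _))]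
  exact ENNReal.ofReal_le_ofReal key
end avg

section avg
variable {E : Type*} [AddCommGroup E] [MeasurableSpace E] [MeasurableAdd₂ E] [MeasurableNeg E]

lemma lpK_hold (p : ℝ) (h1 : 1 < p) (h2 : p ≤ 2) (a y : ℂ) :
    ‖y - a‖ₑ^p ≤ (ENNReal.ofReal (lpK p a y))^(p/2) * ((‖y‖ₑ + ‖a‖ₑ)^p)^(1 - p/2) := by
  by_cases h0 : ‖y‖ + ‖a‖ = 0
  · have hy : ‖y‖ = 0 := by linarith [norm_nonneg y, norm_nonneg a]
    have ha' : ‖a‖ = 0 := by linarith [norm_nonneg y, norm_nonneg a]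
    rw [norm_eq_zero] at hy ha'
    simp [hy, ha', ENNReal.zero_rpow_of_pos (by linarith : 0 < p)]
  · have hp : 0 < ‖y‖ + ‖a‖ := lt_of_le_of_ne (by positivity) (Ne.symm h0)
    rw [← ofReal_norm, ← ofReal_norm, ← ofReal_norm, ← ENNReal.ofReal_add (norm_nonneg _) (norm_nonneg _),
      ENNReal.ofReal_rpow_of_nonneg (norm_nonneg _) (by linarith), ENNReal.ofReal_rpow_of_nonneg (by unfold lpK; positivity) (by linarith),
      ENNReal.ofReal_rpow_of_nonneg hp.le (by linarith), ENNReal.ofReal_rpow_of_nonneg (by positivity) (by linarith), ← ENNReal.ofReal_mul (by unfold lpK; positivity)]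
    apply ENNReal.ofReal_le_ofReal
    unfold lpK
    rw [Real.mul_rpow (by positivity) (by positivity), ← Real.rpow_two, ← Real.rpow_mul (norm_nonneg _), ← Real.rpow_mul hp.le, ← Real.rpow_mul hp.le, mul_assoc,
      ← Real.rpow_add hp, show 2 * (p/2) = p by ring, show (p-2)*(p/2) + p * (1-p/2) = 0 by ring, Real.rpow_zero, mul_one]

/-- one step of the energy argument -/
lemma LP_step (p : ℝ) (h1 : 1 < p) (h2 : p ≤ 2) : ∃ C : ℝ≥0∞, C ≠ ⊤ ∧ ∀ (μ ν : Measure E) [SFinite μ] [μ.IsAddRightInvariant] [IsProbabilityMeasure ν] (f : E → ℂ) (M : ℝ),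
    ν.map (fun z => -z) = ν → StronglyMeasurable f → (∀ x, ‖f x‖ ≤ M) →
    (∫⁻ x, ‖f x - Pav ν (Pav ν f) x‖ₑ^p ∂μ)^(2/p) + C * (∫⁻ x, ‖Pav ν f x‖ₑ^p ∂μ)^(2/p) ≤ C * (∫⁻ x, ‖f x‖ₑ^p ∂μ)^(2/p) := by
  set c := ENNReal.ofReal (p*(p-1)/2) with hc
  have hc0 : c ≠ 0 := by
    have : 0 < p*(p-1)/2 := by nlinarith
    simpa [hc] using this
  have hct : c ≠ ⊤ := ENNReal.ofReal_ne_top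
  have hp0 : 0 < p := by linarith
  set Q : ℝ≥0∞ := (2^(p-1) * 2)^(2/p-1) with hQ
  have hpp : 0 ≤ 2/p - 1 := by rw [sub_nonneg, le_div_iff₀ hp0]; linarith
  have hQ0 : Q ≠ 0 := (ENNReal.rpow_pos (by positivity) (by finiteness)).ne'
  have hQt : Q ≠ ⊤ := ENNReal.rpow_ne_top_of_nonneg hpp (by finiteness)
  refine ⟨c⁻¹ * Q, ENNReal.mul_ne_top (ENNReal.inv_ne_top.2 hc0) hQt, fun μ ν _ _ _ f M hν hf hM => ?_⟩
  set A := ∫⁻ x, ‖f x‖ₑ^p ∂μ with hA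
  by_cases hAt : A = ⊤
  · rw [hAt, ENNReal.top_rpow_of_pos (by positivity), ENNReal.mul_top (mul_ne_zero (ENNReal.inv_ne_zero.2 hct) hQ0)]
    exact le_top
  set g := Pav ν f with hg
  have hgm : StronglyMeasurable g := Pav_meas hf
  have hgM : ∀ x, ‖g x‖ ≤ M := Pav_bdd hM
  set B := ∫⁻ x, ‖g x‖ₑ^p ∂μ with hB
  set κ := ∫⁻ x, ∫⁻ z, ENNReal.ofReal (lpK p (g x) (f (x+z))) ∂ν ∂μ with hκ
  have mf : Measurable f := hf.measurable
  have mg : Measurable g := hgm.measurable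
  have mfxz : Measurable (fun w : E × E => f (w.1 + w.2)) := mf.comp (by fun_prop)
  have mK : Measurable (fun w : E × E => ENNReal.ofReal (lpK p (g w.1) (f (w.1+w.2)))) := by
    unfold lpK; fun_prop
  have mfp : Measurable (fun w : E × E => ‖f (w.1+w.2)‖ₑ^p) := by fun_prop
  have hshift : ∫⁻ x, ∫⁻ z, ‖f (x+z)‖ₑ^p ∂ν ∂μ = A := by
    rw [lintegral_lintegral_swap mfp.aemeasurable]
    have : ∀ z, ∫⁻ x, ‖f (x+z)‖ₑ^p ∂μ = A := fun z => lintegral_add_right_eq_self (fun x => ‖f x‖ₑ^p) z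
    simp [this]
  have step2 : B + c * κ ≤ A := by
    rw [← hshift, hB, hκ, ← lintegral_const_mul _ (mK.lintegral_prod_right'), ← lintegral_add_left (by fun_prop)]
    apply lintegral_mono; intro x
    exact lp_avg p h1 h2 hf hM x
  have hBA : B ≤ A := le_trans le_self_add step2
  -- Hölder
  have step3 : ∫⁻ x, ∫⁻ z, ‖f (x+z) - g x‖ₑ^p ∂ν ∂μ ≤ κ^(p/2) * (2^(p-1) * 2 * A)^(1-p/2) := by
    have ms : Measurable (fun w : E × E => (‖f (w.1+w.2)‖ₑ + ‖g w.1‖ₑ)^p) := by fun_prop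
    have md : Measurable (fun w : E × E => ‖f (w.1+w.2) - g w.1‖ₑ^p) := by fun_prop
    calc _ = ∫⁻ w, ‖f (w.1+w.2) - g w.1‖ₑ^p ∂(μ.prod ν) := by rw [lintegral_prod _ md.aemeasurable]
      _ ≤ ∫⁻ w, (ENNReal.ofReal (lpK p (g w.1) (f (w.1+w.2))))^(p/2) * ((‖f (w.1+w.2)‖ₑ + ‖g w.1‖ₑ)^p)^(1-p/2) ∂(μ.prod ν) := by
          apply lintegral_mono; intro w
          exact lpK_hold p h1 h2 _ _
      _ ≤ (∫⁻ w, ENNReal.ofReal (lpK p (g w.1) (f (w.1+w.2))) ∂(μ.prod ν))^(p/2) * (∫⁻ w, (‖f (w.1+w.2)‖ₑ + ‖g w.1‖ₑ)^p ∂(μ.prod ν))^(1-p/2) :=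
          ENNReal.lintegral_mul_norm_pow_le mK.aemeasurable ms.aemeasurable (by linarith) (by linarith) (by ring)
      _ ≤ _ := by
          rw [lintegral_prod _ mK.aemeasurable]
          gcongr
          · linarith
          calc ∫⁻ w, (‖f (w.1+w.2)‖ₑ + ‖g w.1‖ₑ)^p ∂(μ.prod ν) ≤ ∫⁻ w, 2^(p-1) * (‖f (w.1+w.2)‖ₑ^p + ‖g w.1‖ₑ^p) ∂(μ.prod ν) := by
                apply lintegral_mono; intro w
                exact ENNReal.rpow_add_le_mul_rpow_add_rpow _ _ h1.le
            _ = 2^(p-1) * (A + B) := by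
                have m3 : Measurable (fun w : E × E => ‖f (w.1+w.2)‖ₑ^p + ‖g w.1‖ₑ^p) := by fun_prop
                have m4 : Measurable (fun w : E × E => ‖g w.1‖ₑ^p) := by fun_prop
                rw [lintegral_const_mul _ m3, lintegral_add_left mfp, lintegral_prod _ mfp.aemeasurable, hshift, lintegral_prod _ m4.aemeasurable]
                simp [hB]
            _ ≤ 2^(p-1) * (A + A) := by gcongr
            _ = _ := by ring
  have step4 : ∫⁻ x, ‖f x - Pav ν g x‖ₑ^p ∂μ ≤ ∫⁻ x, ∫⁻ z, ‖f (x+z) - g x‖ₑ^p ∂ν ∂μ := by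
    have m1 : Measurable (fun w : E × E => ‖f w.1 - g (w.1+w.2)‖ₑ^p) := by fun_prop
    have m2 : Measurable (fun w : E × E => ‖f (w.1+w.2) - g w.1‖ₑ^p) := by fun_prop
    calc _ ≤ ∫⁻ x, ∫⁻ z, ‖f x - g (x+z)‖ₑ^p ∂ν ∂μ := by
          apply lintegral_mono; intro x
          have e : f x - Pav ν g x = ∫ z, (f x - g (x+z)) ∂ν := by
            rw [integral_sub (integrable_const _) (Pav_slice_int hgm hgM x)]; simp [Pav]
          dsimp only
          rw [e]
          refine le_trans ?_ (jensen_enn (by fun_prop) p h1.le)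
          gcongr
          exact enorm_integral_le_lintegral_enorm _
      _ = ∫⁻ z, ∫⁻ x, ‖f x - g (x+z)‖ₑ^p ∂μ ∂ν := lintegral_lintegral_swap m1.aemeasurable
      _ = ∫⁻ z, ∫⁻ x, ‖f (x + -z) - g x‖ₑ^p ∂μ ∂ν := by
          apply lintegral_congr; intro z
          have := lintegral_add_right_eq_self (μ := μ) (fun x => ‖f (x + -z) - g x‖ₑ^p) z
          simpa using this
      _ = ∫⁻ z, ∫⁻ x, ‖f (x + z) - g x‖ₑ^p ∂μ ∂ν := by
          conv_rhs => rw [← hν]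
          rw [lintegral_map (m2.lintegral_prod_left') measurable_neg]
      _ = _ := (lintegral_lintegral_swap m2.aemeasurable).symm
  have step5 : (∫⁻ x, ‖f x - Pav ν g x‖ₑ^p ∂μ)^(2/p) ≤ κ * (Q * A^(2/p-1)) := by
    calc _ ≤ (κ^(p/2) * (2^(p-1) * 2 * A)^(1-p/2))^(2/p) := by
          gcongr; exact step4.trans step3
      _ = _ := by
          rw [ENNReal.mul_rpow_of_nonneg _ _ (by positivity), ← ENNReal.rpow_mul, ← ENNReal.rpow_mul, show p/2*(2/p) = 1 by field_simp,
            ENNReal.rpow_one, show (1-p/2)*(2/p) = 2/p-1 by field_simp, ENNReal.mul_rpow_of_nonneg _ _ hpp]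
  have hpow : ∀ X : ℝ≥0∞, X * X^(2/p-1) = X^(2/p) := by
    intro X
    nth_rw 1 [← ENNReal.rpow_one X]
    rw [← ENNReal.rpow_add_of_nonneg _ _ (by norm_num) hpp]; congr 1; ring
  calc _ ≤ κ * (Q * A^(2/p-1)) + c⁻¹ * Q * (B * A^(2/p-1)) := by
        gcongr
        rw [← hpow B]
        gcongr
    _ = c⁻¹ * Q * ((B + c * κ) * A^(2/p-1)) := by
        have : κ = c⁻¹ * c * κ := by rw [ENNReal.inv_mul_cancel hc0 hct, one_mul]
        nth_rw 1 [this]; ring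
    _ ≤ c⁻¹ * Q * (A * A^(2/p-1)) := by gcongr
    _ = _ := by rw [hpow]

/-- iterated averages -/
def Uit (ν : ℕ → Measure E) (f : E → ℂ) : ℕ → E → ℂ
  | 0 => f
  | (i+1) => Pav (ν i) (Uit ν f i)

/-- Littlewood-Paley pieces -/
def Dit (ν : ℕ → Measure E) (f : E → ℂ) (i : ℕ) (x : E) : ℂ := Uit ν f i x - Pav (ν i) (Pav (ν i) (Uit ν f i)) x

lemma Uit_meas {ν : ℕ → Measure E} (hν : ∀ i, IsProbabilityMeasure (ν i)) {f : E → ℂ} (hf : StronglyMeasurable f) (i : ℕ) : StronglyMeasurable (Uit ν f i) := by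
  induction i with
  | zero => exact hf
  | succ i ih => have := hν i; exact Pav_meas ih

lemma Uit_bdd {ν : ℕ → Measure E} (hν : ∀ i, IsProbabilityMeasure (ν i)) {f : E → ℂ} {M : ℝ} (hM : ∀ x, ‖f x‖ ≤ M) (i : ℕ) (x : E) : ‖Uit ν f i x‖ ≤ M := by
  induction i generalizing x with
  | zero => exact hM x
  | succ i ih => have := hν i; exact Pav_bdd ih x

lemma LP_sum (p : ℝ) (h1 : 1 < p) (h2 : p ≤ 2) : ∃ C : ℝ≥0∞, C ≠ ⊤ ∧ ∀ (μ : Measure E) [SFinite μ] [μ.IsAddRightInvariant] (ν : ℕ → Measure E) (f : E → ℂ) (M : ℝ) (N : ℕ),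
    (∀ i, IsProbabilityMeasure (ν i)) → (∀ i, (ν i).map (fun z => -z) = ν i) → StronglyMeasurable f → (∀ x, ‖f x‖ ≤ M) →
    ∑ i ∈ Finset.range N, (∫⁻ x, ‖Dit ν f i x‖ₑ^p ∂μ)^(2/p) ≤ C * (∫⁻ x, ‖f x‖ₑ^p ∂μ)^(2/p) := by
  obtain ⟨C, hC, h⟩ := LP_step (E := E) p h1 h2
  refine ⟨C, hC, fun μ _ _ ν f M N hν hs hf hM => ?_⟩
  have : ∑ i ∈ Finset.range N, (∫⁻ x, ‖Dit ν f i x‖ₑ^p ∂μ)^(2/p) + C * (∫⁻ x, ‖Uit ν f N x‖ₑ^p ∂μ)^(2/p) ≤ C * (∫⁻ x, ‖f x‖ₑ^p ∂μ)^(2/p) := by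
    induction N with
    | zero => simp [Uit]
    | succ N ih =>
      refine le_trans ?_ ih
      rw [Finset.sum_range_succ, add_assoc]
      gcongr
      have := hν N
      exact h μ (ν N) (Uit ν f N) M (hs N) (Uit_meas hν hf N) (Uit_bdd hν hM N)
  exact le_trans le_self_add this
end avg

/-- symbol of a measure on space-time -/
def symb (n : ℕ) (ν : Measure (Eu n × ℝ)) (ξ : Eu n) : ℂ :=
  ∫ z, cexp (2 * Real.pi * I * (inner ℝ z.1 ξ : ℝ) + I * z.2 * ‖ξ‖) ∂ν

instance vol_inv (n : ℕ) : (volume : Measure (Eu n × ℝ)).IsAddRightInvariant := by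
  rw [Measure.volume_eq_prod]
  have : ((volume : Measure (Eu n)).prod (volume : Measure ℝ)).IsAddHaarMeasure := inferInstance
  infer_instance

lemma Pav_int_prod {n : ℕ} {ν : Measure (Eu n × ℝ)} [IsProbabilityMeasure ν] {F : Eu n × ℝ → ℂ} (hFm : StronglyMeasurable F) (hF : Integrable F) :
    Integrable (fun w : (Eu n × ℝ) × (Eu n × ℝ) => F (w.1 + w.2)) (volume.prod ν) := by
  have m : StronglyMeasurable (fun w : (Eu n × ℝ) × (Eu n × ℝ) => F (w.1 + w.2)) := hFm.comp_measurable (by fun_prop)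
  refine ⟨m.aestronglyMeasurable, ?_⟩
  have m2 : Measurable (fun w : (Eu n × ℝ) × (Eu n × ℝ) => ‖F (w.1 + w.2)‖ₑ) := m.measurable.enorm
  rw [HasFiniteIntegral, lintegral_prod _ m2.aemeasurable, lintegral_lintegral_swap m2.aemeasurable]
  have : ∀ z, ∫⁻ x, ‖F (x+z)‖ₑ = ∫⁻ x, ‖F x‖ₑ := fun z => lintegral_add_right_eq_self (fun x => ‖F x‖ₑ) z
  simp only [this, lintegral_const, measure_univ, mul_one]
  exact hF.2

lemma Pav_integrable {n : ℕ} {ν : Measure (Eu n × ℝ)} [IsProbabilityMeasure ν] {F : Eu n × ℝ → ℂ} (hFm : StronglyMeasurable F) (hF : Integrable F) :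
    Integrable (Pav ν F) := (Pav_int_prod (ν := ν) hFm hF).integral_prod_left

lemma Amp_Pav {n : ℕ} {ν : Measure (Eu n × ℝ)} [IsProbabilityMeasure ν] {F : Eu n × ℝ → ℂ} (hFm : StronglyMeasurable F) (hF : Integrable F) (ξ : Eu n) :
    Amp n (Pav ν F) ξ = symb n ν ξ * Amp n F ξ := by
  set e : Eu n × ℝ → ℂ := fun z => cexp (-(2 * Real.pi * I * (inner ℝ z.1 ξ : ℝ) + I * z.2 * ‖ξ‖)) with he
  have hec : Continuous e := by rw [he]; fun_prop
  have e1 : ∀ z, ‖e z‖ = 1 := fun z => Amp_phase_norm z ξ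
  have hA : ∀ H, Amp n H ξ = ∫ z, e z * H z := fun H => rfl
  rw [hA, hA]
  have hi : Integrable (fun w : (Eu n × ℝ) × (Eu n × ℝ) => e w.1 * F (w.1 + w.2)) (volume.prod ν) := by
    refine (Pav_int_prod (ν := ν) hFm hF).bdd_mul (c := 1) (by fun_prop) (Eventually.of_forall fun w => (e1 _).le)
  calc ∫ x, e x * Pav ν F x = ∫ x, ∫ z, e x * F (x+z) ∂ν := by
        apply integral_congr_ae; refine Eventually.of_forall fun x => ?_
        simp only [Pav, integral_const_mul]
    _ = ∫ z, (∫ x, e x * F (x+z)) ∂ν := integral_integral_swap hi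
    _ = ∫ z : Eu n × ℝ, (cexp (2 * Real.pi * I * (inner ℝ z.1 ξ : ℝ) + I * z.2 * ‖ξ‖) * ∫ x, e x * F x) ∂ν := by
        apply integral_congr_ae; refine Eventually.of_forall fun z => ?_
        dsimp only
        rw [← integral_add_right_eq_self (fun x => e x * F x) z, ← integral_const_mul]
        apply integral_congr_ae; refine Eventually.of_forall fun x => ?_
        dsimp only
        rw [← mul_assoc]
        congr 1
        rw [he]; dsimp only
        rw [← Complex.exp_add]
        congr 1
        simp only [Prod.fst_add, Prod.snd_add, inner_add_left]
        push_cast; ring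
    _ = _ := by rw [integral_mul_const]; rfl

lemma Uit_integrable {n : ℕ} {ν : ℕ → Measure (Eu n × ℝ)} (hν : ∀ i, IsProbabilityMeasure (ν i)) {F : Eu n × ℝ → ℂ} (hFm : StronglyMeasurable F) (hF : Integrable F) (i : ℕ) :
    Integrable (Uit ν F i) := by
  induction i with
  | zero => exact hF
  | succ i ih => have := hν i; exact Pav_integrable (Uit_meas hν hFm i) ih

lemma Dit_meas {E : Type*} [AddCommGroup E] [MeasurableSpace E] [MeasurableAdd₂ E] [MeasurableNeg E]
    {ν : ℕ → Measure E} (hν : ∀ i, IsProbabilityMeasure (ν i)) {F : E → ℂ} (hFm : StronglyMeasurable F) (i : ℕ) :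
    StronglyMeasurable (Dit ν F i) := by
  have := hν i
  exact (Uit_meas hν hFm i).sub (Pav_meas (Pav_meas (Uit_meas hν hFm i)))

lemma Dit_integrable {n : ℕ} {ν : ℕ → Measure (Eu n × ℝ)} (hν : ∀ i, IsProbabilityMeasure (ν i)) {F : Eu n × ℝ → ℂ} (hFm : StronglyMeasurable F) (hF : Integrable F) (i : ℕ) :
    Integrable (Dit ν F i) := by
  have := hν i
  exact (Uit_integrable hν hFm hF i).sub (Pav_integrable (Pav_meas (Uit_meas hν hFm i)) (Pav_integrable (Uit_meas hν hFm i) (Uit_integrable hν hFm hF i)))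

lemma Amp_Uit {n : ℕ} {ν : ℕ → Measure (Eu n × ℝ)} (hν : ∀ i, IsProbabilityMeasure (ν i)) {F : Eu n × ℝ → ℂ} (hFm : StronglyMeasurable F) (hF : Integrable F) (i : ℕ) (ξ : Eu n) :
    Amp n (Uit ν F i) ξ = (∏ j ∈ Finset.range i, symb n (ν j) ξ) * Amp n F ξ := by
  induction i with
  | zero => simp [Uit]
  | succ i ih =>
    have := hν i
    rw [Uit, Amp_Pav (Uit_meas hν hFm i) (Uit_integrable hν hFm hF i), ih, Finset.prod_range_succ]; ring

lemma Amp_Dit {n : ℕ} {ν : ℕ → Measure (Eu n × ℝ)} (hν : ∀ i, IsProbabilityMeasure (ν i)) {F : Eu n × ℝ → ℂ} (hFm : StronglyMeasurable F) (hF : Integrable F) (i : ℕ) (ξ : Eu n) :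
    Amp n (Dit ν F i) ξ = (∏ j ∈ Finset.range i, symb n (ν j) ξ) * (1 - symb n (ν i) ξ^2) * Amp n F ξ := by
  have := hν i
  have m1 := Uit_meas hν hFm i
  have i1 := Uit_integrable hν hFm hF i
  have m2 : StronglyMeasurable (Pav (ν i) (Uit ν F i)) := Pav_meas m1
  have i2 : Integrable (Pav (ν i) (Uit ν F i)) := Pav_integrable m1 i1
  have : Amp n (Dit ν F i) ξ = Amp n (Uit ν F i) ξ - Amp n (Pav (ν i) (Pav (ν i) (Uit ν F i))) ξ := by
    unfold Amp Dit
    simp_rw [mul_sub]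
    exact integral_sub (Amp_integrable i1 ξ) (Amp_integrable (Pav_integrable m2 i2) ξ)
  rw [this, Amp_Pav m2 i2, Amp_Pav m1 i1, Amp_Uit hν hFm hF]; ring

/-- gaussian in space, base measure -/
def gE (E : Type*) [NormedAddCommGroup E] [InnerProductSpace ℝ E] [FiniteDimensional ℝ E] [MeasurableSpace E] [BorelSpace E] (c : ℝ) : Measure E :=
  (ProbabilityTheory.stdGaussian E).map (fun z => c • z)

section gE
variable {E : Type*} [NormedAddCommGroup E] [InnerProductSpace ℝ E] [FiniteDimensional ℝ E] [MeasurableSpace E] [BorelSpace E]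

lemma gE_prob (c : ℝ) : IsProbabilityMeasure (gE E c) := Measure.isProbabilityMeasure_map (by fun_prop)

lemma gE_even (c : ℝ) : (gE E c).map (fun z => -z) = gE E c := by
  unfold gE
  have h := ProbabilityTheory.stdGaussian_map (E := E) (LinearIsometryEquiv.neg ℝ (E := E))
  conv_rhs => rw [← h]
  rw [Measure.map_map (by fun_prop) (by fun_prop), Measure.map_map (by fun_prop) (LinearIsometryEquiv.continuous _).measurable]
  congr 1
  ext z; simp

lemma gE_char (c : ℝ) (ξ : E) : ∫ z, cexp ((inner ℝ z ξ : ℝ) * I) ∂(gE E c) = Real.exp (-(c * ‖ξ‖)^2/2) := by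
  unfold gE
  rw [integral_map (by fun_prop) (by fun_prop)]
  have := ProbabilityTheory.charFun_stdGaussian (c • ξ)
  rw [charFun_apply] at this
  simp only [inner_smul_left, inner_smul_right] at this ⊢
  simp only [RCLike.conj_to_real]
  rw [this, norm_smul]
  rw [Complex.ofReal_exp]
  congr 1
  push_cast
  rw [mul_pow, mul_pow]
  have h2 : ((‖c‖:ℝ):ℂ)^2 = (c:ℂ)^2 := by rw [← Complex.ofReal_pow, ← Complex.ofReal_pow, Real.norm_eq_abs, sq_abs]
  rw [h2]
end gE

/-- space gaussian -/
def gS (n : ℕ) (c : ℝ) : Measure (Eu n × ℝ) := (gE (Eu n) (c / (2 * Real.pi))).map (fun z => (z, 0))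
/-- time gaussian -/
def gT (n : ℕ) (c : ℝ) : Measure (Eu n × ℝ) := (gE ℝ c).map (fun s => (0, s))

lemma gS_prob (n : ℕ) (c : ℝ) : IsProbabilityMeasure (gS n c) := by
  have := gE_prob (E := Eu n) (c / (2 * Real.pi))
  exact Measure.isProbabilityMeasure_map (by fun_prop)
lemma gT_prob (n : ℕ) (c : ℝ) : IsProbabilityMeasure (gT n c) := by
  have := gE_prob (E := ℝ) c
  exact Measure.isProbabilityMeasure_map (by fun_prop)

lemma gS_symb (n : ℕ) (c : ℝ) (ξ : Eu n) : symb n (gS n c) ξ = Real.exp (-(c * ‖ξ‖)^2/2) := by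
  unfold symb gS
  rw [integral_map (by fun_prop) (by fun_prop)]
  have := gE_char (E := Eu n) (c/(2*Real.pi)) ((2 * Real.pi) • ξ)
  have hpi := Real.pi_pos
  rw [norm_smul, Real.norm_of_nonneg (by positivity), ← mul_assoc, div_mul_cancel₀ _ (by positivity)] at this
  rw [← this]
  congr 1; ext z
  simp only [inner_smul_right]
  congr 1
  push_cast; ring

lemma gT_symb (n : ℕ) (c : ℝ) (ξ : Eu n) : symb n (gT n c) ξ = Real.exp (-(c * ‖ξ‖)^2/2) := by
  unfold symb gT
  rw [integral_map (by fun_prop) (by fun_prop)]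
  have := gE_char (E := ℝ) c ‖ξ‖
  rw [norm_norm] at this
  rw [← this]
  congr 1; ext z
  simp only [inner_zero_left]
  congr 1
  simp; ring

lemma gS_Pav (n : ℕ) (c : ℝ) {F : Eu n × ℝ → ℂ} (hF : StronglyMeasurable F) (z : Eu n × ℝ) :
    Pav (gS n c) F z = Pav (gE (Eu n) (c / (2 * Real.pi))) (fun x => F (x, z.2)) z.1 := by
  unfold Pav gS
  have m : StronglyMeasurable (fun w => F (z + w)) := hF.comp_measurable (by fun_prop)
  rw [integral_map (by fun_prop) m.aestronglyMeasurable]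
  congr 1; ext w
  congr 1; ext <;> simp

lemma gT_Pav (n : ℕ) (c : ℝ) {F : Eu n × ℝ → ℂ} (hF : StronglyMeasurable F) (z : Eu n × ℝ) :
    Pav (gT n c) F z = Pav (gE ℝ c) (fun s => F (z.1, s)) z.2 := by
  unfold Pav gT
  have m : StronglyMeasurable (fun w => F (z + w)) := hF.comp_measurable (by fun_prop)
  rw [integral_map (by fun_prop) m.aestronglyMeasurable]
  congr 1; ext w
  congr 1; ext <;> simp

lemma gS_Uit (n : ℕ) (c : ℕ → ℝ) {F : Eu n × ℝ → ℂ} (hF : StronglyMeasurable F) (i : ℕ) (z : Eu n × ℝ) :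
    Uit (fun j => gS n (c j)) F i z = Uit (fun j => gE (Eu n) (c j / (2 * Real.pi))) (fun x => F (x, z.2)) i z.1 := by
  induction i generalizing z with
  | zero => rfl
  | succ i ih =>
    rw [Uit, Uit, gS_Pav _ _ (Uit_meas (fun j => gS_prob n (c j)) hF i)]
    simp_rw [ih]

lemma gT_Uit (n : ℕ) (c : ℕ → ℝ) {F : Eu n × ℝ → ℂ} (hF : StronglyMeasurable F) (i : ℕ) (z : Eu n × ℝ) :
    Uit (fun j => gT n (c j)) F i z = Uit (fun j => gE ℝ (c j)) (fun s => F (z.1, s)) i z.2 := by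
  induction i generalizing z with
  | zero => rfl
  | succ i ih =>
    rw [Uit, Uit, gT_Pav _ _ (Uit_meas (fun j => gT_prob n (c j)) hF i)]
    simp_rw [ih]

lemma gS_Dit (n : ℕ) (c : ℕ → ℝ) {F : Eu n × ℝ → ℂ} (hF : StronglyMeasurable F) (i : ℕ) (z : Eu n × ℝ) :
    Dit (fun j => gS n (c j)) F i z = Dit (fun j => gE (Eu n) (c j / (2 * Real.pi))) (fun x => F (x, z.2)) i z.1 := by
  have := gS_prob n (c i)
  have m := Uit_meas (fun j => gS_prob n (c j)) hF i
  rw [Dit, Dit, gS_Pav _ _ (Pav_meas m)]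
  simp_rw [gS_Pav _ _ m, gS_Uit _ _ hF]

lemma gT_Dit (n : ℕ) (c : ℕ → ℝ) {F : Eu n × ℝ → ℂ} (hF : StronglyMeasurable F) (i : ℕ) (z : Eu n × ℝ) :
    Dit (fun j => gT n (c j)) F i z = Dit (fun j => gE ℝ (c j)) (fun s => F (z.1, s)) i z.2 := by
  have := gT_prob n (c i)
  have m := Uit_meas (fun j => gT_prob n (c j)) hF i
  rw [Dit, Dit, gT_Pav _ _ (Pav_meas m)]
  simp_rw [gT_Pav _ _ m, gT_Uit _ _ hF]

/-- dyadic scales -/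
def cK (K i : ℕ) : ℝ := 2^((i:ℝ) - K)

lemma cK_pos (K i : ℕ) : 0 < cK K i := by unfold cK; positivity

lemma cK_succ (K i : ℕ) : cK K (i+1) = 2 * cK K i := by
  unfold cK
  rw [show (((i+1:ℕ):ℝ) - K) = 1 + ((i:ℝ) - K) by push_cast; ring, Real.rpow_add (by norm_num), Real.rpow_one]

lemma cK_sum (K i : ℕ) : ∑ j ∈ Finset.range i, (cK K j)^2 ≤ (cK K i)^2/3 := by
  induction i with
  | zero => simp; positivity
  | succ i ih => rw [Finset.sum_range_succ, cK_succ]; nlinarith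

lemma cK_exists (K : ℕ) (ρ : ℝ) (h1 : 2^(-(K:ℝ)) ≤ ρ) (h2 : ρ ≤ 2^(K:ℝ)) :
    ∃ i ∈ Finset.range (2*K+1), 1 ≤ cK K i * ρ ∧ cK K i * ρ ≤ 2 := by
  have hρ : 0 < ρ := lt_of_lt_of_le (by positivity) h1
  set y := Real.logb 2 ρ with hy
  have hρy : ρ = 2^y := (Real.rpow_logb (by norm_num) (by norm_num) hρ).symm
  have y1 : -(K:ℝ) ≤ y := by rw [hρy] at h1; exact (Real.rpow_le_rpow_left_iff (by norm_num)).1 h1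
  have y2 : y ≤ K := by rw [hρy] at h2; exact (Real.rpow_le_rpow_left_iff (by norm_num)).1 h2
  refine ⟨⌈(K:ℝ) - y⌉₊, ?_, ?_, ?_⟩
  · rw [Finset.mem_range]
    have : ⌈(K:ℝ) - y⌉₊ ≤ 2*K := by
      apply Nat.ceil_le.2; push_cast; linarith
    omega
  · unfold cK
    rw [hρy, ← Real.rpow_add (by norm_num)]
    apply Real.one_le_rpow (by norm_num)
    have := Nat.le_ceil ((K:ℝ) - y)
    linarith
  · unfold cK
    rw [hρy, ← Real.rpow_add (by norm_num)]
    calc (2:ℝ)^((⌈(K:ℝ) - y⌉₊:ℝ) - K + y) ≤ 2^(1:ℝ) := by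
          apply Real.rpow_le_rpow_of_exponent_le (by norm_num)
          have := Nat.ceil_lt_add_one (by linarith : 0 ≤ (K:ℝ) - y)
          linarith
      _ = 2 := by norm_num

/-- annuli -/
def Ann (n K : ℕ) : Set (Eu n) := {ξ | (2:ℝ)^(-(K:ℝ)) ≤ ‖ξ‖ ∧ ‖ξ‖ ≤ (2:ℝ)^(K:ℝ)}

lemma Ann_meas (n K : ℕ) : MeasurableSet (Ann n K) := by
  unfold Ann
  exact (measurableSet_le measurable_const measurable_norm).inter (measurableSet_le measurable_norm measurable_const)

/-- pointwise Littlewood-Paley lower bound -/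
lemma lp_low (n : ℕ) (β : ℝ) : ∃ C : ℝ, 0 < C ∧ ∀ (K : ℕ) (ν : ℕ → Measure (Eu n × ℝ)) (F : Eu n × ℝ → ℂ) (ξ : Eu n),
    (∀ i, IsProbabilityMeasure (ν i)) → (∀ i ξ, symb n (ν i) ξ = Real.exp (-(cK K i * ‖ξ‖)^2/2)) →
    StronglyMeasurable F → Integrable F → ξ ∈ Ann n K →
    ∃ i ∈ Finset.range (2*K+1), ‖ξ‖^β * ‖Amp n F ξ‖^2 ≤ C * ((cK K i)^(-β) * (Real.exp (-(cK K i * ‖ξ‖)) * ‖Amp n (Dit ν F i) ξ‖^2)) := by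
  set a0 : ℝ := Real.exp (-1) * (1 - Real.exp (-1)) with ha0
  have hexp1 : Real.exp (-1) < 1 := by rw [Real.exp_lt_one_iff]; norm_num
  have ha0p : 0 < a0 := mul_pos (Real.exp_pos _) (by linarith)
  refine ⟨2^|β| * Real.exp 2 * (a0⁻¹)^2, by positivity, fun K ν F ξ hν hs hFm hF hξ => ?_⟩
  obtain ⟨i, hi, h1, h2⟩ := cK_exists K ‖ξ‖ hξ.1 hξ.2
  refine ⟨i, hi, ?_⟩
  have hcp := cK_pos K i
  have hξp : 0 < ‖ξ‖ := lt_of_lt_of_le (by positivity) hξ.1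
  set c := cK K i with hc
  have hA : a0 * ‖Amp n F ξ‖ ≤ ‖Amp n (Dit ν F i) ξ‖ := by
    rw [Amp_Dit hν hFm hF, norm_mul]
    gcongr
    rw [norm_mul, norm_prod]
    simp_rw [hs]
    simp only [Complex.norm_real, Real.norm_eq_abs, Real.abs_exp]
    rw [← Real.exp_sum]
    rw [ha0]
    gcongr
    · have : ∑ j ∈ Finset.range i, -(cK K j * ‖ξ‖)^2/2 = -(∑ j ∈ Finset.range i, (cK K j)^2) * (‖ξ‖^2/2) := by
        rw [neg_mul, Finset.sum_mul, ← Finset.sum_neg_distrib]; apply Finset.sum_congr rfl; intros; ring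
      rw [this]
      have h3 := cK_sum K i
      rw [← hc] at h3
      have h4 : (c*‖ξ‖)^2 ≤ 4 := by nlinarith
      have : (∑ j ∈ Finset.range i, (cK K j)^2) * (‖ξ‖^2/2) ≤ c^2/3 * (‖ξ‖^2/2) := by gcongr
      nlinarith
    · rw [← Complex.ofReal_pow, ← Complex.ofReal_one, ← Complex.ofReal_sub, Complex.norm_real]
      refine le_trans ?_ (le_abs_self _)
      rw [← Real.exp_nat_mul]
      have : Real.exp ((2:ℕ) * (-(c*‖ξ‖)^2/2)) ≤ Real.exp (-1) := by
        apply Real.exp_le_exp.2; push_cast; nlinarith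
      linarith
  have hB : ‖ξ‖^β ≤ 2^|β| * c^(-β) := by
    have : ‖ξ‖^β = (c*‖ξ‖)^β * c^(-β) := by
      rw [Real.mul_rpow hcp.le hξp.le, mul_right_comm, ← Real.rpow_add hcp]; simp
    rw [this]
    gcongr
    calc (c*‖ξ‖)^β ≤ (c*‖ξ‖)^|β| := Real.rpow_le_rpow_of_exponent_le h1 (le_abs_self _)
      _ ≤ _ := by gcongr
  have hE : 1 ≤ Real.exp 2 * Real.exp (-(c*‖ξ‖)) := by
    rw [← Real.exp_add]; apply Real.one_le_exp; linarith
  have hA2 : ‖Amp n F ξ‖ ≤ a0⁻¹ * ‖Amp n (Dit ν F i) ξ‖ := by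
    rw [inv_mul_eq_div, le_div_iff₀ ha0p]; linarith
  calc ‖ξ‖^β * ‖Amp n F ξ‖^2 ≤ (2^|β| * c^(-β)) * (a0⁻¹ * ‖Amp n (Dit ν F i) ξ‖)^2 * 1 := by
        rw [mul_one]; gcongr
    _ ≤ (2^|β| * c^(-β)) * (a0⁻¹ * ‖Amp n (Dit ν F i) ξ‖)^2 * (Real.exp 2 * Real.exp (-(c*‖ξ‖))) := by gcongr
    _ = _ := by ring

lemma lp_assemble (n : ℕ) (β : ℝ) : ∃ C : ℝ≥0∞, C ≠ ⊤ ∧ ∀ (K : ℕ) (ν : ℕ → Measure (Eu n × ℝ)) (F : Eu n × ℝ → ℂ),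
    (∀ i, IsProbabilityMeasure (ν i)) → (∀ i ξ, symb n (ν i) ξ = Real.exp (-(cK K i * ‖ξ‖)^2/2)) →
    StronglyMeasurable F → Integrable F →
    ∫⁻ ξ in Ann n K, ENNReal.ofReal (‖ξ‖^β) * ‖Amp n F ξ‖ₑ^2 ≤
      C * ∑ i ∈ Finset.range (2*K+1), ENNReal.ofReal ((cK K i)^(-β)) * Nsq n (cK K i) (Dit ν F i) := by
  obtain ⟨C, hC, h⟩ := lp_low n β
  refine ⟨ENNReal.ofReal C, ENNReal.ofReal_ne_top, fun K ν F hν hs hFm hF => ?_⟩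
  have mA : ∀ i, Measurable (fun ξ => ENNReal.ofReal (Real.exp (-(cK K i * ‖ξ‖))) * ‖Amp n (Dit ν F i) ξ‖ₑ^2) := by
    intro i
    have := (Amp_cont (Dit_integrable hν hFm hF i)).measurable
    fun_prop
  have mA2 : ∀ i, Measurable (fun ξ => ENNReal.ofReal ((cK K i)^(-β)) * (ENNReal.ofReal (Real.exp (-(cK K i * ‖ξ‖))) * ‖Amp n (Dit ν F i) ξ‖ₑ^2)) :=
    fun i => (mA i).const_mul _
  calc _ ≤ ∫⁻ ξ in Ann n K, ENNReal.ofReal C * ∑ i ∈ Finset.range (2*K+1), ENNReal.ofReal ((cK K i)^(-β)) * (ENNReal.ofReal (Real.exp (-(cK K i * ‖ξ‖))) * ‖Amp n (Dit ν F i) ξ‖ₑ^2) := by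
        apply setLIntegral_mono' (Ann_meas n K)
        intro ξ hξ
        obtain ⟨i, hi, hh⟩ := h K ν F ξ hν hs hFm hF hξ
        refine le_trans ?_ (mul_le_mul_right (Finset.single_le_sum (f := fun i => ENNReal.ofReal ((cK K i)^(-β)) * (ENNReal.ofReal (Real.exp (-(cK K i * ‖ξ‖))) * ‖Amp n (Dit ν F i) ξ‖ₑ^2)) (fun _ _ => zero_le) hi) _)
        have hcp := cK_pos K i
        rw [← ofReal_norm, ← ofReal_norm, ← ENNReal.ofReal_pow (norm_nonneg _), ← ENNReal.ofReal_pow (norm_nonneg _), ← ENNReal.ofReal_mul (by positivity),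
          ← ENNReal.ofReal_mul (by positivity), ← ENNReal.ofReal_mul (by positivity), ← ENNReal.ofReal_mul (by positivity)]
        exact ENNReal.ofReal_le_ofReal hh
    _ ≤ ∫⁻ ξ, ENNReal.ofReal C * ∑ i ∈ Finset.range (2*K+1), ENNReal.ofReal ((cK K i)^(-β)) * (ENNReal.ofReal (Real.exp (-(cK K i * ‖ξ‖))) * ‖Amp n (Dit ν F i) ξ‖ₑ^2) :=
        setLIntegral_le_lintegral _ _
    _ = _ := by
        rw [lintegral_const_mul _ (Finset.measurable_sum _ fun i _ => mA2 i), lintegral_finsetSum _ fun i _ => mA2 i]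
        congr 1
        apply Finset.sum_congr rfl; intro i _
        rw [lintegral_const_mul _ (mA i)]; rfl

lemma Ann_limit (n : ℕ) (hn : 1 ≤ n) (f : Eu n → ℝ≥0∞) (A : ℝ≥0∞) (h : ∀ K, ∫⁻ ξ in Ann n K, f ξ ≤ A) : ∫⁻ ξ, f ξ ≤ A := by
  have hmono : Monotone (Ann n) := by
    intro K L hKL ξ hξ
    have : (K:ℝ) ≤ L := by exact_mod_cast hKL
    refine ⟨le_trans ?_ hξ.1, le_trans hξ.2 ?_⟩
    · exact Real.rpow_le_rpow_of_exponent_le (by norm_num) (by linarith)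
    · exact Real.rpow_le_rpow_of_exponent_le (by norm_num) (by linarith)
  have hU : (⋃ K, Ann n K) = {0}ᶜ := by
    ext ξ
    simp only [Set.mem_iUnion, Set.mem_compl_iff, Set.mem_singleton_iff]
    constructor
    · rintro ⟨K, hK⟩ h0
      have := hK.1
      rw [h0, norm_zero] at this
      exact absurd this (not_le.2 (by positivity))
    · intro h0
      have hp : 0 < ‖ξ‖ := norm_pos_iff.2 h0
      obtain ⟨K, hK⟩ := exists_nat_ge (|Real.logb 2 ‖ξ‖|)
      have hy : ‖ξ‖ = 2^(Real.logb 2 ‖ξ‖) := (Real.rpow_logb (by norm_num) (by norm_num) hp).symm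
      refine ⟨K, ?_, ?_⟩
      · rw [hy]; exact Real.rpow_le_rpow_of_exponent_le (by norm_num) (by linarith [neg_abs_le (Real.logb 2 ‖ξ‖)])
      · conv_lhs => rw [hy]
        exact Real.rpow_le_rpow_of_exponent_le (by norm_num) (by linarith [le_abs_self (Real.logb 2 ‖ξ‖)])
  have : Nonempty (Fin n) := ⟨⟨0, hn⟩⟩
  have e : ∫⁻ ξ, f ξ = ∫⁻ ξ in ({0}ᶜ : Set (Eu n)), f ξ := by
    rw [Measure.restrict_congr_set (t := Set.univ) _, Measure.restrict_univ]
    rw [ae_eq_univ, compl_compl]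
    exact measure_singleton 0
  rw [e, ← hU, setLIntegral_iUnion_of_directed _ hmono.directed_le]
  exact iSup_le h

lemma rev_mink {α : Type*} [MeasurableSpace α] {μ : Measure α} (s : ℝ) (hs0 : 0 < s) (hs1 : s ≤ 1) (N : ℕ) (φ : ℕ → α → ℝ≥0∞) (Ψ : α → ℝ≥0∞)
    (hφ : ∀ i, Measurable (φ i)) (hΨ : Measurable Ψ) (h : ∀ x, ∑ i ∈ Finset.range N, φ i x ≤ Ψ x) :
    ∑ i ∈ Finset.range N, (∫⁻ x, φ i x^s ∂μ)^(1/s) ≤ (∫⁻ x, Ψ x^s ∂μ)^(1/s) := by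
  set X := ∫⁻ x, Ψ x^s ∂μ with hX
  by_cases hXt : X = ⊤
  · rw [hXt, ENNReal.top_rpow_of_pos (by positivity)]; exact le_top
  have hfin : ∀ᵐ x ∂μ, Ψ x ≠ ⊤ := by
    have := ae_lt_top (hΨ.pow_const s) hXt
    filter_upwards [this] with x hx h0
    rw [h0, ENNReal.top_rpow_of_pos hs0] at hx
    exact lt_irrefl _ hx
  have h1s : 0 ≤ 1/s - 1 := by rw [sub_nonneg, le_div_iff₀ hs0]; linarith
  have key : ∀ i ∈ Finset.range N, (∫⁻ x, φ i x^s ∂μ)^(1/s) ≤ (∫⁻ x, φ i x * Ψ x^(s-1) ∂μ) * X^(1/s-1) := by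
    intro i hi
    have m1 : Measurable (fun x => φ i x * Ψ x^(s-1)) := (hφ i).mul (hΨ.pow_const _)
    have m2 : Measurable (fun x => Ψ x^s) := hΨ.pow_const _
    calc _ ≤ (∫⁻ x, (φ i x * Ψ x^(s-1))^s * (Ψ x^s)^(1-s) ∂μ)^(1/s) := by
          gcongr 1
          apply lintegral_mono_ae
          filter_upwards [hfin] with x hx
          have hle : φ i x ≤ Ψ x := (Finset.single_le_sum (f := fun i => φ i x) (fun _ _ => zero_le) hi).trans (h x)
          by_cases h0 : Ψ x = 0
          · have : φ i x = 0 := le_antisymm (h0 ▸ hle) zero_le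
            rw [this, ENNReal.zero_rpow_of_pos hs0]; exact zero_le
          · rw [ENNReal.mul_rpow_of_nonneg _ _ hs0.le, ← ENNReal.rpow_mul, ← ENNReal.rpow_mul, mul_assoc, ← ENNReal.rpow_add _ _ h0 hx,
              show (s-1)*s + s*(1-s) = 0 by ring, ENNReal.rpow_zero, mul_one]
      _ ≤ ((∫⁻ x, φ i x * Ψ x^(s-1) ∂μ)^s * X^(1-s))^(1/s) := by
          gcongr 1
          exact ENNReal.lintegral_mul_norm_pow_le m1.aemeasurable m2.aemeasurable hs0.le (by linarith) (by ring)
      _ = _ := by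
          rw [ENNReal.mul_rpow_of_nonneg _ _ (by positivity), ← ENNReal.rpow_mul, ← ENNReal.rpow_mul, mul_one_div_cancel hs0.ne', ENNReal.rpow_one]
          congr 2; field_simp
  calc _ ≤ ∑ i ∈ Finset.range N, (∫⁻ x, φ i x * Ψ x^(s-1) ∂μ) * X^(1/s-1) := Finset.sum_le_sum key
    _ = (∫⁻ x, ∑ i ∈ Finset.range N, φ i x * Ψ x^(s-1) ∂μ) * X^(1/s-1) := by
        have m1 : ∀ i, Measurable (fun x => φ i x * Ψ x^(s-1)) := fun i => (hφ i).mul (hΨ.pow_const _)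
        rw [← Finset.sum_mul, lintegral_finsetSum _ fun i _ => m1 i]
    _ ≤ X * X^(1/s-1) := by
        gcongr 1
        apply lintegral_mono_ae
        filter_upwards [hfin] with x hx
        rw [← Finset.sum_mul]
        calc _ ≤ Ψ x * Ψ x^(s-1) := by gcongr 1; exact h x
          _ ≤ Ψ x^s := by
            by_cases h0 : Ψ x = 0
            · rw [h0, zero_mul]; exact zero_le
            · nth_rw 1 [← ENNReal.rpow_one (Ψ x)]
              rw [← ENNReal.rpow_add _ _ h0 hx]
              apply le_of_eq; congr 1; ring
    _ = _ := by
        nth_rw 1 [← ENNReal.rpow_one X]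
        rw [← ENNReal.rpow_add_of_nonneg _ _ (by norm_num) h1s]; congr 1; ring

/-- squared mixed norm -/
def mixSq (n : ℕ) (q' r' : ℝ) (F : Eu n × ℝ → ℂ) : ℝ≥0∞ := (∫⁻ t, (∫⁻ x, ‖F (x, t)‖ₑ^r')^(q'/r'))^(2/q')

lemma conj_range (q q' : ℝ) (hq : 2 ≤ q) (h : 1/q + 1/q' = 1) : 1 < q' ∧ q' ≤ 2 := by
  have hq0 : 0 < q := by linarith
  have h1 : 1/q ≤ 1/2 := one_div_le_one_div_of_le (by norm_num) hq
  have h2 : 1/q' = 1 - 1/q := by linarith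
  have h3 : 0 < 1/q := by positivity
  have hq'0 : 0 < q' := by
    have : 0 < 1/q' := by linarith
    exact one_div_pos.1 this
  constructor
  · have : 1/q' < 1 := by linarith
    rw [div_lt_one hq'0] at this; exact this
  · have : 1/2 ≤ 1/q' := by linarith
    exact (one_div_le_one_div (by norm_num) hq'0).1 this

lemma mix_LP (n : ℕ) (q' r' : ℝ) (hq1 : 1 < q') (hq2 : q' ≤ 2) (hr1 : 1 < r') (hr2 : r' ≤ 2) : ∃ C : ℝ≥0∞, C ≠ ⊤ ∧
    ∀ (c : ℕ → ℝ) (F : Eu n × ℝ → ℂ) (M : ℝ) (N : ℕ), StronglyMeasurable F → (∀ z, ‖F z‖ ≤ M) →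
    ∑ i ∈ Finset.range N, mixSq n q' r' (Dit (fun j => gS n (c j)) F i) ≤ C * mixSq n q' r' F := by
  obtain ⟨C, hC, h⟩ := LP_sum (E := Eu n) r' hr1 hr2
  refine ⟨C, hC, fun c F M N hF hM => ?_⟩
  set φ : ℕ → ℝ → ℝ≥0∞ := fun i t => (∫⁻ x, ‖Dit (fun j => gS n (c j)) F i (x,t)‖ₑ^r')^(2/r') with hφ
  set Φ : ℝ → ℝ≥0∞ := fun t => (∫⁻ x, ‖F (x,t)‖ₑ^r')^(2/r') with hΦ
  have mm : ∀ H : Eu n × ℝ → ℂ, StronglyMeasurable H → Measurable (fun t => (∫⁻ x, ‖H (x,t)‖ₑ^r')^(2/r')) := by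
    intro H hH
    have : Measurable (fun z : Eu n × ℝ => ‖H z‖ₑ^r') := hH.measurable.enorm.pow_const _
    exact (Measurable.lintegral_prod_left' this).pow_const _
  have hD := fun i => Dit_meas (fun j => gS_prob n (c j)) hF i
  have hsum : ∀ t, ∑ i ∈ Finset.range N, φ i t ≤ C * Φ t := by
    intro t
    have := h volume (fun j => gE (Eu n) (c j / (2*Real.pi))) (fun x => F (x,t)) M N (fun i => gE_prob _) (fun i => gE_even _) (hF.comp_measurable (by fun_prop)) (fun x => hM _)
    simp only [hφ, hΦ]
    simp_rw [gS_Dit n c hF]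
    exact this
  have e1 : ∀ X : ℝ≥0∞, (X^(2/r'))^(q'/2) = X^(q'/r') := by
    intro X; rw [← ENNReal.rpow_mul]; congr 1; field_simp
  have := rev_mink (μ := volume) (q'/2) (by linarith) (by linarith) N φ (fun t => C * Φ t) (fun i => mm _ (hD i)) ((mm F hF).const_mul C) hsum
  simp only [one_div_div] at this
  simp_rw [ENNReal.mul_rpow_of_nonneg _ _ (by linarith : 0 ≤ q'/2)] at this
  have mΦ : Measurable (fun t => Φ t^(q'/2)) := (mm F hF).pow_const _
  rw [lintegral_const_mul _ mΦ, ENNReal.mul_rpow_of_nonneg _ _ (by positivity), ← ENNReal.rpow_mul, show q'/2*(2/q') = 1 by field_simp, ENNReal.rpow_one] at this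
  simp only [hφ, hΦ, e1] at this
  exact this

lemma LPB (n : ℕ) (hn : 1 ≤ n) (q r q' r' : ℝ) (hq : 2 ≤ q) (hr : 2 < r) (hadm : 2/q + ((n:ℝ)-1)/r ≤ ((n:ℝ)-1)/2)
    (hq' : 1/q + 1/q' = 1) (hr' : 1/r + 1/r' = 1) :
    ∃ C : ℝ≥0∞, C ≠ ⊤ ∧ ∀ (F : Eu n × ℝ → ℂ) (M : ℝ), StronglyMeasurable F → Integrable F → (∀ z, ‖F z‖ ≤ M) →
      ∫⁻ ξ, ENNReal.ofReal (‖ξ‖^(2/q + 2*n/r - n)) * ‖Amp n F ξ‖ₑ^2 ≤ C * mixSq n q' r' F := by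
  obtain ⟨q1, q2⟩ := conj_range q q' hq hq'
  obtain ⟨r1, r2⟩ := conj_range r r' hr.le hr'
  obtain ⟨C1, hC1, h1⟩ := strich n hn q r q' r' hq hr hadm hq' hr'
  obtain ⟨C2, hC2, h2⟩ := lp_assemble n (2/q + 2*n/r - n)
  obtain ⟨C3, hC3, h3⟩ := mix_LP n q' r' q1 q2 r1 r2
  refine ⟨C2 * (C1 * C3), by finiteness, fun F M hFm hF hM => Ann_limit n hn _ _ fun K => ?_⟩
  refine (h2 K (fun j => gS n (cK K j)) F (fun i => gS_prob _ _) (fun i ξ => gS_symb _ _ _) hFm hF).trans ?_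
  rw [mul_assoc, mul_assoc]
  gcongr
  calc _ ≤ ∑ i ∈ Finset.range (2*K+1), C1 * mixSq n q' r' (Dit (fun j => gS n (cK K j)) F i) := by
        apply Finset.sum_le_sum; intro i _
        have hc := cK_pos K i
        refine (mul_le_mul_right (h1 (cK K i) _ hc (Dit_meas (fun j => gS_prob _ _) hFm i) (Dit_integrable (fun j => gS_prob _ _) hFm hF i)) _).trans (le_of_eq ?_)
        rw [mul_left_comm, ← mul_assoc (ENNReal.ofReal _), ← ENNReal.ofReal_mul (by positivity), ← Real.rpow_add hc, neg_add_cancel, Real.rpow_zero, ENNReal.ofReal_one, one_mul]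
        rfl
    _ = C1 * ∑ i ∈ Finset.range (2*K+1), mixSq n q' r' (Dit (fun j => gS n (cK K j)) F i) := by rw [Finset.mul_sum]
    _ ≤ _ := by gcongr; exact h3 _ F M _ hFm hM

lemma LPA (n : ℕ) (hn : 3 ≤ n) (p : ℝ) (hp : ((n:ℝ)-1)/2 < p) : ∃ C : ℝ≥0∞, C ≠ ⊤ ∧ ∀ (W : Eu n → ℝ≥0∞) (Λ : ℝ≥0∞) (F : Eu n × ℝ → ℂ) (M : ℝ),
    Measurable W → (∀ x, W x ≠ ⊤) → Λ ≠ 0 → Λ ≠ ⊤ →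
    (∀ x r, 0 < r → ∫⁻ y in ball x r, W y^p ≤ Λ^p * ENNReal.ofReal (r^((n:ℝ)-2*p))) →
    StronglyMeasurable F → Integrable F → (∀ z, ‖F z‖ ≤ M) →
    ∫⁻ ξ, ENNReal.ofReal (‖ξ‖^(-1:ℝ)) * ‖Amp n F ξ‖ₑ^2 ≤ C * (Λ * ∫⁻ z, ‖F z‖ₑ^2 * (W z.1)⁻¹) := by
  obtain ⟨C1, hC1, h1⟩ := wtd n hn p hp
  obtain ⟨C2, hC2, h2⟩ := lp_assemble n (-1)
  obtain ⟨C3, hC3, h3⟩ := LP_sum (E := ℝ) 2 (by norm_num) le_rfl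
  refine ⟨C2 * (C1 * C3), by finiteness, fun W Λ F M hW hWt hΛ0 hΛ hball hFm hF hM => Ann_limit n (by omega) _ _ fun K => ?_⟩
  refine (h2 K (fun j => gT n (cK K j)) F (fun i => gT_prob _ _) (fun i ξ => gT_symb _ _ _) hFm hF).trans ?_
  rw [mul_assoc]
  gcongr
  set D := fun i => Dit (fun j => gT n (cK K j)) F i with hD
  have mD : ∀ i, StronglyMeasurable (D i) := fun i => Dit_meas (fun j => gT_prob _ _) hFm i
  have mm : ∀ H : Eu n × ℝ → ℂ, StronglyMeasurable H → Measurable (fun z => ‖H z‖ₑ^2 * (W z.1)⁻¹) := by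
    intro H hH; have := hH.measurable; fun_prop
  have split : ∀ H : Eu n × ℝ → ℂ, StronglyMeasurable H → ∫⁻ z, ‖H z‖ₑ^2 * (W z.1)⁻¹ = ∫⁻ x, (∫⁻ t, ‖H (x,t)‖ₑ^2) * (W x)⁻¹ := by
    intro H hH
    rw [Measure.volume_eq_prod, lintegral_prod _ (mm H hH).aemeasurable]
    apply lintegral_congr; intro x
    have : Measurable (fun t => ‖H (x,t)‖ₑ^2) := by have := hH.measurable; fun_prop
    exact lintegral_mul_const (W x)⁻¹ this
  have mI : ∀ H : Eu n × ℝ → ℂ, StronglyMeasurable H → Measurable (fun x => ∫⁻ t, ‖H (x,t)‖ₑ^2) := by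
    intro H hH
    have : Measurable (fun z : Eu n × ℝ => ‖H z‖ₑ^2) := hH.measurable.enorm.pow_const _
    exact Measurable.lintegral_prod_right' this
  calc _ ≤ ∑ i ∈ Finset.range (2*K+1), C1 * Λ * ∫⁻ z, ‖D i z‖ₑ^2 * (W z.1)⁻¹ := by
        apply Finset.sum_le_sum; intro i _
        have hc := cK_pos K i
        refine (mul_le_mul_right (h1 W Λ (cK K i) _ hW hWt hΛ0 hΛ hc hball (mD i) (Dit_integrable (fun j => gT_prob _ _) hFm hF i)) _).trans (le_of_eq ?_)
        have : ENNReal.ofReal ((cK K i)^(-(-1:ℝ))) * ENNReal.ofReal ((cK K i)⁻¹) = 1 := by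
          rw [← ENNReal.ofReal_mul (by positivity), neg_neg, Real.rpow_one, mul_inv_cancel₀ hc.ne', ENNReal.ofReal_one]
        calc _ = (ENNReal.ofReal ((cK K i)^(-(-1:ℝ))) * ENNReal.ofReal ((cK K i)⁻¹)) * (C1 * Λ * ∫⁻ z, ‖D i z‖ₑ^2 * (W z.1)⁻¹) := by ring
          _ = _ := by rw [this, one_mul]
    _ = C1 * Λ * ∫⁻ x, ∑ i ∈ Finset.range (2*K+1), (∫⁻ t, ‖D i (x,t)‖ₑ^2) * (W x)⁻¹ := by
        have : ∀ i, Measurable (fun x => (∫⁻ t, ‖D i (x,t)‖ₑ^2) * (W x)⁻¹) := fun i => (mI _ (mD i)).mul hW.inv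
        rw [lintegral_finsetSum _ fun i _ => this i, ← Finset.mul_sum]
        congr 1; apply Finset.sum_congr rfl; intro i _; exact split _ (mD i)
    _ ≤ C1 * Λ * ∫⁻ x, C3 * ((∫⁻ t, ‖F (x,t)‖ₑ^2) * (W x)⁻¹) := by
        gcongr with x
        rw [← Finset.sum_mul, ← mul_assoc]
        gcongr
        have := h3 volume (fun j => gE ℝ (cK K j)) (fun t => F (x,t)) M (2*K+1) (fun i => gE_prob _) (fun i => gE_even _) (hFm.comp_measurable (by fun_prop)) (fun x => hM _)
        simp only [div_self (two_ne_zero' ℝ), ENNReal.rpow_one, ENNReal.rpow_two] at this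
        simp only [hD]
        simp_rw [gT_Dit n (cK K) hFm]
        exact this
    _ = _ := by
        have : Measurable (fun x => (∫⁻ t, ‖F (x,t)‖ₑ^2) * (W x)⁻¹) := (mI _ hFm).mul hW.inv
        rw [lintegral_const_mul _ this, split F hFm]; ring

/-- the half wave propagator -/
def Ew (n : ℕ) (τ : ℝ) (g : Eu n → ℂ) (y : Eu n) : ℂ :=
  𝓕⁻ (fun ξ : Eu n => cexp (-(τ * I) * ‖ξ‖) * 𝓕 g ξ) y

lemma PK_far (n : ℕ) (hn : 1 ≤ n) (R T : ℝ) (hR : 0 < R) (hT : 0 ≤ T) : ∃ C : ℝ, 0 < C ∧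
    ∀ (l τ : ℝ) (x y : Eu n), 0 < l → l ≤ 1 → |τ| ≤ T → 2 * R + 2 * T + 1 ≤ ‖x‖ → ‖y‖ < R →
    ‖PK n (l + τ * I) (y - x)‖ ≤ C * (1 + ‖x‖)^(-((n:ℝ)+1)) := by
  obtain ⟨c, hc, h⟩ := PK_bound n hn
  refine ⟨c * (1 + T) * 2^((n:ℝ)+1), by positivity, fun l τ x y hl hl1 hτ hx hy => ?_⟩
  refine (h l τ (y - x) hl).2.trans ?_
  set d := ‖y - x‖ with hd
  have hd1 : ‖x‖ - ‖y‖ ≤ d := by rw [hd, norm_sub_rev]; exact norm_sub_norm_le _ _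
  have hd2 : (1 + ‖x‖)/2 ≤ d := by linarith
  have hd0 : 0 < d := by linarith
  have hdT : T ≤ d := by linarith
  have hz : zm l τ ≤ 1 + T := by
    rw [zm]; apply Real.sqrt_le_iff.2 ⟨by linarith, ?_⟩
    have : τ^2 ≤ T^2 := by rw [← sq_abs]; gcongr
    nlinarith
  have hpi := Real.pi_gt_three
  have ha := abs_nonneg τ
  have h1 : d ≤ zm l (|τ| + 2 * Real.pi * d) := by
    refine le_trans ?_ (zm_ge' _ _)
    refine le_trans ?_ (le_abs_self _)
    nlinarith
  have h2 : d ≤ zm l (|τ| - 2 * Real.pi * d) := by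
    refine le_trans ?_ (zm_ge' _ _)
    refine le_trans ?_ (neg_le_abs _)
    nlinarith
  have hn0 : (0:ℝ) ≤ n := by positivity
  calc c * zm l τ * (zm l (|τ| + 2 * Real.pi * d) * zm l (|τ| - 2 * Real.pi * d))^(-((n:ℝ)+1)/2)
      ≤ c * (1 + T) * (d * d)^(-((n:ℝ)+1)/2) := by
        have z1 := zm_nonneg l (|τ| + 2 * Real.pi * d)
        have z2 := zm_nonneg l (|τ| - 2 * Real.pi * d)
        have : (zm l (|τ| + 2 * Real.pi * d) * zm l (|τ| - 2 * Real.pi * d))^(-((n:ℝ)+1)/2) ≤ (d * d)^(-((n:ℝ)+1)/2) := by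
          apply Real.rpow_le_rpow_of_nonpos (by positivity) (mul_le_mul h1 h2 hd0.le z1) (by linarith)
        have h0 := zm_nonneg l τ
        have h3 := Real.rpow_nonneg (mul_nonneg z1 z2) (-((n:ℝ)+1)/2)
        gcongr
    _ = c * (1 + T) * d^(-((n:ℝ)+1)) := by
        rw [Real.mul_rpow hd0.le hd0.le, ← Real.rpow_add hd0]; congr 2; ring
    _ ≤ c * (1 + T) * ((1 + ‖x‖)/2)^(-((n:ℝ)+1)) := by
        gcongr c * (1 + T) * ?_
        apply Real.rpow_le_rpow_of_nonpos (by positivity) hd2 (by linarith)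
    _ = _ := by
        rw [Real.div_rpow (by positivity) (by norm_num), Real.rpow_neg (by norm_num : (0:ℝ) ≤ 2)]
        field_simp

lemma Bil_integrable (n : ℕ) (l τ : ℝ) (hl : 0 < l) (f g : Eu n → ℂ) (hf : Integrable f) (hg : Integrable g) :
    Integrable (fun ξ : Eu n => cexp (-((l:ℂ) + τ * I) * ‖ξ‖) * (𝓕 f ξ * starRingEnd ℂ (𝓕 g ξ))) := by
  have c1 := fourier_cont hf
  have c2 := fourier_cont hg
  refine ((integrable_exp_neg_norm n l hl).mul_const ((∫ x, ‖f x‖) * (∫ x, ‖g x‖))).mono' ?_ (Eventually.of_forall fun ξ => ?_)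
  · exact Continuous.aestronglyMeasurable (by fun_prop)
  · rw [norm_mul, norm_cexp_lt, norm_mul, RCLike.norm_conj]
    have := fourier_norm_le' f ξ
    have := fourier_norm_le' g ξ
    gcongr

lemma fourier_addf {n : ℕ} {f g : Eu n → ℂ} (hf : Integrable f) (hg : Integrable g) (ξ : Eu n) :
    𝓕 (fun x => f x + g x) ξ = 𝓕 f ξ + 𝓕 g ξ := by
  rw [Real.fourier_eq, Real.fourier_eq, Real.fourier_eq, ← integral_add]
  · congr 1; ext x; rw [smul_add]
  · exact (VectorFourier.fourierIntegral_convergent_iff Real.continuous_fourierChar (innerSL ℝ).continuous₂ ξ).2 hf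
  · exact (VectorFourier.fourierIntegral_convergent_iff Real.continuous_fourierChar (innerSL ℝ).continuous₂ ξ).2 hg

lemma Bil_add_left (n : ℕ) (l τ : ℝ) (hl : 0 < l) (f f' g : Eu n → ℂ) (hf : Integrable f) (hf' : Integrable f') (hg : Integrable g) :
    Bil n l τ (fun x => f x + f' x) g = Bil n l τ f g + Bil n l τ f' g := by
  unfold Bil
  rw [← integral_add (Bil_integrable n l τ hl f g hf hg) (Bil_integrable n l τ hl f' g hf' hg)]
  congr 1; ext ξ
  rw [fourier_addf hf hf']; ring

/-- pairing bound, damped -/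
lemma Bil_loc (n : ℕ) (hn : 1 ≤ n) (R T : ℝ) (hR : 0 < R) (hT : 0 ≤ T) : ∃ C : ℝ≥0∞, C ≠ ⊤ ∧
    ∀ (l τ : ℝ) (g φ : Eu n → ℂ), 0 < l → l ≤ 1 → |τ| ≤ T → Integrable g → Measurable φ →
      (∀ y, ‖φ y‖ ≤ 1) → (∀ y, R ≤ ‖y‖ → φ y = 0) →
      ‖Bil n l τ g φ‖ₑ ≤ C * ((∫⁻ x in ball (0 : Eu n) (2 * R + 2 * T + 1), ‖g x‖ₑ^2)^((1:ℝ)/2)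
        + ∫⁻ x, ENNReal.ofReal ((1 + ‖x‖)^(-((n:ℝ)+1))) * ‖g x‖ₑ) := by
  obtain ⟨C1, hC1, h1⟩ := Bil_le_L2 n hn
  obtain ⟨C2, hC2, h2⟩ := PK_far n hn R T hR hT
  set N := 2 * R + 2 * T + 1 with hN
  set v := volume (ball (0 : Eu n) R) with hv
  have hvt : v ≠ ⊤ := measure_ball_lt_top.ne
  refine ⟨ENNReal.ofReal C1 * v^((1:ℝ)/2) + ENNReal.ofReal C2 * v, by finiteness, fun l τ g φ hl hl1 hτ hg hφm hφ1 hφ0 => ?_⟩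
  have hφle : ∀ y, ‖φ y‖ₑ ≤ (ball (0 : Eu n) R).indicator (fun _ => (1:ℝ≥0∞)) y := by
    intro y
    by_cases hy : y ∈ ball (0 : Eu n) R
    · rw [Set.indicator_of_mem hy, ← ofReal_norm]
      exact ENNReal.ofReal_le_one.2 (hφ1 y)
    · rw [Set.indicator_of_notMem hy, hφ0 y (by simpa using hy)]; simp
  have hφint : Integrable φ := by
    refine ⟨hφm.aestronglyMeasurable, ?_⟩
    refine (lintegral_mono hφle).trans_lt ?_
    rw [lintegral_indicator measurableSet_ball]; simp [hvt.lt_top, ← hv]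
  have hB : MeasurableSet (ball (0 : Eu n) N) := measurableSet_ball
  set g1 := (ball (0 : Eu n) N).indicator g with hg1
  set g2 := (ball (0 : Eu n) N)ᶜ.indicator g with hg2
  have i1 : Integrable g1 := hg.indicator hB
  have i2 : Integrable g2 := hg.indicator hB.compl
  have e : g = fun x => g1 x + g2 x := by
    ext x
    exact (congrFun (Set.indicator_self_add_compl (ball (0 : Eu n) N) g) x).symm
  have hsum : Bil n l τ g φ = Bil n l τ g1 φ + Bil n l τ g2 φ := by
    conv_lhs => rw [e]
    exact Bil_add_left n l τ hl g1 g2 φ i1 i2 hφint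
  have b1 : ‖Bil n l τ g1 φ‖ₑ ≤ ENNReal.ofReal C1 * v^((1:ℝ)/2) * (∫⁻ x in ball (0 : Eu n) N, ‖g x‖ₑ^2)^((1:ℝ)/2) := by
    refine (h1 l τ g1 φ hl i1 hφint).trans ?_
    rw [mul_assoc, mul_comm (v^((1:ℝ)/2))]
    gcongr ENNReal.ofReal C1 * (?_^((1:ℝ)/2) * ?_^((1:ℝ)/2))
    · rw [← lintegral_indicator hB]
      apply lintegral_mono; intro x
      by_cases hx : x ∈ ball (0 : Eu n) N
      · simp [hg1, hx]
      · simp [hg1, hx]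
    · calc ∫⁻ x, ‖φ x‖ₑ^2 ≤ ∫⁻ x, (ball (0 : Eu n) R).indicator (fun _ => (1:ℝ≥0∞)) x := by
            apply lintegral_mono; intro x
            have := hφle x
            by_cases hx : x ∈ ball (0 : Eu n) R
            · rw [Set.indicator_of_mem hx] at this ⊢
              exact pow_le_one₀ zero_le this
            · rw [Set.indicator_of_notMem hx] at this ⊢
              simp [le_antisymm this zero_le]
        _ = v := by rw [lintegral_indicator measurableSet_ball]; simp [hv]
  have b2 : ‖Bil n l τ g2 φ‖ₑ ≤ ENNReal.ofReal C2 * v * ∫⁻ x, ENNReal.ofReal ((1 + ‖x‖)^(-((n:ℝ)+1))) * ‖g x‖ₑ := by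
    refine (Bil_le_PK n l τ hl g2 φ i2 hφint).trans ?_
    calc ∫⁻ w : Eu n × Eu n, ‖PK n (l + τ * I) (w.2 - w.1)‖ₑ * (‖g2 w.1‖ₑ * ‖φ w.2‖ₑ)
        ≤ ∫⁻ w : Eu n × Eu n, (ENNReal.ofReal C2 * (ENNReal.ofReal ((1 + ‖w.1‖)^(-((n:ℝ)+1))) * ‖g w.1‖ₑ)) * (ball (0 : Eu n) R).indicator (fun _ => (1:ℝ≥0∞)) w.2 := by
          apply lintegral_mono; intro w; dsimp only
          by_cases hy : w.2 ∈ ball (0 : Eu n) R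
          · by_cases hx : w.1 ∈ ball (0 : Eu n) N
            · simp [hg2, hx]
            · have hgx : g2 w.1 = g w.1 := by simp only [hg2]; rw [Set.indicator_of_mem]; exact hx
              have := h2 l τ w.1 w.2 hl hl1 hτ (by simpa using hx) (by simpa using hy)
              have hP : ‖PK n (l + τ * I) (w.2 - w.1)‖ₑ ≤ ENNReal.ofReal C2 * ENNReal.ofReal ((1 + ‖w.1‖)^(-((n:ℝ)+1))) := by
                rw [← ofReal_norm, ← ENNReal.ofReal_mul hC2.le]
                exact ENNReal.ofReal_le_ofReal this
              rw [hgx, ← mul_assoc, ← mul_assoc]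
              gcongr
              exact hφle _
          · have : φ w.2 = 0 := hφ0 _ (by simpa using hy)
            simp [this]
      _ = _ := by
          rw [Measure.volume_eq_prod, lintegral_prod_mul (f := fun x : Eu n => ENNReal.ofReal C2 * (ENNReal.ofReal ((1 + ‖x‖)^(-((n:ℝ)+1))) * ‖g x‖ₑ))]
          · rw [lintegral_indicator measurableSet_ball, lintegral_const_mul' _ _ (by finiteness)]
            simp only [lintegral_const, Measure.restrict_apply_univ, one_mul, ← hv]
            ring
          · have : Measurable (fun x : Eu n => ENNReal.ofReal ((1 + ‖x‖)^(-((n:ℝ)+1)))) := by fun_prop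
            exact (this.aemeasurable.mul hg.aestronglyMeasurable.enorm).const_mul _
          · exact (measurable_const.indicator measurableSet_ball).aemeasurable
  rw [hsum]
  refine (enorm_add_le _ _).trans ((add_le_add b1 b2).trans ?_)
  rw [mul_add]
  gcongr
  · exact le_self_add
  · exact le_add_self

/-- pairing formula for the inverse Fourier transform -/
lemma pair_inv {n : ℕ} {a φ : Eu n → ℂ} (ha : Integrable a) (hφ : Integrable φ) :
    ∫ y, 𝓕⁻ a y * starRingEnd ℂ (φ y) = ∫ ξ, a ξ * starRingEnd ℂ (𝓕 φ ξ) := by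
  have hφ' : Integrable (fun y => starRingEnd ℂ (φ y)) := (LinearIsometryEquiv.integrable_comp_iff conjLIE).2 hφ
  have hi : Integrable (fun w : Eu n × Eu n => cexp (↑(2 * Real.pi * inner ℝ w.2 w.1) * I) * (a w.2 * starRingEnd ℂ (φ w.1))) (volume.prod volume) := by
    have h1 : Integrable (fun w : Eu n × Eu n => a w.2 * starRingEnd ℂ (φ w.1)) (volume.prod volume) :=
      (hφ'.mul_prod ha).congr (Eventually.of_forall fun w => mul_comm _ _)
    refine h1.bdd_mul (c := 1) ?_ (Eventually.of_forall fun w => ?_)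
    · exact Continuous.aestronglyMeasurable (by fun_prop)
    · rw [Complex.norm_exp_ofReal_mul_I]
  calc ∫ y, 𝓕⁻ a y * starRingEnd ℂ (φ y)
      = ∫ y, ∫ ξ, cexp (↑(2 * Real.pi * inner ℝ ξ y) * I) * (a ξ * starRingEnd ℂ (φ y)) := by
        congr 1; ext y
        rw [Real.fourierInv_eq', ← integral_mul_const]
        congr 1; ext ξ; rw [smul_eq_mul]; ring
    _ = ∫ ξ, ∫ y, cexp (↑(2 * Real.pi * inner ℝ ξ y) * I) * (a ξ * starRingEnd ℂ (φ y)) :=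
        integral_integral_swap hi
    _ = _ := by
        congr 1; ext ξ
        rw [Real.fourier_eq', ← integral_conj, ← integral_const_mul]
        congr 1; ext y
        rw [smul_eq_mul, map_mul, ← Complex.exp_conj, map_mul, Complex.conj_I, Complex.conj_ofReal, real_inner_comm]
        push_cast
        have : (2 * Real.pi * (inner ℝ y ξ : ℝ) * I : ℂ) = (-2 * Real.pi * (inner ℝ y ξ : ℝ) * -I : ℂ) := by ring
        rw [this]; ring

lemma fourierInv_cont {n : ℕ} {a : Eu n → ℂ} (ha : Integrable a) : Continuous (𝓕⁻ a) := by
  have : 𝓕⁻ a = fun x => 𝓕 a (-x) := by ext x; exact Real.fourierInv_eq_fourier_neg a x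
  rw [this]
  exact (fourier_cont ha).comp continuous_neg

lemma cexp_norm_one (τ r : ℝ) : ‖cexp (-(τ * I) * r)‖ = 1 := by
  have := norm_cexp_lt 0 τ r
  simpa using this

lemma Ew_integrable {n : ℕ} {g : Eu n → ℂ} (τ : ℝ) (hg : Integrable (𝓕 g)) :
    Integrable (fun ξ : Eu n => cexp (-(τ * I) * ‖ξ‖) * 𝓕 g ξ) := by
  refine hg.bdd_mul (c := 1) ?_ (Eventually.of_forall fun w => ?_)
  · exact Continuous.aestronglyMeasurable (by fun_prop)
  · rw [cexp_norm_one]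

set_option maxHeartbeats 1000000 in
/-- local bound for the half wave propagator -/
lemma Ew_loc (n : ℕ) (hn : 1 ≤ n) (R T : ℝ) (hR : 0 < R) (hT : 0 ≤ T) : ∃ C : ℝ≥0∞, C ≠ ⊤ ∧
    ∀ (τ : ℝ) (g : Eu n → ℂ), |τ| ≤ T → Integrable g → Integrable (𝓕 g) →
      ∫⁻ y in ball (0 : Eu n) R, ‖Ew n τ g y‖ₑ ≤ C * ((∫⁻ x in ball (0 : Eu n) (2 * R + 2 * T + 1), ‖g x‖ₑ^2)^((1:ℝ)/2)
        + ∫⁻ x, ENNReal.ofReal ((1 + ‖x‖)^(-((n:ℝ)+1))) * ‖g x‖ₑ) := by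
  obtain ⟨C, hC, h⟩ := Bil_loc n hn R T hR hT
  refine ⟨C, hC, fun τ g hτ hg hg' => ?_⟩
  set B := ball (0 : Eu n) R with hB
  have hBm : MeasurableSet B := measurableSet_ball
  have hi := Ew_integrable τ hg'
  have hc : Continuous (Ew n τ g) := fourierInv_cont hi
  set φ : Eu n → ℂ := B.indicator (fun y => (↑(‖Ew n τ g y‖⁻¹) : ℂ) * Ew n τ g y) with hφ
  have hφm : Measurable φ := by
    apply Measurable.indicator _ hBm
    have := hc.measurable
    fun_prop
  have hφ1 : ∀ y, ‖φ y‖ ≤ 1 := by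
    intro y
    simp only [hφ]
    by_cases hy : y ∈ B
    · rw [Set.indicator_of_mem hy, norm_mul, Complex.norm_real, norm_inv, norm_norm]
      exact inv_mul_le_one
    · rw [Set.indicator_of_notMem hy]; simp
  have hφ0 : ∀ y, R ≤ ‖y‖ → φ y = 0 := by
    intro y hy
    simp only [hφ]
    rw [Set.indicator_of_notMem (by simpa [hB] using hy)]
  have hφi : Integrable φ := by
    have h1 : IntegrableOn (fun y => (↑(‖Ew n τ g y‖⁻¹) : ℂ) * Ew n τ g y) B := by
      apply Measure.integrableOn_of_bounded (M := 1) measure_ball_lt_top.ne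
      · have := hc.measurable
        exact Measurable.aestronglyMeasurable (by fun_prop)
      · refine Eventually.of_forall fun y => ?_
        rw [norm_mul, Complex.norm_real, norm_inv, norm_norm]
        exact inv_mul_le_one
    exact h1.integrable_indicator hBm
  have e1 : ∫⁻ y in B, ‖Ew n τ g y‖ₑ = ‖∫ y, Ew n τ g y * starRingEnd ℂ (φ y)‖ₑ := by
    have e2 : ∀ y, Ew n τ g y * starRingEnd ℂ (φ y) = ((B.indicator (fun y => ‖Ew n τ g y‖) y : ℝ) : ℂ) := by
      intro y
      simp only [hφ]
      by_cases hy : y ∈ B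
      · rw [Set.indicator_of_mem hy, Set.indicator_of_mem hy, map_mul, Complex.conj_ofReal]
        have : Ew n τ g y * (↑(‖Ew n τ g y‖⁻¹) * starRingEnd ℂ (Ew n τ g y)) = ↑(‖Ew n τ g y‖⁻¹) * (Ew n τ g y * starRingEnd ℂ (Ew n τ g y)) := by ring
        rw [this, Complex.mul_conj, Complex.normSq_eq_norm_sq, ← Complex.ofReal_mul]
        congr 1
        by_cases h0 : ‖Ew n τ g y‖ = 0
        · simp [h0]
        · field_simp
      · rw [Set.indicator_of_notMem hy, Set.indicator_of_notMem hy]; simp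
    simp_rw [e2]
    rw [integral_complex_ofReal, integral_indicator hBm, ← ofReal_norm, Complex.norm_real, Real.norm_of_nonneg (integral_nonneg fun y => norm_nonneg _),
      ofReal_integral_eq_lintegral_ofReal]
    · simp_rw [ofReal_norm]
    · have : IntegrableOn (fun y => ‖Ew n τ g y‖) (closedBall (0 : Eu n) R) := hc.norm.continuousOn.integrableOn_compact (isCompact_closedBall _ _)
      exact this.mono_set ball_subset_closedBall
    · exact Eventually.of_forall fun y => norm_nonneg _
  rw [e1]
  have e3 : ∫ y, Ew n τ g y * starRingEnd ℂ (φ y) = ∫ ξ, (cexp (-(τ * I) * ‖ξ‖) * 𝓕 g ξ) * starRingEnd ℂ (𝓕 φ ξ) :=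
    pair_inv hi hφi
  rw [e3]
  have hlim : Tendsto (fun k : ℕ => Bil n (1 / ((k:ℝ) + 1)) τ g φ) atTop (nhds (∫ ξ, (cexp (-(τ * I) * ‖ξ‖) * 𝓕 g ξ) * starRingEnd ℂ (𝓕 φ ξ))) := by
    unfold Bil
    have c1 := fourier_cont hg
    have c2 := fourier_cont hφi
    apply tendsto_integral_of_dominated_convergence (fun ξ => ‖𝓕 g ξ‖ * (∫ x, ‖φ x‖))
    · intro k
      exact Continuous.aestronglyMeasurable (by fun_prop)
    · exact hg'.norm.mul_const _
    · intro k
      refine Eventually.of_forall fun ξ => ?_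
      rw [norm_mul, norm_cexp_lt, norm_mul, RCLike.norm_conj]
      have h1 := fourier_norm_le' φ ξ
      have h2 : Real.exp (-(1 / ((k:ℝ)+1) * ‖ξ‖)) ≤ 1 := by
        apply Real.exp_le_one_iff.2
        have : 0 ≤ 1 / ((k:ℝ)+1) * ‖ξ‖ := by positivity
        linarith
      calc _ ≤ 1 * (‖𝓕 g ξ‖ * (∫ x, ‖φ x‖)) := by gcongr
        _ = _ := one_mul _
    · refine Eventually.of_forall fun ξ => ?_
      rw [mul_assoc]
      apply Tendsto.mul_const
      have h1 : Tendsto (fun k : ℕ => ((1 / ((k:ℝ) + 1) : ℝ) : ℂ)) atTop (nhds ((0:ℝ):ℂ)) :=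
        (Complex.continuous_ofReal.tendsto 0).comp tendsto_one_div_add_atTop_nhds_zero_nat
      have h2 : Continuous (fun z : ℂ => cexp (-(z + τ * I) * ‖ξ‖)) := by fun_prop
      have := (h2.tendsto ((0:ℝ):ℂ)).comp h1
      simpa [Function.comp_def] using this
  refine le_of_tendsto (hlim.enorm) (Eventually.of_forall fun k => ?_)
  refine h _ τ g φ (by positivity) ?_ hτ hg hφm hφ1 hφ0
  rw [div_le_one (by positivity)]
  have : (0:ℝ) ≤ k := by positivity
  linarith

lemma eLp2 {α : Type*} [MeasurableSpace α] {μ : Measure α} (f : α → ℂ) :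
    eLpNorm f 2 μ = (∫⁻ x, ‖f x‖ₑ^2 ∂μ)^((1:ℝ)/2) := by
  rw [eLpNorm_eq_lintegral_rpow_enorm_toReal (by norm_num) (by norm_num)]
  simp

/-- completeness of L2, concrete form -/
lemma L2lim {α : Type*} [MeasurableSpace α] {μ : Measure α} (a : ℕ → α → ℂ) (ha : ∀ k, AEStronglyMeasurable (a k) μ) (A : ℝ≥0∞) (hA : A ≠ ⊤)
    (hb : ∀ k, ∫⁻ x, ‖a k x‖ₑ^2 ∂μ ≤ A) (δ : ℕ → ℝ≥0∞) (hδ : Tendsto δ atTop (nhds 0))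
    (hc : ∀ j k N, N ≤ j → N ≤ k → ∫⁻ x, ‖a j x - a k x‖ₑ^2 ∂μ ≤ δ N) :
    ∃ f : α → ℂ, StronglyMeasurable f ∧ ∫⁻ x, ‖f x‖ₑ^2 ∂μ ≤ A ∧
      Tendsto (fun k => ∫⁻ x, ‖a k x - f x‖ₑ^2 ∂μ) atTop (nhds 0) := by
  have hm : ∀ k, MemLp (a k) 2 μ := fun k => ⟨ha k, by
    rw [eLp2]; exact ENNReal.rpow_lt_top_of_nonneg (by norm_num) ((hb k).trans_lt hA.lt_top).ne⟩
  have hcau : CauchySeq (fun k => (hm k).toLp (a k)) := by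
    rw [EMetric.cauchySeq_iff_le_tendsto_0]
    refine ⟨fun N => (δ N)^((1:ℝ)/2), ?_, ?_⟩
    · intro j k N hj hk
      rw [Lp.edist_toLp_toLp, eLp2]
      exact ENNReal.rpow_le_rpow (hc j k N hj hk) (by norm_num)
    · have := (ENNReal.continuous_rpow_const (y := (1:ℝ)/2)).tendsto 0
      rw [ENNReal.zero_rpow_of_pos (by norm_num)] at this
      exact this.comp hδ
  obtain ⟨f, hf⟩ := cauchySeq_tendsto_of_complete hcau
  refine ⟨f, Lp.stronglyMeasurable f, ?_, ?_⟩
  · have h1 := hf.enorm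
    have h2 : ‖f‖ₑ ≤ A^((1:ℝ)/2) := by
      refine le_of_tendsto h1 (Eventually.of_forall fun k => ?_)
      rw [Lp.enorm_toLp, eLp2]
      gcongr
      exact hb k
    rw [Lp.enorm_def, eLp2] at h2
    exact (ENNReal.rpow_le_rpow_iff (by norm_num)).1 h2
  · have h1 := (Lp.tendsto_Lp_iff_tendsto_eLpNorm' _ _).1 hf
    have h2 : ∀ k, ∫⁻ x, ‖a k x - f x‖ₑ^2 ∂μ = (eLpNorm (((hm k).toLp (a k) : α → ℂ) - (f : α → ℂ)) 2 μ)^(2:ℝ) := by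
      intro k
      rw [eLp2, ← ENNReal.rpow_mul]; norm_num
      apply lintegral_congr_ae
      filter_upwards [(hm k).coeFn_toLp] with x hx
      rw [hx]
    simp_rw [h2]
    have := (ENNReal.continuous_rpow_const (y := (2:ℝ))).tendsto 0
    rw [ENNReal.zero_rpow_of_pos (by norm_num)] at this
    exact this.comp h1

/-- good times -/
def Es (n : ℕ) (G : Eu n × ℝ → ℂ) (k : ℕ) : Set ℝ :=
  {s | ∫⁻ x, ‖G (x, s)‖ₑ ≤ k ∧ ∫⁻ ξ, ‖𝓕 (fun x => G (x, s)) ξ‖ₑ ≤ k}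

/-- truncation of G to good times -/
def Gk (n : ℕ) (G : Eu n × ℝ → ℂ) (k : ℕ) (z : Eu n × ℝ) : ℂ := (Es n G k).indicator (fun s => G (z.1, s)) z.2

/-- standing hypotheses on G -/
structure Gok (n : ℕ) (G : Eu n × ℝ → ℂ) (R : ℝ) : Prop where
  cont : Continuous G
  int : ∀ s, Integrable (fun x => G (x, s))
  fint : ∀ s, Integrable (𝓕 (fun x => G (x, s)))
  supp : ∀ x s, R < |s| → G (x, s) = 0

lemma Es_meas {n : ℕ} {G : Eu n × ℝ → ℂ} {R : ℝ} (h : Gok n G R) (k : ℕ) : MeasurableSet (Es n G k) := by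
  have m1 : Measurable (fun s : ℝ => ∫⁻ x, ‖G (x, s)‖ₑ) :=
    h.cont.measurable.enorm.lintegral_prod_left'
  have m2 : Measurable (fun s : ℝ => ∫⁻ ξ, ‖𝓕 (fun x => G (x, s)) ξ‖ₑ) :=
    (slice_meas h.cont.stronglyMeasurable).enorm.lintegral_prod_left'
  exact (measurableSet_le m1 measurable_const).inter (measurableSet_le m2 measurable_const)

lemma Es_mono {n : ℕ} (G : Eu n × ℝ → ℂ) : Monotone (Es n G) := by
  intro j k hjk s hs
  have : (j:ℝ≥0∞) ≤ k := by exact_mod_cast hjk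
  exact ⟨hs.1.trans this, hs.2.trans this⟩

lemma Es_ev {n : ℕ} {G : Eu n × ℝ → ℂ} {R : ℝ} (h : Gok n G R) (s : ℝ) : ∃ k, s ∈ Es n G k := by
  obtain ⟨k1, h1⟩ := ENNReal.exists_nat_gt (r := ∫⁻ x, ‖G (x, s)‖ₑ) (h.int s).2.ne
  obtain ⟨k2, h2⟩ := ENNReal.exists_nat_gt (r := ∫⁻ ξ, ‖𝓕 (fun x => G (x, s)) ξ‖ₑ) (h.fint s).2.ne
  refine ⟨max k1 k2, h1.le.trans ?_, h2.le.trans ?_⟩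
  · exact_mod_cast le_max_left _ _
  · exact_mod_cast le_max_right _ _

lemma G_bound {n : ℕ} {G : Eu n × ℝ → ℂ} {R : ℝ} (h : Gok n G R) (k : ℕ) {s : ℝ} (hs : s ∈ Es n G k) (x : Eu n) :
    ‖G (x, s)‖ ≤ k := by
  have hc : Continuous (fun x => G (x, s)) := h.cont.comp (by fun_prop)
  have e := congrFun (hc.fourierInv_fourier_eq (h.int s) (h.fint s)) x
  have e1 : G (x, s) = 𝓕⁻ (𝓕 (fun x => G (x, s))) x := e.symm
  have h1 : ‖G (x, s)‖ₑ ≤ k := by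
    rw [e1, Real.fourierInv_eq_fourier_neg]
    exact (fourier_norm_le _ _).trans hs.2
  rw [← ofReal_norm] at h1
  have := ENNReal.ofReal_le_iff_le_toReal (a := ‖G (x,s)‖) (b := k) (by finiteness)
  simpa using this.1 h1

lemma Gk_sm {n : ℕ} {G : Eu n × ℝ → ℂ} {R : ℝ} (h : Gok n G R) (k : ℕ) : StronglyMeasurable (Gk n G k) := by
  have : Gk n G k = (Prod.snd ⁻¹' (Es n G k)).indicator G := by
    ext z; unfold Gk
    by_cases hz : z.2 ∈ Es n G k
    · rw [Set.indicator_of_mem hz, Set.indicator_of_mem (by exact hz)]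
    · rw [Set.indicator_of_notMem hz, Set.indicator_of_notMem (by exact hz)]
  rw [this]
  exact h.cont.stronglyMeasurable.indicator ((Es_meas h k).preimage measurable_snd)

lemma Gk_le {n : ℕ} {G : Eu n × ℝ → ℂ} {R : ℝ} (h : Gok n G R) (k : ℕ) (z : Eu n × ℝ) : ‖Gk n G k z‖ ≤ k := by
  unfold Gk
  by_cases hz : z.2 ∈ Es n G k
  · rw [Set.indicator_of_mem hz]; exact G_bound h k hz _
  · rw [Set.indicator_of_notMem hz]; simp

lemma Gk_slice {n : ℕ} (G : Eu n × ℝ → ℂ) (k : ℕ) (s : ℝ) (ξ : Eu n) :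
    𝓕 (fun x => Gk n G k (x, s)) ξ = (Es n G k).indicator (fun s => 𝓕 (fun x => G (x, s)) ξ) s := by
  by_cases hz : s ∈ Es n G k
  · simp only [Gk, Set.indicator_of_mem hz]
  · simp only [Gk, Set.indicator_of_notMem hz]
    rw [Real.fourier_eq]; simp

lemma Gk_supp {n : ℕ} {G : Eu n × ℝ → ℂ} {R : ℝ} (h : Gok n G R) (k : ℕ) (x : Eu n) (s : ℝ) (hs : R < |s|) : Gk n G k (x, s) = 0 := by
  unfold Gk
  by_cases hz : s ∈ Es n G k
  · rw [Set.indicator_of_mem hz]; exact h.supp _ _ hs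
  · rw [Set.indicator_of_notMem hz]

lemma Gk_lint {n : ℕ} {G : Eu n × ℝ → ℂ} {R : ℝ} (h : Gok n G R) (k : ℕ) (s : ℝ) :
    ∫⁻ x, ‖Gk n G k (x, s)‖ₑ ≤ (Set.Icc (-R) R).indicator (fun _ => (k:ℝ≥0∞)) s := by
  by_cases hs : R < |s|
  · simp only [Gk_supp h k _ s hs]; simp
  · have : s ∈ Set.Icc (-R) R := by rw [Set.mem_Icc, ← abs_le]; exact not_lt.1 hs
    rw [Set.indicator_of_mem this]
    by_cases hz : s ∈ Es n G k
    · simp only [Gk, Set.indicator_of_mem hz]; exact hz.1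
    · simp only [Gk, Set.indicator_of_notMem hz]; simp

lemma Gk_int {n : ℕ} {G : Eu n × ℝ → ℂ} {R : ℝ} (h : Gok n G R) (k : ℕ) : Integrable (Gk n G k) := by
  refine ⟨(Gk_sm h k).aestronglyMeasurable, ?_⟩
  unfold HasFiniteIntegral
  have hm : Measurable (fun z => ‖Gk n G k z‖ₑ) := (Gk_sm h k).measurable.enorm
  rw [Measure.volume_eq_prod, lintegral_prod_symm _ hm.aemeasurable]
  refine (lintegral_mono (Gk_lint h k)).trans_lt ?_
  rw [lintegral_indicator measurableSet_Icc]
  simp only [lintegral_const, Measure.restrict_apply_univ, Real.volume_Icc]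
  exact ENNReal.mul_lt_top (by simp) (by simp)

/-- time reflection -/
def tR (n : ℕ) (F : Eu n × ℝ → ℂ) (z : Eu n × ℝ) : ℂ := F (z.1, -z.2)

lemma tR_sm {n : ℕ} {F : Eu n × ℝ → ℂ} (h : StronglyMeasurable F) : StronglyMeasurable (tR n F) :=
  h.comp_measurable (by fun_prop)

lemma tR_mp (n : ℕ) : MeasurePreserving (fun z : Eu n × ℝ => (z.1, -z.2)) volume volume := by
  rw [Measure.volume_eq_prod]
  exact (MeasurePreserving.id volume).prod (Measure.measurePreserving_neg volume)

lemma tR_int {n : ℕ} {F : Eu n × ℝ → ℂ} (h : Integrable F) : Integrable (tR n F) :=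
  (tR_mp n).integrable_comp_of_integrable h

lemma tR_mixSq {n : ℕ} (q' r' : ℝ) (F : Eu n × ℝ → ℂ) : mixSq n q' r' (tR n F) = mixSq n q' r' F := by
  unfold mixSq tR
  congr 1
  exact lintegral_neg_eq_self (μ := volume) (fun t : ℝ => (∫⁻ x, ‖F (x, t)‖ₑ^r')^(q'/r'))

lemma Amp_sub {n : ℕ} {F G : Eu n × ℝ → ℂ} (hF : Integrable F) (hG : Integrable G) (ξ : Eu n) :
    Amp n (fun z => F z - G z) ξ = Amp n F ξ - Amp n G ξ := by
  unfold Amp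
  rw [← integral_sub (Amp_integrable hF ξ) (Amp_integrable hG ξ)]
  congr 1; ext z; ring

/-- slice norm to the power -/
def Xs (n : ℕ) (q' r' : ℝ) (G : Eu n × ℝ → ℂ) (t : ℝ) : ℝ≥0∞ := (∫⁻ x, ‖G (x, t)‖ₑ^r')^(q'/r')

lemma Xs_meas {n : ℕ} (q' r' : ℝ) {G : Eu n × ℝ → ℂ} (hG : Measurable G) : Measurable (Xs n q' r' G) := by
  unfold Xs
  have : Measurable (fun t : ℝ => ∫⁻ x, ‖G (x, t)‖ₑ^r') :=
    (hG.enorm.pow_const r').lintegral_prod_left'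
  exact this.pow_const _

/-- tail of the mixed norm -/
def dl (n : ℕ) (q' r' : ℝ) (G : Eu n × ℝ → ℂ) (N : ℕ) : ℝ≥0∞ := (∫⁻ t, (Es n G N)ᶜ.indicator (Xs n q' r' G) t)^(2/q')

lemma mixSq_fin {n : ℕ} {q' r' : ℝ} (hq' : 1 < q') {G : Eu n × ℝ → ℂ} (hm : mixSq n q' r' G ≠ ⊤) : ∫⁻ t, Xs n q' r' G t ≠ ⊤ := by
  intro h
  apply hm
  unfold mixSq
  unfold Xs at h
  rw [h]
  exact ENNReal.top_rpow_of_pos (by positivity)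

lemma tail_tendsto {n : ℕ} {G : Eu n × ℝ → ℂ} {R : ℝ} (h : Gok n G R) (X : ℝ → ℝ≥0∞) (hX : Measurable X) (hf : ∫⁻ t, X t ≠ ⊤) :
    Tendsto (fun N => ∫⁻ t, (Es n G N)ᶜ.indicator X t) atTop (nhds 0) := by
  have := tendsto_lintegral_of_dominated_convergence (μ := volume) (F := fun N t => (Es n G N)ᶜ.indicator X t) (f := fun _ => 0) X
    (fun N => hX.indicator (Es_meas h N).compl) (fun N => Eventually.of_forall fun t => Set.indicator_le_self _ _ t) hf
    (Eventually.of_forall fun t => by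
      obtain ⟨k, hk⟩ := Es_ev h t
      apply tendsto_const_nhds.congr'
      filter_upwards [Filter.eventually_ge_atTop k] with N hN
      rw [Set.indicator_of_notMem]
      exact fun hh => hh (Es_mono G hN hk))
  simpa using this

lemma dl_tendsto {n : ℕ} {q' r' : ℝ} (hq' : 1 < q') {G : Eu n × ℝ → ℂ} {R : ℝ} (h : Gok n G R) (hm : mixSq n q' r' G ≠ ⊤) :
    Tendsto (dl n q' r' G) atTop (nhds 0) := by
  have h1 := tail_tendsto h _ (Xs_meas q' r' h.cont.measurable) (mixSq_fin hq' hm)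
  have := (ENNReal.continuous_rpow_const (y := 2/q')).tendsto 0
  rw [ENNReal.zero_rpow_of_pos (by positivity)] at this
  exact this.comp h1

lemma Gk_mix {n : ℕ} {q' r' : ℝ} (hq' : 1 < q') (hr' : 1 < r') (G : Eu n × ℝ → ℂ) (k : ℕ) :
    mixSq n q' r' (Gk n G k) ≤ mixSq n q' r' G := by
  unfold mixSq
  gcongr with t x
  unfold Gk
  dsimp only
  by_cases hz : t ∈ Es n G k
  · rw [Set.indicator_of_mem hz]
  · rw [Set.indicator_of_notMem hz]; simp

lemma Gk_mix_sub {n : ℕ} {q' r' : ℝ} (hq' : 1 < q') (hr' : 1 < r') (G : Eu n × ℝ → ℂ) (j k N : ℕ) (hj : N ≤ j) (hk : N ≤ k) :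
    mixSq n q' r' (fun z => Gk n G j z - Gk n G k z) ≤ dl n q' r' G N := by
  unfold mixSq dl
  gcongr with t
  by_cases hz : t ∈ Es n G N
  · have e1 : ∀ x, Gk n G j (x, t) - Gk n G k (x, t) = 0 := by
      intro x; unfold Gk; dsimp only
      rw [Set.indicator_of_mem (Es_mono G hj hz), Set.indicator_of_mem (Es_mono G hk hz), sub_self]
    simp only [e1, enorm_zero]
    rw [ENNReal.zero_rpow_of_pos (by linarith), lintegral_zero, ENNReal.zero_rpow_of_pos (by positivity)]
    exact zero_le
  · rw [Set.indicator_of_mem (by exact hz)]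
    unfold Xs
    gcongr with x
    unfold Gk; dsimp only
    by_cases h1 : t ∈ Es n G j <;> by_cases h2 : t ∈ Es n G k <;> simp [h1, h2]

lemma rpow_half_sq {n : ℕ} (γ : ℝ) (a : ℂ) (ξ : Eu n) :
    ‖((‖ξ‖^γ : ℝ) : ℂ) * a‖ₑ^2 = ENNReal.ofReal (‖ξ‖^(2*γ)) * ‖a‖ₑ^2 := by
  rw [enorm_mul, mul_pow]
  congr 1
  rw [← ofReal_norm, Complex.norm_real, Real.norm_of_nonneg (by positivity), ← ENNReal.ofReal_pow (by positivity)]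
  congr 1
  rw [mul_comm, Real.rpow_mul (norm_nonneg _), Real.rpow_two]

/-- L2 limits of weighted amplitudes -/
lemma famp (n : ℕ) (hn : 1 ≤ n) (q r q' r' : ℝ) (hq : 2 ≤ q) (hr : 2 < r) (hadm : 2/q + ((n:ℝ)-1)/r ≤ ((n:ℝ)-1)/2)
    (hq' : 1/q + 1/q' = 1) (hr' : 1/r + 1/r' = 1) :
    ∃ C : ℝ≥0∞, C ≠ ⊤ ∧ ∀ (G : Eu n × ℝ → ℂ) (R : ℝ), Gok n G R → mixSq n q' r' G ≠ ⊤ →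
      (∃ f : Eu n → ℂ, StronglyMeasurable f ∧ ∫⁻ ξ, ‖f ξ‖ₑ^2 ≤ C * mixSq n q' r' G ∧
        Tendsto (fun k => ∫⁻ ξ, ‖((‖ξ‖^(1/q + n/r - n/2) : ℝ):ℂ) * Amp n (Gk n G k) ξ - f ξ‖ₑ^2) atTop (nhds 0)) ∧
      (∃ f : Eu n → ℂ, StronglyMeasurable f ∧ ∫⁻ ξ, ‖f ξ‖ₑ^2 ≤ C * mixSq n q' r' G ∧
        Tendsto (fun k => ∫⁻ ξ, ‖((‖ξ‖^(1/q + n/r - n/2) : ℝ):ℂ) * Amp n (tR n (Gk n G k)) ξ - f ξ‖ₑ^2) atTop (nhds 0)) := by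
  obtain ⟨C, hC, h⟩ := LPB n hn q r q' r' hq hr hadm hq' hr'
  obtain ⟨q1, q2⟩ := conj_range q q' hq hq'
  obtain ⟨r1, r2⟩ := conj_range r r' hr.le hr'
  refine ⟨C, hC, fun G R hG hm => ?_⟩
  have eγ : 2 * (1/q + (n:ℝ)/r - n/2) = 2/q + 2*n/r - n := by ring
  have key : ∀ F : ℕ → Eu n × ℝ → ℂ, (∀ k, StronglyMeasurable (F k)) → (∀ k, Integrable (F k)) → (∀ k z, ‖F k z‖ ≤ k) →
      (∀ k, mixSq n q' r' (F k) ≤ mixSq n q' r' G) →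
      (∀ j k N, N ≤ j → N ≤ k → mixSq n q' r' (fun z => F j z - F k z) ≤ dl n q' r' G N) →
      (∃ f : Eu n → ℂ, StronglyMeasurable f ∧ ∫⁻ ξ, ‖f ξ‖ₑ^2 ≤ C * mixSq n q' r' G ∧
        Tendsto (fun k => ∫⁻ ξ, ‖((‖ξ‖^(1/q + n/r - n/2) : ℝ):ℂ) * Amp n (F k) ξ - f ξ‖ₑ^2) atTop (nhds 0)) := by
    intro F hF1 hF2 hF3 hF4 hF5
    apply L2lim (fun k ξ => ((‖ξ‖^(1/q + n/r - n/2) : ℝ):ℂ) * Amp n (F k) ξ) _ (C * mixSq n q' r' G) (by finiteness) _ (fun N => C * dl n q' r' G N)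
    · have := ENNReal.Tendsto.const_mul (a := C) (dl_tendsto q1 hG hm) (Or.inr hC)
      simpa using this
    · intro j k N hj hk
      simp only [← mul_sub, rpow_half_sq, eγ]
      refine le_trans (le_of_eq ?_) ((h (fun z => F j z - F k z) (j + k) ((hF1 j).sub (hF1 k)) ((hF2 j).sub (hF2 k)) ?_).trans (mul_le_mul_right (hF5 j k N hj hk) C))
      · apply lintegral_congr; intro ξ; rw [Amp_sub (hF2 j) (hF2 k)]
      · intro z; exact (norm_sub_le _ _).trans (add_le_add (hF3 j z) (hF3 k z))
    · intro k
      have m1 : Measurable (fun ξ : Eu n => ((‖ξ‖^(1/q + n/r - n/2) : ℝ):ℂ)) := by fun_prop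
      exact (m1.mul (Amp_cont (hF2 k)).measurable).aestronglyMeasurable
    · intro k
      simp only [rpow_half_sq, eγ]
      exact (h (F k) k (hF1 k) (hF2 k) (hF3 k)).trans (mul_le_mul_right (hF4 k) C)
  constructor
  · exact key (Gk n G) (Gk_sm hG) (Gk_int hG) (Gk_le hG) (Gk_mix q1 r1 G) (Gk_mix_sub q1 r1 G)
  · refine key (fun k => tR n (Gk n G k)) (fun k => tR_sm (Gk_sm hG k)) (fun k => tR_int (Gk_int hG k)) (fun k z => Gk_le hG k _) ?_ ?_
    · intro k; rw [tR_mixSq]; exact Gk_mix q1 r1 G k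
    · intro j k N hj hk
      have : (fun z => tR n (Gk n G j) z - tR n (Gk n G k) z) = tR n (fun z => Gk n G j z - Gk n G k z) := rfl
      rw [this, tR_mixSq]; exact Gk_mix_sub q1 r1 G j k N hj hk

/-- sine propagator applied to slice s -/
def Sw (n : ℕ) (G : Eu n × ℝ → ℂ) (t s : ℝ) (y : Eu n) : ℂ :=
  𝓕⁻ (fun ξ : Eu n => ((Real.sin ((t - s) * ‖ξ‖) : ℝ) : ℂ) * 𝓕 (fun z => G (z, s)) ξ) y

/-- Duhamel integral -/
def Ft (n : ℕ) (G : Eu n × ℝ → ℂ) (t : ℝ) (y : Eu n) : ℂ := ∫ s, Sw n G t s y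

lemma Sw_sm {n : ℕ} {G : Eu n × ℝ → ℂ} (hG : StronglyMeasurable G) :
    StronglyMeasurable (fun v : (ℝ × Eu n) × ℝ => Sw n G v.1.1 v.2 v.1.2) := by
  unfold Sw
  simp_rw [Real.fourierInv_eq']
  have : StronglyMeasurable (fun u : ((ℝ × Eu n) × ℝ) × Eu n => cexp (↑(2 * Real.pi * inner ℝ u.2 u.1.1.2) * I) • (((Real.sin ((u.1.1.1 - u.1.2) * ‖u.2‖) : ℝ) : ℂ) * 𝓕 (fun z => G (z, u.1.2)) u.2)) := by
    have h1 : StronglyMeasurable (fun u : ((ℝ × Eu n) × ℝ) × Eu n => cexp (↑(2 * Real.pi * inner ℝ u.2 u.1.1.2) * I)) :=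
      Continuous.stronglyMeasurable (by fun_prop)
    have h2 : StronglyMeasurable (fun u : ((ℝ × Eu n) × ℝ) × Eu n => ((Real.sin ((u.1.1.1 - u.1.2) * ‖u.2‖) : ℝ) : ℂ)) :=
      Continuous.stronglyMeasurable (by fun_prop)
    have h3 : StronglyMeasurable (fun u : ((ℝ × Eu n) × ℝ) × Eu n => 𝓕 (fun z => G (z, u.1.2)) u.2) :=
      (slice_meas hG).comp_measurable (g := fun u : ((ℝ × Eu n) × ℝ) × Eu n => (u.2, u.1.2)) (by fun_prop)
    exact h1.smul (h2.mul h3)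
  exact this.integral_prod_right' (ν := (volume : Measure (Eu n)))

lemma Ft_sm {n : ℕ} {G : Eu n × ℝ → ℂ} (hG : StronglyMeasurable G) :
    StronglyMeasurable (fun v : ℝ × Eu n => Ft n G v.1 v.2) :=
  (Sw_sm hG).integral_prod_right' (ν := (volume : Measure ℝ))

lemma Sw_smt {n : ℕ} {G : Eu n × ℝ → ℂ} (hG : StronglyMeasurable G) (t : ℝ) :
    StronglyMeasurable (fun v : Eu n × ℝ => Sw n G t v.2 v.1) :=
  (Sw_sm hG).comp_measurable (g := fun v : Eu n × ℝ => ((t, v.1), v.2)) (by fun_prop)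

lemma sin_exp (a r : ℝ) : ((Real.sin (a * r) : ℝ) : ℂ) = (I/2) * (cexp (-(a * I) * r) - cexp (-((-a : ℝ) * I) * r)) := by
  push_cast
  rw [Complex.sin]
  have e1 : -(a * r : ℂ) * I = -(a * I) * r := by ring
  have e2 : (a * r : ℂ) * I = -(-a * I) * r := by ring
  rw [e1, e2]; ring

lemma fourierInv_add' {n : ℕ} {f g : Eu n → ℂ} (hf : Integrable f) (hg : Integrable g) (c : ℂ) (x : Eu n) :
    𝓕⁻ (fun ξ => c * (f ξ - g ξ)) x = c * (𝓕⁻ f x - 𝓕⁻ g x) := by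
  rw [Real.fourierInv_eq', Real.fourierInv_eq', Real.fourierInv_eq', ← integral_sub, ← integral_const_mul]
  · congr 1; ext ξ; simp only [smul_eq_mul]; ring
  · refine hf.bdd_mul (c := 1) (Continuous.aestronglyMeasurable (by fun_prop)) (Eventually.of_forall fun w => ?_)
    rw [Complex.norm_exp_ofReal_mul_I]
  · refine hg.bdd_mul (c := 1) (Continuous.aestronglyMeasurable (by fun_prop)) (Eventually.of_forall fun w => ?_)
    rw [Complex.norm_exp_ofReal_mul_I]

lemma Sw_eq {n : ℕ} {G : Eu n × ℝ → ℂ} {R : ℝ} (h : Gok n G R) (t s : ℝ) (y : Eu n) :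
    Sw n G t s y = (I/2) * (Ew n (t - s) (fun z => G (z, s)) y - Ew n (-(t - s)) (fun z => G (z, s)) y) := by
  unfold Sw Ew
  rw [← fourierInv_add' (Ew_integrable _ (h.fint s)) (Ew_integrable _ (h.fint s))]
  have : (fun ξ : Eu n => ((Real.sin ((t - s) * ‖ξ‖) : ℝ) : ℂ) * 𝓕 (fun z => G (z, s)) ξ) = fun ξ : Eu n =>
      (I/2) * (cexp (-((t - s : ℝ) * I) * ‖ξ‖) * 𝓕 (fun z => G (z, s)) ξ - cexp (-((-(t - s) : ℝ) * I) * ‖ξ‖) * 𝓕 (fun z => G (z, s)) ξ) := by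
    ext ξ
    rw [sin_exp]; ring
  rw [this]

lemma Sw_supp {n : ℕ} {G : Eu n × ℝ → ℂ} {R : ℝ} (h : Gok n G R) (t s : ℝ) (hs : R < |s|) (y : Eu n) :
    Sw n G t s y = 0 := by
  unfold Sw
  have : (fun z => G (z, s)) = fun _ => 0 := by ext z; exact h.supp z s hs
  rw [this, Real.fourierInv_eq]
  have e : ∀ ξ : Eu n, 𝓕 (fun _ : Eu n => (0:ℂ)) ξ = 0 := by intro ξ; rw [Real.fourier_eq]; simp
  simp [e]

lemma wt_holder (n : ℕ) (r r' : ℝ) (hr : 2 < r) (hr' : 1/r + 1/r' = 1) : ∃ A : ℝ≥0∞, A ≠ ⊤ ∧ ∀ g : Eu n → ℂ, Measurable g →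
    ∫⁻ x, ENNReal.ofReal ((1 + ‖x‖)^(-((n:ℝ)+1))) * ‖g x‖ₑ ≤ A * (∫⁻ x, ‖g x‖ₑ^r')^(1/r') := by
  have hi : Integrable (fun x : Eu n => (1 + ‖x‖)^(-((n:ℝ)+1))) :=
    integrable_one_add_norm (by simp)
  have hm : Measurable (fun x : Eu n => ENNReal.ofReal ((1 + ‖x‖)^(-((n:ℝ)+1)))) := by fun_prop
  refine ⟨(∫⁻ x : Eu n, ENNReal.ofReal ((1 + ‖x‖)^(-((n:ℝ)+1)))^r)^(1/r), ?_, fun g hg => ?_⟩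
  · apply ENNReal.rpow_ne_top_of_nonneg (by positivity)
    refine ne_top_of_le_ne_top hi.lintegral_lt_top.ne (lintegral_mono fun x => ?_)
    dsimp only
    have h1 : ENNReal.ofReal ((1 + ‖x‖)^(-((n:ℝ)+1))) ≤ 1 := by
      apply ENNReal.ofReal_le_one.2
      apply Real.rpow_le_one_of_one_le_of_nonpos
      · linarith [norm_nonneg x]
      · have : (0:ℝ) ≤ n := by positivity
        linarith
    calc _ ≤ ENNReal.ofReal ((1 + ‖x‖)^(-((n:ℝ)+1)))^(1:ℝ) := ENNReal.rpow_le_rpow_of_exponent_ge h1 (by linarith)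
      _ = _ := ENNReal.rpow_one _
  · have hc : r.HolderConjugate r' := by
      rw [Real.holderConjugate_iff]
      refine ⟨by linarith, ?_⟩
      rw [← hr']; ring
    exact ENNReal.lintegral_mul_le_Lp_mul_Lq volume hc hm.aemeasurable hg.enorm.aemeasurable

set_option maxHeartbeats 1000000 in
lemma loc_int {n : ℕ} (hn : 1 ≤ n) {r q' r' : ℝ} (hr : 2 < r) (hr' : 1/r + 1/r' = 1) (hq1 : 1 < q') {G : Eu n × ℝ → ℂ} {R : ℝ} (h : Gok n G R)
    (hm : mixSq n q' r' G ≠ ⊤) (t ρ : ℝ) (hρ : 0 < ρ) :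
    ∫⁻ s, ∫⁻ y in ball (0 : Eu n) ρ, ‖Sw n G t s y‖ₑ ≠ ⊤ := by
  obtain ⟨r1, r2⟩ := conj_range r r' hr.le hr'
  obtain ⟨C, hC, hE⟩ := Ew_loc n hn ρ (|t| + |R|) hρ (by positivity)
  obtain ⟨A, hA, hH⟩ := wt_holder n r r' hr hr'
  set N := 2 * ρ + 2 * (|t| + |R|) + 1 with hN
  obtain ⟨K, hK⟩ := ((isCompact_closedBall (0 : Eu n) N).prod (isCompact_Icc (a := -R) (b := R))).exists_bound_of_continuousOn h.cont.continuousOn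
  set D := ((ENNReal.ofReal K)^2 * volume (ball (0 : Eu n) N))^((1:ℝ)/2) with hD
  have hDt : D ≠ ⊤ := by
    apply ENNReal.rpow_ne_top_of_nonneg (by norm_num)
    exact ENNReal.mul_ne_top (by finiteness) measure_ball_lt_top.ne
  have hle : ∀ s, ∫⁻ y in ball (0 : Eu n) ρ, ‖Sw n G t s y‖ₑ ≤ (Set.Icc (-R) R).indicator (fun s => 2 * C * (D + A * (1 + Xs n q' r' G s))) s := by
    intro s
    by_cases hs : R < |s|
    · simp only [Sw_supp h t s hs]; simp
    · have hs' : |s| ≤ R := not_lt.1 hs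
      have hsm : s ∈ Set.Icc (-R) R := by rw [Set.mem_Icc, ← abs_le]; exact hs'
      rw [Set.indicator_of_mem hsm]
      have hts : |t - s| ≤ |t| + |R| := (abs_sub _ _).trans (by linarith [le_abs_self R])
      have b0 : (∫⁻ x in ball (0 : Eu n) N, ‖G (x, s)‖ₑ^2)^((1:ℝ)/2) + ∫⁻ x, ENNReal.ofReal ((1 + ‖x‖)^(-((n:ℝ)+1))) * ‖G (x, s)‖ₑ
          ≤ D + A * (1 + Xs n q' r' G s) := by
        gcongr ?_ + ?_
        · apply ENNReal.rpow_le_rpow _ (by norm_num)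
          calc ∫⁻ x in ball (0 : Eu n) N, ‖G (x, s)‖ₑ^2 ≤ ∫⁻ x in ball (0 : Eu n) N, (ENNReal.ofReal K)^2 := by
                apply setLIntegral_mono' measurableSet_ball
                intro x hx
                have := hK (x, s) ⟨ball_subset_closedBall hx, hsm⟩
                rw [← ofReal_norm]; gcongr
            _ = _ := by simp
        · refine (hH (fun x => G (x, s)) (h.cont.measurable.comp (by fun_prop))).trans ?_
          gcongr
          unfold Xs
          set Y := ∫⁻ x, ‖G (x, s)‖ₑ^r'
          rcases le_total Y 1 with hY | hY
          · exact (ENNReal.rpow_le_one hY (by positivity)).trans le_self_add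
          · refine le_trans ?_ le_add_self
            apply ENNReal.rpow_le_rpow_of_exponent_le hY
            gcongr
      have b1 := hE (t - s) (fun z => G (z, s)) hts (h.int s) (h.fint s)
      have b2 := hE (-(t - s)) (fun z => G (z, s)) (by rwa [abs_neg]) (h.int s) (h.fint s)
      have mE : ∀ τ, Measurable (fun y => ‖Ew n τ (fun z => G (z, s)) y‖ₑ) := fun τ =>
        (fourierInv_cont (Ew_integrable τ (h.fint s))).measurable.enorm
      calc ∫⁻ y in ball (0 : Eu n) ρ, ‖Sw n G t s y‖ₑ
          ≤ ∫⁻ y in ball (0 : Eu n) ρ, (‖Ew n (t - s) (fun z => G (z, s)) y‖ₑ + ‖Ew n (-(t - s)) (fun z => G (z, s)) y‖ₑ) := by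
            apply lintegral_mono; intro y
            dsimp only
            rw [Sw_eq h, enorm_mul]
            have : ‖(I/2 : ℂ)‖ₑ ≤ 1 := by
              rw [← ofReal_norm]; apply ENNReal.ofReal_le_one.2; simp; norm_num
            calc _ ≤ 1 * ‖Ew n (t - s) (fun z => G (z, s)) y - Ew n (-(t - s)) (fun z => G (z, s)) y‖ₑ := by gcongr
              _ ≤ _ := by rw [one_mul]; exact enorm_sub_le
        _ = (∫⁻ y in ball (0 : Eu n) ρ, ‖Ew n (t - s) (fun z => G (z, s)) y‖ₑ) + ∫⁻ y in ball (0 : Eu n) ρ, ‖Ew n (-(t - s)) (fun z => G (z, s)) y‖ₑ :=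
            lintegral_add_left (mE _) _
        _ ≤ C * (D + A * (1 + Xs n q' r' G s)) + C * (D + A * (1 + Xs n q' r' G s)) := by
            gcongr
            · exact b1.trans (mul_le_mul_right b0 C)
            · exact b2.trans (mul_le_mul_right b0 C)
        _ = _ := by ring
  refine ne_top_of_le_ne_top ?_ (lintegral_mono hle)
  rw [lintegral_indicator measurableSet_Icc]
  have hXm := Xs_meas q' r' h.cont.measurable
  have f1 : ∫⁻ a in Set.Icc (-R) R, Xs n q' r' G a ≠ ⊤ := ne_top_of_le_ne_top (mixSq_fin hq1 hm) (setLIntegral_le_lintegral _ _)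
  have f2 : ∀ c : ℝ≥0∞, c ≠ ⊤ → ∫⁻ _ in Set.Icc (-R) R, c ≠ ⊤ := by
    intro c hc
    simp only [lintegral_const, Measure.restrict_apply_univ, Real.volume_Icc]
    finiteness
  rw [lintegral_const_mul _ (by fun_prop), lintegral_add_left measurable_const, lintegral_const_mul _ (by fun_prop), lintegral_add_left measurable_const]
  have f3 := f2 D hDt
  have f4 := f2 1 (by simp)
  finiteness

lemma sin_int {n : ℕ} {g : Eu n → ℂ} (τ : ℝ) (hg : Integrable g) :
    Integrable (fun ξ : Eu n => ((Real.sin (τ * ‖ξ‖) : ℝ) : ℂ) * g ξ) := by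
  refine hg.bdd_mul (c := 1) (Continuous.aestronglyMeasurable (by fun_prop)) (Eventually.of_forall fun w => ?_)
  rw [Complex.norm_real]; exact Real.abs_sin_le_one _

set_option maxHeartbeats 1000000 in
/-- pairing of the Duhamel integral with test functions -/
lemma pairF {n : ℕ} (hn : 1 ≤ n) {r q' r' : ℝ} (hr : 2 < r) (hr' : 1/r + 1/r' = 1) (hq1 : 1 < q') {G : Eu n × ℝ → ℂ} {R : ℝ} (h : Gok n G R)
    (hm : mixSq n q' r' G ≠ ⊤) (t ρ M : ℝ) (hρ : 0 < ρ) (φ : Eu n → ℂ) (hφ : Integrable φ) (hφM : ∀ x, ‖φ x‖ ≤ M) (hφ0 : ∀ y, ρ ≤ ‖y‖ → φ y = 0) :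
    Tendsto (fun k => ∫ ξ, (∫ s, ((Real.sin ((t - s) * ‖ξ‖) : ℝ) : ℂ) * 𝓕 (fun x => Gk n G k (x, s)) ξ) * starRingEnd ℂ (𝓕 φ ξ))
      atTop (nhds (∫ y, Ft n G t y * starRingEnd ℂ (φ y))) := by
  have hl := loc_int hn hr hr' hq1 h hm t ρ hρ
  have hsm := Sw_smt h.cont.stronglyMeasurable t
  have hφc : AEStronglyMeasurable (fun y => starRingEnd ℂ (φ y)) := ((LinearIsometryEquiv.integrable_comp_iff conjLIE).2 hφ).aestronglyMeasurable
  have hi : Integrable (fun v : Eu n × ℝ => Sw n G t v.2 v.1 * starRingEnd ℂ (φ v.1)) (volume.prod volume) := by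
    have ham : AEStronglyMeasurable (fun v : Eu n × ℝ => Sw n G t v.2 v.1 * starRingEnd ℂ (φ v.1)) (volume.prod volume) :=
      hsm.aestronglyMeasurable.mul hφc.comp_fst
    refine ⟨ham, ?_⟩
    unfold HasFiniteIntegral
    rw [lintegral_prod_symm _ ham.enorm]
    calc ∫⁻ s, ∫⁻ y, ‖Sw n G t s y * starRingEnd ℂ (φ y)‖ₑ ≤ ∫⁻ s, ENNReal.ofReal M * ∫⁻ y in ball (0 : Eu n) ρ, ‖Sw n G t s y‖ₑ := by
          apply lintegral_mono; intro s; dsimp only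
          rw [← lintegral_const_mul' _ _ (by finiteness), ← lintegral_indicator measurableSet_ball]
          apply lintegral_mono; intro y; dsimp only
          by_cases hy : y ∈ ball (0 : Eu n) ρ
          · rw [Set.indicator_of_mem hy, enorm_mul, mul_comm]
            gcongr
            rw [← ofReal_norm, RCLike.norm_conj]
            exact ENNReal.ofReal_le_ofReal (hφM y)
          · rw [hφ0 y (by simpa using hy)]; simp
      _ = ENNReal.ofReal M * ∫⁻ s, ∫⁻ y in ball (0 : Eu n) ρ, ‖Sw n G t s y‖ₑ := lintegral_const_mul' _ _ (by finiteness)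
      _ < ⊤ := by finiteness
  set c : ℝ → ℂ := fun s => ∫ y, Sw n G t s y * starRingEnd ℂ (φ y) with hc
  have e1 : ∫ y, Ft n G t y * starRingEnd ℂ (φ y) = ∫ s, c s := by
    unfold Ft
    rw [hc, ← integral_integral_swap hi]
    congr 1; ext y
    rw [integral_mul_const]
  have hci : Integrable c := hi.integral_prod_right
  have e2 : ∀ s, c s = ∫ ξ, (((Real.sin ((t - s) * ‖ξ‖) : ℝ) : ℂ) * 𝓕 (fun z => G (z, s)) ξ) * starRingEnd ℂ (𝓕 φ ξ) := by
    intro s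
    exact pair_inv (sin_int _ (h.fint s)) hφ
  have e3 : ∀ k, ∫ ξ, (∫ s, ((Real.sin ((t - s) * ‖ξ‖) : ℝ) : ℂ) * 𝓕 (fun x => Gk n G k (x, s)) ξ) * starRingEnd ℂ (𝓕 φ ξ) = ∫ s, (Es n G k).indicator c s := by
    intro k
    have hcφ := fourier_cont hφ
    have hj : Integrable (fun v : Eu n × ℝ => (((Real.sin ((t - v.2) * ‖v.1‖) : ℝ) : ℂ) * 𝓕 (fun x => Gk n G k (x, v.2)) v.1) * starRingEnd ℂ (𝓕 φ v.1)) (volume.prod volume) := by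
      have hgm := slice_meas (Gk_sm h k)
      have ham : AEStronglyMeasurable (fun v : Eu n × ℝ => (((Real.sin ((t - v.2) * ‖v.1‖) : ℝ) : ℂ) * 𝓕 (fun x => Gk n G k (x, v.2)) v.1) * starRingEnd ℂ (𝓕 φ v.1)) (volume.prod volume) := by
        apply AEStronglyMeasurable.mul
        · apply AEStronglyMeasurable.mul
          · exact Continuous.aestronglyMeasurable (by fun_prop)
          · exact hgm.aestronglyMeasurable
        · exact Continuous.aestronglyMeasurable (by fun_prop)
      refine ⟨ham, ?_⟩
      unfold HasFiniteIntegral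
      rw [lintegral_prod_symm _ ham.enorm]
      have hle : ∀ s, ∫⁻ ξ, ‖(((Real.sin ((t - s) * ‖ξ‖) : ℝ) : ℂ) * 𝓕 (fun x => Gk n G k (x, s)) ξ) * starRingEnd ℂ (𝓕 φ ξ)‖ₑ
          ≤ (Set.Icc (-R) R).indicator (fun _ => (k:ℝ≥0∞) * ∫⁻ x, ‖φ x‖ₑ) s := by
        intro s
        by_cases hs : s ∈ Set.Icc (-R) R ∧ s ∈ Es n G k
        · rw [Set.indicator_of_mem hs.1]
          calc _ ≤ ∫⁻ ξ, ‖𝓕 (fun x => G (x, s)) ξ‖ₑ * ∫⁻ x, ‖φ x‖ₑ := by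
                apply lintegral_mono; intro ξ; dsimp only
                rw [Gk_slice, Set.indicator_of_mem hs.2, enorm_mul, enorm_mul]
                have i1 : ‖((Real.sin ((t - s) * ‖ξ‖) : ℝ) : ℂ)‖ₑ ≤ 1 := by
                  rw [← ofReal_norm, Complex.norm_real]; exact ENNReal.ofReal_le_one.2 (Real.abs_sin_le_one _)
                have i2 : ‖starRingEnd ℂ (𝓕 φ ξ)‖ₑ ≤ ∫⁻ x, ‖φ x‖ₑ := by
                  rw [← ofReal_norm, RCLike.norm_conj, ofReal_norm]; exact fourier_norm_le _ _
                calc _ ≤ 1 * ‖𝓕 (fun x => G (x, s)) ξ‖ₑ * ∫⁻ x, ‖φ x‖ₑ := by gcongr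
                  _ = _ := by rw [one_mul]
            _ = (∫⁻ ξ, ‖𝓕 (fun x => G (x, s)) ξ‖ₑ) * ∫⁻ x, ‖φ x‖ₑ := lintegral_mul_const' _ _ hφ.2.ne
            _ ≤ _ := by gcongr; exact hs.2.2
        · have : ∀ ξ, 𝓕 (fun x => Gk n G k (x, s)) ξ = 0 := by
            intro ξ
            by_cases h1 : s ∈ Es n G k
            · have h2 : R < |s| := by
                by_contra h3
                exact hs ⟨by rw [Set.mem_Icc, ← abs_le]; exact not_lt.1 h3, h1⟩
              simp only [Gk_supp h k _ s h2]
              rw [Real.fourier_eq]; simp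
            · rw [Gk_slice, Set.indicator_of_notMem h1]
          simp [this]
      refine (lintegral_mono hle).trans_lt ?_
      rw [lintegral_indicator measurableSet_Icc]
      simp only [lintegral_const, Measure.restrict_apply_univ, Real.volume_Icc]
      have := hφ.2.ne
      unfold HasFiniteIntegral at this
      finiteness
    calc _ = ∫ ξ, ∫ s, (((Real.sin ((t - s) * ‖ξ‖) : ℝ) : ℂ) * 𝓕 (fun x => Gk n G k (x, s)) ξ) * starRingEnd ℂ (𝓕 φ ξ) := by
          congr 1; ext ξ; rw [integral_mul_const]
      _ = ∫ s, ∫ ξ, (((Real.sin ((t - s) * ‖ξ‖) : ℝ) : ℂ) * 𝓕 (fun x => Gk n G k (x, s)) ξ) * starRingEnd ℂ (𝓕 φ ξ) :=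
          integral_integral_swap hj
      _ = _ := by
          congr 1; ext s
          by_cases hs : s ∈ Es n G k
          · rw [Set.indicator_of_mem hs, e2]
            congr 1; ext ξ
            rw [Gk_slice, Set.indicator_of_mem hs]
          · rw [Set.indicator_of_notMem hs]
            simp_rw [Gk_slice, Set.indicator_of_notMem hs]
            simp
  simp_rw [e3, e1]
  apply tendsto_integral_of_dominated_convergence (fun s => ‖c s‖)
  · intro k; exact hci.aestronglyMeasurable.indicator (Es_meas h k)
  · exact hci.norm
  · intro k
    exact Eventually.of_forall fun s => norm_indicator_le_norm_self _ _
  · refine Eventually.of_forall fun s => ?_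
    obtain ⟨k, hk⟩ := Es_ev h s
    apply tendsto_const_nhds.congr'
    filter_upwards [Filter.eventually_ge_atTop k] with N hN
    rw [Set.indicator_of_mem (Es_mono G hN hk)]

lemma vanish {n : ℕ} {b : Eu n → ℂ} (hb : Integrable b) (h0 : ∀ z, 𝓕⁻ b z = 0) : ∀ᵐ ξ, b ξ = 0 := by
  apply ae_eq_zero_of_integral_contDiff_smul_eq_zero hb.locallyIntegrable
  intro g hg hgc
  have c1 : HasCompactSupport (fun x => (g x : ℂ)) := hgc.comp_left (g := fun r : ℝ => (r : ℂ)) (by simp)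
  have c2 : ContDiff ℝ (⊤ : ℕ∞) (fun x => (g x : ℂ)) := Complex.ofRealCLM.contDiff.comp hg
  set S : 𝓢(Eu n, ℂ) := c1.toSchwartzMap c2 with hS
  have e := pair_inv hb (𝓕⁻ S).integrable
  rw [← SchwartzMap.fourier_coe] at e
  have e2 : 𝓕 (𝓕⁻ S) = S := FourierTransform.fourier_fourierInv_eq S
  rw [e2] at e
  simp only [h0, zero_mul, integral_zero] at e
  rw [e]
  congr 1; ext x
  rw [hS, HasCompactSupport.toSchwartzMap_toFun]
  simp [mul_comm]

lemma fourier_shift {n : ℕ} (φ : Eu n → ℂ) (z ξ : Eu n) : 𝓕 (fun x => φ (x - z)) ξ = cexp (-(2 * Real.pi * inner ℝ z ξ * I)) * 𝓕 φ ξ := by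
  rw [Real.fourier_eq', Real.fourier_eq', ← integral_add_right_eq_self _ z, ← integral_const_mul]
  congr 1; ext x
  rw [add_sub_cancel_right, smul_eq_mul, smul_eq_mul, ← mul_assoc, ← Complex.exp_add]
  congr 2
  rw [inner_add_left]; push_cast; ring

lemma bump_ex {n : ℕ} (ε : ℝ) (hε : 0 < ε) : ∃ f : Eu n → ℝ, ContDiff ℝ (⊤ : ℕ∞) f ∧ HasCompactSupport f ∧ (∀ x, 0 ≤ f x) ∧ f 0 ≠ 0 ∧ ∀ x, f x ≠ 0 → ‖x‖ < ε := by
  let f : ContDiffBump (0 : Eu n) := ⟨ε/2, ε, by positivity, by linarith⟩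
  refine ⟨f, f.contDiff, f.hasCompactSupport, fun x => f.nonneg, ?_, ?_⟩
  · have : f 0 = 1 := f.one_of_mem_closedBall (by simp [f.rIn_pos.le])
    rw [this]; simp
  · intro x hx
    have h2 : x ∈ Function.support f := hx
    rw [f.support_eq] at h2
    simpa using h2

lemma bump_pos {n : ℕ} (K : ℝ) (hK : 0 < K) : ∃ φ : Eu n → ℂ, ContDiff ℝ (⊤ : ℕ∞) φ ∧ HasCompactSupport φ ∧ ∀ ξ : Eu n, ‖ξ‖ ≤ K → 𝓕 φ ξ ≠ 0 := by
  obtain ⟨f, f1, f2, f3, f4, f5⟩ := bump_ex (n := n) (1/(8*K)) (by positivity)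
  have f2c : HasCompactSupport (fun x => (f x : ℂ)) := f2.comp_left (g := fun r : ℝ => (r : ℂ)) (by simp)
  have fc := f1.continuous
  refine ⟨fun x => (f x : ℂ), Complex.ofRealCLM.contDiff.comp f1, f2c, ?_⟩
  intro ξ hξ h0
  have hre : (𝓕 (fun x => (f x : ℂ)) ξ).re = ∫ x, Real.cos (2 * Real.pi * inner ℝ x ξ) * f x := by
    rw [Real.fourier_eq']
    simp only [smul_eq_mul]
    have hi : Integrable (fun v : Eu n => cexp (↑(-2 * Real.pi * inner ℝ v ξ) * I) * (f v : ℂ)) := by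
      apply Continuous.integrable_of_hasCompactSupport
      · fun_prop
      · exact f2c.mul_left
    have := integral_re hi
    simp only [RCLike.re_eq_complex_re] at this
    rw [← this]
    congr 1; ext x
    rw [Complex.re_mul_ofReal, Complex.exp_ofReal_mul_I_re, ← Real.cos_neg]
    congr 2; ring
  rw [h0] at hre
  have hpos : ∀ x : Eu n, f x ≠ 0 → 0 < Real.cos (2 * Real.pi * inner ℝ x ξ) := by
    intro x hx
    have hx2 := f5 x hx
    have h1 : |inner ℝ x ξ| ≤ 1/8 := by
      calc _ ≤ ‖x‖ * ‖ξ‖ := abs_real_inner_le_norm x ξ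
        _ ≤ 1/(8*K) * K := by gcongr
        _ = 1/8 := by field_simp
    have h2 := abs_le.1 h1
    have := Real.pi_pos
    apply Real.cos_pos_of_mem_Ioo
    constructor <;> nlinarith
  have : 0 < ∫ x, Real.cos (2 * Real.pi * inner ℝ x ξ) * f x := by
    apply Continuous.integral_pos_of_hasCompactSupport_nonneg_nonzero (x := 0)
    · fun_prop
    · exact f2.mul_left
    · intro x
      by_cases hx : f x = 0
      · simp [hx]
      · exact mul_nonneg (hpos x hx).le (f3 x)
    · simpa using f4
  rw [← hre] at this
  simp at this

lemma ident {n : ℕ} {D : Eu n → ℂ} (h : ∀ φ : Eu n → ℂ, ContDiff ℝ (⊤ : ℕ∞) φ → HasCompactSupport φ →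
    Integrable (fun ξ => D ξ * starRingEnd ℂ (𝓕 φ ξ)) ∧ ∫ ξ, D ξ * starRingEnd ℂ (𝓕 φ ξ) = 0) : ∀ᵐ ξ, D ξ = 0 := by
  have key : ∀ φ : Eu n → ℂ, ContDiff ℝ (⊤ : ℕ∞) φ → HasCompactSupport φ → ∀ᵐ ξ, D ξ * starRingEnd ℂ (𝓕 φ ξ) = 0 := by
    intro φ h1 h2
    apply vanish (h φ h1 h2).1
    intro z
    have hz := (h (fun x => φ (x - z)) (h1.comp (by fun_prop)) (h2.comp_homeomorph (Homeomorph.subRight z))).2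
    rw [← hz, Real.fourierInv_eq']
    congr 1; ext ξ
    rw [fourier_shift, map_mul, ← Complex.exp_conj, smul_eq_mul]
    simp only [map_neg, map_mul, conj_ofReal, conj_I, map_ofNat]
    rw [real_inner_comm]
    push_cast
    rw [show (-(2 * (Real.pi : ℂ) * (inner ℝ z ξ : ℝ) * -I)) = 2 * Real.pi * (inner ℝ z ξ : ℝ) * I by ring]
    ring
  have : ∀ K : ℕ, ∀ᵐ ξ : Eu n, ‖ξ‖ ≤ K + 1 → D ξ = 0 := by
    intro K
    obtain ⟨φ, h1, h2, h3⟩ := bump_pos (n := n) (K + 1) (by positivity)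
    filter_upwards [key φ h1 h2] with ξ hξ hn
    rcases mul_eq_zero.1 hξ with h4 | h4
    · exact h4
    · exact absurd ((map_eq_zero _).1 h4) (h3 ξ hn)
  filter_upwards [ae_all_iff.2 this] with ξ hξ
  obtain ⟨K, hK⟩ := exists_nat_ge ‖ξ‖
  exact hξ K (by linarith)

lemma wt_schwartz {n : ℕ} (β : ℝ) (hβ : 0 ≤ β) (S : 𝓢(Eu n, ℂ)) : ∫⁻ ξ, ENNReal.ofReal (‖ξ‖^β) * ‖S ξ‖ₑ^2 ≠ ⊤ := by
  obtain ⟨K, hK⟩ := exists_nat_ge β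
  obtain ⟨C, hC⟩ := S.decay 0 0
  have hi : Integrable (fun ξ => (C * (‖S ξ‖ + ‖ξ‖^K * ‖S ξ‖))) := (S.integrable.norm.add (S.integrable_pow_mul volume K)).const_mul C
  refine ne_top_of_le_ne_top hi.lintegral_lt_top.ne (lintegral_mono fun ξ => ?_)
  dsimp only
  rw [← ofReal_norm, ← ENNReal.ofReal_pow (norm_nonneg _), ← ENNReal.ofReal_mul (by positivity)]
  apply ENNReal.ofReal_le_ofReal
  have h1 : ‖S ξ‖ ≤ C := by simpa using hC.2 ξ
  have h2 : ‖ξ‖^β ≤ 1 + ‖ξ‖^K := by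
    rcases le_total ‖ξ‖ 1 with h | h
    · have := Real.rpow_le_one (norm_nonneg ξ) h hβ
      have : 0 ≤ ‖ξ‖^K := by positivity
      linarith
    · have : ‖ξ‖^β ≤ ‖ξ‖^(K:ℝ) := Real.rpow_le_rpow_of_exponent_le h hK
      rw [Real.rpow_natCast] at this; linarith
  have := hC.1
  calc ‖ξ‖^β * ‖S ξ‖^2 ≤ (1 + ‖ξ‖^K) * ‖S ξ‖^2 := by gcongr
    _ = ‖S ξ‖ * (‖S ξ‖ + ‖ξ‖^K * ‖S ξ‖) := by ring
    _ ≤ _ := by gcongr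

/-- half wave combination giving the sine propagator -/
def Hh (n : ℕ) (a b : Eu n → ℂ) (t : ℝ) (ξ : Eu n) : ℂ :=
  (I/2) * (cexp (-(t * I) * ‖ξ‖) * b ξ - cexp (-((-t : ℝ) * I) * ‖ξ‖) * a ξ)

lemma sin_Amp {n : ℕ} {F : Eu n × ℝ → ℂ} (hm : StronglyMeasurable F) (hF : Integrable F) (t : ℝ) (ξ : Eu n) :
    ∫ s, ((Real.sin ((t - s) * ‖ξ‖) : ℝ) : ℂ) * 𝓕 (fun x => F (x, s)) ξ = Hh n (Amp n F) (Amp n (tR n F)) t ξ := by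
  have hi : Integrable (fun s : ℝ => 𝓕 (fun x => F (x, s)) ξ) := by
    have h1 : Integrable F (volume.prod volume) := hF
    refine Integrable.mono' h1.norm.integral_prod_right ?_ (Eventually.of_forall fun s => fourier_norm_le' _ _)
    exact ((slice_meas hm).comp_measurable (measurable_const.prodMk measurable_id)).aestronglyMeasurable
  have hexp : ∀ a : ℝ, Integrable (fun s : ℝ => cexp (-((a * s : ℝ) * I) * ‖ξ‖) * 𝓕 (fun x => F (x, s)) ξ) := by
    intro a
    refine hi.bdd_mul (c := 1) (Continuous.aestronglyMeasurable (by fun_prop)) (Eventually.of_forall fun s => ?_)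
    exact (cexp_norm_one _ _).le
  unfold Hh
  rw [Amp_eq hF, Amp_eq (tR_int hF), ← integral_neg_eq_self (fun s : ℝ => cexp (-(I * s * ‖ξ‖)) * 𝓕 (fun x => tR n F (x, s)) ξ)]
  have e1 : ∫ s : ℝ, cexp (-(I * (-s : ℝ) * ‖ξ‖)) * 𝓕 (fun x => tR n F (x, -s)) ξ = ∫ s : ℝ, cexp (-((-1 * s : ℝ) * I) * ‖ξ‖) * 𝓕 (fun x => F (x, s)) ξ := by
    congr 1; ext s
    simp only [tR, neg_neg]
    congr 2; push_cast; ring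
  have e2 : ∫ s : ℝ, cexp (-(I * s * ‖ξ‖)) * 𝓕 (fun x => F (x, s)) ξ = ∫ s : ℝ, cexp (-((1 * s : ℝ) * I) * ‖ξ‖) * 𝓕 (fun x => F (x, s)) ξ := by
    congr 1; ext s
    congr 2; push_cast; ring
  rw [e1, e2, ← integral_const_mul, ← integral_const_mul, ← integral_sub ((hexp _).const_mul _) ((hexp _).const_mul _), ← integral_const_mul]
  congr 1; ext s
  rw [sin_exp, ← mul_assoc (cexp _) (cexp _), ← mul_assoc (cexp _) (cexp _), ← Complex.exp_add, ← Complex.exp_add,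
    show -((t - s : ℝ) * I) * (‖ξ‖ : ℂ) = -(t * I) * ‖ξ‖ + -((-1 * s : ℝ) * I) * ‖ξ‖ by push_cast; ring,
    show -((-(t - s) : ℝ) * I) * (‖ξ‖ : ℂ) = -((-t : ℝ) * I) * ‖ξ‖ + -((1 * s : ℝ) * I) * ‖ξ‖ by push_cast; ring]
  ring

lemma Hh_le {n : ℕ} (a b : Eu n → ℂ) (t : ℝ) (ξ : Eu n) : ‖Hh n a b t ξ‖ ≤ (‖a ξ‖ + ‖b ξ‖)/2 := by
  unfold Hh
  rw [norm_mul]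
  have : ‖(I/2 : ℂ)‖ = 1/2 := by simp
  rw [this]
  have h2 := norm_sub_le (cexp (-(t * I) * ‖ξ‖) * b ξ) (cexp (-((-t : ℝ) * I) * ‖ξ‖) * a ξ)
  rw [norm_mul, norm_mul, cexp_norm_one, cexp_norm_one] at h2
  linarith

lemma Hh_sq {n : ℕ} (a b : Eu n → ℂ) (t : ℝ) (ξ : Eu n) : ‖Hh n a b t ξ‖ₑ^2 ≤ ‖a ξ‖ₑ^2 + ‖b ξ‖ₑ^2 := by
  have h := Hh_le a b t ξ
  simp only [← ofReal_norm]
  rw [← ENNReal.ofReal_pow (norm_nonneg _), ← ENNReal.ofReal_pow (norm_nonneg _), ← ENNReal.ofReal_pow (norm_nonneg _), ← ENNReal.ofReal_add (by positivity) (by positivity)]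
  apply ENNReal.ofReal_le_ofReal
  have h0 := norm_nonneg (Hh n a b t ξ)
  nlinarith [sq_nonneg (‖a ξ‖ - ‖b ξ‖), norm_nonneg (a ξ), norm_nonneg (b ξ)]

lemma Hh_sm {n : ℕ} {a b : Eu n → ℂ} (ha : StronglyMeasurable a) (hb : StronglyMeasurable b) (t : ℝ) : StronglyMeasurable (Hh n a b t) := by
  unfold Hh
  have c1 : StronglyMeasurable (fun ξ : Eu n => cexp (-(t * I) * ‖ξ‖)) := Continuous.stronglyMeasurable (by fun_prop)
  have c2 : StronglyMeasurable (fun ξ : Eu n => cexp (-((-t : ℝ) * I) * ‖ξ‖)) := Continuous.stronglyMeasurable (by fun_prop)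
  exact ((c1.mul hb).sub (c2.mul ha)).const_mul _

lemma rpow_sm {n : ℕ} (γ : ℝ) : StronglyMeasurable (fun ξ : Eu n => ((‖ξ‖^γ : ℝ) : ℂ)) := by
  have : Measurable (fun ξ : Eu n => ((‖ξ‖^γ : ℝ) : ℂ)) := by fun_prop
  exact this.stronglyMeasurable

set_option maxHeartbeats 1000000 in
lemma pair_lim {n : ℕ} (hn : 1 ≤ n) (γ : ℝ) (a b : ℕ → Eu n → ℂ) (fp fm : Eu n → ℂ) (ha : ∀ k, Continuous (a k)) (hb : ∀ k, Continuous (b k))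
    (haB : ∀ k, ∃ B, ∀ ξ, ‖a k ξ‖ ≤ B) (hbB : ∀ k, ∃ B, ∀ ξ, ‖b k ξ‖ ≤ B)
    (hfp : StronglyMeasurable fp) (hfm : StronglyMeasurable fm) (t : ℝ) (ψ : Eu n → ℂ) (hψ : Continuous ψ) (hψi : Integrable ψ)
    (hψw : ∫⁻ ξ, ENNReal.ofReal (‖ξ‖^(-2*γ)) * ‖ψ ξ‖ₑ^2 ≠ ⊤)
    (l1 : Tendsto (fun k => ∫⁻ ξ, ‖((‖ξ‖^γ : ℝ) : ℂ) * a k ξ - fp ξ‖ₑ^2) atTop (nhds 0))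
    (l2 : Tendsto (fun k => ∫⁻ ξ, ‖((‖ξ‖^γ : ℝ) : ℂ) * b k ξ - fm ξ‖ₑ^2) atTop (nhds 0)) :
    Tendsto (fun k => ∫ ξ, Hh n (a k) (b k) t ξ * ψ ξ) atTop (nhds (∫ ξ, ((‖ξ‖^(-γ) : ℝ) : ℂ) * Hh n fp fm t ξ * ψ ξ)) := by
  have hw := rpow_sm (n := n) γ
  have hw' := rpow_sm (n := n) (-γ)
  apply tendsto_integral_of_L1
  · exact ((hw'.mul (Hh_sm hfp hfm t)).mul hψ.stronglyMeasurable).aestronglyMeasurable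
  · refine Eventually.of_forall fun k => ?_
    obtain ⟨A, hA⟩ := haB k
    obtain ⟨B, hB⟩ := hbB k
    refine hψi.bdd_mul (c := (A + B)/2) (Hh_sm (ha k).stronglyMeasurable (hb k).stronglyMeasurable t).aestronglyMeasurable (Eventually.of_forall fun ξ => ?_)
    have := Hh_le (a k) (b k) t ξ
    linarith [hA ξ, hB ξ]
  · set da : ℕ → Eu n → ℂ := fun k ξ => ((‖ξ‖^γ : ℝ) : ℂ) * a k ξ - fp ξ with hda
    set db : ℕ → Eu n → ℂ := fun k ξ => ((‖ξ‖^γ : ℝ) : ℂ) * b k ξ - fm ξ with hdb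
    have hdam : ∀ k, StronglyMeasurable (da k) := fun k => (hw.mul (ha k).stronglyMeasurable).sub hfp
    have hdbm : ∀ k, StronglyMeasurable (db k) := fun k => (hw.mul (hb k).stronglyMeasurable).sub hfm
    have hne : ∀ᵐ ξ : Eu n, ξ ≠ 0 := by
      haveI : Nonempty (Fin n) := ⟨⟨0, hn⟩⟩
      haveI : Nontrivial (Eu n) := by unfold Eu; infer_instance
      exact (measure_singleton (0 : Eu n) : volume {(0 : Eu n)} = 0) |> fun h => compl_mem_ae_iff.2 h
    have hle : ∀ k, ∫⁻ ξ, ‖Hh n (a k) (b k) t ξ * ψ ξ - ((‖ξ‖^(-γ) : ℝ) : ℂ) * Hh n fp fm t ξ * ψ ξ‖ₑ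
        ≤ ((∫⁻ ξ, ‖da k ξ‖ₑ^2) + ∫⁻ ξ, ‖db k ξ‖ₑ^2)^((1:ℝ)/2) * (∫⁻ ξ, ENNReal.ofReal (‖ξ‖^(-2*γ)) * ‖ψ ξ‖ₑ^2)^((1:ℝ)/2) := by
      intro k
      calc _ = ∫⁻ ξ, ‖Hh n (da k) (db k) t ξ‖ₑ * ‖((‖ξ‖^(-γ) : ℝ) : ℂ) * ψ ξ‖ₑ := by
            apply lintegral_congr_ae
            filter_upwards [hne] with ξ hξ
            rw [← enorm_mul]
            congr 1
            have h1 : ((‖ξ‖^(-γ) : ℝ) : ℂ) * ((‖ξ‖^γ : ℝ) : ℂ) = 1 := by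
              rw [← Complex.ofReal_mul, ← Real.rpow_add (norm_pos_iff.2 hξ)]; simp
            simp only [Hh, hda, hdb]
            linear_combination (-(I/2) * (cexp (-(t * I) * ‖ξ‖) * b k ξ - cexp (-((-t : ℝ) * I) * ‖ξ‖) * a k ξ) * ψ ξ) * h1
        _ ≤ (∫⁻ ξ, ‖Hh n (da k) (db k) t ξ‖ₑ^2)^((1:ℝ)/2) * (∫⁻ ξ, ‖((‖ξ‖^(-γ) : ℝ) : ℂ) * ψ ξ‖ₑ^2)^((1:ℝ)/2) :=
            lintegral_cs _ _ _ (Hh_sm (hdam k) (hdbm k) t).enorm.aemeasurable (hw'.mul hψ.stronglyMeasurable).enorm.aemeasurable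
        _ ≤ _ := by
            gcongr ?_^((1:ℝ)/2) * ?_^((1:ℝ)/2)
            · rw [← lintegral_add_left ((hdam k).enorm.pow_const 2)]
              exact lintegral_mono fun ξ => Hh_sq _ _ _ _
            · apply le_of_eq
              congr 1; ext ξ
              rw [rpow_half_sq, mul_neg, neg_mul]
    have l3 : Tendsto (fun k => ((∫⁻ ξ, ‖da k ξ‖ₑ^2) + ∫⁻ ξ, ‖db k ξ‖ₑ^2)^((1:ℝ)/2) * (∫⁻ ξ, ENNReal.ofReal (‖ξ‖^(-2*γ)) * ‖ψ ξ‖ₑ^2)^((1:ℝ)/2)) atTop (nhds 0) := by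
      have l4 := ENNReal.Tendsto.mul_const ((l1.add l2).ennrpow_const ((1:ℝ)/2))
        (b := (∫⁻ ξ, ENNReal.ofReal (‖ξ‖^(-2*γ)) * ‖ψ ξ‖ₑ^2)^((1:ℝ)/2)) (Or.inr (by finiteness))
      rw [add_zero, ENNReal.zero_rpow_of_pos (by norm_num), zero_mul] at l4
      exact l4
    exact tendsto_of_tendsto_of_tendsto_of_le_of_le tendsto_const_nhds l3 (fun k => zero_le) hle

lemma wt_int {n : ℕ} (γ : ℝ) (f ψ : Eu n → ℂ) (hf : StronglyMeasurable f) (hψ : StronglyMeasurable ψ) (h1 : ∫⁻ ξ, ‖f ξ‖ₑ^2 ≠ ⊤)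
    (hψw : ∫⁻ ξ, ENNReal.ofReal (‖ξ‖^(2*γ)) * ‖ψ ξ‖ₑ^2 ≠ ⊤) : Integrable (fun ξ => ((‖ξ‖^γ : ℝ) : ℂ) * f ξ * ψ ξ) := by
  have hw := rpow_sm (n := n) γ
  refine ⟨((hw.mul hf).mul hψ).aestronglyMeasurable, ?_⟩
  unfold HasFiniteIntegral
  calc _ = ∫⁻ ξ, ‖f ξ‖ₑ * ‖((‖ξ‖^γ : ℝ) : ℂ) * ψ ξ‖ₑ := by
        congr 1; ext ξ; rw [← enorm_mul]; congr 1; ring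
    _ ≤ (∫⁻ ξ, ‖f ξ‖ₑ^2)^((1:ℝ)/2) * (∫⁻ ξ, ‖((‖ξ‖^γ : ℝ) : ℂ) * ψ ξ‖ₑ^2)^((1:ℝ)/2) :=
        lintegral_cs _ _ _ hf.enorm.aemeasurable (hw.mul hψ).enorm.aemeasurable
    _ < ⊤ := by
        simp_rw [rpow_half_sq]
        finiteness

/-- the Fourier transform of the Duhamel integral -/
lemma ft_ident {n : ℕ} (hn : 1 ≤ n) {r q' r' : ℝ} (hr : 2 < r) (hr' : 1/r + 1/r' = 1) (hq1 : 1 < q') {G : Eu n × ℝ → ℂ} {R : ℝ} (h : Gok n G R)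
    (hm : mixSq n q' r' G ≠ ⊤) (t γ : ℝ) (hγ : γ ≤ 0) (fp fm : Eu n → ℂ) (hfp : StronglyMeasurable fp) (hfm : StronglyMeasurable fm)
    (f1 : ∫⁻ ξ, ‖fp ξ‖ₑ^2 ≠ ⊤) (f2 : ∫⁻ ξ, ‖fm ξ‖ₑ^2 ≠ ⊤)
    (l1 : Tendsto (fun k => ∫⁻ ξ, ‖((‖ξ‖^γ : ℝ) : ℂ) * Amp n (Gk n G k) ξ - fp ξ‖ₑ^2) atTop (nhds 0))
    (l2 : Tendsto (fun k => ∫⁻ ξ, ‖((‖ξ‖^γ : ℝ) : ℂ) * Amp n (tR n (Gk n G k)) ξ - fm ξ‖ₑ^2) atTop (nhds 0))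
    (hF : Integrable (Ft n G t)) : ∀ᵐ ξ, 𝓕 (Ft n G t) ξ = ((‖ξ‖^(-γ) : ℝ) : ℂ) * Hh n fp fm t ξ := by
  have hH : ∫⁻ ξ, ‖Hh n fp fm t ξ‖ₑ^2 ≠ ⊤ := by
    refine ne_top_of_le_ne_top ?_ (lintegral_mono fun ξ => Hh_sq fp fm t ξ)
    rw [lintegral_add_left (hfp.enorm.pow_const 2)]
    finiteness
  have main : ∀ᵐ ξ, 𝓕 (Ft n G t) ξ - ((‖ξ‖^(-γ) : ℝ) : ℂ) * Hh n fp fm t ξ = 0 := by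
    apply ident
    intro φ c1 c2
    set S : 𝓢(Eu n, ℂ) := c2.toSchwartzMap c1 with hS
    have hSφ : (S : Eu n → ℂ) = φ := by ext x; rw [hS, HasCompactSupport.toSchwartzMap_toFun]
    have hφi : Integrable φ := by rw [← hSφ]; exact S.integrable
    have hFS : ((𝓕 S : 𝓢(Eu n, ℂ)) : Eu n → ℂ) = 𝓕 φ := by rw [SchwartzMap.fourier_coe, hSφ]
    have hφfi : Integrable (𝓕 φ) := by rw [← hFS]; exact (𝓕 S).integrable
    have hcc : Continuous (fun ξ => starRingEnd ℂ (𝓕 φ ξ)) := by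
      have := fourier_cont hφi; fun_prop
    have hci : Integrable (fun ξ => starRingEnd ℂ (𝓕 φ ξ)) := (LinearIsometryEquiv.integrable_comp_iff conjLIE).2 hφfi
    have hcw : ∫⁻ ξ, ENNReal.ofReal (‖ξ‖^(-2*γ)) * ‖starRingEnd ℂ (𝓕 φ ξ)‖ₑ^2 ≠ ⊤ := by
      have := wt_schwartz (-2*γ) (by linarith) (𝓕 S)
      rw [hFS] at this
      convert this using 5 with ξ
      rw [← ofReal_norm, RCLike.norm_conj, ofReal_norm]
    have i1 : Integrable (fun ξ => 𝓕 (Ft n G t) ξ * starRingEnd ℂ (𝓕 φ ξ)) := by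
      refine hci.bdd_mul (c := ∫ x, ‖Ft n G t x‖) (fourier_cont hF).aestronglyMeasurable (Eventually.of_forall fun ξ => fourier_norm_le' _ _)
    have i2 : Integrable (fun ξ => ((‖ξ‖^(-γ) : ℝ) : ℂ) * Hh n fp fm t ξ * starRingEnd ℂ (𝓕 φ ξ)) :=
      wt_int (-γ) _ _ (Hh_sm hfp hfm t) hcc.stronglyMeasurable hH (by rwa [mul_neg, ← neg_mul])
    have e1 : ∫ ξ, 𝓕 (Ft n G t) ξ * starRingEnd ℂ (𝓕 φ ξ) = ∫ y, Ft n G t y * starRingEnd ℂ (φ y) := by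
      have hp := pair_inv hφfi hF
      have hinv : 𝓕⁻ (𝓕 φ) = φ := Continuous.fourierInv_fourier_eq c1.continuous hφi hφfi
      rw [hinv] at hp
      have hp2 := congrArg (starRingEnd ℂ) hp
      rw [← integral_conj, ← integral_conj] at hp2
      simp only [map_mul, Complex.conj_conj] at hp2
      simp_rw [mul_comm _ (starRingEnd ℂ _)]
      exact hp2.symm
    have e2 : ∫ y, Ft n G t y * starRingEnd ℂ (φ y) = ∫ ξ, ((‖ξ‖^(-γ) : ℝ) : ℂ) * Hh n fp fm t ξ * starRingEnd ℂ (𝓕 φ ξ) := by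
      obtain ⟨ρ, hρ, hsub⟩ := c2.isCompact.isBounded.subset_ball_lt 0 0
      obtain ⟨M, hM⟩ := c1.continuous.bounded_above_of_compact_support c2
      have p1 := pairF hn hr hr' hq1 h hm t ρ M hρ φ hφi hM (by
        intro y hy
        by_contra hne
        have := hsub (subset_tsupport φ hne)
        rw [mem_ball_zero_iff] at this
        linarith)
      simp_rw [fun k ξ => sin_Amp (Gk_sm h k) (Gk_int h k) t ξ] at p1
      refine tendsto_nhds_unique p1 (pair_lim hn γ _ _ fp fm (fun k => Amp_cont (Gk_int h k)) (fun k => Amp_cont (tR_int (Gk_int h k)))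
        (fun k => ⟨_, fun ξ => Amp_le _ ξ⟩) (fun k => ⟨_, fun ξ => Amp_le _ ξ⟩) hfp hfm t _ hcc hci hcw l1 l2)
    simp_rw [sub_mul]
    refine ⟨i1.sub i2, ?_⟩
    rw [integral_sub i1 i2, e1, e2, sub_self]
  filter_upwards [main] with ξ hξ
  exact sub_eq_zero.1 hξ

lemma inv_norm_ball (n : ℕ) (hn : 3 ≤ n) : ∫⁻ ξ in ball (0 : Eu n) 1, ENNReal.ofReal (‖ξ‖^(-1:ℝ)) ≠ ⊤ := by
  haveI : Nonempty (Fin n) := ⟨⟨0, by omega⟩⟩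
  haveI : Nontrivial (Eu n) := by unfold Eu; infer_instance
  have h : IntegrableOn (fun ξ : Eu n => ‖ξ‖^(-1:ℝ)) (ball 0 1) := by
    rw [integrableOn_fun_norm_addHaar volume (f := fun y : ℝ => y^(-1:ℝ))]
    have hd : Module.finrank ℝ (Eu n) = n := by unfold Eu; simp
    rw [hd]
    have hm : Measurable (fun y : ℝ => y^(n-1) • y^(-1:ℝ)) := by
      simp only [smul_eq_mul]; fun_prop
    refine Measure.integrableOn_of_bounded (M := 1) (by simp) hm.aestronglyMeasurable ?_
    filter_upwards [ae_restrict_mem measurableSet_Ioo] with y hy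
    rw [smul_eq_mul, Real.norm_of_nonneg (mul_nonneg (pow_nonneg hy.1.le _) (Real.rpow_nonneg hy.1.le _)), Real.rpow_neg_one]
    rw [show n - 1 = (n - 2) + 1 by omega, pow_succ, mul_assoc, mul_inv_cancel₀ hy.1.ne', mul_one]
    exact pow_le_one₀ hy.1.le hy.2.le
  exact h.lintegral_lt_top.ne

lemma plancherel_le (n : ℕ) (hn : 1 ≤ n) : ∃ C : ℝ≥0∞, C ≠ ⊤ ∧ ∀ f : Eu n → ℂ, Integrable f → ∫⁻ ξ, ‖𝓕 f ξ‖ₑ^2 ≤ C * ∫⁻ x, ‖f x‖ₑ^2 := by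
  obtain ⟨C, hC, h⟩ := fourier_L2 n hn
  refine ⟨ENNReal.ofReal C, by simp, fun f hf => ?_⟩
  have hc := fourier_cont hf
  have hpt : ∀ ξ : Eu n, Tendsto (fun k : ℕ => ENNReal.ofReal (Real.exp (-((1/((k:ℝ)+1)) * ‖ξ‖))) * ‖𝓕 f ξ‖ₑ^2) atTop (nhds (‖𝓕 f ξ‖ₑ^2)) := by
    intro ξ
    have h1 : Tendsto (fun k : ℕ => Real.exp (-((1/((k:ℝ)+1)) * ‖ξ‖))) atTop (nhds (Real.exp (-(0 * ‖ξ‖)))) := by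
      apply (Real.continuous_exp.tendsto _).comp
      exact (tendsto_one_div_add_atTop_nhds_zero_nat.mul_const _).neg
    have h2 := ENNReal.Tendsto.mul_const (ENNReal.tendsto_ofReal h1) (b := ‖𝓕 f ξ‖ₑ^2) (Or.inr (by finiteness))
    simpa using h2
  calc ∫⁻ ξ, ‖𝓕 f ξ‖ₑ^2 = ∫⁻ ξ, Filter.liminf (fun k : ℕ => ENNReal.ofReal (Real.exp (-((1/((k:ℝ)+1)) * ‖ξ‖))) * ‖𝓕 f ξ‖ₑ^2) atTop := by
        congr 1; ext ξ; exact (hpt ξ).liminf_eq.symm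
    _ ≤ Filter.liminf (fun k : ℕ => ∫⁻ ξ, ENNReal.ofReal (Real.exp (-((1/((k:ℝ)+1)) * ‖ξ‖))) * ‖𝓕 f ξ‖ₑ^2) atTop :=
        lintegral_liminf_le fun k => by fun_prop
    _ ≤ Filter.liminf (fun k : ℕ => ENNReal.ofReal C * ∫⁻ x, ‖f x‖ₑ^2) atTop :=
        Filter.liminf_le_liminf (Eventually.of_forall fun k => h _ f (by positivity) hf)
    _ = _ := by simp

lemma hs_bound (n : ℕ) (hn : 3 ≤ n) : ∃ C : ℝ≥0∞, C ≠ ⊤ ∧ ∀ f : Eu n → ℂ, Integrable f →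
    ∫⁻ ξ, ENNReal.ofReal (‖ξ‖^(-1:ℝ)) * ‖𝓕 f ξ‖ₑ^2 ≤ C * ((∫⁻ x, ‖f x‖ₑ)^2 + ∫⁻ x, ‖f x‖ₑ^2) := by
  obtain ⟨C, hC, h⟩ := plancherel_le n (by omega)
  have hA := inv_norm_ball n hn
  set A := ∫⁻ ξ in ball (0 : Eu n) 1, ENNReal.ofReal (‖ξ‖^(-1:ℝ)) with hAd
  refine ⟨A + C, by finiteness, fun f hf => ?_⟩
  have hf1 : ∫⁻ x, ‖f x‖ₑ ≠ ⊤ := hf.2.ne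
  rw [← lintegral_add_compl _ (measurableSet_ball : MeasurableSet (ball (0 : Eu n) 1))]
  calc _ ≤ (∫⁻ ξ in ball (0 : Eu n) 1, ENNReal.ofReal (‖ξ‖^(-1:ℝ)) * (∫⁻ x, ‖f x‖ₑ)^2) + ∫⁻ ξ in (ball (0 : Eu n) 1)ᶜ, ‖𝓕 f ξ‖ₑ^2 := by
        apply add_le_add
        · apply lintegral_mono; intro ξ; dsimp only
          gcongr _ * ?_^2
          exact fourier_norm_le f ξ
        · apply setLIntegral_mono' measurableSet_ball.compl
          intro ξ hξ
          have : 1 ≤ ‖ξ‖ := by simpa using hξ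
          have h2 : ENNReal.ofReal (‖ξ‖^(-1:ℝ)) ≤ 1 := by
            apply ENNReal.ofReal_le_one.2
            exact Real.rpow_le_one_of_one_le_of_nonpos this (by norm_num)
          calc _ ≤ 1 * ‖𝓕 f ξ‖ₑ^2 := by gcongr
            _ = _ := one_mul _
    _ ≤ A * (∫⁻ x, ‖f x‖ₑ)^2 + C * ∫⁻ x, ‖f x‖ₑ^2 := by
        rw [lintegral_mul_const' _ _ (by finiteness)]
        gcongr
        exact (setLIntegral_le_lintegral _ _).trans (h f hf)
    _ ≤ _ := by
        rw [add_mul, mul_add, mul_add]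
        exact add_le_add le_self_add le_add_self

/-- Fubini computation for the dual pairing -/
lemma dual_pair {n : ℕ} (hn : 3 ≤ n) (fp fm : Eu n → ℂ) (hfp : StronglyMeasurable fp) (hfm : StronglyMeasurable fm)
    (f1 : ∫⁻ ξ, ‖fp ξ‖ₑ^2 ≠ ⊤) (f2 : ∫⁻ ξ, ‖fm ξ‖ₑ^2 ≠ ⊤) (U h : Eu n × ℝ → ℂ) (hh : StronglyMeasurable h)
    (N M : ℝ) (hM : ∀ z, ‖h z‖ ≤ M) (hs : ∀ x t, h (x, t) ≠ 0 → ‖x‖ ≤ N ∧ |t| ≤ N)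
    (hsl : ∀ t, (∀ x, h (x, t) = 0) ∨ ∃ a : Eu n → ℂ, Integrable a ∧ (∀ x, U (x, t) = 𝓕⁻ a x) ∧
      ∀ᵐ ξ, a ξ = ((‖ξ‖^(-(1/2) : ℝ) : ℝ) : ℂ) * Hh n fp fm t ξ) :
    ∫ t, ∫ x, U (x, t) * starRingEnd ℂ (h (x, t)) =
      ∫ ξ, ((‖ξ‖^(-(1/2) : ℝ) : ℝ) : ℂ) * ((I/2) * (fm ξ * starRingEnd ℂ (Amp n (tR n h) ξ) - fp ξ * starRingEnd ℂ (Amp n h ξ))) := by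
  have hle1 : ∀ z : Eu n × ℝ, ‖h z‖ₑ ≤ (closedBall (0 : Eu n) N ×ˢ Set.Icc (-N) N).indicator (fun _ => ENNReal.ofReal M) z := by
    rintro ⟨x, t⟩
    by_cases hz : h (x, t) = 0
    · rw [hz]; simp
    · have := hs x t hz
      rw [Set.indicator_of_mem]
      · rw [← ofReal_norm]; exact ENNReal.ofReal_le_ofReal (hM _)
      · exact ⟨by simpa using this.1, by rw [Set.mem_Icc, ← abs_le]; exact this.2⟩
  have hmS : MeasurableSet (closedBall (0 : Eu n) N ×ˢ Set.Icc (-N) N) := measurableSet_closedBall.prod measurableSet_Icc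
  have hhi : Integrable h := by
    refine ⟨hh.aestronglyMeasurable, (lintegral_mono hle1).trans_lt ?_⟩
    rw [lintegral_indicator hmS, lintegral_const, Measure.restrict_apply_univ, Measure.volume_eq_prod, Measure.prod_prod]
    have := measure_closedBall_lt_top (μ := volume) (x := (0 : Eu n)) (r := N)
    rw [Real.volume_Icc]
    finiteness
  have hcb : volume (closedBall (0 : Eu n) N) ≠ ⊤ := measure_closedBall_lt_top.ne
  have hslm : ∀ t, StronglyMeasurable (fun x => h (x, t)) := fun t => hh.comp_measurable (by fun_prop)
  have hle2 : ∀ t x, ‖h (x, t)‖ₑ ≤ (closedBall (0 : Eu n) N).indicator (fun _ => ENNReal.ofReal M) x := by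
    intro t x
    by_cases hz : h (x, t) = 0
    · rw [hz]; simp
    · rw [Set.indicator_of_mem (by simpa using (hs x t hz).1), ← ofReal_norm]; exact ENNReal.ofReal_le_ofReal (hM _)
  have b1 : ∀ t, ∫⁻ x, ‖h (x, t)‖ₑ ≤ ENNReal.ofReal M * volume (closedBall (0 : Eu n) N) := by
    intro t
    refine (lintegral_mono (hle2 t)).trans_eq ?_
    rw [lintegral_indicator measurableSet_closedBall, lintegral_const, Measure.restrict_apply_univ]
  have b2 : ∀ t, ∫⁻ x, ‖h (x, t)‖ₑ^2 ≤ ENNReal.ofReal M^2 * volume (closedBall (0 : Eu n) N) := by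
    intro t
    calc _ ≤ ∫⁻ x, (closedBall (0 : Eu n) N).indicator (fun _ => ENNReal.ofReal M^2) x := by
          apply lintegral_mono; intro x; dsimp only
          have := hle2 t x
          by_cases hx : x ∈ closedBall (0 : Eu n) N
          · rw [Set.indicator_of_mem hx] at this ⊢; gcongr
          · rw [Set.indicator_of_notMem hx] at this ⊢; simpa using this
      _ = _ := by rw [lintegral_indicator measurableSet_closedBall, lintegral_const, Measure.restrict_apply_univ]
  have hsi : ∀ t, Integrable (fun x => h (x, t)) := fun t =>
    ⟨(hslm t).aestronglyMeasurable, (b1 t).trans_lt (by finiteness)⟩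
  obtain ⟨C, hC, hsb⟩ := hs_bound n hn
  have b3 : ∃ K : ℝ≥0∞, K ≠ ⊤ ∧ ∀ t, ∫⁻ ξ, ENNReal.ofReal (‖ξ‖^(-1:ℝ)) * ‖𝓕 (fun x => h (x, t)) ξ‖ₑ^2 ≤ K := by
    refine ⟨C * ((ENNReal.ofReal M * volume (closedBall (0 : Eu n) N))^2 + ENNReal.ofReal M^2 * volume (closedBall (0 : Eu n) N)), by finiteness, fun t => ?_⟩
    refine (hsb _ (hsi t)).trans ?_
    gcongr
    · exact b1 t
    · exact b2 t
  obtain ⟨K, hK, b3⟩ := b3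
  have hH : ∀ t, ∫⁻ ξ, ‖Hh n fp fm t ξ‖ₑ^2 ≤ (∫⁻ ξ, ‖fp ξ‖ₑ^2) + ∫⁻ ξ, ‖fm ξ‖ₑ^2 := by
    intro t
    rw [← lintegral_add_left (hfp.enorm.pow_const 2)]
    exact lintegral_mono fun ξ => Hh_sq fp fm t ξ
  have hw := rpow_sm (n := n) (-(1/2))
  have hft := slice_meas hh
  -- integrability on the product space
  have hJ : Integrable (fun v : Eu n × ℝ => ((‖v.1‖^(-(1/2) : ℝ) : ℝ) : ℂ) * Hh n fp fm v.2 v.1 * starRingEnd ℂ (𝓕 (fun x => h (x, v.2)) v.1)) (volume.prod volume) := by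
    have hHm : StronglyMeasurable (fun v : Eu n × ℝ => Hh n fp fm v.2 v.1) := by
      unfold Hh
      have c1 : StronglyMeasurable (fun v : Eu n × ℝ => cexp (-(v.2 * I) * ‖v.1‖)) := Continuous.stronglyMeasurable (by fun_prop)
      have c2 : StronglyMeasurable (fun v : Eu n × ℝ => cexp (-((-v.2 : ℝ) * I) * ‖v.1‖)) := Continuous.stronglyMeasurable (by fun_prop)
      exact ((c1.mul (hfm.comp_measurable measurable_fst)).sub (c2.mul (hfp.comp_measurable measurable_fst))).const_mul _
    have hcm : StronglyMeasurable (fun v : Eu n × ℝ => starRingEnd ℂ (𝓕 (fun x => h (x, v.2)) v.1)) := Complex.continuous_conj.comp_stronglyMeasurable hft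
    have ham : StronglyMeasurable (fun v : Eu n × ℝ => ((‖v.1‖^(-(1/2) : ℝ) : ℝ) : ℂ) * Hh n fp fm v.2 v.1 * starRingEnd ℂ (𝓕 (fun x => h (x, v.2)) v.1)) := (((hw.comp_measurable (measurable_fst (β := ℝ))).mul hHm).mul hcm)
    refine ⟨ham.aestronglyMeasurable, ?_⟩
    unfold HasFiniteIntegral
    rw [lintegral_prod_symm _ ham.enorm.aemeasurable]
    have hle : ∀ t, ∫⁻ ξ, ‖((‖ξ‖^(-(1/2) : ℝ) : ℝ) : ℂ) * Hh n fp fm t ξ * starRingEnd ℂ (𝓕 (fun x => h (x, t)) ξ)‖ₑ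
        ≤ (Set.Icc (-N) N).indicator (fun _ => ((∫⁻ ξ, ‖fp ξ‖ₑ^2) + ∫⁻ ξ, ‖fm ξ‖ₑ^2)^((1:ℝ)/2) * K^((1:ℝ)/2)) t := by
      intro t
      by_cases ht : t ∈ Set.Icc (-N) N
      · rw [Set.indicator_of_mem ht]
        have hc := fourier_cont (hsi t)
        calc _ = ∫⁻ ξ, ‖Hh n fp fm t ξ‖ₑ * ‖((‖ξ‖^(-(1/2) : ℝ) : ℝ) : ℂ) * 𝓕 (fun x => h (x, t)) ξ‖ₑ := by
              congr 1; ext ξ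
              rw [← enorm_mul, ← ofReal_norm, ← ofReal_norm]
              simp only [norm_mul, RCLike.norm_conj]
              congr 1; ring
          _ ≤ (∫⁻ ξ, ‖Hh n fp fm t ξ‖ₑ^2)^((1:ℝ)/2) * (∫⁻ ξ, ‖((‖ξ‖^(-(1/2) : ℝ) : ℝ) : ℂ) * 𝓕 (fun x => h (x, t)) ξ‖ₑ^2)^((1:ℝ)/2) :=
              lintegral_cs _ _ _ (Hh_sm hfp hfm t).enorm.aemeasurable (hw.mul hc.stronglyMeasurable).enorm.aemeasurable
          _ ≤ _ := by
              gcongr ?_^((1:ℝ)/2) * ?_^((1:ℝ)/2)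
              · exact hH t
              · simp_rw [rpow_half_sq]
                rw [show (2 * (-(1/2)) : ℝ) = -1 by norm_num]
                exact b3 t
      · have h0 : ∀ x, h (x, t) = 0 := by
          intro x; by_contra hne
          exact ht (by rw [Set.mem_Icc, ← abs_le]; exact (hs x t hne).2)
        have : ∀ ξ : Eu n, 𝓕 (fun x : Eu n => h (x, t)) ξ = 0 := by
          intro ξ; simp only [h0]; rw [Real.fourier_eq]; simp
        simp [this]
    refine (lintegral_mono hle).trans_lt ?_
    rw [lintegral_indicator measurableSet_Icc, lintegral_const, Measure.restrict_apply_univ, Real.volume_Icc]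
    finiteness
  calc ∫ t, ∫ x, U (x, t) * starRingEnd ℂ (h (x, t))
      = ∫ t, ∫ ξ, ((‖ξ‖^(-(1/2) : ℝ) : ℝ) : ℂ) * Hh n fp fm t ξ * starRingEnd ℂ (𝓕 (fun x => h (x, t)) ξ) := by
        congr 1; ext t
        rcases hsl t with h0 | ⟨a, ha, hU, hae⟩
        · have : ∀ ξ : Eu n, 𝓕 (fun x : Eu n => h (x, t)) ξ = 0 := by
            intro ξ; simp only [h0]; rw [Real.fourier_eq]; simp
          simp only [this]
          simp [h0]
        · simp_rw [hU]
          rw [pair_inv ha (hsi t)]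
          apply integral_congr_ae
          filter_upwards [hae] with ξ hξ
          rw [hξ]
    _ = ∫ ξ, ∫ t, ((‖ξ‖^(-(1/2) : ℝ) : ℝ) : ℂ) * Hh n fp fm t ξ * starRingEnd ℂ (𝓕 (fun x => h (x, t)) ξ) :=
        (integral_integral_swap hJ).symm
    _ = _ := by
        congr 1; ext ξ
        have hi : Integrable (fun s : ℝ => starRingEnd ℂ (𝓕 (fun x => h (x, s)) ξ)) := by
          have h1 : Integrable (fun s : ℝ => 𝓕 (fun x => h (x, s)) ξ) := by
            refine Integrable.mono' (slice_norm_int hhi) ?_ (Eventually.of_forall fun s => fourier_norm_le' _ _)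
            exact (hft.comp_measurable (measurable_const.prodMk measurable_id)).aestronglyMeasurable
          exact (LinearIsometryEquiv.integrable_comp_iff conjLIE).2 h1
        have hexp : ∀ a : ℝ, Integrable (fun s : ℝ => cexp (-((a * s : ℝ) * I) * ‖ξ‖) * starRingEnd ℂ (𝓕 (fun x => h (x, s)) ξ)) := by
          intro a
          refine hi.bdd_mul (c := 1) (Continuous.aestronglyMeasurable (by fun_prop)) (Eventually.of_forall fun s => ?_)
          exact (cexp_norm_one _ _).le
        rw [Amp_eq hhi, Amp_eq (tR_int hhi), ← integral_neg_eq_self (fun s : ℝ => cexp (-(I * s * ‖ξ‖)) * 𝓕 (fun x => tR n h (x, s)) ξ)]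
        rw [← integral_conj, ← integral_conj]
        have e1 : ∫ s : ℝ, starRingEnd ℂ (cexp (-(I * (-s : ℝ) * ‖ξ‖)) * 𝓕 (fun x => tR n h (x, -s)) ξ) = ∫ s : ℝ, cexp (-((1 * s : ℝ) * I) * ‖ξ‖) * starRingEnd ℂ (𝓕 (fun x => h (x, s)) ξ) := by
          congr 1; ext s
          simp only [tR, neg_neg, map_mul, ← Complex.exp_conj, map_neg, conj_I, conj_ofReal]
          congr 2; push_cast; ring
        have e2 : ∫ s : ℝ, starRingEnd ℂ (cexp (-(I * s * ‖ξ‖)) * 𝓕 (fun x => h (x, s)) ξ) = ∫ s : ℝ, cexp (-((-1 * s : ℝ) * I) * ‖ξ‖) * starRingEnd ℂ (𝓕 (fun x => h (x, s)) ξ) := by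
          congr 1; ext s
          simp only [map_mul, ← Complex.exp_conj, map_neg, conj_I, conj_ofReal]
          congr 2; push_cast; ring
        rw [e1, e2, ← integral_const_mul, ← integral_const_mul, ← integral_sub ((hexp _).const_mul _) ((hexp _).const_mul _), ← integral_const_mul, ← integral_const_mul]
        congr 1; ext s
        unfold Hh
        rw [show -((1 * s : ℝ) * I) * (‖ξ‖ : ℂ) = -(s * I) * ‖ξ‖ by push_cast; ring, show -((-1 * s : ℝ) * I) * (‖ξ‖ : ℂ) = -((-s : ℝ) * I) * ‖ξ‖ by push_cast; ring]
        ring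

lemma quad_absorb {Q X : ℝ≥0∞} (hQ : Q ≠ ⊤) (h : Q ≤ (X * Q)^((1:ℝ)/2)) : Q ≤ X := by
  by_cases h0 : Q = 0
  · rw [h0]; exact zero_le
  have h2 : Q^(2:ℝ) ≤ X * Q := by
    calc Q^(2:ℝ) ≤ ((X * Q)^((1:ℝ)/2))^(2:ℝ) := by gcongr
      _ = X * Q := by rw [← ENNReal.rpow_mul]; norm_num
  rw [ENNReal.rpow_two, sq] at h2
  exact (ENNReal.mul_le_mul_iff_left h0 hQ).1 h2

lemma dual_bound {n : ℕ} (fp fm a b : Eu n → ℂ) (hfp : StronglyMeasurable fp) (hfm : StronglyMeasurable fm) (ha : Continuous a) (hb : Continuous b)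
    (A B : ℝ≥0∞) (f1 : ∫⁻ ξ, ‖fp ξ‖ₑ^2 ≤ A) (f2 : ∫⁻ ξ, ‖fm ξ‖ₑ^2 ≤ A)
    (g1 : ∫⁻ ξ, ENNReal.ofReal (‖ξ‖^(-1:ℝ)) * ‖a ξ‖ₑ^2 ≤ B) (g2 : ∫⁻ ξ, ENNReal.ofReal (‖ξ‖^(-1:ℝ)) * ‖b ξ‖ₑ^2 ≤ B) :
    ‖∫ ξ, ((‖ξ‖^(-(1/2) : ℝ) : ℝ) : ℂ) * ((I/2) * (fm ξ * starRingEnd ℂ (b ξ) - fp ξ * starRingEnd ℂ (a ξ)))‖ₑ ≤ 2 * (A^((1:ℝ)/2) * B^((1:ℝ)/2)) := by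
  have hw := rpow_sm (n := n) (-(1/2))
  have key : ∀ f c : Eu n → ℂ, StronglyMeasurable f → Continuous c → ∫⁻ ξ, ‖f ξ‖ₑ^2 ≤ A → ∫⁻ ξ, ENNReal.ofReal (‖ξ‖^(-1:ℝ)) * ‖c ξ‖ₑ^2 ≤ B →
      ∫⁻ ξ, ‖f ξ‖ₑ * ‖((‖ξ‖^(-(1/2) : ℝ) : ℝ) : ℂ) * c ξ‖ₑ ≤ A^((1:ℝ)/2) * B^((1:ℝ)/2) := by
    intro f c hf hc h1 h2
    have h3 := lintegral_cs volume (fun ξ => ‖f ξ‖ₑ) (fun ξ => ‖((‖ξ‖^(-(1/2) : ℝ) : ℝ) : ℂ) * c ξ‖ₑ) hf.enorm.aemeasurable (hw.mul hc.stronglyMeasurable).enorm.aemeasurable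
    simp_rw [rpow_half_sq] at h3
    rw [show (2 * (-(1/2)) : ℝ) = -1 by norm_num] at h3
    exact h3.trans (mul_le_mul' (ENNReal.rpow_le_rpow h1 (by norm_num)) (ENNReal.rpow_le_rpow h2 (by norm_num)))
  have hm1 : Measurable (fun ξ => ‖fp ξ‖ₑ * ‖((‖ξ‖^(-(1/2) : ℝ) : ℝ) : ℂ) * a ξ‖ₑ) :=
    hfp.enorm.mul (hw.mul ha.stronglyMeasurable).enorm
  refine (enorm_integral_le_lintegral_enorm _).trans ?_
  calc _ ≤ ∫⁻ ξ, (‖fp ξ‖ₑ * ‖((‖ξ‖^(-(1/2) : ℝ) : ℝ) : ℂ) * a ξ‖ₑ + ‖fm ξ‖ₑ * ‖((‖ξ‖^(-(1/2) : ℝ) : ℝ) : ℂ) * b ξ‖ₑ) := by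
        apply lintegral_mono; intro ξ; dsimp only
        rw [← enorm_mul, ← enorm_mul]
        simp only [← ofReal_norm]
        rw [← ENNReal.ofReal_add (norm_nonneg _) (norm_nonneg _)]
        apply ENNReal.ofReal_le_ofReal
        have h2 := norm_sub_le (fm ξ * starRingEnd ℂ (b ξ)) (fp ξ * starRingEnd ℂ (a ξ))
        simp only [norm_mul, RCLike.norm_conj] at h2 ⊢
        have h3 : ‖(I/2 : ℂ)‖ = 1/2 := by simp
        rw [h3]
        have h4 := norm_nonneg (((‖ξ‖^(-(1/2) : ℝ) : ℝ) : ℂ))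
        set w := ‖((‖ξ‖^(-(1/2) : ℝ) : ℝ) : ℂ)‖
        have h5 : 0 ≤ ‖fm ξ‖ * ‖b ξ‖ + ‖fp ξ‖ * ‖a ξ‖ := by positivity
        calc _ ≤ w * (1/2 * (‖fm ξ‖ * ‖b ξ‖ + ‖fp ξ‖ * ‖a ξ‖)) := by gcongr
          _ ≤ w * (1 * (‖fm ξ‖ * ‖b ξ‖ + ‖fp ξ‖ * ‖a ξ‖)) := by gcongr; norm_num
          _ = _ := by ring
    _ ≤ _ := by
        rw [lintegral_add_left hm1, two_mul]
        exact add_le_add (key fp a hfp ha f1 g1) (key fm b hfm hb f2 g2)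

lemma Q_bound {n : ℕ} (hn : 3 ≤ n) (fp fm : Eu n → ℂ) (hfp : StronglyMeasurable fp) (hfm : StronglyMeasurable fm) (A CL Λ : ℝ≥0∞) (hA : A ≠ ⊤)
    (f1 : ∫⁻ ξ, ‖fp ξ‖ₑ^2 ≤ A) (f2 : ∫⁻ ξ, ‖fm ξ‖ₑ^2 ≤ A) (U : Eu n × ℝ → ℂ) (hU : StronglyMeasurable U) (V : Eu n → ℂ) (hV : Measurable V)
    (hL : ∀ (F : Eu n × ℝ → ℂ) (M : ℝ), StronglyMeasurable F → Integrable F → (∀ z, ‖F z‖ ≤ M) →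
      ∫⁻ ξ, ENNReal.ofReal (‖ξ‖^(-1:ℝ)) * ‖Amp n F ξ‖ₑ^2 ≤ CL * (Λ * ∫⁻ z, ‖F z‖ₑ^2 * (‖V z.1‖ₑ)⁻¹))
    (hsl : ∀ t, (∀ x, U (x, t) = 0) ∨ ∃ a : Eu n → ℂ, Integrable a ∧ (∀ x, U (x, t) = 𝓕⁻ a x) ∧
      ∀ᵐ ξ, a ξ = ((‖ξ‖^(-(1/2) : ℝ) : ℝ) : ℂ) * Hh n fp fm t ξ)
    (N : ℝ) (hN : 0 ≤ N) (Z : Set (Eu n × ℝ)) (hZ : MeasurableSet Z) (hZN : ∀ x t, (x, t) ∈ Z → ‖x‖ ≤ N ∧ |t| ≤ N ∧ ‖U (x, t)‖ ≤ N ∧ ‖V x‖ ≤ N) :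
    ∫⁻ z in Z, ‖U z‖ₑ^2 * ‖V z.1‖ₑ ≤ 4 * (A * (CL * Λ)) := by
  have hVm : StronglyMeasurable (fun z : Eu n × ℝ => ((‖V z.1‖ : ℝ) : ℂ)) := by
    have : Measurable (fun z : Eu n × ℝ => ((‖V z.1‖ : ℝ) : ℂ)) := by fun_prop
    exact this.stronglyMeasurable
  set h : Eu n × ℝ → ℂ := Z.indicator (fun z => U z * ((‖V z.1‖ : ℝ) : ℂ)) with hh
  have hhm : StronglyMeasurable h := (hU.mul hVm).indicator hZ
  have hhM : ∀ z, ‖h z‖ ≤ N * N := by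
    rintro ⟨x, t⟩
    by_cases hz : (x, t) ∈ Z
    · rw [hh, Set.indicator_of_mem hz, norm_mul, Complex.norm_real, norm_norm]
      have := hZN x t hz
      gcongr
      · exact this.2.2.1
      · exact this.2.2.2
    · rw [hh, Set.indicator_of_notMem hz]; simp; positivity
  have hs : ∀ x t, h (x, t) ≠ 0 → ‖x‖ ≤ N ∧ |t| ≤ N := by
    intro x t hne
    have hz : (x, t) ∈ Z := by
      by_contra hz; exact hne (Set.indicator_of_notMem hz _)
    exact ⟨(hZN x t hz).1, (hZN x t hz).2.1⟩
  have hvZ : volume Z ≠ ⊤ := by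
    have hsub : Z ⊆ closedBall (0 : Eu n) N ×ˢ Set.Icc (-N) N := by
      rintro ⟨x, t⟩ hz
      exact ⟨by simpa using (hZN x t hz).1, by rw [Set.mem_Icc, ← abs_le]; exact (hZN x t hz).2.1⟩
    refine ne_top_of_le_ne_top ?_ (measure_mono hsub)
    rw [Measure.volume_eq_prod, Measure.prod_prod, Real.volume_Icc]
    have := measure_closedBall_lt_top (μ := volume) (x := (0 : Eu n)) (r := N)
    finiteness
  have hhi : Integrable h := by
    rw [hh, integrable_indicator_iff hZ]
    refine Measure.integrableOn_of_bounded (M := N * N) hvZ (hU.mul hVm).aestronglyMeasurable ?_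
    filter_upwards [ae_restrict_mem hZ] with z hz
    have := hhM z
    rwa [hh, Set.indicator_of_mem hz] at this
  set Q := ∫⁻ z in Z, ‖U z‖ₑ^2 * ‖V z.1‖ₑ with hQ
  set g : Eu n × ℝ → ℝ := Z.indicator (fun z => ‖U z‖^2 * ‖V z.1‖) with hg
  have hgm : Measurable g := by
    have h1 : Measurable (fun z : Eu n × ℝ => ‖U z‖^2 * ‖V z.1‖) := by
      have := hU.measurable; fun_prop
    exact h1.indicator hZ
  have hg0 : ∀ z, 0 ≤ g z := fun z => Set.indicator_nonneg (fun z _ => by positivity) z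
  have hgi : Integrable g (volume.prod volume) := by
    rw [← Measure.volume_eq_prod, hg, integrable_indicator_iff hZ]
    refine Measure.integrableOn_of_bounded (M := N^2 * N) hvZ ?_ ?_
    · have h1 : Measurable (fun z : Eu n × ℝ => ‖U z‖^2 * ‖V z.1‖) := by
        have := hU.measurable; fun_prop
      exact h1.aestronglyMeasurable
    · filter_upwards [ae_restrict_mem hZ] with z hz
      rw [Real.norm_of_nonneg (by positivity)]
      have := hZN z.1 z.2 hz
      gcongr
      · exact this.2.2.1
      · exact this.2.2.2
  have hQg : Q = ENNReal.ofReal (∫ z, g z) := by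
    have hgi2 : Integrable g := hgi
    rw [ofReal_integral_eq_lintegral_ofReal hgi2 (Eventually.of_forall hg0), hQ, ← lintegral_indicator hZ]
    congr 1; ext z
    by_cases hz : z ∈ Z
    · rw [hg, Set.indicator_of_mem hz, Set.indicator_of_mem hz, ENNReal.ofReal_mul (by positivity), ENNReal.ofReal_pow (norm_nonneg _), ofReal_norm, ofReal_norm]
    · rw [hg, Set.indicator_of_notMem hz, Set.indicator_of_notMem hz]; simp
  have hQt : Q ≠ ⊤ := by rw [hQg]; simp
  have hpair : ∫ t, ∫ x, U (x, t) * starRingEnd ℂ (h (x, t)) = ((∫ z, g z : ℝ) : ℂ) := by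
    have e : ∀ t x, U (x, t) * starRingEnd ℂ (h (x, t)) = ((g (x, t) : ℝ) : ℂ) := by
      intro t x
      by_cases hz : (x, t) ∈ Z
      · simp only [hh, hg, Set.indicator_of_mem hz]
        rw [map_mul, conj_ofReal, ← mul_assoc, Complex.mul_conj, Complex.normSq_eq_norm_sq]
        push_cast; ring
      · simp only [hh, hg, Set.indicator_of_notMem hz]; simp
    simp_rw [e]
    simp_rw [integral_complex_ofReal]
    congr 1
    exact (integral_prod_symm _ hgi).symm
  have hd := dual_pair hn fp fm hfp hfm (ne_top_of_le_ne_top hA f1) (ne_top_of_le_ne_top hA f2) U h hhm N (N * N) hhM hs (by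
    intro t
    rcases hsl t with h0 | h1
    · left; intro x
      simp only [hh, Set.indicator, h0]; simp
    · right; exact h1)
  have hW : ∀ z, ‖h z‖ₑ^2 * (‖V z.1‖ₑ)⁻¹ ≤ Z.indicator (fun z => ‖U z‖ₑ^2 * ‖V z.1‖ₑ) z := by
    intro z
    by_cases hz : z ∈ Z
    · simp only [hh, Set.indicator_of_mem hz]
      by_cases hv : V z.1 = 0
      · simp [hv]
      · rw [enorm_mul, mul_pow]
        have e0 : ‖((‖V z.1‖ : ℝ) : ℂ)‖ₑ = ‖V z.1‖ₑ := by
          rw [← ofReal_norm, Complex.norm_real, norm_norm, ofReal_norm]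
        rw [e0, sq ‖V z.1‖ₑ, mul_assoc, mul_assoc, ENNReal.mul_inv_cancel (by simpa using hv) (by simp), mul_one]
    · simp only [hh, Set.indicator_of_notMem hz]; simp
  have hI : ∫⁻ z, ‖h z‖ₑ^2 * (‖V z.1‖ₑ)⁻¹ ≤ Q := by
    rw [hQ, ← lintegral_indicator hZ]
    exact lintegral_mono hW
  have hIR : ∫⁻ z, ‖tR n h z‖ₑ^2 * (‖V z.1‖ₑ)⁻¹ ≤ Q := by
    have hmm : Measurable (fun z : Eu n × ℝ => ‖h z‖ₑ^2 * (‖V z.1‖ₑ)⁻¹) := by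
      have := hhm.measurable
      fun_prop
    have := (tR_mp n).lintegral_comp hmm
    exact this.le.trans hI
  have g1 := (hL h _ hhm hhi hhM).trans (mul_le_mul_right (mul_le_mul_right hI Λ) CL)
  have g2 := (hL (tR n h) _ (tR_sm hhm) (tR_int hhi) (fun z => hhM _)).trans (mul_le_mul_right (mul_le_mul_right hIR Λ) CL)
  have hb := dual_bound fp fm (Amp n h) (Amp n (tR n h)) hfp hfm (Amp_cont hhi) (Amp_cont (tR_int hhi)) A _ f1 f2 g1 g2
  rw [← hd, hpair, ← ofReal_norm, Complex.norm_real, Real.norm_of_nonneg (integral_nonneg hg0), ← hQg] at hb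
  apply quad_absorb hQt
  refine hb.trans_eq ?_
  rw [← ENNReal.mul_rpow_of_nonneg _ _ (by norm_num), show 4 * (A * (CL * Λ)) * Q = 4 * (A * (CL * (Λ * Q))) by ring,
    ENNReal.mul_rpow_of_nonneg 4 _ (by norm_num)]
  congr 1
  rw [show (4 : ℝ≥0∞) = 2^(2:ℝ) by rw [ENNReal.rpow_two]; norm_num, ← ENNReal.rpow_mul]
  norm_num

lemma fp_ball {n : ℕ} {p : ℝ} (hp : 0 < p) (V : Eu n → ℂ) (x : Eu n) (r : ℝ) (hr : 0 < r) :
    ∫⁻ y in ball x r, ‖V y‖ₑ^p ≤ (fpNorm n p V)^p * ENNReal.ofReal (r^((n:ℝ)-2*p)) := by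
  have h : ENNReal.ofReal (r ^ (2 - n / p)) * (∫⁻ y in ball x r, ENNReal.ofReal (‖V y‖ ^ p)) ^ (1 / p) ≤ fpNorm n p V := by
    unfold fpNorm
    exact le_iSup_of_le x (le_iSup_of_le r (le_iSup_of_le hr le_rfl))
  have e : ∀ y, ENNReal.ofReal (‖V y‖ ^ p) = ‖V y‖ₑ^p := fun y => by
    rw [← ofReal_norm, ENNReal.ofReal_rpow_of_nonneg (norm_nonneg _) hp.le]
  simp only [e] at h
  have h2 := ENNReal.rpow_le_rpow h hp.le
  rw [ENNReal.mul_rpow_of_nonneg _ _ hp.le, ← ENNReal.rpow_mul, one_div_mul_cancel hp.ne', ENNReal.rpow_one,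
    ENNReal.ofReal_rpow_of_nonneg (by positivity) hp.le, ← Real.rpow_mul hr.le] at h2
  have e2 : (2 - n/p)*p = -((n:ℝ)-2*p) := by field_simp; ring
  rw [e2] at h2
  have e3 : ENNReal.ofReal (r^((n:ℝ)-2*p)) * ENNReal.ofReal (r^(-((n:ℝ)-2*p))) = 1 := by
    rw [← ENNReal.ofReal_mul (by positivity), ← Real.rpow_add hr]; simp
  calc ∫⁻ y in ball x r, ‖V y‖ₑ^p = (ENNReal.ofReal (r^(-((n:ℝ)-2*p))) * ∫⁻ y in ball x r, ‖V y‖ₑ^p) * ENNReal.ofReal (r^((n:ℝ)-2*p)) := by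
        rw [mul_comm, ← mul_assoc, e3, one_mul]
    _ ≤ _ := by gcongr

lemma fp_zero {n : ℕ} {p : ℝ} (hp : 0 < p) {V : Eu n → ℂ} (hV : Measurable V) (h0 : fpNorm n p V = 0) : ∀ᵐ x, V x = 0 := by
  have h : ∀ k : ℕ, ∀ᵐ x ∂(volume.restrict (ball (0 : Eu n) (k+1))), V x = 0 := by
    intro k
    have h1 := fp_ball hp V 0 (k+1) (by positivity)
    rw [h0, ENNReal.zero_rpow_of_pos hp, zero_mul, nonpos_iff_eq_zero, lintegral_eq_zero_iff (by fun_prop)] at h1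
    filter_upwards [h1] with x hx
    simpa [ENNReal.rpow_eq_zero_iff, hp, not_lt.2 hp.le] using hx
  have h2 := (ae_restrict_iUnion_iff (μ := volume) (fun k : ℕ => ball (0 : Eu n) (k+1)) (fun x => V x = 0)).2 h
  have hu : (⋃ k : ℕ, ball (0 : Eu n) (k+1)) = Set.univ := by
    apply Set.eq_univ_of_forall
    intro x
    obtain ⟨k, hk⟩ := exists_nat_ge ‖x‖
    exact Set.mem_iUnion.2 ⟨k, by rw [mem_ball_zero_iff]; linarith⟩
  rwa [hu, Measure.restrict_univ] at h2

lemma mixed_sq {n : ℕ} {q' r' : ℝ} (hq : 0 < q') (G : Eu n → ℝ → ℂ) :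
    mixedNorm n q' r' G ^ (2:ℝ) = mixSq n q' r' (fun z => G z.1 z.2) := by
  unfold mixedNorm mixSq
  rw [← ENNReal.rpow_mul, show 1/q'*2 = 2/q' by ring]
  rfl

lemma gok_of {n : ℕ} {G : Eu n → ℝ → ℂ} {R : ℝ} (h1 : ∀ s : ℝ, IsSchwartz (fun x => G x s))
    (h2 : Continuous (fun z : Eu n × ℝ => G z.1 z.2)) (h3 : ∀ x, ∀ s : ℝ, R < |s| → G x s = 0) :
    Gok n (fun z => G z.1 z.2) R := by
  have key : ∀ s, ∃ φ : 𝓢(Eu n, ℂ), (fun x => G x s) = φ := fun s => by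
    obtain ⟨φ, h⟩ := h1 s; exact ⟨φ, funext h⟩
  refine ⟨h2, fun s => ?_, fun s => ?_, h3⟩
  · obtain ⟨φ, h⟩ := key s
    dsimp only
    rw [h]; exact φ.integrable
  · obtain ⟨φ, h⟩ := key s
    dsimp only
    rw [h, ← SchwartzMap.fourier_coe]; exact (𝓕 φ).integrable

/-- The function under the weighted norm. -/
def Uu (n : ℕ) (G : Eu n × ℝ → ℂ) (γ : ℝ) (z : Eu n × ℝ) : ℂ :=
  𝓕⁻ (fun ξ : Eu n => ((‖ξ‖^γ : ℝ) : ℂ) * 𝓕 (Ft n G z.2) ξ) z.1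

lemma Uu_sm {n : ℕ} {G : Eu n × ℝ → ℂ} (hG : StronglyMeasurable G) (γ : ℝ) : StronglyMeasurable (Uu n G γ) := by
  have h1 : StronglyMeasurable (fun v : Eu n × ℝ => Ft n G v.2 v.1) := (Ft_sm hG).comp_measurable (g := fun v : Eu n × ℝ => (v.2, v.1)) (by fun_prop)
  have h2 := slice_meas h1
  have h3 : StronglyMeasurable (fun v : Eu n × ℝ => ((‖v.1‖^γ : ℝ) : ℂ) * 𝓕 (Ft n G v.2) v.1) :=
    ((rpow_sm γ).comp_measurable measurable_fst).mul h2
  have h4 := (slice_meas h3).comp_measurable (g := fun v : Eu n × ℝ => (-v.1, v.2)) (by fun_prop)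
  have e : Uu n G γ = _ := funext fun v => (Real.fourierInv_eq_fourier_neg _ _)
  rw [e]; exact h4

lemma fourier_undef {n : ℕ} {a : Eu n → ℂ} (ha : ¬ Integrable a) (w : Eu n) : 𝓕 a w = 0 := by
  rw [Real.fourier_eq]
  apply integral_undef
  rwa [Real.fourierIntegral_convergent_iff]

lemma Uu_slice {n : ℕ} {G : Eu n × ℝ → ℂ} (hn : 1 ≤ n) (fp fm : Eu n → ℂ) (σ γ : ℝ) (hσ : σ - 1 - γ = -(1/2)) (t : ℝ)
    (hid : Integrable (Ft n G t) → ∀ᵐ ξ, 𝓕 (Ft n G t) ξ = ((‖ξ‖^(-γ) : ℝ) : ℂ) * Hh n fp fm t ξ) :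
    (∀ x, Uu n G (σ-1) (x, t) = 0) ∨ ∃ a : Eu n → ℂ, Integrable a ∧ (∀ x, Uu n G (σ-1) (x, t) = 𝓕⁻ a x) ∧
      ∀ᵐ ξ, a ξ = ((‖ξ‖^(-(1/2) : ℝ) : ℝ) : ℂ) * Hh n fp fm t ξ := by
  by_cases hF : Integrable (Ft n G t)
  · by_cases ha : Integrable (fun ξ : Eu n => ((‖ξ‖^(σ-1) : ℝ) : ℂ) * 𝓕 (Ft n G t) ξ)
    · refine Or.inr ⟨_, ha, fun x => rfl, ?_⟩
      haveI : Nonempty (Fin n) := ⟨⟨0, hn⟩⟩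
      have hne : ∀ᵐ ξ : Eu n, ξ ≠ 0 := by simp [ae_iff]
      filter_upwards [hid hF, hne] with ξ h1 h2
      rw [h1, ← mul_assoc, ← Complex.ofReal_mul, ← Real.rpow_add (norm_pos_iff.2 h2), ← hσ, sub_eq_add_neg (σ-1)]
    · left; intro x
      unfold Uu
      rw [Real.fourierInv_eq_fourier_neg]
      exact fourier_undef ha _
  · left; intro x
    unfold Uu
    have : 𝓕 (Ft n G t) = 0 := funext fun w => fourier_undef hF w
    simp [this, Real.fourierInv_eq]

lemma exhaust {n : ℕ} {U : Eu n × ℝ → ℂ} (hU : StronglyMeasurable U) {V : Eu n → ℂ} (hV : Measurable V) (B : ℝ≥0∞)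
    (h : ∀ N : ℝ, 0 ≤ N → ∀ Z : Set (Eu n × ℝ), MeasurableSet Z → (∀ x t, (x, t) ∈ Z → ‖x‖ ≤ N ∧ |t| ≤ N ∧ ‖U (x, t)‖ ≤ N ∧ ‖V x‖ ≤ N) →
      ∫⁻ z in Z, ‖U z‖ₑ^2 * ‖V z.1‖ₑ ≤ B) : ∫⁻ z, ‖U z‖ₑ^2 * ‖V z.1‖ₑ ≤ B := by
  have hUm := hU.measurable
  let m : Eu n × ℝ → ℝ := fun z => ‖z.1‖ + |z.2| + ‖U z‖ + ‖V z.1‖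
  have hm : Measurable m := by fun_prop
  have hu : (⋃ k : ℕ, {z | m z ≤ k}) = Set.univ := by
    apply Set.eq_univ_of_forall
    intro z
    obtain ⟨k, hk⟩ := exists_nat_ge (m z)
    exact Set.mem_iUnion.2 ⟨k, hk⟩
  have hd : Directed (· ⊆ ·) (fun k : ℕ => {z | m z ≤ k}) := by
    apply Monotone.directed_le
    intro j k hjk z (hz : m z ≤ j)
    exact hz.trans (by exact_mod_cast hjk)
  rw [← setLIntegral_univ, ← hu, setLIntegral_iUnion_of_directed _ hd]
  refine iSup_le fun k => h k (by positivity) _ (measurableSet_le hm measurable_const) ?_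
  intro x t (hz : ‖x‖ + |t| + ‖U (x,t)‖ + ‖V x‖ ≤ k)
  have := norm_nonneg x; have := abs_nonneg t; have := norm_nonneg (U (x,t)); have := norm_nonneg (V x)
  refine ⟨?_, ?_, ?_, ?_⟩ <;> linarith

/-- Weighted space-time `L²` estimate for the untruncated
inhomogeneous wave term. -/
theorem weighted_L2_untruncated (n : ℕ) (hn : 3 ≤ n) (p q r q' r' σ : ℝ)
    (hp : ((n : ℝ) - 1) / 2 < p) (hq : 2 ≤ q) (hr : 2 ≤ r)
    (hadm : 2 / q + ((n : ℝ) - 1) / r ≤ ((n : ℝ) - 1) / 2)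
    (hσ : σ = 1 / q + (n : ℝ) / r - ((n : ℝ) - 1) / 2)
    (hq' : 1 / q + 1 / q' = 1) (hr' : 1 / r + 1 / r' = 1) :
    ∃ C > (0 : ℝ), ∀ V : EuclideanSpace ℝ (Fin n) → ℂ, Measurable V →
      fpNorm n p V < ⊤ →
      ∀ G : EuclideanSpace ℝ (Fin n) → ℝ → ℂ,
        (∀ s : ℝ, IsSchwartz (fun x => G x s)) →
        Continuous (fun z : EuclideanSpace ℝ (Fin n) × ℝ => G z.1 z.2) →
        (∃ R : ℝ, ∀ x, ∀ s : ℝ, R < |s| → G x s = 0) →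
        wtNorm n (fun x => (‖V x‖₊ : ℝ≥0∞))
            (fun x t => mOp n (powMult (σ - 1))
              (fun y => ∫ s : ℝ, mOp n (sinMult (t - s)) (fun z => G z s) y) x) ≤
          ENNReal.ofReal C * fpNorm n p V ^ ((1 : ℝ) / 2) * mixedNorm n q' r' G := by
  have hn3 : (3:ℝ) ≤ n := by exact_mod_cast hn
  have hp0 : 0 < p := by linarith
  have hq0 : 0 < 1/q := by positivity
  have hr2 : 2 < r := by
    rcases hr.lt_or_eq with h | h
    · exact h
    · rw [← h] at hadm
      have : 2/q = 2*(1/q) := by ring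
      linarith
  have hγ : 1/q + (n:ℝ)/r - n/2 ≤ 0 := by
    have h1 : 1/r ≤ 1/2 := one_div_le_one_div_of_le (by norm_num) hr
    have h2 : 2/q = 2*(1/q) := by ring
    have h3 : ((n:ℝ)-1)/r = n*(1/r) - 1/r := by ring
    have h4 : (n:ℝ)/r = n*(1/r) := by ring
    rw [h2, h3] at hadm
    rw [h4]
    nlinarith
  obtain ⟨q1, q2⟩ := conj_range q q' hq hq'
  obtain ⟨Cs, hCs, hs⟩ := famp n (by omega) q r q' r' hq hr2 hadm hq' hr'
  obtain ⟨CL, hCL, hL⟩ := LPA n hn p hp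
  set K : ℝ≥0∞ := (4 * (Cs * CL))^((1:ℝ)/2) with hK
  have hKt : K ≠ ⊤ := by rw [hK]; finiteness
  refine ⟨K.toReal + 1, by positivity, fun V hV hfp G h1 h2 ⟨R, h3⟩ => ?_⟩
  set G' : Eu n × ℝ → ℂ := fun z => G z.1 z.2 with hG'
  have hok : Gok n G' R := gok_of h1 h2 h3
  have hU := Uu_sm hok.cont.stronglyMeasurable (σ-1)
  have hVm : Measurable (fun z : Eu n × ℝ => ‖Uu n G' (σ-1) z‖ₑ^2 * ‖V z.1‖ₑ) := by
    have := hU.measurable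
    fun_prop
  have hw : wtNorm n (fun x => (‖V x‖₊ : ℝ≥0∞))
            (fun x t => mOp n (powMult (σ - 1))
              (fun y => ∫ s : ℝ, mOp n (sinMult (t - s)) (fun z => G z s) y) x)
      = (∫⁻ z, ‖Uu n G' (σ-1) z‖ₑ^2 * ‖V z.1‖ₑ)^((1:ℝ)/2) := by
    unfold wtNorm
    rw [Measure.volume_eq_prod, lintegral_prod_symm _ hVm.aemeasurable]
    simp only [ENNReal.rpow_ofNat]
    rfl
  rw [hw]
  have hKC : K ≤ ENNReal.ofReal (K.toReal + 1) := by
    rw [← ENNReal.ofReal_toReal hKt]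
    exact ENNReal.ofReal_le_ofReal (by rw [ENNReal.ofReal_toReal hKt]; linarith)
  rcases eq_or_ne (fpNorm n p V) 0 with h0 | h0
  · have hz : ∫⁻ z, ‖Uu n G' (σ-1) z‖ₑ^2 * ‖V z.1‖ₑ = 0 := by
      rw [Measure.volume_eq_prod, lintegral_prod_symm _ hVm.aemeasurable]
      apply lintegral_eq_zero_of_ae_eq_zero
      refine Eventually.of_forall fun t => ?_
      apply lintegral_eq_zero_of_ae_eq_zero
      filter_upwards [fp_zero hp0 hV h0] with x hx
      simp [hx]
    rw [hz, ENNReal.zero_rpow_of_pos (by norm_num)]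
    exact zero_le
  have hms := mixed_sq (n := n) (r' := r') (by linarith : 0 < q') G
  by_cases hmt : mixedNorm n q' r' G = ⊤
  · have hne : ENNReal.ofReal (K.toReal + 1) * fpNorm n p V ^ ((1 : ℝ) / 2) ≠ 0 := by
      apply mul_ne_zero
      · have : 0 < K.toReal + 1 := by positivity
        simpa using this
      · simp [ENNReal.rpow_eq_zero_iff, h0]
    rw [hmt, ENNReal.mul_top hne]
    exact le_top
  have hm : mixSq n q' r' G' ≠ ⊤ := by
    rw [← hms]; finiteness
  obtain ⟨⟨fp, p1, p2, p3⟩, ⟨fm, m1, m2, m3⟩⟩ := hs G' R hok hm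
  have hA : Cs * mixSq n q' r' G' ≠ ⊤ := by finiteness
  have hQ : ∫⁻ z, ‖Uu n G' (σ-1) z‖ₑ^2 * ‖V z.1‖ₑ ≤ 4 * ((Cs * mixSq n q' r' G') * (CL * fpNorm n p V)) := by
    refine exhaust hU hV _ fun N hN Z hZ hZN => Q_bound hn fp fm p1 m1 _ CL (fpNorm n p V) hA p2 m2 _ hU V hV ?_ ?_ N hN Z hZ hZN
    · intro F M f1 f2 f3
      exact hL (fun x => ‖V x‖ₑ) (fpNorm n p V) F M (by fun_prop) (fun x => enorm_ne_top) h0 hfp.ne (fun x r hr => fp_ball hp0 V x r hr) f1 f2 f3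
    · intro t
      refine Uu_slice (by omega) fp fm σ (1/q + (n:ℝ)/r - n/2) (by rw [hσ]; ring) t fun hF => ?_
      exact ft_ident (by omega) hr2 hr' q1 hok hm t _ hγ fp fm p1 m1 (ne_top_of_le_ne_top hA p2) (ne_top_of_le_ne_top hA m2) p3 m3 hF
  calc _ ≤ (4 * ((Cs * mixSq n q' r' G') * (CL * fpNorm n p V)))^((1:ℝ)/2) := ENNReal.rpow_le_rpow hQ (by norm_num)
    _ = K * fpNorm n p V ^ ((1:ℝ)/2) * mixedNorm n q' r' G := by
        rw [← hms, show 4 * ((Cs * mixedNorm n q' r' G ^ (2:ℝ)) * (CL * fpNorm n p V)) = (4 * (Cs * CL)) * fpNorm n p V * mixedNorm n q' r' G ^ (2:ℝ) by ring,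
          ENNReal.mul_rpow_of_nonneg _ _ (by norm_num), ENNReal.mul_rpow_of_nonneg _ _ (by norm_num), ← ENNReal.rpow_mul]
        norm_num [hK]
    _ ≤ _ := by gcongr

end
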